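/- Let (R, m) be an analytically unramified Cohen-Macaulay local ring of dimension d ≥ 3, type t(R) ≤ 2, infinite residue field; I an ideal with closure(I) = m and ē₃(I) = 0. Then the associated graded ring Ḡ of the normal filtration of I is Cohen-Macaulay. -/

import Mathlib

set_option synthInstance.maxHeartbeats 1000000
set_option maxHeartbeats 2000000

open IsLocalRing Polynomial Finset

variable {R : Type*}

/-- `x` is integral over the ideal `I`: it satisfies an equation
`x^n + a₁ x^{n-1} + ⋯ + aₙ = 0` with `aᵢ ∈ Iⁱ`. -/
def IsIntegralOverIdeal [CommRing R] (I : Ideal R) (x : R) : Prop :=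
  ∃ n : ℕ, 0 < n ∧ ∃ a : ℕ → R, (∀ i ∈ Finset.Icc 1 n, a i ∈ I ^ i) ∧
    x ^ n + ∑ i ∈ Finset.Icc 1 n, a i * x ^ (n - i) = 0

/-- The integral closure of an ideal (the set of integral elements is an ideal,
so the span equals it). -/
def intCl [CommRing R] (I : Ideal R) : Ideal R :=
  Ideal.span {x | IsIntegralOverIdeal I x}

/-- Length of a module, as the Krull dimension of its lattice of submodules. -/
noncomputable def mlen (R M : Type*) [CommRing R] [AddCommGroup M] [Module R M] :
    WithBot ℕ∞ :=
  Order.krullDim (Submodule R M)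

/-- The quotient module `N/(K ∩ N)` for ideals `N K`. -/
abbrev idealQuot [CommRing R] (N K : Ideal R) :=
  N ⧸ (Submodule.comap N.subtype K)

/-- Depth of `M` with respect to the ideal `J`: sup of lengths of `M`-regular
sequences contained in `J`. -/
noncomputable def rdepth (A : Type*) [CommRing A] (J : Ideal A)
    (M : Type*) [AddCommGroup M] [Module A M] : ℕ∞ :=
  sSup {n : ℕ∞ | ∃ rs : List A, (rs.length : ℕ∞) = n ∧ (∀ x ∈ rs, x ∈ J) ∧
    RingTheory.Sequence.IsRegular M rs}

/-- A local ring is Cohen-Macaulay if its depth equals its Krull dimension. -/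
def IsCMLocal (R : Type*) [CommRing R] [IsLocalRing R] : Prop :=
  (rdepth R (maximalIdeal R) R : WithBot ℕ∞) = ringKrullDim R

/-- A local ring is analytically unramified if its `m`-adic completion is reduced. -/
def AnalyticallyUnramified (R : Type*) [CommRing R] [IsLocalRing R] : Prop :=
  IsReduced (AdicCompletion (maximalIdeal R) R)

/-- An ideal is `m`-primary. -/
def IsMPrimary [CommRing R] [IsLocalRing R] (I : Ideal R) : Prop :=
  I.radical = maximalIdeal R

/-- `J ⊆ I` is a minimal reduction: generated by `d = dim R` elements and
`I^{n+1} = J I^n` for `n ≫ 0`. -/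
def IsMinimalReduction [CommRing R] (d : ℕ) (J I : Ideal R) : Prop :=
  J ≤ I ∧ (∃ s : Fin d → R, J = Ideal.span (Set.range s)) ∧
    ∃ N : ℕ, ∀ n ≥ N, I ^ (n + 1) = J * I ^ n

/-- Normal Hilbert data: `L n = λ(R/ intCl(I^{n+1}))` and for `n ≫ 0` this agrees
with the polynomial whose normalized coefficients are the `e i`. -/
def NormalHilbertData [CommRing R] (d : ℕ) (I : Ideal R) (L : ℕ → ℕ) (e : ℕ → ℤ) : Prop :=
  (∀ n, mlen R (R ⧸ intCl (I ^ (n + 1))) = (L n : WithBot ℕ∞)) ∧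
    ∃ N : ℕ, ∀ n ≥ N, (L n : ℤ) =
      ∑ i ∈ Finset.range (d + 1), (-1 : ℤ) ^ i * e i * ((n + d - i).choose (d - i))

/-- `t` is the Cohen-Macaulay type of the local ring `R` of dimension `d`:
`t = λ((Q : m)/Q)` for every ideal `Q` generated by a maximal regular sequence in `m`. -/
def CMTypeData (R : Type*) [CommRing R] [IsLocalRing R] (d t : ℕ) : Prop :=
  ∀ s : List R, s.length = d → (∀ x ∈ s, x ∈ maximalIdeal R) →
    RingTheory.Sequence.IsRegular R s →
      mlen R (idealQuot ((Ideal.span {x | x ∈ s}).colon (maximalIdeal R))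
        (Ideal.span {x | x ∈ s})) = (t : WithBot ℕ∞)

/-- The quotient module `N/(K ∩ N)` for submodules `N K` of a module. -/
abbrev submoduleQuot {A M : Type*} [CommRing A] [AddCommGroup M] [Module A M]
    (N K : Submodule A M) :=
  N ⧸ (Submodule.comap N.subtype K)

namespace CMP

section nI

variable {R : Type*} [CommRing R]

/-- asymptotic order at least `n`. -/
def As (J : Ideal R) (n : ℕ) (z : R) : Prop := ∃ c, ∀ j, z ^ j ∈ J ^ (n * j - c)

lemma As.mono {J : Ideal R} {n m : ℕ} {z : R} (h : As J n z) (hm : m ≤ n) : As J m z := by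
  obtain ⟨c, hc⟩ := h
  refine ⟨c, fun j => Ideal.pow_le_pow_right ?_ (hc j)⟩
  have := Nat.mul_le_mul_right j hm
  omega

lemma As.add {J : Ideal R} {n : ℕ} {z w : R} (hz : As J n z) (hw : As J n w) :
    As J n (z + w) := by
  obtain ⟨c, hc⟩ := hz
  obtain ⟨c', hc'⟩ := hw
  refine ⟨c + c', fun j => ?_⟩
  rw [add_pow]
  refine Ideal.sum_mem _ fun r hr => ?_
  refine Ideal.mul_mem_right _ _ ?_
  have h1 := Ideal.mul_mem_mul (hc r) (hc' (j - r))
  rw [← pow_add] at h1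
  refine Ideal.pow_le_pow_right ?_ h1
  have : r ≤ j := by simp at hr; omega
  have h2 : n * j = n * r + n * (j - r) := by rw [← mul_add]; congr 1; omega
  omega

lemma As.mul {J : Ideal R} {n m : ℕ} {z w : R} (hz : As J n z) (hw : As J m w) :
    As J (n + m) (z * w) := by
  obtain ⟨c, hc⟩ := hz
  obtain ⟨c', hc'⟩ := hw
  refine ⟨c + c', fun j => ?_⟩
  rw [mul_pow]
  have h1 := Ideal.mul_mem_mul (hc j) (hc' j)
  rw [← pow_add] at h1
  refine Ideal.pow_le_pow_right ?_ h1
  rw [add_mul]; omega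

lemma As.of_mem {J : Ideal R} {n : ℕ} {z : R} (hz : z ∈ J ^ n) : As J n z := by
  refine ⟨0, fun j => ?_⟩
  rw [Nat.sub_zero, pow_mul]
  exact Ideal.pow_mem_pow hz j

lemma As.zero_deg (J : Ideal R) (z : R) : As J 0 z := As.of_mem (by simp)

lemma As.root {J : Ideal R} {n b : ℕ} {z : R} (hb : 0 < b) (h : As J (n * b) (z ^ b)) :
    As J n z := by
  obtain ⟨c, hc⟩ := h
  refine ⟨c + n * b, fun j => ?_⟩
  have h1 := hc (j / b)
  rw [← pow_mul] at h1
  have h2 : z ^ j = z ^ (b * (j / b)) * z ^ (j % b) := by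
    rw [← pow_add, Nat.div_add_mod]
  rw [h2]
  refine Ideal.mul_mem_right _ _ (Ideal.pow_le_pow_right ?_ h1)
  have h3 := Nat.div_add_mod j b
  have h4 := Nat.mod_lt j hb
  have h5 : n * j ≤ n * b * (j / b) + n * b := by
    calc n * j ≤ n * (b * (j / b) + b) := Nat.mul_le_mul_left _ (by omega)
      _ = _ := by ring
  omega

lemma As.pow {J : Ideal R} {n : ℕ} {z : R} (h : As J n z) (b : ℕ) : As J (n * b) (z ^ b) := by
  obtain ⟨c, hc⟩ := h
  refine ⟨c, fun j => ?_⟩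
  rw [← pow_mul, mul_assoc]
  exact hc _

/-- the asymptotic closure of `J ^ n` -/
def nI (J : Ideal R) (n : ℕ) : Ideal R where
  carrier := {z | As J n z}
  add_mem' := fun ha hb => As.add ha hb
  zero_mem' := As.of_mem (Ideal.zero_mem _)
  smul_mem' := fun c z hz => by
    have := (As.zero_deg J c).mul hz
    rwa [zero_add] at this

lemma mem_nI {J : Ideal R} {n : ℕ} {z : R} : z ∈ nI J n ↔ As J n z := Iff.rfl

lemma pow_le_nI (J : Ideal R) (n : ℕ) : J ^ n ≤ nI J n := fun _ hz => As.of_mem hz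

lemma nI_anti (J : Ideal R) {n m : ℕ} (h : m ≤ n) : nI J n ≤ nI J m := fun _ hz => As.mono hz h

lemma nI_zero (J : Ideal R) : nI J 0 = ⊤ := by
  rw [eq_top_iff]; intro z _; exact As.zero_deg J z

lemma mul_mem_nI {J : Ideal R} {n m : ℕ} {z w : R} (hz : z ∈ nI J n) (hw : w ∈ nI J m) :
    z * w ∈ nI J (n + m) := As.mul hz hw

lemma nI_mul_le (J : Ideal R) (n m : ℕ) : nI J n * nI J m ≤ nI J (n + m) :=
  Ideal.mul_le.2 fun _ hz _ hw => As.mul hz hw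

lemma pow_mem_nI {J : Ideal R} {n : ℕ} {z : R} (h : z ∈ nI J n) (b : ℕ) :
    z ^ b ∈ nI J (n * b) := As.pow h b

lemma nI_root {J : Ideal R} {n b : ℕ} {z : R} (hb : 0 < b) (h : z ^ b ∈ nI J (n * b)) :
    z ∈ nI J n := As.root hb h

/-- integral elements are in the asymptotic closure -/
lemma As.of_integral {J : Ideal R} {n : ℕ} {z : R} (h : IsIntegralOverIdeal (J ^ n) z) :
    As J n z := by
  obtain ⟨b, hb, a, ha, he⟩ := h
  refine ⟨n * b, fun j => ?_⟩
  rw [← Nat.mul_sub]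
  induction j using Nat.strong_induction_on with
  | _ j ih =>
    by_cases hj : j < b
    · rw [Nat.sub_eq_zero_of_le hj.le]; simp
    push Not at hj
    have h1 : z ^ j = - ∑ i ∈ Finset.Icc 1 b, a i * z ^ (j - i) := by
      have h2 : z ^ (j - b) * (z ^ b + ∑ i ∈ Finset.Icc 1 b, a i * z ^ (b - i)) = 0 := by
        rw [he, mul_zero]
      rw [mul_add, ← pow_add, Nat.sub_add_cancel hj, Finset.mul_sum] at h2
      rw [eq_neg_iff_add_eq_zero, ← h2]
      congr 1
      refine Finset.sum_congr rfl fun i hi => ?_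
      simp only [Finset.mem_Icc] at hi
      rw [mul_left_comm, ← pow_add]
      congr 2; omega
    rw [h1]
    refine neg_mem (Ideal.sum_mem _ fun i hi => ?_)
    have hi' := Finset.mem_Icc.1 hi
    have h3 := Ideal.mul_mem_mul (ha i hi) (ih (j - i) (by omega))
    rw [← pow_mul, ← pow_add, ← mul_add] at h3
    refine Ideal.pow_le_pow_right (Nat.mul_le_mul_left _ ?_) h3
    omega


lemma mem_sup_span_pow {A : Ideal R} {z : R} (j : ℕ) : ∀ {y : R},
    y ∈ (A ⊔ Ideal.span {z}) ^ j → ∃ a : ℕ → R, (∀ i ≤ j, a i ∈ A ^ (j - i)) ∧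
      y = ∑ i ∈ Finset.range (j+1), a i * z ^ i := by
  induction j with
  | zero => intro y _; exact ⟨fun _ => y, by simp, by simp⟩
  | succ j ih =>
    intro y hy
    rw [pow_succ'] at hy
    refine Submodule.mul_induction_on hy ?_ ?_
    · intro u hu v hv
      obtain ⟨a, ha, rfl⟩ := ih hv
      obtain ⟨p, hp, q, hq, rfl⟩ := Submodule.mem_sup.1 hu
      obtain ⟨b, rfl⟩ := Ideal.mem_span_singleton'.1 hq
      refine ⟨fun i => (if i ≤ j then p * a i else 0) + (if 1 ≤ i then b * a (i - 1) else 0),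
        fun i hi => ?_, ?_⟩
      · refine add_mem ?_ ?_
        · split_ifs with h
          · have := Ideal.mul_mem_mul hp (ha i h)
            rwa [← pow_succ', show j - i + 1 = j + 1 - i by omega] at this
          · exact zero_mem _
        · split_ifs with h
          · refine Ideal.mul_mem_left _ _ ?_
            have := ha (i - 1) (by omega)
            rwa [show j - (i - 1) = j + 1 - i by omega] at this
          · exact zero_mem _
      · simp only [add_mul, Finset.sum_add_distrib]
        congr 1
        · conv_rhs => rw [Finset.sum_range_succ]
          simp only [show ¬ (j + 1 ≤ j) by omega, if_false, zero_mul, add_zero, Finset.mul_sum]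
          refine Finset.sum_congr rfl fun i hi => ?_
          have : i ≤ j := by simp at hi; omega
          simp [this, mul_assoc]
        · conv_rhs => rw [Finset.sum_range_succ']
          rw [Finset.mul_sum]
          simp only [show ¬ (1 ≤ 0) by omega, if_false, zero_mul, add_zero]
          refine Finset.sum_congr rfl fun i hi => ?_
          simp only [Nat.le_add_left, if_true, Nat.add_sub_cancel]
          ring
    · rintro u v ⟨a, ha, rfl⟩ ⟨b, hb, rfl⟩
      refine ⟨fun i => a i + b i, fun i hi => add_mem (ha i hi) (hb i hi), ?_⟩
      simp [add_mul, Finset.sum_add_distrib]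

lemma mem_mul_sup_span_pow {A : Ideal R} {z : R} (j : ℕ) {y : R}
    (hy : y ∈ A * (A ⊔ Ideal.span {z}) ^ j) : ∃ a : ℕ → R, (∀ i ≤ j, a i ∈ A ^ (j + 1 - i)) ∧
      y = ∑ i ∈ Finset.range (j+1), a i * z ^ i := by
  refine Submodule.mul_induction_on hy ?_ ?_
  · intro u hu v hv
    obtain ⟨a, ha, rfl⟩ := mem_sup_span_pow j hv
    refine ⟨fun i => u * a i, fun i hi => ?_, ?_⟩
    · have := Ideal.mul_mem_mul hu (ha i hi)
      rwa [← pow_succ', show j - i + 1 = j + 1 - i by omega] at this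
    · simp [Finset.mul_sum, mul_assoc]
  · rintro u v ⟨a, ha, rfl⟩ ⟨b, hb, rfl⟩
    refine ⟨fun i => a i + b i, fun i hi => add_mem (ha i hi) (hb i hi), ?_⟩
    simp [add_mul, Finset.sum_add_distrib]

/-- the shifted adic filtration -/
def shiftFilt (A : Ideal R) (c : ℕ) : A.Filtration R where
  N j := A ^ (j - c)
  mono i := Ideal.pow_le_pow_right (by omega)
  smul_le i := by
    rw [smul_eq_mul, ← pow_succ']
    exact Ideal.pow_le_pow_right (by omega)

lemma shiftFilt_stable (A : Ideal R) (c : ℕ) : (shiftFilt A c).Stable := by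
  refine ⟨c, fun n hn => ?_⟩
  change A • (A ^ (n - c)) = A ^ (n + 1 - c)
  rw [smul_eq_mul, ← pow_succ']; congr 1; omega

/-- the filtration of powers of `A + (z)` -/
def supFilt (A : Ideal R) (z : R) : A.Filtration R where
  N j := (A ⊔ Ideal.span {z}) ^ j
  mono i := Ideal.pow_le_pow_right (by omega)
  smul_le i := by
    rw [smul_eq_mul, pow_succ']
    exact Ideal.mul_mono_left le_sup_left

lemma IsIntegralOverIdeal.of_pow_mem [IsNoetherianRing R] {A : Ideal R} {z : R} {c : ℕ}
    (h : ∀ j, z ^ j ∈ A ^ (j - c)) : IsIntegralOverIdeal A z := by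
  have hle : supFilt A z ≤ shiftFilt A c := by
    intro j y hy
    obtain ⟨a, ha, rfl⟩ := mem_sup_span_pow j hy
    refine Ideal.sum_mem _ fun i hi => ?_
    have hi' : i ≤ j := by simp at hi; omega
    have := Ideal.mul_mem_mul (ha i hi') (h i)
    rw [← pow_add] at this
    exact Ideal.pow_le_pow_right (by omega) this
  have hst := Ideal.Filtration.Stable.of_le (shiftFilt_stable A c) hle
  obtain ⟨n, hn⟩ := hst
  have h1 := hn n le_rfl
  change A • (A ⊔ Ideal.span {z}) ^ n = (A ⊔ Ideal.span {z}) ^ (n + 1) at h1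
  have h2 : z ^ (n + 1) ∈ (A ⊔ Ideal.span {z}) ^ (n + 1) :=
    Ideal.pow_mem_pow (Ideal.mem_sup_right (Ideal.mem_span_singleton_self z)) _
  rw [← h1, smul_eq_mul] at h2
  obtain ⟨a, ha, he⟩ := mem_mul_sup_span_pow n h2
  refine ⟨n + 1, Nat.succ_pos _, fun i => - a (n + 1 - i), fun i hi => ?_, ?_⟩
  · simp only [Finset.mem_Icc] at hi
    have := ha (n + 1 - i) (by omega)
    rw [show n + 1 - (n + 1 - i) = i by omega] at this
    exact neg_mem this
  · have : ∑ i ∈ Finset.Icc 1 (n+1), (- a (n + 1 - i)) * z ^ (n + 1 - i)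
        = - ∑ i ∈ Finset.range (n+1), a i * z ^ i := by
      rw [← Finset.sum_neg_distrib]
      refine Finset.sum_bij' (fun i _ => n + 1 - i) (fun i _ => n + 1 - i) ?_ ?_ ?_ ?_ ?_
      · intro i hi; simp at hi ⊢; omega
      · intro i hi; simp at hi ⊢; omega
      · intro i hi; simp at hi ⊢; omega
      · intro i hi; simp at hi ⊢; omega
      · intro i hi; simp
    rw [this, he]; ring

lemma integral_of_As [IsNoetherianRing R] {J : Ideal R} {n : ℕ} {z : R} (h : As J n z) :
    IsIntegralOverIdeal (J ^ n) z := by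
  rcases Nat.eq_zero_or_pos n with rfl | hn
  · exact IsIntegralOverIdeal.of_pow_mem (c := 0) (fun j => by simp [Ideal.top_pow])
  obtain ⟨c, hc⟩ := h
  refine IsIntegralOverIdeal.of_pow_mem (c := c) fun j => ?_
  rw [← pow_mul]
  refine Ideal.pow_le_pow_right ?_ (hc j)
  rw [Nat.mul_sub]
  have := Nat.mul_le_mul_right c hn
  omega

lemma IsIntegralOverIdeal.mono {A B : Ideal R} (h : A ≤ B) {z : R}
    (hz : IsIntegralOverIdeal A z) : IsIntegralOverIdeal B z := by
  obtain ⟨n, hn, a, ha, he⟩ := hz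
  exact ⟨n, hn, a, fun i hi => Ideal.pow_right_mono h _ (ha i hi), he⟩

/-- the normal filtration in terms of a reduction -/
lemma intCl_eq_nI [IsNoetherianRing R] {I J : Ideal R} (hJI : J ≤ I)
    (hred : ∃ N, ∀ n ≥ N, I ^ (n + 1) = J * I ^ n) (n : ℕ) :
    intCl (I ^ n) = nI J n := by
  obtain ⟨N, hN⟩ := hred
  have hp : ∀ k, I ^ (k + N) ≤ J ^ k := by
    intro k
    induction k with
    | zero => simp
    | succ k ih =>
      rw [show k + 1 + N = (k + N) + 1 by omega, hN _ (by omega), pow_succ']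
      exact Ideal.mul_mono_right ih
  have hp' : ∀ k, I ^ k ≤ J ^ (k - N) := by
    intro k
    by_cases h : N ≤ k
    · obtain ⟨m, rfl⟩ := Nat.exists_eq_add_of_le' h
      simpa using hp m
    · rw [Nat.sub_eq_zero_of_le (by omega)]; simp
  apply le_antisymm
  · refine Ideal.span_le.2 fun z hz => ?_
    obtain ⟨c, hc⟩ := As.of_integral hz
    refine ⟨c + N, fun j => ?_⟩
    have := hp' _ (hc j)
    rwa [Nat.sub_sub] at this
  · intro z hz
    exact Ideal.subset_span (IsIntegralOverIdeal.mono (Ideal.pow_right_mono hJI n) (integral_of_As hz))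

end nI
end CMP

namespace CMP

section trans

variable {R : Type*} [CommRing R]

/-- transitivity of the closure -/
lemma nI_of_eq {J : Ideal R} {n b : ℕ} {z : R} (a : ℕ → R)
    (ha : ∀ i ∈ Finset.Icc 1 b, a i ∈ nI J (n * i))
    (he : z ^ b + ∑ i ∈ Finset.Icc 1 b, a i * z ^ (b - i) = 0) : z ∈ nI J n := by
  have hc : ∀ i, ∃ c, i ∈ Finset.Icc 1 b → ∀ j, a i ^ j ∈ J ^ (n * i * j - c) := by
    intro i
    by_cases h : i ∈ Finset.Icc 1 b
    · obtain ⟨c, hc⟩ := ha i h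
      exact ⟨c, fun _ => hc⟩
    · exact ⟨0, fun h' => absurd h' h⟩
  choose c hc using hc
  set S : ℕ → Ideal R := fun s => Ideal.span {y | ∃ e : ℕ → ℕ, s ≤ ∑ i ∈ Finset.Icc 1 b, i * e i ∧
    y = ∏ i ∈ Finset.Icc 1 b, a i ^ e i} with hS
  have hmul : ∀ i ∈ Finset.Icc 1 b, ∀ s, ∀ y ∈ S s, a i * y ∈ S (s + i) := by
    intro i hi s y hy
    refine Submodule.span_induction ?_ ?_ ?_ ?_ hy
    · rintro _ ⟨e, h1, rfl⟩
      refine Ideal.subset_span ⟨fun k => if k = i then e k + 1 else e k, ?_, ?_⟩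
      · have : ∀ k, k * (if k = i then e k + 1 else e k) = k * e k + if k = i then i else 0 := by
          intro k; split_ifs with h
          · subst h; ring
          · ring
        simp only [this, Finset.sum_add_distrib, Finset.sum_ite_eq', hi, if_true]
        omega
      · have : ∀ k, a k ^ (if k = i then e k + 1 else e k) =
            a k ^ e k * if k = i then a i else 1 := by
          intro k; split_ifs with h
          · subst h; ring
          · ring
        simp only [this, Finset.prod_mul_distrib, Finset.prod_ite_eq', hi, if_true]
        ring
    · simp
    · intro u v _ _ hu hv; rw [mul_add]; exact add_mem hu hv
    · intro r u _ hu; rw [smul_eq_mul, mul_left_comm]; exact Ideal.mul_mem_left _ _ hu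
  have hz : ∀ j, z ^ j ∈ S (j - b) := by
    intro j
    induction j using Nat.strong_induction_on with
    | _ j ih =>
      by_cases hj : j < b
      · rw [Nat.sub_eq_zero_of_le hj.le]
        have : (1 : R) ∈ S 0 := Ideal.subset_span ⟨fun _ => 0, by simp, by simp⟩
        simpa using Ideal.mul_mem_left (S 0) (z ^ j) this
      push Not at hj
      have h1 : z ^ j = - ∑ i ∈ Finset.Icc 1 b, a i * z ^ (j - i) := by
        have h2 : z ^ (j - b) * (z ^ b + ∑ i ∈ Finset.Icc 1 b, a i * z ^ (b - i)) = 0 := by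
          rw [he, mul_zero]
        rw [mul_add, ← pow_add, Nat.sub_add_cancel hj, Finset.mul_sum] at h2
        rw [eq_neg_iff_add_eq_zero, ← h2]
        congr 1
        refine Finset.sum_congr rfl fun i hi => ?_
        simp only [Finset.mem_Icc] at hi
        rw [mul_left_comm, ← pow_add]
        congr 2; omega
      rw [h1]
      refine neg_mem (Ideal.sum_mem _ fun i hi => ?_)
      have hi' := Finset.mem_Icc.1 hi
      have h3 := hmul i hi _ _ (ih (j - i) (by omega))
      refine Ideal.span_mono ?_ h3
      rintro y ⟨e, h4, h5⟩
      exact ⟨e, by omega, h5⟩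
  have hSJ : ∀ s, S s ≤ J ^ (n * s - ∑ i ∈ Finset.Icc 1 b, c i) := by
    intro s
    refine Ideal.span_le.2 ?_
    rintro _ ⟨e, h1, rfl⟩
    have h2 : ∀ T : Finset ℕ, T ⊆ Finset.Icc 1 b → ∏ i ∈ T, a i ^ e i ∈
        J ^ (n * (∑ i ∈ T, i * e i) - ∑ i ∈ T, c i) := by
      intro T
      induction T using Finset.induction_on with
      | empty => simp
      | insert i T hi ih =>
        intro hT
        rw [Finset.prod_insert hi, Finset.sum_insert hi, Finset.sum_insert hi]
        have h3 := Ideal.mul_mem_mul (hc i (hT (Finset.mem_insert_self _ _)) (e i))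
          (ih (fun k hk => hT (Finset.mem_insert_of_mem hk)))
        rw [← pow_add] at h3
        refine Ideal.pow_le_pow_right ?_ h3
        rw [mul_add, ← mul_assoc]
        omega
    refine Ideal.pow_le_pow_right ?_ (h2 _ (Finset.Subset.refl _))
    have := Nat.mul_le_mul_left n h1
    omega
  refine ⟨n * b + ∑ i ∈ Finset.Icc 1 b, c i, fun j => ?_⟩
  refine Ideal.pow_le_pow_right ?_ (hSJ _ (hz j))
  rw [Nat.mul_sub]
  omega

end trans

end CMP

namespace CMP

section qr

variable {B : Type*} [CommRing B]

/-- the ideal generated by `x` -/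
abbrev Jx {d : ℕ} (x : Fin d → B) : Ideal B := Ideal.span (Set.range x)

/-- quasi-regular sequences -/
def QR {d : ℕ} (x : Fin d → B) : Prop :=
  ∀ n (F : MvPolynomial (Fin d) B), F.IsHomogeneous n →
    MvPolynomial.eval x F ∈ Jx x ^ (n + 1) → ∀ a, F.coeff a ∈ Jx x

lemma mem_Jx_pow {d : ℕ} (x : Fin d → B) (n : ℕ) (z : B) :
    z ∈ Jx x ^ n ↔ ∃ F : MvPolynomial (Fin d) B, F.IsHomogeneous n ∧ MvPolynomial.eval x F = z := by
  rw [Ideal.mem_span_pow_iff_exists_isHomogeneous]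

lemma eval_mem_of_coeff {d : ℕ} (x : Fin d → B) {n : ℕ} {F : MvPolynomial (Fin d) B}
    (hF : F.IsHomogeneous n) {Q : Ideal B} (hQ : ∀ a, F.coeff a ∈ Q) :
    MvPolynomial.eval x F ∈ Q * Jx x ^ n := by
  rw [MvPolynomial.eval_eq]
  refine Ideal.sum_mem _ fun a ha => Ideal.mul_mem_mul (hQ a) ?_
  rw [mem_Jx_pow]
  refine ⟨MvPolynomial.monomial a 1, ?_, ?_⟩
  · refine MvPolynomial.isHomogeneous_monomial _ ?_
    have := hF (MvPolynomial.mem_support_iff.1 ha)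
    rw [Finsupp.degree_eq_weight_one]
    exact this
  · rw [MvPolynomial.eval_monomial, one_mul]; rfl

variable [IsLocalRing B]

/-- unit content -/
def UC {σ : Type*} (F : MvPolynomial σ B) : Prop := ∃ a, F.coeff a ∉ maximalIdeal B

lemma UC_iff {σ : Type*} (F : MvPolynomial σ B) :
    UC F ↔ MvPolynomial.map (residue B) F ≠ 0 := by
  unfold UC
  rw [Ne, MvPolynomial.ext_iff]
  push Not
  refine exists_congr fun a => ?_
  rw [MvPolynomial.coeff_map, MvPolynomial.coeff_zero, Ne, residue_eq_zero_iff]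

lemma UC.mul {σ : Type*} {F G : MvPolynomial σ B} (hF : UC F) (hG : UC G) : UC (F * G) := by
  rw [UC_iff] at *
  rw [map_mul]; exact mul_ne_zero hF hG

lemma UC.pow {σ : Type*} {F : MvPolynomial σ B} (hF : UC F) (j : ℕ) : UC (F ^ j) := by
  rw [UC_iff] at *
  rw [map_pow]; exact pow_ne_zero _ hF

lemma UC_one {σ : Type*} : UC (1 : MvPolynomial σ B) := by
  rw [UC_iff, map_one]; exact one_ne_zero

/-- unit content polynomials are non zero divisors modulo `Q[y]` for `Q` primary -/
lemma coeff_mem_of_mul {d : ℕ} {s f : MvPolynomial (Fin d) B} (hs : UC s) {Q : Ideal B}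
    {N : ℕ} (hQ : maximalIdeal B ^ N ≤ Q) (h : ∀ a, (s * f).coeff a ∈ Q) : ∀ a, f.coeff a ∈ Q := by
  classical
  have key : ∀ i, ∀ a, f.coeff a ∈ Q ⊔ maximalIdeal B ^ i := by
    intro i
    induction i with
    | zero => intro a; simp
    | succ i ih =>
      by_contra hcon
      push Not at hcon
      obtain ⟨a, ha⟩ := hcon
      set mo := MonomialOrder.lex (σ := Fin d) with hmo
      obtain ⟨b, hb⟩ := hs
      obtain ⟨a1, ha1, ha1m⟩ := Finset.exists_max_image
        (f.support.filter fun a => f.coeff a ∉ Q ⊔ maximalIdeal B ^ (i+1)) mo.toSyn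
        ⟨a, by
          simp only [Finset.mem_filter, MvPolynomial.mem_support_iff]
          exact ⟨fun h0 => ha (by rw [h0]; exact zero_mem _), ha⟩⟩
      obtain ⟨a0, ha0, ha0m⟩ := Finset.exists_max_image
        (s.support.filter fun a => s.coeff a ∉ maximalIdeal B) mo.toSyn
        ⟨b, by
          simp only [Finset.mem_filter, MvPolynomial.mem_support_iff]
          exact ⟨fun h0 => hb (by rw [h0]; exact zero_mem _), hb⟩⟩
      simp only [Finset.mem_filter, MvPolynomial.mem_support_iff] at ha1 ha0 ha1m ha0m
      have h1 := h (a0 + a1)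
      rw [MvPolynomial.coeff_mul, ← Finset.add_sum_erase _ _
        (show (a0, a1) ∈ Finset.HasAntidiagonal.antidiagonal (a0 + a1) by simp)] at h1
      have h2 : ∑ p ∈ (Finset.HasAntidiagonal.antidiagonal (a0 + a1)).erase (a0, a1),
          s.coeff p.1 * f.coeff p.2 ∈ Q ⊔ maximalIdeal B ^ (i+1) := by
        refine Ideal.sum_mem _ fun p hp => ?_
        rw [Finset.mem_erase, Finset.HasAntidiagonal.mem_antidiagonal] at hp
        obtain ⟨hp1, hp2⟩ := hp
        by_cases hq : f.coeff p.2 ∈ Q ⊔ maximalIdeal B ^ (i+1)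
        · exact Ideal.mul_mem_left _ _ hq
        by_cases hr : s.coeff p.1 ∈ maximalIdeal B
        · have h3 : maximalIdeal B * (Q ⊔ maximalIdeal B ^ i) ≤ Q ⊔ maximalIdeal B ^ (i+1) := by
            rw [Ideal.mul_sup, pow_succ']
            exact sup_le_sup_right Ideal.mul_le_right _
          exact h3 (Ideal.mul_mem_mul hr (ih _))
        exfalso
        have e1 := ha1m p.2 ⟨fun h0 => hq (by rw [h0]; exact zero_mem _), hq⟩
        have e2 := ha0m p.1 ⟨fun h0 => hr (by rw [h0]; exact zero_mem _), hr⟩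
        have e3 : mo.toSyn p.1 + mo.toSyn p.2 = mo.toSyn a0 + mo.toSyn a1 := by
          rw [← map_add, ← map_add, hp2]
        apply hp1
        have e4 : mo.toSyn p.2 = mo.toSyn a1 := by
          refine le_antisymm e1 ?_
          by_contra hlt
          push Not at hlt
          exact absurd e3 (add_lt_add_of_le_of_lt e2 hlt).ne
        have e5 : mo.toSyn p.1 = mo.toSyn a0 := by
          rw [e4] at e3; exact add_right_cancel e3
        exact Prod.ext (mo.toSyn.injective e5) (mo.toSyn.injective e4)
      have h3 : s.coeff a0 * f.coeff a1 ∈ Q ⊔ maximalIdeal B ^ (i+1) :=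
        (Ideal.add_mem_iff_left _ h2).1 (Ideal.mem_sup_left h1)
      have h4 : IsUnit (s.coeff a0) := by
        have := ha0.2
        rwa [mem_maximalIdeal, mem_nonunits_iff, not_not] at this
      exact ha1.2 ((Ideal.unit_mul_mem_iff_mem _ h4).1 h3)
  intro a
  have := key N a
  rwa [sup_eq_left.2 hQ] at this

/-- the standing assumptions on `x` -/
structure QS {d : ℕ} (x : Fin d → B) : Prop where
  qr : QR x
  prim : ∃ N, maximalIdeal B ^ N ≤ Jx x
  le : Jx x ≤ maximalIdeal B

variable {d : ℕ} {x : Fin d → B}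

lemma QS.one_notMem (h : QS x) : (1 : B) ∉ Jx x := fun h1 =>
  (maximalIdeal.isMaximal B).ne_top ((Ideal.eq_top_iff_one _).2 (h.le h1))

lemma QS.cancel_step (h : QS x) {f : ℕ} {F : MvPolynomial (Fin d) B} (hF : F.IsHomogeneous f)
    (hu : UC F) {i : ℕ} {G : MvPolynomial (Fin d) B} (hG : G.IsHomogeneous i)
    (hz : MvPolynomial.eval x F * MvPolynomial.eval x G ∈ Jx x ^ (f + i + 1)) (a) :
    G.coeff a ∈ Jx x := by
  obtain ⟨N, hN⟩ := h.prim
  refine coeff_mem_of_mul hu hN (h.qr _ _ (hF.mul hG) ?_) a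
  rwa [map_mul]

/-- forms of unit content are non zero divisors on the associated graded ring -/
lemma QS.cancel (h : QS x) {f : ℕ} {F : MvPolynomial (Fin d) B} (hF : F.IsHomogeneous f)
    (hu : UC F) {n : ℕ} {z : B} (hz : MvPolynomial.eval x F * z ∈ Jx x ^ (f + n)) :
    z ∈ Jx x ^ n := by
  have key : ∀ i ≤ n, z ∈ Jx x ^ i := by
    intro i
    induction i with
    | zero => simp
    | succ i ih =>
      intro hi
      obtain ⟨G, hG, rfl⟩ := (mem_Jx_pow _ _ _).1 (ih (by omega))
      have := h.cancel_step hF hu hG (Ideal.pow_le_pow_right (by omega) hz)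
      rw [pow_succ']
      exact eval_mem_of_coeff x hG this
  exact key n le_rfl

lemma QS.cancel_nI (h : QS x) {f : ℕ} {F : MvPolynomial (Fin d) B} (hF : F.IsHomogeneous f)
    (hu : UC F) {n : ℕ} {z : B} (hz : MvPolynomial.eval x F * z ∈ nI (Jx x) (f + n)) :
    z ∈ nI (Jx x) n := by
  obtain ⟨c, hc⟩ := hz
  refine ⟨c, fun j => ?_⟩
  have h1 := hc j
  rw [mul_pow, ← map_pow] at h1
  by_cases hj : c ≤ n * j
  · refine h.cancel (hF.pow j) (hu.pow j) ?_
    rwa [show f * j + (n * j - c) = (f + n) * j - c by rw [add_mul]; omega]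
  · rw [Nat.sub_eq_zero_of_le (by omega)]; simp

lemma X_UC (i : Fin d) : UC (MvPolynomial.X i : MvPolynomial (Fin d) B) := by
  rw [UC_iff, MvPolynomial.map_X]; exact MvPolynomial.X_ne_zero i

lemma QS.cancel_X (h : QS x) (i : Fin d) {k n : ℕ} {z : B} (hz : x i ^ k * z ∈ Jx x ^ (k + n)) :
    z ∈ Jx x ^ n := by
  have := h.cancel (f := k) (F := MvPolynomial.X i ^ k) (n := n) (z := z)
    (by simpa using (MvPolynomial.isHomogeneous_X B i).pow k) ((X_UC i).pow k) (by simpa using hz)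
  exact this

lemma QS.cancel_X_nI (h : QS x) (i : Fin d) {k n : ℕ} {z : B}
    (hz : x i ^ k * z ∈ nI (Jx x) (k + n)) : z ∈ nI (Jx x) n := by
  have := h.cancel_nI (f := k) (F := MvPolynomial.X i ^ k) (n := n) (z := z)
    (by simpa using (MvPolynomial.isHomogeneous_X B i).pow k) ((X_UC i).pow k) (by simpa using hz)
  exact this

/-- a form of degree `n` whose value is in the closure of `J ^ (n+1)` has coefficients in `m` -/
lemma QS.coeff_mem_of_nI (h : QS x) {n : ℕ} {F : MvPolynomial (Fin d) B} (hF : F.IsHomogeneous n)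
    (hz : MvPolynomial.eval x F ∈ nI (Jx x) (n + 1)) (a) : F.coeff a ∈ maximalIdeal B := by
  by_contra hcon
  have hu : UC F := ⟨a, hcon⟩
  obtain ⟨c, hc⟩ := hz
  have h1 := hc (c + 1)
  rw [← map_pow] at h1
  have h2 := h.cancel (z := 1) (n := 1) (hF.pow (c + 1)) (hu.pow (c+1))
    (by rw [mul_one]
        refine Ideal.pow_le_pow_right ?_ h1
        rw [add_mul, one_mul]; omega)
  rw [pow_one] at h2
  exact h.one_notMem h2

lemma QS.nI_inf_pow (h : QS x) {n : ℕ} {z : B} (h1 : z ∈ nI (Jx x) (n + 1)) (h2 : z ∈ Jx x ^ n) :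
    z ∈ maximalIdeal B * Jx x ^ n := by
  obtain ⟨F, hF, rfl⟩ := (mem_Jx_pow _ _ _).1 h2
  exact eval_mem_of_coeff x hF (h.coeff_mem_of_nI hF h1)

lemma QS.nI_one_le (h : QS x) : nI (Jx x) 1 ≤ maximalIdeal B := by
  intro z hz
  have := h.nI_inf_pow (n := 0) (z := z) hz (by simp)
  simpa using this

end qr
end CMP

namespace CMP

section len

variable {B : Type*} [CommRing B]

/-- colength of an ideal -/
noncomputable def len (Q : Ideal B) : ℕ∞ := Module.length B (B ⧸ Q)

lemma len_range {M : Type*} [AddCommGroup M] [Module B M] (f : M →ₗ[B] B) (P : Ideal B) :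
    len P = Module.length B (M ⧸ Submodule.comap f P) + len (LinearMap.range f ⊔ P) := by
  refine Module.length_eq_add_of_exact
    (Submodule.mapQ (Submodule.comap f P) P f le_rfl)
    (Submodule.mapQ P (LinearMap.range f ⊔ P) LinearMap.id (by
      rw [Submodule.comap_id]; exact le_sup_right)) ?_ ?_ ?_
  · rw [← LinearMap.ker_eq_bot, Submodule.ker_mapQ]
    simp
  · rw [← LinearMap.range_eq_top, Submodule.range_mapQ]
    simp
  · rw [LinearMap.exact_iff, Submodule.ker_mapQ, Submodule.range_mapQ]
    simp [Submodule.map_sup]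

lemma len_colon (P : Ideal B) (u : B) :
    len P = len (P.colon (Ideal.span {u})) + len (Ideal.span {u} ⊔ P) := by
  have := len_range (LinearMap.mulRight B u) P
  have h1 : Submodule.comap (LinearMap.mulRight B u) P = P.colon (Ideal.span {u}) := by
    ext z
    rw [Submodule.mem_comap, Submodule.mem_colon]
    simp only [LinearMap.mulRight_apply, smul_eq_mul, SetLike.mem_coe, Ideal.mem_span_singleton']
    constructor
    · rintro h _ ⟨a, rfl⟩
      rw [mul_left_comm]; exact P.mul_mem_left _ h
    · intro h; exact h u ⟨1, one_mul _⟩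
  have h2 : LinearMap.range (LinearMap.mulRight B u) = Ideal.span {u} := by
    ext z
    simp [LinearMap.mem_range, Ideal.mem_span_singleton']
  rw [h1, h2] at this
  exact this

lemma len_anti {P Q : Ideal B} (h : P ≤ Q) : len Q ≤ len P :=
  Module.length_le_of_surjective (Submodule.mapQ P Q LinearMap.id (by simpa using h))
    (by rw [← LinearMap.range_eq_top, Submodule.range_mapQ]; simp)

lemma len_eq_coheight (Q : Ideal B) : len Q = Order.coheight Q := Module.length_quotient

lemma len_lt {P Q : Ideal B} (h : P < Q) : len Q + 1 ≤ len P := by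
  rw [len_eq_coheight, len_eq_coheight] at *
  exact Order.coheight_add_one_le h

lemma eq_of_len {P Q : Ideal B} (h : P ≤ Q) (hfin : len Q ≠ ⊤) (hl : len P ≤ len Q) : P = Q := by
  by_contra hne
  have := len_lt (lt_of_le_of_ne h hne)
  have h2 := this.trans hl
  exact absurd h2 (not_le.2 ((ENat.lt_add_one_iff hfin).2 le_rfl))

/-- monomials of degree `n` -/
noncomputable def mons (d n : ℕ) : Finset (Fin d →₀ ℕ) := (univ : Finset (Fin d)).finsuppAntidiag n

lemma mem_mons {d n : ℕ} {a : Fin d →₀ ℕ} : a ∈ mons d n ↔ a.degree = n := by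
  rw [mons, Finset.mem_finsuppAntidiag]
  simp [Finsupp.degree_eq_sum]

lemma card_mons (d n : ℕ) : (mons d n).card = d.multichoose n := by
  rw [mons, Finset.card_finsuppAntidiag_nat_eq_multichoose, Finset.card_univ, Fintype.card_fin]

variable {d : ℕ}

/-- value of a monomial -/
def xm (x : Fin d → B) (a : Fin d →₀ ℕ) : B := a.prod fun i k => x i ^ k

lemma xm_eq_eval (x : Fin d → B) (a) : xm x a = MvPolynomial.eval x (MvPolynomial.monomial a 1) := by
  rw [MvPolynomial.eval_monomial, one_mul]; rfl

lemma xm_mem (x : Fin d → B) {a : Fin d →₀ ℕ} {n} (h : a.degree = n) : xm x a ∈ Jx x ^ n := by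
  rw [mem_Jx_pow]
  exact ⟨_, MvPolynomial.isHomogeneous_monomial _ h, (xm_eq_eval x a).symm⟩

lemma xm_add (x : Fin d → B) (a b) : xm x (a + b) = xm x a * xm x b := by
  rw [xm_eq_eval, xm_eq_eval, xm_eq_eval, ← map_mul, MvPolynomial.monomial_mul, one_mul]

lemma isHomogeneous_sum_mons {n : ℕ} (c : (Fin d →₀ ℕ) → B) :
    (∑ a ∈ mons d n, MvPolynomial.monomial a (c a)).IsHomogeneous n :=
  MvPolynomial.IsHomogeneous.sum _ _ _ fun a ha =>
    MvPolynomial.isHomogeneous_monomial _ (mem_mons.1 ha)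

lemma coeff_sum_mons {n : ℕ} (c : (Fin d →₀ ℕ) → B) {a} (ha : a ∈ mons d n) :
    (∑ b ∈ mons d n, MvPolynomial.monomial b (c b)).coeff a = c a := by
  classical
  rw [MvPolynomial.coeff_sum]
  simp [MvPolynomial.coeff_monomial, ha]

lemma eval_sum_mons (x : Fin d → B) {n : ℕ} (c : (Fin d →₀ ℕ) → B) :
    MvPolynomial.eval x (∑ b ∈ mons d n, MvPolynomial.monomial b (c b)) =
      ∑ b ∈ mons d n, c b * xm x b := by
  rw [map_sum]
  refine Finset.sum_congr rfl fun b _ => ?_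
  rw [MvPolynomial.eval_monomial]; rfl

lemma eq_sum_mons {n : ℕ} {F : MvPolynomial (Fin d) B} (hF : F.IsHomogeneous n) :
    F = ∑ b ∈ mons d n, MvPolynomial.monomial b (F.coeff b) := by
  classical
  ext a
  by_cases ha : a ∈ mons d n
  · rw [coeff_sum_mons _ ha]
  · rw [MvPolynomial.coeff_sum, Finset.sum_eq_zero]
    · by_contra h
      apply ha
      rw [mem_mons, Finsupp.degree_eq_weight_one]
      exact hF h
    · intro b hb
      rw [MvPolynomial.coeff_monomial, if_neg]
      rintro rfl; exact ha hb

lemma mem_mul_Jx_pow (x : Fin d → B) (n : ℕ) (Q : Ideal B) (z : B) :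
    z ∈ Q * Jx x ^ n ↔ ∃ F : MvPolynomial (Fin d) B, F.IsHomogeneous n ∧ (∀ a, F.coeff a ∈ Q) ∧
      MvPolynomial.eval x F = z := by
  constructor
  · intro hz
    refine Submodule.mul_induction_on hz ?_ ?_
    · intro q hq w hw
      obtain ⟨F, hF, rfl⟩ := (mem_Jx_pow _ _ _).1 hw
      refine ⟨MvPolynomial.C q * F, ?_, ?_, ?_⟩
      · simpa using (MvPolynomial.isHomogeneous_C _ q).mul hF
      · intro a; rw [MvPolynomial.coeff_C_mul]; exact Q.mul_mem_right _ hq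
      · rw [map_mul, MvPolynomial.eval_C]
    · rintro _ _ ⟨F, hF, hF2, rfl⟩ ⟨G, hG, hG2, rfl⟩
      exact ⟨F + G, hF.add hG, fun a => by
        rw [MvPolynomial.coeff_add]; exact Q.add_mem (hF2 a) (hG2 a), by rw [map_add]⟩
  · rintro ⟨F, hF, h, rfl⟩
    exact eval_mem_of_coeff x hF h

lemma QR.coeff_mem {x : Fin d → B} (h : QR x) {n : ℕ} {Q : Ideal B} (hQ : Jx x ≤ Q)
    {F : MvPolynomial (Fin d) B} (hF : F.IsHomogeneous n)
    (hz : MvPolynomial.eval x F ∈ Q * Jx x ^ n) (a) : F.coeff a ∈ Q := by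
  obtain ⟨G, hG, hG2, hGF⟩ := (mem_mul_Jx_pow _ _ _ _).1 hz
  have := h n (F - G) (hF.sub hG) (by rw [map_sub, hGF, sub_self]; exact zero_mem _) a
  rw [MvPolynomial.coeff_sub] at this
  exact (Q.sub_mem_iff_left (hG2 a)).1 (hQ this)

lemma len_mul_pow {x : Fin d → B} (h : QR x) {Q : Ideal B} (hQ : Jx x ≤ Q) (n : ℕ) :
    len (Q * Jx x ^ n) = d.multichoose n * len Q + len (Jx x ^ n) := by
  classical
  let f : (mons d n → B) →ₗ[B] B :=
    ∑ a : mons d n, (LinearMap.mulRight B (xm x a.1)).comp (LinearMap.proj a)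
  have hf : ∀ c : (Fin d →₀ ℕ) → B, f (fun a => c a.1) = ∑ a ∈ mons d n, c a * xm x a := by
    intro c
    rw [← Finset.sum_coe_sort (mons d n) (fun a => c a * xm x a)]
    simp [f]
  have hext : ∀ c : mons d n → B, ∃ c' : (Fin d →₀ ℕ) → B, c = fun a => c' a.1 := by
    intro c
    refine ⟨fun a => if h : a ∈ mons d n then c ⟨a, h⟩ else 0, ?_⟩
    ext a; simp
  rw [len_range f (Q * Jx x ^ n)]
  congr 1
  · have h1 : Submodule.comap f (Q * Jx x ^ n) = Submodule.pi Set.univ (fun _ => Q) := by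
      ext c
      obtain ⟨c, rfl⟩ := hext c
      rw [Submodule.mem_comap, hf, ← eval_sum_mons, Submodule.mem_pi]
      constructor
      · intro hz a _
        have := h.coeff_mem hQ (isHomogeneous_sum_mons c) hz a.1
        rwa [coeff_sum_mons _ a.2] at this
      · intro hc
        rw [eval_sum_mons]
        refine Ideal.sum_mem _ fun a ha => Ideal.mul_mem_mul (hc ⟨a, ha⟩ trivial)
          (xm_mem x (mem_mons.1 ha))
    rw [h1, (Submodule.quotientPi _).length_eq, Module.length_pi, len, ENat.card_eq_coe_fintype_card,
      Fintype.card_coe, card_mons]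
  · congr 1
    apply le_antisymm
    · refine sup_le ?_ Ideal.mul_le_right
      rintro _ ⟨c, rfl⟩
      obtain ⟨c, rfl⟩ := hext c
      rw [hf]
      exact Ideal.sum_mem _ fun a ha => Ideal.mul_mem_left _ _ (xm_mem x (mem_mons.1 ha))
    · refine le_sup_of_le_left ?_
      intro z hz
      obtain ⟨F, hF, rfl⟩ := (mem_Jx_pow _ _ _).1 hz
      refine ⟨fun a => F.coeff a.1, ?_⟩
      rw [hf (fun a => F.coeff a), ← eval_sum_mons, ← eq_sum_mons hF]

lemma sum_multichoose (d n : ℕ) : ∑ i ∈ range (n + 1), d.multichoose i = (d + 1).multichoose n := by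
  induction n with
  | zero => simp
  | succ n ih => rw [Finset.sum_range_succ, ih, Nat.multichoose_succ_succ, add_comm]

lemma len_Jx_pow {x : Fin d → B} (h : QR x) (n : ℕ) :
    len (Jx x ^ (n + 1)) = (d + 1).multichoose n * len (Jx x) := by
  induction n with
  | zero => simp
  | succ n ih =>
    rw [pow_succ', len_mul_pow h le_rfl, ih, Nat.multichoose_succ_succ, Nat.cast_add, add_mul]

end len
end CMP

namespace CMP

section count

variable {B : Type*} [CommRing B]

lemma count_aux {ι α : Type*} [LinearOrder α] (key : ι → α) (u : ι → B) (Q : Ideal B)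
    (S : Finset ι) :
    (∃ s0 ∈ S, ∃ c : ι → B, c s0 = 1 ∧ ∑ s ∈ S with key s ≤ key s0, c s * u s ∈ Q) ∨
      len (Ideal.span (Set.image u S) ⊔ Q) + S.card ≤ len Q := by
  classical
  induction S using Finset.induction_on_max_value key with
  | empty => right; simp
  | insert a S ha hmax ih =>
    rcases ih with ⟨s0, hs0, c, hc, h⟩ | ih
    · left
      refine ⟨s0, Finset.mem_insert_of_mem hs0, fun s => if s = a then 0 else c s, ?_, ?_⟩
      · show (if s0 = a then 0 else c s0) = 1
        rw [if_neg]; exact hc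
        rintro rfl; exact ha hs0
      · rw [Finset.filter_insert]
        have h3 : ∑ s ∈ S with key s ≤ key s0, (if s = a then 0 else c s) * u s ∈ Q := by
          rw [Finset.sum_congr rfl (g := fun s => c s * u s)]
          · exact h
          · intro s hs
            rw [if_neg]
            rintro rfl; exact ha (Finset.mem_filter.1 hs).1
        split_ifs with h2
        · rw [Finset.sum_insert (by simp [ha])]
          simpa using h3
        · exact h3
    · by_cases hm : u a ∈ Ideal.span (Set.image u S) ⊔ Q
      · left
        obtain ⟨y, hy, q, hq, hyq⟩ := Submodule.mem_sup.1 hm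
        obtain ⟨c0, hc0⟩ := Submodule.mem_span_image_finset_iff_exists_fun B |>.1 hy
        obtain ⟨c, hc⟩ : ∃ c : ι → B, ∑ s ∈ S, c s • u s = y := by
          refine ⟨fun s => if h : s ∈ S then c0 ⟨s, h⟩ else 0, ?_⟩
          rw [← hc0, ← Finset.sum_coe_sort]
          simp
        refine ⟨a, Finset.mem_insert_self _ _, fun s => if s = a then 1 else - c s, by simp, ?_⟩
        rw [Finset.filter_true_of_mem (by
          intro s hs
          rcases Finset.mem_insert.1 hs with rfl | hs
          · exact le_rfl
          · exact hmax s hs), Finset.sum_insert ha]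
        beta_reduce
        rw [if_pos rfl, one_mul, Finset.sum_congr rfl (g := fun s => - (c s • u s))]
        · rw [Finset.sum_neg_distrib, hc, ← sub_eq_add_neg, ← hyq, add_sub_cancel_left]
          exact hq
        · intro s hs
          rw [if_neg (by rintro rfl; exact ha hs), smul_eq_mul, neg_mul]
      · right
        rw [Finset.card_insert_of_notMem ha]
        have h1 : Ideal.span (Set.image u S) ⊔ Q < Ideal.span (Set.image u (insert a S : Finset ι)) ⊔ Q := by
          refine lt_of_le_of_ne (sup_le_sup_right (Ideal.span_mono (Set.image_mono ?_)) _) ?_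
          · simp
          · intro h; apply hm; rw [h]
            exact Ideal.mem_sup_left (Ideal.subset_span ⟨a, by simp, rfl⟩)
        calc _ = len (Ideal.span (Set.image u (insert a S : Finset ι)) ⊔ Q) + 1 + S.card := by
              push_cast; ring
          _ ≤ _ := (add_le_add_left (len_lt h1) _).trans ih

lemma count {ι α : Type*} [LinearOrder α] (key : ι → α) (u : ι → B) (Q : Ideal B)
    (S : Finset ι) (h : len Q < S.card) :
    ∃ s0 ∈ S, ∃ c : ι → B, c s0 = 1 ∧ ∑ s ∈ S with key s ≤ key s0, c s * u s ∈ Q := by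
  rcases count_aux key u Q S with h1 | h1
  · exact h1
  · exact absurd ((le_add_left le_rfl).trans h1) (not_le.2 h)

end count
end CMP

namespace CMP

section growth

open Filter Topology

lemma choose_pos' (n d : ℕ) : (0 : ℝ) < ((n + d).choose d : ℝ) := by
  exact_mod_cast Nat.choose_pos (by omega)

lemma tend_shift_one (d : ℕ) :
    Tendsto (fun n : ℕ => ((n + 1 + d).choose d : ℝ) / ((n + d).choose d : ℝ)) atTop (𝓝 1) := by
  have h1 : ∀ n : ℕ, ((n + 1 + d).choose d : ℝ) / ((n + d).choose d : ℝ)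
      = 1 + (d : ℝ) * (1 / ((n : ℝ) + 1)) := by
    intro n
    have h0 := choose_pos' n d
    have h2 : (n + 1) * (n + 1 + d).choose d = (n + 1 + d) * (n + d).choose d := by
      have := Nat.add_one_mul_choose_eq (n + d) n
      rw [Nat.choose_symm_add] at this
      have h3 : (n+d).succ.choose n.succ = (n + 1 + d).choose d := by
        rw [show (n+d).succ = n.succ + d by omega, Nat.choose_symm_add]
      rw [h3] at this
      rw [show n + 1 + d = (n+d).succ by omega] at *
      linarith
    have h3 : ((n : ℝ) + 1) * ((n + 1 + d).choose d : ℝ) = (n + 1 + d) * ((n + d).choose d : ℝ) := by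
      exact_mod_cast h2
    have : (n : ℝ) + 1 ≠ 0 := by positivity
    field_simp
    linarith
  simp_rw [h1]
  have := (tendsto_one_div_add_atTop_nhds_zero_nat (𝕜 := ℝ)).const_mul (d : ℝ)
  simpa using this.const_add 1

lemma tend_shift (d c : ℕ) :
    Tendsto (fun n : ℕ => ((n + c + d).choose d : ℝ) / ((n + d).choose d : ℝ)) atTop (𝓝 1) := by
  induction c with
  | zero =>
    refine tendsto_const_nhds.congr fun n => ?_
    rw [add_zero, div_self (choose_pos' n d).ne']
  | succ c ih =>
    have h := ((tend_shift_one d).comp (tendsto_add_atTop_nat c)).mul ih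
    rw [one_mul] at h
    refine h.congr fun n => ?_
    simp only [Function.comp]
    rw [show n + (c + 1) + d = n + c + 1 + d by omega]
    exact div_mul_div_cancel₀ (choose_pos' (n+c) d).ne'

lemma tend_lower_one (d : ℕ) :
    Tendsto (fun n : ℕ => ((n + d).choose d : ℝ) / ((n + (d+1)).choose (d+1) : ℝ)) atTop (𝓝 0) := by
  have h1 : ∀ n : ℕ, ((n + d).choose d : ℝ) / ((n + (d+1)).choose (d+1) : ℝ)
      = ((d : ℝ) + 1) * (1 / (((n + d : ℕ) : ℝ) + 1)) := by
    intro n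
    have h0 := choose_pos' n (d+1)
    have h2 := Nat.add_one_mul_choose_eq (n + d) d
    have h3 : ((n + d : ℕ) + 1 : ℝ) * ((n + d).choose d : ℝ) =
      ((n + (d+1)).choose (d+1) : ℝ) * (d + 1) := by exact_mod_cast h2
    have : ((n + d : ℕ) : ℝ) + 1 ≠ 0 := by positivity
    field_simp
    linarith
  simp_rw [h1]
  have := ((tendsto_one_div_add_atTop_nhds_zero_nat (𝕜 := ℝ)).comp
    (tendsto_add_atTop_nat d)).const_mul ((d : ℝ) + 1)
  simpa using this

lemma tend_lower (j d : ℕ) (h : j < d) :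
    Tendsto (fun n : ℕ => ((n + j).choose j : ℝ) / ((n + d).choose d : ℝ)) atTop (𝓝 0) := by
  induction d, h using Nat.le_induction with
  | base => exact tend_lower_one j
  | succ d _ ih =>
    have := ih.mul (tend_lower_one d)
    rw [zero_mul] at this
    exact this.congr fun n => div_mul_div_cancel₀ (choose_pos' n d).ne'

lemma growth (d ρ c : ℕ) : ∃ n, ρ * (n + c + d).choose d < (ρ + 1) * (n + d).choose d := by
  have h := (tend_shift d c).const_mul (ρ : ℝ)
  rw [mul_one] at h
  have h2 := h.eventually (gt_mem_nhds (show (ρ : ℝ) < ρ + 1 by linarith))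
  obtain ⟨n, hn⟩ := h2.exists
  refine ⟨n, ?_⟩
  rw [← mul_div_assoc, div_lt_iff₀ (choose_pos' n d)] at hn
  exact_mod_cast hn

lemma multichoose_succ_eq (d n : ℕ) : (d + 1).multichoose n = (n + d).choose d := by
  rw [Nat.multichoose_eq, show d + 1 + n - 1 = n + d by omega, Nat.choose_symm_add]

end growth

section rank

variable {B : Type*} [CommRing B] {d : ℕ} {x : Fin d → B}

/-- monomials of degree `≤ n` -/
noncomputable def monsLE (d n : ℕ) : Finset (Fin d →₀ ℕ) := (range (n + 1)).biUnion (mons d)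

lemma mem_monsLE {n : ℕ} {a : Fin d →₀ ℕ} : a ∈ monsLE d n ↔ a.degree ≤ n := by
  simp [monsLE, mem_mons, Nat.lt_succ_iff]

lemma card_monsLE (d n : ℕ) : (monsLE d n).card = (n + d).choose d := by
  rw [monsLE, Finset.card_biUnion, ← multichoose_succ_eq, ← sum_multichoose]
  · exact Finset.sum_congr rfl fun i _ => card_mons d i
  · intro i _ j _ hij
    show Disjoint (mons d i) (mons d j)
    rw [Finset.disjoint_left]
    intro a ha hb
    rw [mem_mons] at ha hb
    exact hij (ha.symm.trans hb)

lemma len_nI_le (h : QR x) {ρ : ℕ} (hρ : len (Jx x) ≤ ρ) (n : ℕ) :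
    len (nI (Jx x) (n + 1)) ≤ (ρ * (n + d).choose d : ℕ) := by
  refine (len_anti (pow_le_nI _ _)).trans ?_
  rw [len_Jx_pow h, multichoose_succ_eq, mul_comm]
  push_cast
  gcongr

lemma rank_rel (h : QR x) {ρ : ℕ} (hρ : len (Jx x) ≤ ρ) (y : Fin (ρ + 1) → B)
    (lam : Fin (ρ + 1) → ℝ) (H : ℝ → Ideal B)
    (h1 : ∀ j a (l : ℝ), l < lam j + a.degree → xm x a * y j ∈ H l)
    (h2 : ∀ (n : ℕ) (l : ℝ), l < n → nI (Jx x) n ≤ H l) :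
    ∃ (e : ℝ) (F : Fin (ρ + 1) → MvPolynomial (Fin d) B),
      (∀ j a, (F j).coeff a ≠ 0 → lam j + a.degree = e) ∧
      (∃ j a, (F j).coeff a = 1) ∧ ∑ j, MvPolynomial.eval x (F j) * y j ∈ H e := by
  classical
  obtain ⟨c, hc⟩ : ∃ c : ℕ, ∀ j, lam j < c := by
    obtain ⟨c, hc⟩ := exists_nat_gt (∑ j, |lam j|)
    refine ⟨c, fun j => ((le_abs_self _).trans ?_).trans_lt hc⟩
    exact Finset.single_le_sum (f := fun j => |lam j|) (fun i _ => abs_nonneg _) (Finset.mem_univ j)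
  obtain ⟨n, hn⟩ := growth d ρ c
  obtain ⟨s0, hs0, k, hk, hrel⟩ := count
    (fun s : Fin (ρ+1) × (Fin d →₀ ℕ) => - (lam s.1 + s.2.degree)) (fun s => xm x s.2 * y s.1)
    (nI (Jx x) (n + c + 1)) (univ ×ˢ monsLE d n) (by
      refine (len_nI_le h hρ _).trans_lt ?_
      rw [Finset.card_product, Finset.card_univ, Fintype.card_fin, card_monsLE]
      exact_mod_cast hn)
  set e := lam s0.1 + s0.2.degree with he
  have hcoe : ∀ j a, (∑ a ∈ monsLE d n with lam j + (a.degree : ℝ) = e,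
      MvPolynomial.monomial a (k (j, a))).coeff a =
      if a ∈ monsLE d n ∧ lam j + (a.degree : ℝ) = e then k (j, a) else 0 := by
    intro j a
    rw [MvPolynomial.coeff_sum]
    simp only [MvPolynomial.coeff_monomial]
    rw [Finset.sum_ite_eq']
    simp
  have hs0' : s0.2 ∈ monsLE d n := (Finset.mem_product.1 hs0).2
  refine ⟨e, fun j => ∑ a ∈ monsLE d n with lam j + (a.degree : ℝ) = e,
    MvPolynomial.monomial a (k (j, a)), ?_, ⟨s0.1, s0.2, ?_⟩, ?_⟩
  · intro j a ha
    rw [hcoe] at ha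
    by_contra hne
    rw [if_neg (fun h => hne h.2)] at ha
    exact ha rfl
  · rw [hcoe, if_pos ⟨hs0', he.symm⟩]; exact hk
  · have h3 : nI (Jx x) (n + c + 1) ≤ H e := by
      refine h2 _ _ ?_
      have := hc s0.1
      have h4 : (s0.2.degree : ℝ) ≤ n := by exact_mod_cast mem_monsLE.1 hs0'
      push_cast; linarith
    have h4 := h3 hrel
    have h5 : ∑ j, MvPolynomial.eval x (∑ a ∈ monsLE d n with lam j + (a.degree : ℝ) = e,
        MvPolynomial.monomial a (k (j, a))) * y j =
        ∑ s ∈ univ ×ˢ monsLE d n, if lam s.1 + (s.2.degree : ℝ) = e then k s * (xm x s.2 * y s.1)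
          else 0 := by
      rw [Finset.sum_product]
      refine Finset.sum_congr rfl fun j _ => ?_
      rw [← Finset.sum_filter, map_sum, Finset.sum_mul]
      refine Finset.sum_congr rfl fun a _ => ?_
      rw [MvPolynomial.eval_monomial, mul_assoc]; rfl
    rw [h5]
    rw [Finset.sum_filter] at h4
    rw [← sub_add_cancel (∑ s ∈ _, _) (∑ s ∈ _, _)]
    refine add_mem ?_ h4
    rw [← Finset.sum_sub_distrib]
    refine Ideal.sum_mem _ fun s _ => ?_
    by_cases hs : lam s.1 + (s.2.degree : ℝ) = e
    · rw [if_pos hs, if_pos (by rw [hs]), sub_self]; exact zero_mem _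
    · rw [if_neg hs]
      split_ifs with h6
      · rw [zero_sub]
        refine neg_mem (Ideal.mul_mem_left _ _ (h1 _ _ _ ?_))
        exact lt_of_le_of_ne (neg_le_neg_iff.1 h6) (Ne.symm hs)
      · simp

end rank
end CMP

namespace CMP

section claimA

variable {B : Type*} [CommRing B] {d : ℕ} {x : Fin d → B}

lemma isHom_of {n : ℕ} {F : MvPolynomial (Fin d) B} (h : ∀ a, F.coeff a ≠ 0 → a.degree = n) :
    F.IsHomogeneous n := by
  intro a ha
  have := h a ha
  rw [Finsupp.degree_eq_weight_one] at this
  exact this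

lemma deg_of_isHom {n : ℕ} {F : MvPolynomial (Fin d) B} (h : F.IsHomogeneous n) {a}
    (ha : F.coeff a ≠ 0) : a.degree = n := by
  rw [Finsupp.degree_eq_weight_one]
  exact h ha

lemma eval_mem_Jx_pow {f : ℕ} {F : MvPolynomial (Fin d) B} (hF : F.IsHomogeneous f) :
    MvPolynomial.eval x F ∈ Jx x ^ f := (mem_Jx_pow _ _ _).2 ⟨F, hF, rfl⟩

variable [IsLocalRing B]

lemma claimA_aux (h : QS x) {n e f b : ℕ} {y r : B} (hb : 0 < b) {g : ℕ → B}
    (hf : f + n * b = e)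
    (hg : ∀ k, 1 ≤ k → k < b → g k ∈ nI (Jx x) (e - n * k))
    {F : MvPolynomial (Fin d) B} (hF : F.IsHomogeneous f) (hu : UC F)
    (hr : r ∈ nI (Jx x) e)
    (hrel : MvPolynomial.eval x F * y ^ b + ∑ k ∈ Ico 1 b, g k * y ^ k = r) :
    y ∈ nI (Jx x) n := by
  set v := MvPolynomial.eval x F with hv
  have hvm : v ∈ nI (Jx x) f := pow_le_nI _ _ (eval_mem_Jx_pow hF)
  refine h.cancel_nI hF hu ?_
  refine nI_of_eq (b := b) (fun i => if i = b then - r * v ^ (b-1) else g (b - i) * v ^ (i-1))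
    ?_ ?_
  · intro i hi
    rw [Finset.mem_Icc] at hi
    beta_reduce
    split_ifs with hib
    · subst hib
      rw [neg_mul]
      refine neg_mem (nI_anti _ ?_ (mul_mem_nI hr (pow_mem_nI hvm (i-1))))
      obtain ⟨i, rfl⟩ := Nat.exists_eq_add_of_le' hb
      rw [← hf, Nat.add_sub_cancel]; nlinarith
    · refine nI_anti _ ?_ (mul_mem_nI (hg (b-i) (by omega) (by omega)) (pow_mem_nI hvm (i-1)))
      obtain ⟨i, rfl⟩ := Nat.exists_eq_add_of_le' hi.1
      obtain ⟨b, rfl⟩ := Nat.exists_eq_add_of_le' hi.2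
      rw [← hf, Nat.add_sub_cancel, Nat.add_sub_cancel, Nat.mul_add n b, ← add_assoc,
        show f + n * b + n * (i+1) - n * b = f + n * (i+1) by omega]
      nlinarith
  · rw [← Finset.Ico_succ_right_eq_Icc, Nat.succ_eq_succ, Nat.succ_eq_add_one,
      Finset.sum_Ico_succ_top (by omega), if_pos rfl, Nat.sub_self, pow_zero, mul_one]
    have h1 : ∑ i ∈ Ico 1 b, (if i = b then - r * v ^ (b-1) else g (b - i) * v ^ (i-1)) *
        (v * y) ^ (b - i) = v ^ (b-1) * ∑ k ∈ Ico 1 b, g k * y ^ k := by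
      have hre := Finset.sum_Ico_reflect (fun i => (if i = b then - r * v ^ (b-1) else
        g (b - i) * v ^ (i-1)) * (v * y) ^ (b - i)) 1 (Nat.le_succ b)
      rw [Nat.add_sub_cancel, Nat.add_sub_cancel_left] at hre
      rw [← hre, Finset.mul_sum]
      refine Finset.sum_congr rfl fun k hk => ?_
      rw [Finset.mem_Ico] at hk
      rw [if_neg (by omega), show b - (b - k) = k by omega, mul_pow]
      rw [show b - 1 = (b - k - 1) + k by omega, pow_add]
      ring
    rw [h1, ← hrel]
    obtain ⟨b, rfl⟩ := Nat.exists_eq_add_of_le' hb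
    rw [Nat.add_sub_cancel]
    ring

/-- Claim A -/
lemma claimA_one (h : QS x) (hm : maximalIdeal B ≤ nI (Jx x) 1) {ρ : ℕ} (hρ : len (Jx x) ≤ ρ)
    {n : ℕ} {y : B} (hy : ∀ j, y ^ j ∈ nI (Jx x) (n * j - 1)) : y ∈ nI (Jx x) n := by
  classical
  have hxy : ∀ (j : ℕ) (a : Fin d →₀ ℕ) (k : ℕ), (k < n * j + a.degree ∨ k = 0) →
      xm x a * y ^ j ∈ nI (Jx x) k := by
    intro j a k hk
    rcases hk with hk | rfl
    · exact nI_anti _ (by omega) (mul_mem_nI (pow_le_nI _ _ (xm_mem x rfl)) (hy j))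
    · rw [nI_zero]; trivial
  obtain ⟨e', F, hF, ⟨j1, a1, hj1⟩, hrel⟩ := rank_rel h.qr hρ (fun j => y ^ (j.1 + 1))
    (fun j => ((n * (j.1 + 1) : ℕ) : ℝ)) (fun l => nI (Jx x) ⌊l⌋₊) (by
      intro j a l hl
      refine hxy _ _ _ ?_
      rcases lt_or_ge l 0 with h0 | h0
      · exact Or.inr (Nat.floor_of_nonpos h0.le)
      · left; rw [Nat.floor_lt h0]; exact_mod_cast hl) (by
      intro k l hl
      rcases lt_or_ge l 0 with h0 | h0
      · rw [Nat.floor_of_nonpos h0.le, nI_zero]; exact le_top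
      · exact nI_anti _ ((Nat.floor_lt h0).2 hl).le)
  obtain ⟨e, rfl⟩ : ∃ e : ℕ, e' = e := by
    refine ⟨n * (j1.1 + 1) + a1.degree, ?_⟩
    rw [← hF j1 a1 (by rw [hj1]; exact one_ne_zero)]
    push_cast; ring
  rw [Nat.floor_natCast] at hrel
  set Fn : ℕ → MvPolynomial (Fin d) B := fun k => if h : k < ρ + 1 then F ⟨k, h⟩ else 0 with hFn
  have hFn1 : ∀ k a, (Fn k).coeff a ≠ 0 → n * (k + 1) + a.degree = e := by
    intro k a hk
    simp only [hFn] at hk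
    split_ifs at hk with hlt
    · have := hF _ _ hk
      simp only at this
      exact_mod_cast this
    · simp at hk
  have hFn2 : ∀ k, (Fn k).IsHomogeneous (e - n * (k + 1)) := by
    intro k
    refine isHom_of fun a ha => ?_
    have := hFn1 k a ha
    omega
  have hrel2 : ∑ k ∈ range (ρ + 1), MvPolynomial.eval x (Fn k) * y ^ (k + 1) ∈ nI (Jx x) e := by
    rw [Finset.sum_range]
    convert hrel using 2 with j _
    simp only [hFn, j.2, dif_pos, Fin.eta]
  obtain ⟨j0, hj0, hmax⟩ := Finset.exists_max_image ((range (ρ + 1)).filter fun k => UC (Fn k)) id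
    ⟨j1.1, by
      rw [Finset.mem_filter, Finset.mem_range]
      refine ⟨j1.2, a1, ?_⟩
      simp only [hFn, j1.2, dif_pos, Fin.eta, hj1]
      exact fun hone => (maximalIdeal.isMaximal B).ne_top ((Ideal.eq_top_iff_one _).2 hone)⟩
  rw [Finset.mem_filter, Finset.mem_range] at hj0
  have hle : n * (j0 + 1) ≤ e := by
    obtain ⟨a, ha⟩ := hj0.2
    have := hFn1 j0 a (fun h0 => ha (by rw [h0]; exact zero_mem _))
    omega
  have hrest : ∑ k ∈ Ico (j0 + 1) (ρ + 1), MvPolynomial.eval x (Fn k) * y ^ (k + 1)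
      ∈ nI (Jx x) e := by
    refine Ideal.sum_mem _ fun k hk => ?_
    rw [Finset.mem_Ico] at hk
    have hnu : ∀ a, (Fn k).coeff a ∈ maximalIdeal B := by
      by_contra hcon
      push Not at hcon
      have := hmax k (by rw [Finset.mem_filter, Finset.mem_range]; exact ⟨hk.2, hcon⟩)
      simp only [id] at this
      omega
    rw [MvPolynomial.eval_eq, Finset.sum_mul]
    refine Ideal.sum_mem _ fun a ha => ?_
    have h1 := hFn1 k a (MvPolynomial.mem_support_iff.1 ha)
    rw [mul_assoc]
    have h2 : xm x a * y ^ (k+1) ∈ nI (Jx x) (e - 1) := hxy _ _ _ (by omega)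
    exact nI_anti _ (by omega) (mul_mem_nI (hm (hnu a)) h2)
  refine claimA_aux h (n := n) (e := e) (f := e - n * (j0 + 1)) (b := j0 + 1) (y := y) (by omega)
    (g := fun k => MvPolynomial.eval x (Fn (k - 1))) (by omega) ?_ (hFn2 j0) hj0.2
    (r := ∑ k ∈ range (j0 + 1), MvPolynomial.eval x (Fn k) * y ^ (k + 1)) ?_ ?_
  · intro k hk _
    obtain ⟨k, rfl⟩ := Nat.exists_eq_add_of_le' hk
    exact pow_le_nI _ _ (eval_mem_Jx_pow (hFn2 k))
  · rw [← Finset.sum_range_add_sum_Ico _ (show j0 + 1 ≤ ρ + 1 by omega)] at hrel2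
    exact (Submodule.add_mem_iff_left _ hrest).1 hrel2
  · rw [Finset.sum_range_succ, add_comm, add_right_cancel_iff, Finset.range_eq_Ico,
      ← Finset.sum_Ico_add' (fun k => MvPolynomial.eval x (Fn (k - 1)) * y ^ k) 0 j0 1]
    rfl

lemma claimA (h : QS x) (hm : maximalIdeal B ≤ nI (Jx x) 1) {ρ : ℕ} (hρ : len (Jx x) ≤ ρ)
    {n : ℕ} {y : B} (c : ℕ) (hy : ∀ j, y ^ j ∈ nI (Jx x) (n * j - c)) : y ∈ nI (Jx x) n := by
  refine claimA_one h hm hρ fun j => ?_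
  refine nI_root (b := c + 1) (by omega) ?_
  rw [← pow_mul]
  refine nI_anti _ ?_ (hy _)
  rw [← mul_assoc, Nat.sub_mul]
  have : c ≤ 1 * (c + 1) := by omega
  omega

/-- root filtration -/
def kn (h : QS x) (hm : maximalIdeal B ≤ nI (Jx x) 1) {ρ : ℕ} (hρ : len (Jx x) ≤ ρ)
    (M n : ℕ) : Ideal B where
  carrier := {z | z ^ (M + 1) ∈ nI (Jx x) n}
  zero_mem' := by simp
  smul_mem' := by
    intro c z hz
    show (c * z) ^ (M + 1) ∈ nI (Jx x) n
    rw [mul_pow]; exact Ideal.mul_mem_left _ _ hz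
  add_mem' := by
    intro z w hz hw
    refine claimA h hm hρ (2 * n) fun j => ?_
    rw [← pow_mul, add_pow]
    refine Ideal.sum_mem _ fun i hi => Ideal.mul_mem_right _ _ ?_
    rw [Finset.mem_range, Nat.lt_succ_iff] at hi
    have key : ∀ {u : B} (_ : u ^ (M + 1) ∈ nI (Jx x) n) (i : ℕ),
        u ^ i ∈ nI (Jx x) (n * (i / (M + 1))) := by
      intro u hu i
      conv => enter [2]; rw [← Nat.div_add_mod i (M + 1)]
      rw [pow_add, pow_mul]
      exact Ideal.mul_mem_right _ _ (pow_mem_nI hu _)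
    refine nI_anti _ ?_ (mul_mem_nI (key hz i) (key hw ((M + 1) * j - i)))
    have h1 := Nat.div_add_mod i (M + 1)
    have h2 := Nat.div_add_mod ((M + 1) * j - i) (M + 1)
    have h3 := Nat.mod_lt i (show 0 < M + 1 by omega)
    have h4 := Nat.mod_lt ((M + 1) * j - i) (show 0 < M + 1 by omega)
    set q1 := i / (M + 1)
    set q2 := ((M + 1) * j - i) / (M + 1)
    have h5 : (M + 1) * (q1 + q2 + 2) > (M + 1) * j := by
      have : (M + 1) * (q1 + q2 + 2) = (M+1) * q1 + (M+1) * q2 + 2 * (M + 1) := by ring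
      omega
    have h6 : j ≤ q1 + q2 + 2 := (lt_of_mul_lt_mul_left h5 (Nat.zero_le _)).le
    have h7 : n * j ≤ n * (q1 + q2 + 2) := Nat.mul_le_mul_left _ h6
    have : n * (q1 + q2 + 2) = n * q1 + n * q2 + 2 * n := by ring
    omega

lemma mem_kn {h : QS x} {hm : maximalIdeal B ≤ nI (Jx x) 1} {ρ : ℕ} {hρ : len (Jx x) ≤ ρ}
    {M n : ℕ} {z : B} : z ∈ kn h hm hρ M n ↔ z ^ (M + 1) ∈ nI (Jx x) n := Iff.rfl

end claimA
end CMP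

namespace CMP

section lemC

variable {B : Type*} [CommRing B] {d : ℕ} {x : Fin d → B} [IsLocalRing B]

/-- elements of asymptotic order `> l` -/
def hI (h : QS x) (hm : maximalIdeal B ≤ nI (Jx x) 1) {ρ : ℕ} (hρ : len (Jx x) ≤ ρ)
    (l : ℝ) : Ideal B where
  carrier := {z | ∃ a b : ℕ, 0 < b ∧ l * b < a ∧ z ^ b ∈ nI (Jx x) a}
  zero_mem' := by
    obtain ⟨n, hn⟩ := exists_nat_gt l
    exact ⟨n, 1, one_pos, by simpa using hn, by simp⟩
  smul_mem' := by
    rintro c z ⟨a, b, hb, hl, hz⟩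
    refine ⟨a, b, hb, hl, ?_⟩
    rw [smul_eq_mul, mul_pow]; exact Ideal.mul_mem_left _ _ hz
  add_mem' := by
    rintro z w ⟨a, b, hb, hl, hz⟩ ⟨a', b', hb', hl', hw⟩
    have hb1 : (0:ℝ) < b := by exact_mod_cast hb
    have hb2 : (0:ℝ) < b' := by exact_mod_cast hb'
    have hbb : 0 < b * b' := Nat.mul_pos hb hb'
    obtain ⟨M, hM⟩ := Nat.exists_eq_add_of_le' hbb
    refine ⟨min (a * b') (a' * b), b * b', hbb, ?_, ?_⟩
    · push_cast
      rw [lt_min_iff]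
      constructor <;> nlinarith
    · have e1 : z ∈ kn h hm hρ M (min (a * b') (a' * b)) := by
        rw [mem_kn, ← hM, pow_mul]
        exact nI_anti _ (min_le_left _ _) (pow_mem_nI hz b')
      have e2 : w ∈ kn h hm hρ M (min (a * b') (a' * b)) := by
        rw [mem_kn, ← hM, mul_comm b b', pow_mul]
        exact nI_anti _ (min_le_right _ _) (pow_mem_nI hw b)
      have := add_mem e1 e2
      rwa [mem_kn, ← hM] at this

lemma mem_hI {h : QS x} {hm : maximalIdeal B ≤ nI (Jx x) 1} {ρ : ℕ} {hρ : len (Jx x) ≤ ρ}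
    {l : ℝ} {z : B} : z ∈ hI h hm hρ l ↔ ∃ a b : ℕ, 0 < b ∧ l * b < a ∧ z ^ b ∈ nI (Jx x) a :=
  Iff.rfl

/-- asymptotic orders have bounded denominators -/
lemma lemC (h : QS x) (hm : maximalIdeal B ≤ nI (Jx x) 1) {ρ : ℕ} (hρ : len (Jx x) ≤ ρ)
    {z : B} {n a b : ℕ} (hb : 0 < b) (hlt : n * b < a * ρ.factorial)
    (hz : z ^ b ∈ nI (Jx x) a) : z ^ ρ.factorial ∈ nI (Jx x) (n + 1) := by
  classical
  by_contra hcon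
  set M := ρ.factorial with hM
  have hM0 : 0 < M := Nat.factorial_pos ρ
  have hM0' : (0:ℝ) < M := by exact_mod_cast hM0
  have hbd : ∀ a b : ℕ, 0 < b → z ^ b ∈ nI (Jx x) a → a * M < (n + 1) * b := by
    intro a b hb hz
    by_contra hle
    push Not at hle
    refine hcon (nI_root hb ?_)
    rw [← pow_mul, mul_comm M, pow_mul]
    exact nI_anti _ hle (pow_mem_nI hz M)
  set S : Set ℝ := {r | ∃ a b : ℕ, 0 < b ∧ z ^ b ∈ nI (Jx x) a ∧ r = a / b} with hS
  have hSbd : ∀ r ∈ S, r ≤ (n + 1) / M := by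
    rintro r ⟨a, b, hb, hz, rfl⟩
    have := hbd a b hb hz
    rw [div_le_div_iff₀ (by exact_mod_cast hb) hM0']
    exact_mod_cast this.le
  have hSb : BddAbove S := ⟨_, hSbd⟩
  set α := sSup S with hα
  have hle : ∀ a b : ℕ, 0 < b → z ^ b ∈ nI (Jx x) a → (a : ℝ) ≤ α * b := by
    intro a b hb hz
    have : (a / b : ℝ) ≤ α := le_csSup hSb ⟨a, b, hb, hz, rfl⟩
    rwa [div_le_iff₀ (by exact_mod_cast hb)] at this
  have hSne : S.Nonempty := ⟨_, a, b, hb, hz, rfl⟩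
  have hex : ∀ l < α, ∃ a b : ℕ, 0 < b ∧ z ^ b ∈ nI (Jx x) a ∧ l * b < a := by
    intro l hl
    obtain ⟨r, ⟨a, b, hb, hz, rfl⟩, hr⟩ := exists_lt_of_lt_csSup hSne hl
    refine ⟨a, b, hb, hz, ?_⟩
    rwa [lt_div_iff₀ (by exact_mod_cast hb)] at hr
  have hα1 : (n : ℝ) < α * M := by
    have h1 := hle a b hb hz
    have hb' : (0:ℝ) < b := by exact_mod_cast hb
    have h2 : (n * b : ℝ) < a * M := by exact_mod_cast hlt
    by_contra hcc
    push Not at hcc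
    have : (n : ℝ) * b < n * b := by
      calc (n : ℝ) * b < a * M := h2
        _ ≤ α * b * M := by gcongr
        _ = α * M * b := by ring
        _ ≤ n * b := by gcongr
    exact lt_irrefl _ this
  have hα2 : α * M < n + 1 := by
    have h1 : α ≤ (n + 1) / M := csSup_le hSne hSbd
    rw [le_div_iff₀ hM0'] at h1
    refine lt_of_le_of_ne h1 fun heq => hcon ?_
    refine claimA h hm hρ 1 fun j => ?_
    rcases Nat.eq_zero_or_pos j with rfl | hj
    · simp [nI_zero]
    have hj' : (0:ℝ) < j := by exact_mod_cast hj
    obtain ⟨a, b, hb, hz, hab⟩ := hex (α - 1 / (M * j)) (by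
      have : (0:ℝ) < 1 / (M * j) := by positivity
      linarith)
    refine nI_root hb ?_
    rw [← pow_mul, ← pow_mul, show M * (j * b) = b * (M * j) by ring, pow_mul]
    refine nI_anti _ ?_ (pow_mem_nI hz _)
    have hge : 1 ≤ (n + 1) * j := Nat.mul_pos (by omega) hj
    zify [hge]
    have h3 : ((α * M) * j - 1) * b < a * (M * j) := by
      have h4 := mul_lt_mul_of_pos_right hab (show (0:ℝ) < M * j by positivity)
      have h5 : (α - 1 / (M * j)) * b * (M * j) = ((α * M) * j - 1) * b := by
        field_simp
      rwa [h5] at h4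
    rw [heq] at h3
    exact_mod_cast h3.le
  have hIntg : ∀ (j : ℕ) (k : ℤ), 1 ≤ j → j ≤ ρ → (j : ℝ) * α ≠ k := by
    intro j k h1 h2 heq
    obtain ⟨q, hq⟩ := Nat.dvd_factorial h1 h2
    have h3 : α * M = ((k * q : ℤ) : ℝ) := by
      rw [hM, hq]; push_cast; rw [← heq]; ring
    rw [h3] at hα1 hα2
    have e1 : (n : ℤ) < k * q := by exact_mod_cast hα1
    have e2 : k * q < (n : ℤ) + 1 := by exact_mod_cast hα2
    omega
  have hα0 : 0 < α := by
    by_contra hc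
    push Not at hc
    have : α * M ≤ 0 := mul_nonpos_of_nonpos_of_nonneg hc hM0'.le
    have : (0:ℝ) ≤ n := Nat.cast_nonneg n
    linarith
  obtain ⟨e, F, hF, ⟨j1, a1, hj1⟩, hrel⟩ := rank_rel h.qr hρ (fun j => z ^ j.1)
    (fun j => (j.1 : ℝ) * α) (fun l => hI h hm hρ l) (by
      intro j u l hl
      beta_reduce at hl ⊢
      rw [mem_hI]
      rcases Nat.eq_zero_or_pos j.1 with h0 | hj
      · refine ⟨u.degree, 1, one_pos, ?_, ?_⟩
        · rw [h0] at hl; simpa using hl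
        · rw [h0, pow_zero, mul_one, pow_one]; exact pow_le_nI _ _ (xm_mem x rfl)
      have hj' : (0:ℝ) < j.1 := by exact_mod_cast hj
      obtain ⟨a, b, hb, hz, hab⟩ := hex ((l - u.degree) / j.1) (by
        rw [div_lt_iff₀ hj']; linarith)
      refine ⟨u.degree * b + a * j.1, b, hb, ?_, ?_⟩
      · rw [div_mul_eq_mul_div, div_lt_iff₀ hj'] at hab
        push_cast
        linarith
      · rw [mul_pow, ← pow_mul, mul_comm j.1 b, pow_mul]
        exact mul_mem_nI (pow_mem_nI (pow_le_nI _ _ (xm_mem x rfl)) _) (pow_mem_nI hz _)) (by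
      intro k l hl w hw
      exact ⟨k, 1, one_pos, by simpa using hl, by simpa using hw⟩)
  have hne : (F j1).coeff a1 ≠ 0 := by rw [hj1]; exact one_ne_zero
  have he := hF j1 a1 hne
  have hzero : ∀ j ≠ j1, F j = 0 := by
    intro j hj
    ext u
    by_contra hu
    rw [MvPolynomial.coeff_zero] at hu
    have h2 := hF j u hu
    rw [← h2] at he
    beta_reduce at he
    have hjj : j.1 ≠ j1.1 := fun hh => hj (Fin.ext hh)
    rcases lt_or_gt_of_ne hjj with hlt | hlt
    · refine hIntg (j1.1 - j.1) (u.degree - a1.degree) (by omega) (by omega) ?_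
      rw [Nat.cast_sub hlt.le]; push_cast; linarith
    · refine hIntg (j.1 - j1.1) (a1.degree - u.degree) (by omega) (by omega) ?_
      rw [Nat.cast_sub hlt.le]; push_cast; linarith
  rw [Finset.sum_eq_single j1 (fun j _ hj => by rw [hzero j hj]; simp) (by simp)] at hrel
  have hhom : (F j1).IsHomogeneous a1.degree := by
    refine isHom_of fun u hu => ?_
    have h2 := hF j1 u hu
    rw [← he] at h2
    beta_reduce at h2
    have : (u.degree : ℝ) = a1.degree := by linarith
    exact_mod_cast this
  have hUC : UC (F j1) := ⟨a1, by
    rw [hj1]; exact fun hone => (maximalIdeal.isMaximal B).ne_top ((Ideal.eq_top_iff_one _).2 hone)⟩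
  obtain ⟨a, b, hb, hab, hw⟩ := hrel
  have hb' : (0:ℝ) < b := by exact_mod_cast hb
  beta_reduce at he
  rw [← he] at hab
  have hfa : a1.degree * b ≤ a := by
    have : (a1.degree * b : ℝ) ≤ a := by
      have : 0 ≤ (j1.1 : ℝ) * α * b := by positivity
      nlinarith
    exact_mod_cast this
  rw [mul_pow, ← map_pow, ← pow_mul] at hw
  have hw2 := h.cancel_nI (n := a - a1.degree * b) (hhom.pow b) (hUC.pow b) (by
    rwa [Nat.add_sub_cancel' hfa])
  rcases Nat.eq_zero_or_pos j1.1 with h0 | hj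
  · rw [h0, zero_mul, pow_zero] at hw2
    rw [h0] at hab
    have h1 : a1.degree * b < a := by
      have : (a1.degree * b : ℝ) < a := by simpa using hab
      exact_mod_cast this
    have := h.nI_one_le (nI_anti _ (show 1 ≤ a - a1.degree * b by omega) hw2)
    exact (maximalIdeal.isMaximal B).ne_top ((Ideal.eq_top_iff_one _).2 this)
  · have := hle _ _ (Nat.mul_pos hj hb) hw2
    rw [Nat.cast_sub hfa] at this
    push_cast at this
    nlinarith

end lemC
end CMP

namespace CMP

section star

variable {B : Type*} [CommRing B]

/-- the filtration generated by `z` in degree `N` -/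
def AA (J : Ideal B) (z : B) (N i n : ℕ) : Ideal B :=
  ⨆ j : Fin i, Ideal.span {z ^ j.1} * J ^ (n - N * j.1)

lemma AA_le {J : Ideal B} {z : B} {N i n : ℕ} {P : Ideal B} :
    AA J z N i n ≤ P ↔ ∀ j < i, ∀ w ∈ J ^ (n - N * j), z ^ j * w ∈ P := by
  unfold AA
  rw [iSup_le_iff]
  constructor
  · intro h j hj w hw
    exact h ⟨j, hj⟩ (Ideal.mul_mem_mul (Ideal.mem_span_singleton_self _) hw)
  · intro h j
    rw [Ideal.mul_le]
    intro r hr s hs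
    obtain ⟨c, rfl⟩ := Ideal.mem_span_singleton'.1 hr
    rw [mul_assoc]
    exact Ideal.mul_mem_left _ _ (h j.1 j.2 s hs)

lemma mem_AA {J : Ideal B} {z : B} {N i n : ℕ} {j : ℕ} (hj : j < i) {w : B}
    (hw : w ∈ J ^ (n - N * j)) : z ^ j * w ∈ AA J z N i n := AA_le.1 le_rfl j hj w hw

lemma AA_mono {J : Ideal B} {z : B} {N i i' n n' : ℕ} (hi : i ≤ i') (hn : n' ≤ n) :
    AA J z N i n ≤ AA J z N i' n' :=
  AA_le.2 fun _ hj _ hw => mem_AA (hj.trans_le hi) (Ideal.pow_le_pow_right (by omega) hw)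

lemma le_comap_mul {P Q : Ideal B} {u : B} : (∀ y ∈ P, u * y ∈ Q) ↔
    P ≤ Submodule.comap (LinearMap.mulLeft B u) Q := Iff.rfl

lemma mul_AA {J : Ideal B} {z : B} {N i n k : ℕ} {u : B} (hu : u ∈ J ^ k) {y : B}
    (hy : y ∈ AA J z N i n) : u * y ∈ AA J z N i (n + k) := by
  revert y
  rw [le_comap_mul, AA_le]
  intro j hj w hw
  rw [Submodule.mem_comap, LinearMap.mulLeft_apply]
  rw [mul_left_comm]
  refine mem_AA hj (Ideal.pow_le_pow_right ?_ (by
    rw [pow_add]; exact Ideal.mul_mem_mul hu hw) : u * w ∈ J ^ _)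
  omega

lemma z_mul_AA {J : Ideal B} {z : B} {N i n : ℕ} {y : B}
    (hy : y ∈ AA J z N i n) : z * y ∈ AA J z N (i + 1) (n + N) := by
  revert y
  rw [le_comap_mul, AA_le]
  intro j hj w hw
  rw [Submodule.mem_comap, LinearMap.mulLeft_apply]
  rw [← mul_assoc, ← pow_succ']
  refine mem_AA (by omega) (Ideal.pow_le_pow_right ?_ hw)
  rw [mul_add]; omega

lemma AA_le_J {J : Ideal B} {z : B} {N n c : ℕ} (hc : ∀ j, z ^ j ∈ J ^ (N * j - c)) (i : ℕ) :
    AA J z N i n ≤ J ^ (n - c) := by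
  rw [AA_le]
  intro j _ w hw
  have := Ideal.mul_mem_mul (hc j) hw
  rw [← pow_add] at this
  exact Ideal.pow_le_pow_right (by omega) this

lemma AA_le_J' {J : Ideal B} {z : B} {N n i : ℕ} : AA J z N i n ≤ J ^ (n - N * (i - 1)) := by
  rw [AA_le]
  intro j hj w hw
  refine Ideal.mul_mem_left _ _ (Ideal.pow_le_pow_right ?_ hw)
  have : N * j ≤ N * (i - 1) := Nat.mul_le_mul_left _ (by omega)
  omega

lemma exists_AA_integral [IsNoetherianRing B] {J : Ideal B} {z : B} {N : ℕ} (hz : z ∈ nI J N) :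
    ∃ b, z ^ b ∈ AA J z N b (N * b) := by
  obtain ⟨b, hb, a, ha, heq⟩ := integral_of_As hz
  refine ⟨b, ?_⟩
  rw [eq_neg_of_add_eq_zero_left heq]
  rw [Ideal.neg_mem_iff]
  refine Ideal.sum_mem _ fun i hi => ?_
  have h1 := ha i hi
  rw [Finset.mem_Icc] at hi
  rw [mul_comm (a i)]
  refine mem_AA (by omega) ?_
  rw [← pow_mul] at h1
  refine Ideal.pow_le_pow_right ?_ h1
  rw [← Nat.mul_sub]
  exact Nat.mul_le_mul_left _ (by omega)

lemma AA_stab {J : Ideal B} {z : B} {N b : ℕ} (hb : z ^ b ∈ AA J z N b (N * b)) {n : ℕ} {y : B}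
    (hy : y ∈ AA J z N b n) : z * y ∈ AA J z N b (n + N) := by
  revert y
  rw [le_comap_mul, AA_le]
  intro j hj w hw
  rw [Submodule.mem_comap, LinearMap.mulLeft_apply]
  rw [← mul_assoc, ← pow_succ']
  rcases Nat.lt_or_ge (j + 1) b with h | h
  · refine mem_AA h (Ideal.pow_le_pow_right ?_ hw)
    rw [mul_add]; omega
  · obtain rfl : b = j + 1 := by omega
    rw [mul_comm]
    refine AA_mono le_rfl ?_ (mul_AA hw hb)
    rw [mul_add]; omega

lemma pow_AA_stab {J : Ideal B} {z : B} {N b : ℕ} (hb : z ^ b ∈ AA J z N b (N * b)) {n : ℕ} {y : B}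
    (hy : y ∈ AA J z N b n) (k : ℕ) : z ^ k * y ∈ AA J z N b (n + N * k) := by
  induction k with
  | zero => simpa using hy
  | succ k ih =>
    rw [pow_succ', mul_assoc]
    have := AA_stab hb ih
    rwa [show n + N * k + N = n + N * (k + 1) by ring] at this

lemma pow_z_mul_AA {J : Ideal B} {z : B} {N i n : ℕ} {y : B}
    (hy : y ∈ AA J z N i n) (k : ℕ) : z ^ k * y ∈ AA J z N (i + k) (n + N * k) := by
  induction k with
  | zero => simpa using hy
  | succ k ih =>
    rw [pow_succ', mul_assoc]
    have := z_mul_AA ih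
    rwa [show n + N * k + N = n + N * (k + 1) by ring] at this

lemma one_mem_AA {J : Ideal B} {z : B} {N b : ℕ} (hb : z ^ b ∈ AA J z N b (N * b)) :
    (1 : B) ∈ AA J z N b 0 := by
  rcases Nat.eq_zero_or_pos b with rfl | hb0
  · simpa using hb
  · have := mem_AA (J := J) (z := z) (N := N) (n := 0) (w := 1) hb0 (by simp)
    simpa using this

lemma mem_AA' {J : Ideal B} {z : B} {N b : ℕ} (hb : z ^ b ∈ AA J z N b (N * b)) {n k j : ℕ} {w : B}
    (hw : w ∈ J ^ k) (hn : n ≤ k + N * j) : w * z ^ j ∈ AA J z N b n := by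
  have h1 := mul_AA hw (pow_AA_stab hb (one_mem_AA hb) j)
  rw [mul_one] at h1
  exact AA_mono le_rfl (by omega) h1

variable {d : ℕ} {x : Fin d → B} [IsLocalRing B]

lemma AA_descend {z : B} {N b i f : ℕ} {u : B} (hu : u ∈ Jx x ^ f)
    (hb : z ^ b ∈ AA (Jx x) z N b (N * b))
    (hrel : u * z ^ i ∈ AA (Jx x) z N i (f + N * i) ⊔ AA (Jx x) z N b (f + N * i + 1)) (k : ℕ) :
    ∀ n, ∀ y ∈ AA (Jx x) z N (i + k) n, u ^ k * y ∈ AA (Jx x) z N i (n + f * k) ⊔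
      AA (Jx x) z N b (n + f * k + 1) := by
  induction k with
  | zero => intro n y hy; simpa using Ideal.mem_sup_left hy
  | succ k ih =>
    intro n y hy
    have key : ∀ y ∈ AA (Jx x) z N (i + (k+1)) n, u * y ∈ AA (Jx x) z N (i + k) (n + f) ⊔
        AA (Jx x) z N b (n + f + 1) := by
      rw [le_comap_mul, AA_le]
      intro j hj w hw
      rw [Submodule.mem_comap, LinearMap.mulLeft_apply]
      rcases Nat.lt_or_ge j (i + k) with h | h
      · exact Ideal.mem_sup_left (mul_AA hu (mem_AA h hw))
      · obtain rfl : j = i + k := by omega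
        rw [show u * (z ^ (i + k) * w) = w * (z ^ k * (u * z ^ i)) by ring]
        obtain ⟨p, hp, q, hq, hpq⟩ := Submodule.mem_sup.1 hrel
        rw [← hpq, mul_add, mul_add]
        refine Submodule.add_mem_sup ?_ ?_
        · refine AA_mono le_rfl ?_ (mul_AA hw (pow_z_mul_AA hp k))
          rw [mul_add]; omega
        · refine AA_mono le_rfl ?_ (mul_AA hw (pow_AA_stab hb hq k))
          rw [mul_add]; omega
    obtain ⟨p, hp, q, hq, hpq⟩ := Submodule.mem_sup.1 (key y hy)
    rw [pow_succ, mul_assoc, ← hpq, mul_add (u ^ k)]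
    refine Ideal.add_mem _ ?_ ?_
    · have := ih _ p hp
      rwa [show n + f + f * k = n + f * (k + 1) by ring] at this
    · refine Ideal.mem_sup_right ?_
      have hk : u ^ k ∈ Jx x ^ (f * k) := by rw [pow_mul]; exact Ideal.pow_mem_pow hu k
      refine AA_mono le_rfl ?_ (mul_AA hk hq)
      rw [mul_add]; omega

lemma AA_iter {z : B} {N b i g : ℕ} {u : B} (hu : u ∈ Jx x ^ g)
    (hrel : ∀ n, ∀ y ∈ AA (Jx x) z N b n, u * y ∈ AA (Jx x) z N i (n + g) ⊔
      AA (Jx x) z N b (n + g + 1)) (c : ℕ) :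
    ∀ n, ∀ y ∈ AA (Jx x) z N b n, u ^ c * y ∈ AA (Jx x) z N i (n + g * c) ⊔
      AA (Jx x) z N b (n + g * c + c) := by
  induction c with
  | zero => intro n y hy; simpa using Ideal.mem_sup_right hy
  | succ c ih =>
    intro n y hy
    obtain ⟨p, hp, q, hq, hpq⟩ := Submodule.mem_sup.1 (ih n y hy)
    rw [pow_succ', mul_assoc, ← hpq, mul_add u]
    refine Ideal.add_mem _ ?_ ?_
    · refine Ideal.mem_sup_left ?_
      have := mul_AA hu hp
      rwa [show n + g * c + g = n + g * (c + 1) by ring] at this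
    · obtain ⟨p', hp', q', hq', hpq'⟩ := Submodule.mem_sup.1 (hrel _ q hq)
      rw [← hpq']
      refine Submodule.add_mem_sup (AA_mono le_rfl ?_ hp') (AA_mono le_rfl ?_ hq')
      · rw [mul_add]; omega
      · rw [mul_add]; omega

lemma star_rel (h : QS x) {ρ : ℕ} (hρ : len (Jx x) ≤ ρ) {z : B} {N b : ℕ} 
    (hz : z ∈ nI (Jx x) N) (hb : z ^ b ∈ AA (Jx x) z N b (N * b)) :
    ∃ (i f : ℕ) (F : MvPolynomial (Fin d) B), 1 ≤ i ∧ i ≤ ρ ∧ F.IsHomogeneous f ∧ UC F ∧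
      MvPolynomial.eval x F * z ^ i ∈ AA (Jx x) z N i (f + N * i) ⊔
        AA (Jx x) z N b (f + N * i + 1) := by
  classical
  obtain ⟨n, hn⟩ := growth d ρ (N * ρ)
  set Q := AA (Jx x) z N b (n + N * ρ + 1) with hQ
  have hQl : len Q ≤ (ρ * (n + N * ρ + d).choose d : ℕ) := by
    have hle : Jx x ^ (n + N * ρ + 1) ≤ Q := by
      intro w hw
      simpa using mem_AA' hb (j := 0) hw le_rfl
    refine (len_anti hle).trans ?_
    rw [len_Jx_pow h.qr, multichoose_succ_eq, mul_comm]
    push_cast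
    gcongr
  obtain ⟨s0, hs0, k, hk, hrel⟩ := count
    (fun s : ℕ × (Fin d →₀ ℕ) => (toLex (-((s.2.degree + N * s.1 : ℕ) : ℤ), s.1) : ℤ ×ₗ ℕ))
    (fun s => xm x s.2 * z ^ s.1) Q (range (ρ + 1) ×ˢ monsLE d n) (by
      refine hQl.trans_lt ?_
      rw [Finset.card_product, card_monsLE, Finset.card_range]
      exact_mod_cast hn)
  obtain ⟨i, a0⟩ := s0
  rw [Finset.mem_product, Finset.mem_range, mem_monsLE] at hs0
  simp only at hs0
  set f := a0.degree with hf
  have hNi : N * i ≤ N * ρ := Nat.mul_le_mul_left _ (by omega)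
  set T := (range (ρ + 1) ×ˢ monsLE d n).filter (fun s => 
    (toLex (-((s.2.degree + N * s.1 : ℕ) : ℤ), s.1) : ℤ ×ₗ ℕ) ≤
      toLex (-((f + N * i : ℕ) : ℤ), i)) with hT
  set F : MvPolynomial (Fin d) B := ∑ a ∈ mons d f, MvPolynomial.monomial a (k (i, a)) with hF
  have hFh : F.IsHomogeneous f := isHomogeneous_sum_mons _
  have hFu : UC F := ⟨a0, by
    rw [hF, coeff_sum_mons _ (mem_mons.2 hf.symm), hk]
    exact fun hone => (maximalIdeal.isMaximal B).ne_top ((Ideal.eq_top_iff_one _).2 hone)⟩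
  have hsplit : ∑ s ∈ T, k s * (xm x s.2 * z ^ s.1) = MvPolynomial.eval x F * z ^ i +
      ∑ s ∈ T with ¬ (s.1 = i ∧ s.2.degree = f), k s * (xm x s.2 * z ^ s.1) := by
    rw [← Finset.sum_filter_add_sum_filter_not T (fun s => s.1 = i ∧ s.2.degree = f)]
    congr 1
    rw [hF, eval_sum_mons, Finset.sum_mul]
    symm
    refine Finset.sum_bij (fun a _ => (i, a)) ?_ ?_ ?_ ?_
    · intro a ha
      rw [mem_mons] at ha
      rw [Finset.mem_filter, hT, Finset.mem_filter, Finset.mem_product, Finset.mem_range, mem_monsLE]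
      refine ⟨⟨⟨hs0.1, by simp only; omega⟩, ?_⟩, rfl, ha⟩
      simp only [ha]; exact le_rfl
    · intro a _ a' _ haa
      exact (Prod.mk.inj haa).2
    · rintro ⟨j, a⟩ hja
      rw [Finset.mem_filter] at hja
      obtain ⟨_, rfl, h2⟩ := hja
      exact ⟨a, mem_mons.2 h2, rfl⟩
    · intro a _
      simp only; ring
  have hmem : MvPolynomial.eval x F * z ^ i ∈ AA (Jx x) z N i (f + N * i) ⊔
        AA (Jx x) z N b (f + N * i + 1) := by
    change ∑ s ∈ T, k s * (xm x s.2 * z ^ s.1) ∈ Q at hrel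
    rw [hsplit] at hrel
    refine (Submodule.add_mem_iff_left _ ?_).1 (Ideal.mem_sup_right (AA_mono le_rfl ?_ hrel))
    · refine Ideal.sum_mem _ fun s hs => Ideal.mul_mem_left _ _ ?_
      rw [Finset.mem_filter, hT, Finset.mem_filter, Prod.Lex.toLex_le_toLex] at hs
      obtain ⟨⟨_, hs1⟩, hs2⟩ := hs
      simp only at hs1
      rcases hs1 with h1 | ⟨h1, h2⟩
      · refine Ideal.mem_sup_right (mem_AA' hb (xm_mem x rfl) ?_)
        omega
      · rcases Nat.lt_or_ge s.1 i with h3 | h3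
        · refine Ideal.mem_sup_left ?_
          rw [mul_comm (xm x s.2)]
          refine mem_AA h3 (xm_mem x ?_)
          omega
        · have h4 : s.1 = i := le_antisymm h2 h3
          refine absurd ⟨h4, ?_⟩ hs2
          rw [h4] at h1
          omega
    · omega
  refine ⟨i, f, F, ?_, by omega, hFh, hFu, hmem⟩
  by_contra hi
  obtain rfl : i = 0 := by omega
  obtain ⟨c, hc⟩ := hz
  have h0 : MvPolynomial.eval x F ∈ nI (Jx x) (f + 1) := by
    have h1 : AA (Jx x) z N 0 (f + N * 0) ⊔ AA (Jx x) z N b (f + N * 0 + 1) ≤ nI (Jx x) (f + 1) := by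
      refine sup_le (AA_le.2 (by intro j hj; omega)) (AA_le.2 ?_)
      intro j _ w hw
      refine nI_anti _ ?_ (mul_mem_nI (pow_mem_nI (show z ∈ nI (Jx x) N from ⟨c, hc⟩) j)
        (pow_le_nI _ _ hw))
      omega
    simpa using h1 hmem
  obtain ⟨a, ha⟩ := hFu
  exact ha (h.coeff_mem_of_nI hFh h0 a)

/-- powers of elements in the closure -/
lemma star [IsNoetherianRing B] (h : QS x) {ρ : ℕ} (hρ : len (Jx x) ≤ ρ) {z : B} {N : ℕ}
    (hz : z ∈ nI (Jx x) N) : z ^ ρ ∈ Jx x ^ N := by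
  obtain ⟨b, hb⟩ := exists_AA_integral hz
  obtain ⟨i, f, F, hi1, hi2, hF, hUC, hrel⟩ := star_rel h hρ hz hb
  obtain ⟨c, hc⟩ := hz
  set u := MvPolynomial.eval x F with hu
  have huJ : u ∈ Jx x ^ f := eval_mem_Jx_pow hF
  have h1 := AA_iter (b := b) (i := i) (g := f * b) (u := u ^ b) (z := z) (N := N)
    (by rw [pow_mul]; exact Ideal.pow_mem_pow huJ b)
    (fun n y hy => AA_descend huJ hb hrel b n y (AA_mono (by omega) le_rfl hy)) c (N * i) (z ^ i)
    (by simpa using mem_AA' hb (k := 0) (w := 1) (j := i) (n := N * i) (by simp) (by omega))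
  have h2 : (u ^ b) ^ c * z ^ i ∈ Jx x ^ (f * b * c + N) := by
    refine (sup_le (c := Jx x ^ (f * b * c + N)) ?_ ?_ : _ ≤ _) h1
    · refine AA_le_J'.trans (Ideal.pow_le_pow_right ?_)
      obtain ⟨i, rfl⟩ := Nat.exists_eq_add_of_le' hi1
      rw [Nat.add_sub_cancel, mul_add]; omega
    · refine (AA_le_J hc _).trans (Ideal.pow_le_pow_right ?_)
      obtain ⟨i, rfl⟩ := Nat.exists_eq_add_of_le' hi1
      rw [mul_add]; omega
  rw [hu, ← map_pow, ← map_pow] at h2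
  have h3 := h.cancel ((hF.pow b).pow c) ((hUC.pow b).pow c) h2
  obtain ⟨k, rfl⟩ := Nat.exists_eq_add_of_le hi2
  rw [pow_add]
  exact Ideal.mul_mem_right _ _ h3

end star
end CMP

namespace CMP

section chev

variable {B : Type*} [CommRing B] {d : ℕ} {x : Fin d → B} [IsLocalRing B]

lemma stabilise (f : ℕ → Ideal B) (hf : Antitone f) {Q : Ideal B} (hQ : ∀ n, Q ≤ f n)
    (hlen : len Q ≠ ⊤) : ∃ n0, ∀ n ≥ n0, f n = f n0 := by
  have hfin : ∀ n, len (f n) ≠ ⊤ := fun n => ((len_anti (hQ n)).trans_lt hlen.lt_top).ne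
  have hbd : BddAbove (Set.range fun n => (len (f n)).toNat) := by
    refine ⟨(len Q).toNat, ?_⟩
    rintro _ ⟨n, rfl⟩
    exact ENat.toNat_le_toNat (len_anti (hQ n)) hlen
  obtain ⟨n0, hn0⟩ := Nat.sSup_mem (Set.range_nonempty fun n => (len (f n)).toNat) hbd
  refine ⟨n0, fun n hn => eq_of_len (hf hn) (hfin n0) ?_⟩
  have h1 : (len (f n)).toNat ≤ (len (f n0)).toNat := by
    rw [show (len (f n0)).toNat = _ from hn0]
    exact le_csSup hbd ⟨n, rfl⟩
  rw [← ENat.coe_toNat (hfin n), ← ENat.coe_toNat (hfin n0)]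
  exact_mod_cast h1

lemma len_pow_ne_top (h : QS x) {ρ : ℕ} (hρ : len (Jx x) ≤ ρ) (n : ℕ) :
    len (Jx x ^ n) ≠ ⊤ := by
  refine ((len_anti (Ideal.pow_le_pow_right (Nat.le_succ n))).trans_lt ?_).ne
  rw [Nat.succ_eq_add_one, len_Jx_pow h.qr]
  refine (mul_le_mul_right hρ _).trans_lt ?_
  exact_mod_cast ENat.coe_lt_top _

lemma chevalley [IsNoetherianRing B] (h : QS x) {ρ : ℕ} (hρ : len (Jx x) ≤ ρ)
    (hAU : IsReduced (AdicCompletion (maximalIdeal B) B)) (N : ℕ) :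
    ∃ n, nI (Jx x) n ≤ Jx x ^ N := by
  classical
  by_contra hcon
  push Not at hcon
  set m := maximalIdeal B with hmdef
  obtain ⟨k0, hk0⟩ : ∃ k0, m ^ k0 ≤ Jx x ^ N := by
    obtain ⟨k, hk⟩ := h.prim
    refine ⟨k * N, ?_⟩
    rw [pow_mul]; exact Ideal.pow_right_mono hk N
  have hstab : ∀ k, ∃ n0, ∀ n ≥ n0, nI (Jx x) n ⊔ m ^ k = nI (Jx x) n0 ⊔ m ^ k := by
    intro k
    refine stabilise (fun n => nI (Jx x) n ⊔ m ^ k)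
      (fun a b hab => sup_le_sup_right (nI_anti _ hab) _) (Q := Jx x ^ k) (fun n => ?_)
      (len_pow_ne_top h hρ k)
    exact (Ideal.pow_right_mono h.le k).trans le_sup_right
  choose n0 hn0 using hstab
  set S : ℕ → Ideal B := fun k => nI (Jx x) (n0 k) ⊔ m ^ k with hS
  have hS1 : ∀ k n, S k ≤ nI (Jx x) n ⊔ m ^ k := by
    intro k n
    simp only [hS]
    rw [← hn0 k (max n (n0 k)) (le_max_right _ _)]
    exact sup_le_sup_right (nI_anti _ (le_max_left _ _)) _
  have hstep : ∀ k, ∀ z ∈ S k, ∃ w ∈ S (k + 1), z - w ∈ m ^ k := by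
    intro k z hz
    obtain ⟨w, hw, t, ht, rfl⟩ := Submodule.mem_sup.1 (hS1 k (n0 (k+1)) hz)
    exact ⟨w, Ideal.mem_sup_left hw, by simpa using ht⟩
  obtain ⟨z0, hz0, hz0'⟩ := SetLike.not_le_iff_exists.1 (hcon (n0 k0))
  choose g hg1 hg2 using hstep
  let seq : ∀ i : ℕ, S (k0 + i) := fun i => Nat.rec ⟨z0, Ideal.mem_sup_left hz0⟩
    (fun i p => ⟨g (k0 + i) p.1 p.2, hg1 _ _ _⟩) i
  have hseq : ∀ i, (seq i).1 - (seq (i+1)).1 ∈ m ^ (k0 + i) := fun i => hg2 (k0 + i) _ _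
  have hseq0 : ∀ i, z0 - (seq i).1 ∈ m ^ k0 := by
    intro i
    induction i with
    | zero => simp [seq]
    | succ i ih =>
      have := add_mem ih (Ideal.pow_le_pow_right (by omega) (hseq i) : _ ∈ m ^ k0)
      simpa using this
  let f := AdicCompletion.AdicCauchySequence.mk m B (fun i => (seq i).1) (by
    intro i
    rw [SModEq.sub_mem]
    simpa using Ideal.pow_le_pow_right (by omega) (hseq i))
  have hnil : IsNilpotent (AdicCompletion.mk m B f) := by
    refine ⟨ρ, AdicCompletion.ext_evalₐ fun n => ?_⟩
    rw [map_pow, AdicCompletion.evalₐ_mk, map_zero, ← map_pow, Ideal.Quotient.eq_zero_iff_mem]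
    show (seq n).1 ^ ρ ∈ m ^ n
    obtain ⟨w, hw, t, ht, hwt⟩ := Submodule.mem_sup.1 (hS1 _ n (seq n).2)
    have h1 : w ^ ρ ∈ m ^ n := Ideal.pow_right_mono h.le n (star h hρ hw)
    have h2 : (seq n).1 ^ ρ - w ^ ρ ∈ m ^ n := by
      have h3 : (seq n).1 - w ∣ (seq n).1 ^ ρ - w ^ ρ := sub_dvd_pow_sub_pow _ _ _
      refine Ideal.mem_of_dvd _ h3 ?_
      rw [← hwt, add_sub_cancel_left]
      exact Ideal.pow_le_pow_right (by omega) ht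
    have := add_mem h2 h1
    rwa [sub_add_cancel] at this
  have h0 := hnil.eq_zero
  have h1 := congrArg (AdicCompletion.evalₐ m k0) h0
  rw [AdicCompletion.evalₐ_mk, map_zero, Ideal.Quotient.eq_zero_iff_mem] at h1
  change (seq k0).1 ∈ m ^ k0 at h1
  refine hz0' (hk0 ?_)
  have := add_mem (hseq0 k0) h1
  rwa [sub_add_cancel] at this

end chev
end CMP

namespace CMP

section thmN

lemma exists_lam' {K F : Type*} [Field K] [Field F] (φ : K →+* F) {c0 : F} (hc0 : c0 ≠ 0) :
    ∃ l : F →+ K, (∀ a c, l (φ a * c) = a * l c) ∧ l c0 ≠ 0 := by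
  letI : Algebra K F := φ.toAlgebra
  by_contra hcon
  push Not at hcon
  refine hc0 ((Module.forall_dual_apply_eq_zero_iff K c0).1 fun f => ?_)
  refine hcon f.toAddMonoidHom fun a c => ?_
  have : φ a * c = a • c := (Algebra.smul_def a c).symm
  rw [this]
  exact f.map_smul a c

lemma exists_lam {k : Type*} [Field k] (p : ℕ) [ExpChar k p] (e : ℕ) {c0 : k} (hc0 : c0 ≠ 0) :
    ∃ l : k →+ k, (∀ a c, l (a ^ p ^ e * c) = a * l c) ∧ l c0 ≠ 0 :=
  exists_lam' (iterateFrobenius k p e) hc0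

/-- Cartier type operators on a polynomial ring -/
lemma exists_cartier {k σ : Type*} [Field k] (p : ℕ) [ExpChar k p] (e : ℕ)
    {f0 : MvPolynomial σ k} (hf0 : f0 ≠ 0) :
    ∃ π : MvPolynomial σ k →+ MvPolynomial σ k, (∀ a f, π (a ^ p ^ e * f) = a * π f) ∧ π f0 ≠ 0 := by
  classical
  obtain ⟨b, hb⟩ := MvPolynomial.ne_zero_iff.1 hf0
  obtain ⟨l, hl, hl0⟩ := exists_lam p e hb
  set q := p ^ e with hq
  have hq0 : 0 < q := pow_pos (expChar_pos k p) e
  set α : σ →₀ ℕ := b.mapRange (· % q) (by simp) with hα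
  set β : σ →₀ ℕ := b.mapRange (· / q) (by simp) with hβ
  have hab : q • β + α = b := by
    ext i
    simp only [Finsupp.add_apply, Finsupp.smul_apply, hα, hβ, Finsupp.mapRange_apply, smul_eq_mul]
    exact Nat.div_add_mod _ _
  have hαlt : ∀ i, α i < q := fun i => by
    simp only [hα, Finsupp.mapRange_apply]; exact Nat.mod_lt _ hq0
  have hinj : Function.Injective (fun γ : σ →₀ ℕ => q • γ + α) := by
    intro γ γ' h
    ext i
    have := DFunLike.congr_fun h i
    simp only [Finsupp.add_apply, Finsupp.smul_apply, smul_eq_mul] at this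
    exact Nat.eq_of_mul_eq_mul_left hq0 (by omega)
  have hle : ∀ γ δ : σ →₀ ℕ, q • δ ≤ q • γ + α ↔ δ ≤ γ := by
    intro γ δ
    rw [Finsupp.le_def, Finsupp.le_def]
    refine forall_congr' fun i => ?_
    simp only [Finsupp.add_apply, Finsupp.smul_apply, smul_eq_mul]
    have := hαlt i
    constructor
    · intro h
      have : q * δ i < q * (γ i + 1) := by rw [mul_add]; omega
      exact Nat.lt_succ_iff.1 (lt_of_mul_lt_mul_left this (Nat.zero_le _))
    · intro h
      exact (Nat.mul_le_mul_left q h).trans (Nat.le_add_right _ _)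
  let π0 : MvPolynomial σ k → MvPolynomial σ k := fun f =>
    AddMonoidAlgebra.coeffAddEquiv.symm (Finsupp.mapRange l (map_zero l)
        (Finsupp.comapDomain (fun γ => q • γ + α) (AddMonoidAlgebra.coeffAddEquiv f) hinj.injOn))
  have hπ0 : ∀ f γ, (π0 f).coeff γ = l (f.coeff (q • γ + α)) := fun f γ => rfl
  let π : MvPolynomial σ k →+ MvPolynomial σ k :=
    { toFun := π0
      map_zero' := by ext γ; rw [hπ0]; simp
      map_add' := fun f g => by
        ext γ; rw [hπ0, MvPolynomial.coeff_add, MvPolynomial.coeff_add, hπ0, hπ0, map_add] }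
  have hπ : ∀ f γ, (π f).coeff γ = l (f.coeff (q • γ + α)) := hπ0
  refine ⟨π, fun a f => ?_, ?_⟩
  · induction a using MvPolynomial.induction_on' with
    | monomial δ c =>
      ext γ
      rw [MvPolynomial.monomial_pow, hπ, MvPolynomial.coeff_monomial_mul',
        MvPolynomial.coeff_monomial_mul', hπ]
      simp only [hle]
      split_ifs with h
      · rw [hl]
        congr 3
        ext i
        have := h i
        simp only [Finsupp.add_apply, Finsupp.smul_apply, smul_eq_mul, Finsupp.tsub_apply]
        have := Nat.mul_le_mul_left q this
        rw [Nat.mul_sub]; omega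
      · exact map_zero l
    | add a b ha hb =>
      rw [add_pow_expChar_pow, add_mul, map_add, ha, hb, add_mul]
  · intro h0
    have := hπ f0 β
    rw [h0, hab] at this
    exact hl0 (by rw [← this]; simp)

/-- functionals in the domain case -/
lemma functional_dom {D W K L : Type*} [CommRing D] [IsDomain D] [IsIntegrallyClosed D]
    [CommRing W] [IsDomain W] [Algebra D W] [Algebra.IsIntegral D W]
    [Field K] [Algebra D K] [IsFractionRing D K] [Field L] [Algebra W L] [IsFractionRing W L]
    [Algebra D L] [IsScalarTower D W L] [Algebra K L] [IsScalarTower D K L]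
    (p : ℕ) [ExpChar K p]
    (hcart : ∀ (e : ℕ) (f0 : D), f0 ≠ 0 → ∃ π : D →+ D, (∀ a f, π (a ^ p ^ e * f) = a * π f) ∧
      π f0 ≠ 0) [FiniteDimensional K L] {w : W} (hw : w ≠ 0) :
    ∃ φ : W →ₗ[D] D, φ w ≠ 0 := by
  have : IsPurelyInseparable (separableClosure K L) L := separableClosure.isPurelyInseparable K L
  have : FiniteDimensional (separableClosure K L) L := inferInstance
  have : IsPurelyInseparable.HasExponent (separableClosure K L) L :=
    IsPurelyInseparable.hasExponent_of_finiteDimensional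
  have : ExpChar (separableClosure K L) p :=
    expChar_of_injective_algebraMap (algebraMap K (separableClosure K L)).injective p
  set e := IsPurelyInseparable.exponent (separableClosure K L) L with he
  set Φ := IsPurelyInseparable.iterateFrobenius (separableClosure K L) L p he.ge with hΦ
  have hΦ1 : ∀ a : L, algebraMap (separableClosure K L) L (Φ a) = a ^ p ^ e :=
    IsPurelyInseparable.algebraMap_iterateFrobenius (separableClosure K L) p he.ge
  have hDK := IsFractionRing.injective D K
  have hWL := IsFractionRing.injective W L
  have hsLinj : Function.Injective (algebraMap (separableClosure K L) L) :=
    (algebraMap (separableClosure K L) L).injective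
  have hw' : Φ (algebraMap W L w) ≠ 0 := by
    rw [_root_.map_ne_zero, map_ne_zero_iff _ hWL]; exact hw
  have hsc2 : IsScalarTower D K (separableClosure K L) := inferInstance
  have hsc : IsScalarTower D (separableClosure K L) L := IsScalarTower.of_algebraMap_eq fun a => by
    rw [IsScalarTower.algebraMap_apply D K (separableClosure K L),
      ← IsScalarTower.algebraMap_apply K (separableClosure K L) L,
      ← IsScalarTower.algebraMap_apply D K L]
  -- a good multiplier
  obtain ⟨c0, hc0⟩ : ∃ c0, Algebra.trace K (separableClosure K L) c0 ≠ 0 := by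
    by_contra hcon
    push Not at hcon
    exact Algebra.trace_ne_zero K (separableClosure K L) (LinearMap.ext hcon)
  have halg : IsAlgebraic D ((Φ (algebraMap W L w))⁻¹ * c0) := by
    have h1 : IsAlgebraic K ((Φ (algebraMap W L w))⁻¹ * c0) := Algebra.IsAlgebraic.isAlgebraic _
    exact (IsFractionRing.isAlgebraic_iff D K _).2 h1
  obtain ⟨b, hb, hbi⟩ := halg.exists_integral_multiple
  set c := b • ((Φ (algebraMap W L w))⁻¹ * c0) with hc
  have hΦi : ∀ u : W, IsIntegral D (Φ (algebraMap W L u)) := by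
    intro u
    rw [← isIntegral_algebraMap_iff hsLinj, hΦ1]
    exact (((Algebra.IsIntegral.isIntegral (R := D) u).algebraMap)).pow _
  have hex : ∀ u : W, ∃ a : D, algebraMap D K a =
      Algebra.trace K (separableClosure K L) (Φ (algebraMap W L u) * c) := fun u =>
    IsIntegrallyClosed.isIntegral_iff.1 (Algebra.isIntegral_trace ((hΦi u).mul hbi))
  choose ψ hψ using hex
  have hψadd : ∀ u v, ψ (u + v) = ψ u + ψ v := by
    intro u v
    apply hDK
    rw [map_add, hψ, hψ, hψ, map_add, map_add, add_mul, map_add]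
  have hψsm : ∀ (a : D) u, ψ (a • u) = a ^ p ^ e * ψ u := by
    intro a u
    apply hDK
    have h1 : Φ (algebraMap W L (a • u)) = (algebraMap D K a) ^ p ^ e • Φ (algebraMap W L u) := by
      apply hsLinj
      rw [hΦ1, Algebra.smul_def, map_mul, mul_pow, Algebra.smul_def, map_mul, hΦ1, map_pow,
        map_pow, ← IsScalarTower.algebraMap_apply K (separableClosure K L) L,
        ← IsScalarTower.algebraMap_apply D K L, ← IsScalarTower.algebraMap_apply D W L]
    rw [hψ, h1, smul_mul_assoc, map_smul, map_mul (algebraMap D K), hψ, map_pow, smul_eq_mul]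
  have hψw : ψ w ≠ 0 := by
    intro h0
    have := hψ w
    rw [h0, map_zero, hc, mul_smul_comm, ← mul_assoc, mul_inv_cancel₀ hw', one_mul,
      ← algebraMap_smul K b c0, map_smul, smul_eq_mul, eq_comm, mul_eq_zero] at this
    rcases this with h | h
    · exact hb ((map_eq_zero_iff _ hDK).1 h)
    · exact hc0 h
  obtain ⟨π, hπ, hπ0⟩ := hcart e _ hψw
  refine ⟨{ toFun := fun u => π (ψ u), map_add' := fun u v => ?_, map_smul' := fun a u => ?_ }, hπ0⟩
  · rw [hψadd, map_add]
  · rw [hψsm, hπ]; rfl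

lemma functional {D Z : Type*} [CommRing D] [IsDomain D] [IsIntegrallyClosed D]
    [CommRing Z] [IsReduced Z] [Algebra D Z] [Algebra.IsIntegral D Z]
    (htf : ∀ (a : D) (z : Z), a ≠ 0 → a • z = 0 → z = 0) (ρ : ℕ)
    (hrk : ∀ s : Fin (ρ + 1) → Z, ¬ LinearIndependent D s)
    (p : ℕ) [ExpChar D p]
    (hcart : ∀ (e : ℕ) (f0 : D), f0 ≠ 0 → ∃ π : D →+ D, (∀ a f, π (a ^ p ^ e * f) = a * π f) ∧
      π f0 ≠ 0) {z : Z} (hz : z ≠ 0) :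
    ∃ φ : Z →ₗ[D] D, φ z ≠ 0 := by
  let S : Submonoid Z :=
    { carrier := {u | ∃ (a : D) (n : ℕ), a ≠ 0 ∧ u = a • z ^ n}
      one_mem' := ⟨1, 0, one_ne_zero, by simp⟩
      mul_mem' := by
        rintro _ _ ⟨a, n, ha, rfl⟩ ⟨b, m, hb, rfl⟩
        exact ⟨a * b, n + m, mul_ne_zero ha hb, by rw [smul_mul_smul_comm, pow_add]⟩ }
  obtain ⟨P, hP, -, hPS⟩ := Ideal.exists_le_prime_disjoint (⊥ : Ideal Z) S (by
    rw [Set.disjoint_left]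
    rintro u hu ⟨a, n, ha, rfl⟩
    exact hz (eq_zero_of_pow_eq_zero (htf a _ ha hu) : z = 0))
  rw [Set.disjoint_left] at hPS
  have hinj : Function.Injective (algebraMap D (Z ⧸ P)) := by
    rw [injective_iff_map_eq_zero]
    intro a ha
    by_contra ha0
    rw [IsScalarTower.algebraMap_apply D Z (Z ⧸ P)] at ha
    refine hPS (Ideal.Quotient.eq_zero_iff_mem.1 ha) ⟨a, 0, ha0, ?_⟩
    rw [pow_zero, Algebra.algebraMap_eq_smul_one]
  have hzP : Ideal.Quotient.mk P z ≠ 0 := fun h =>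
    hPS (Ideal.Quotient.eq_zero_iff_mem.1 h) ⟨1, 1, one_ne_zero, by simp⟩
  have : Algebra.IsIntegral D (Z ⧸ P) :=
    Algebra.IsIntegral.of_surjective (Ideal.Quotient.mkₐ D P) Ideal.Quotient.mk_surjective
  have hrk' : ∀ s : Fin (ρ + 1) → Z ⧸ P, ¬ LinearIndependent D s := by
    intro s hs
    choose g hg using fun i => Ideal.Quotient.mk_surjective (s i)
    refine hrk g (LinearIndependent.of_comp (Ideal.Quotient.mkₐ D P).toLinearMap ?_)
    have hcomp : ⇑(Ideal.Quotient.mkₐ D P).toLinearMap ∘ g = s := funext hg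
    rw [hcomp]
    exact hs
  have hfs : FaithfulSMul D (FractionRing (Z ⧸ P)) := by
    rw [faithfulSMul_iff_algebraMap_injective, IsScalarTower.algebraMap_eq D (Z ⧸ P)]
    exact (IsFractionRing.injective (Z ⧸ P) (FractionRing (Z ⧸ P))).comp hinj
  let _ : Algebra (FractionRing D) (FractionRing (Z ⧸ P)) := FractionRing.liftAlgebra D _
  have : IsScalarTower D (FractionRing D) (FractionRing (Z ⧸ P)) :=
    FractionRing.isScalarTower_liftAlgebra D _
  have : ExpChar (FractionRing D) p :=
    expChar_of_injective_algebraMap (IsFractionRing.injective D (FractionRing D)) p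
  have hfin : FiniteDimensional (FractionRing D) (FractionRing (Z ⧸ P)) := by
    have : Module.rank (FractionRing D) (FractionRing (Z ⧸ P)) ≤ ρ := by
      refine rank_le fun s hs => ?_
      by_contra hcon
      push Not at hcon
      have hcard : Fintype.card (Fin (ρ + 1)) ≤ Fintype.card s := by
        rw [Fintype.card_fin, Fintype.card_coe]; omega
      obtain ⟨em⟩ := Function.Embedding.nonempty_of_card_le hcard
      have h1 := hs.comp em em.injective
      rw [← LinearIndependent.iff_fractionRing D] at h1
      obtain ⟨b, hb⟩ := IsLocalization.exist_integer_multiples_of_finite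
        (nonZeroDivisors (Z ⧸ P)) (fun i => ((em i : s) : FractionRing (Z ⧸ P)))
      choose g hg using hb
      refine hrk' g ?_
      have hb0 : (b : Z ⧸ P) ≠ 0 := nonZeroDivisors.ne_zero b.2
      rw [Fintype.linearIndependent_iff] at h1 ⊢
      intro c hc
      refine h1 c ?_
      have h2 := congrArg (algebraMap (Z ⧸ P) (FractionRing (Z ⧸ P))) hc
      rw [map_zero, map_sum] at h2
      have h3 : ∀ i, algebraMap (Z ⧸ P) (FractionRing (Z ⧸ P)) (c i • g i) =
          (b : Z ⧸ P) • (c i • ((em i : s) : FractionRing (Z ⧸ P))) := by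
        intro i
        rw [smul_comm, ← hg]
        exact map_smul (IsScalarTower.toAlgHom D (Z ⧸ P) (FractionRing (Z ⧸ P))) (c i) (g i)
      rw [Finset.sum_congr rfl fun i _ => h3 i, ← Finset.smul_sum, Algebra.smul_def,
        mul_eq_zero, map_eq_zero_iff _ (IsFractionRing.injective (Z ⧸ P) (FractionRing (Z ⧸ P)))] at h2
      exact h2.resolve_left hb0
    exact Module.rank_lt_aleph0_iff.1 (this.trans_lt (Cardinal.natCast_lt_aleph0))
  obtain ⟨φ, hφ⟩ := functional_dom (D := D) (W := Z ⧸ P) (K := FractionRing D)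
    (L := FractionRing (Z ⧸ P)) p hcart hzP
  exact ⟨φ.comp (Ideal.Quotient.mkₐ D P).toLinearMap, hφ⟩

/-- A torsion free reduced integral extension of bounded rank of a polynomial ring over a field is
module-finite. -/
theorem thmN {k σ Z : Type*} [Field k] [Finite σ] [CommRing Z] [IsReduced Z]
    [Algebra (MvPolynomial σ k) Z] [Algebra.IsIntegral (MvPolynomial σ k) Z]
    (htf : ∀ (a : MvPolynomial σ k) (z : Z), a ≠ 0 → a • z = 0 → z = 0) (ρ : ℕ)
    (hrk : ∀ s : Fin (ρ + 1) → Z, ¬ LinearIndependent (MvPolynomial σ k) s) :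
    Module.Finite (MvPolynomial σ k) Z := by
  classical
  obtain ⟨p, hp⟩ := ExpChar.exists k
  have : ExpChar (MvPolynomial σ k) p :=
    expChar_of_injective_algebraMap (MvPolynomial.C_injective σ k) p
  have hfun : ∀ z : Z, z ≠ 0 → ∃ φ : Z →ₗ[MvPolynomial σ k] MvPolynomial σ k, φ z ≠ 0 :=
    fun z hz => functional htf ρ hrk p (fun e f0 hf0 => exists_cartier p e hf0) hz
  -- independent families with functionals
  by_contra hcon
  have key : ∀ n : ℕ, ∃ s : Fin n → Z, ∃ T : Finset (Z →ₗ[MvPolynomial σ k] MvPolynomial σ k),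
      ∀ c : Fin n → MvPolynomial σ k, (∀ φ ∈ T, φ (∑ i, c i • s i) = 0) → c = 0 := by
    intro n
    induction n with
    | zero => exact ⟨Fin.elim0, ∅, fun c _ => Subsingleton.elim _ _⟩
    | succ n ih =>
      obtain ⟨s, T, hT⟩ := ih
      obtain ⟨z, hz0, hz⟩ : ∃ z : Z, z ≠ 0 ∧ ∀ φ ∈ T, φ z = 0 := by
        by_contra hno
        push Not at hno
        refine hcon ?_
        let Ψ : Z →ₗ[MvPolynomial σ k] (T → MvPolynomial σ k) := LinearMap.pi fun φ => φ.1
        have hΨ : Function.Injective Ψ := by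
          rw [injective_iff_map_eq_zero]
          intro z hz
          by_contra hz0
          obtain ⟨φ, hφ, h⟩ := hno z hz0
          exact h (congrFun hz ⟨φ, hφ⟩)
        exact Module.Finite.of_injective Ψ hΨ
      obtain ⟨φ0, hφ0⟩ := hfun z hz0
      refine ⟨Fin.cons z s, insert φ0 T, fun c hc => ?_⟩
      have h1 : (fun i : Fin n => c i.succ) = 0 := by
        refine hT _ fun φ hφ => ?_
        have := hc φ (Finset.mem_insert_of_mem hφ)
        rw [Fin.sum_univ_succ, map_add, Fin.cons_zero, map_smul, hz φ hφ, smul_zero, zero_add] at this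
        simpa using this
      have h2 := hc φ0 (Finset.mem_insert_self _ _)
      rw [Fin.sum_univ_succ, Fin.cons_zero, Finset.sum_eq_zero (fun i _ => by
        rw [congrFun h1 i]; simp), add_zero, map_smul, smul_eq_mul, mul_eq_zero] at h2
      funext i
      refine Fin.cases ?_ (fun j => ?_) i
      · exact h2.resolve_right hφ0
      · exact congrFun h1 j
  obtain ⟨s, T, hT⟩ := key (ρ + 1)
  refine hrk s (Fintype.linearIndependent_iff.2 fun c hc i => ?_)
  exact congrFun (hT c fun φ _ => by rw [hc, map_zero]) i

end thmN
end CMP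

namespace CMP

section rankhom

/-- it is enough to bound the rank on a generating set -/
lemma rank_of_gen {D Z : Type*} [CommRing D] [IsDomain D] [AddCommGroup Z] [Module D Z]
    (S : Set Z) (hS : Submodule.span D S = ⊤) (ρ : ℕ)
    (hrk : ∀ s : Fin (ρ + 1) → Z, (∀ i, s i ∈ S) → ¬ LinearIndependent D s)
    (s : Fin (ρ + 1) → Z) : ¬ LinearIndependent D s := by
  intro hs
  let f := LocalizedModule.mkLinearMap (nonZeroDivisors D) Z
  obtain ⟨b, hbS, hbspan, hb⟩ := exists_linearIndependent (FractionRing D) (Set.image f S)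
  have hcard : ∀ t : Fin (ρ + 1) → LocalizedModule (nonZeroDivisors D) Z,
      Function.Injective t → ¬ (∀ i, t i ∈ b) := by
    intro t hti ht
    choose g hg hgt using fun i => hbS (ht i)
    refine hrk g hg (LinearIndependent.of_comp f ?_)
    have h1 : ⇑f ∘ g = t := funext hgt
    rw [h1, LinearIndependent.iff_fractionRing D (FractionRing D)]
    exact hb.comp (fun i => (⟨t i, ht i⟩ : b)) (fun i j h => hti (congrArg Subtype.val h))
  have hbfin : b.Finite := by
    by_contra hinf
    have hinf' : b.Infinite := hinf
    have := hinf'.to_subtype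
    exact hcard (fun i => ((Infinite.natEmbedding b i : b) : _))
      (fun i j h => Fin.ext ((Infinite.natEmbedding b).injective (Subtype.ext h)))
      (fun i => (Infinite.natEmbedding b i).2)
  have := hbfin.fintype
  have hbcard : Fintype.card b ≤ ρ := by
    by_contra hcon
    push Not at hcon
    obtain ⟨em⟩ := Function.Embedding.nonempty_of_card_le
      (show Fintype.card (Fin (ρ + 1)) ≤ Fintype.card b by rw [Fintype.card_fin]; omega)
    exact hcard (fun i => ((em i : b) : _)) (fun i j h => em.injective (Subtype.ext h))
      (fun i => (em i).2)
  have htop : Submodule.span (FractionRing D) b = ⊤ := by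
    rw [hbspan]
    rw [eq_top_iff]
    intro v _
    obtain ⟨⟨z, c⟩, rfl⟩ := IsLocalizedModule.mk'_surjective (nonZeroDivisors D) f v
    have hz : z ∈ Submodule.span D S := by rw [hS]; trivial
    have h2 : f z ∈ Submodule.span (FractionRing D) (Set.image f S) := by
      have h3 := Submodule.mem_map_of_mem (f := f) hz
      rw [Submodule.map_span] at h3
      exact Submodule.span_le_restrictScalars D (FractionRing D) _ h3
    have h4 : (c : D) • IsLocalizedModule.mk' f z c = f z := IsLocalizedModule.mk'_cancel' f z c
    have hc0 : algebraMap D (FractionRing D) c ≠ 0 :=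
      IsFractionRing.to_map_ne_zero_of_mem_nonZeroDivisors c.2
    rw [← algebraMap_smul (FractionRing D)] at h4
    have h5 := Submodule.smul_mem _ (algebraMap D (FractionRing D) c)⁻¹ h2
    rw [← h4, smul_smul, inv_mul_cancel₀ hc0, one_smul] at h5
    exact h5
  have hs' : LinearIndependent (FractionRing D) (⇑f ∘ s) :=
    LinearIndependent.of_isLocalizedModule (FractionRing D) (nonZeroDivisors D) f hs
  have hle := linearIndependent_le_span (R := FractionRing D) _ hs' b htop
  rw [Cardinal.mk_fin] at hle
  have : ρ + 1 ≤ Fintype.card b := by exact_mod_cast hle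
  omega

end rankhom

section grf

variable {B : Type*} [CommRing B] [IsLocalRing B] {d : ℕ} {x : Fin d → B}

/-- the properties of the filtration used to form its associated graded ring -/
structure KF (x : Fin d → B) (q : ℕ) (K : ℕ → Ideal B) : Prop where
  zero : K 0 = ⊤
  anti : ∀ {a b}, a ≤ b → K b ≤ K a
  mul : ∀ {a b y z}, y ∈ K a → z ∈ K b → y * z ∈ K (a + b)
  max : maximalIdeal B ≤ K 1
  xmem : ∀ i, x i ∈ K q

variable {q : ℕ} {K : ℕ → Ideal B}

lemma KF.Jx_pow (h : KF x q K) (f : ℕ) : Jx x ^ f ≤ K (q * f) := by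
  induction f with
  | zero => rw [mul_zero, h.zero]; exact le_top
  | succ f ih =>
    rw [pow_succ, Ideal.mul_le]
    intro r hr s hs
    rw [mul_add, mul_one]
    refine h.mul (ih hr) ?_
    exact (Ideal.span_le (I := K q)).2 (by rintro _ ⟨i, rfl⟩; exact h.xmem i) hs

/-- the Rees algebra of the filtration -/
def rA (h : KF x q K) : Subring B[X] where
  carrier := {p | ∀ n, p.coeff n ∈ K n}
  zero_mem' := fun n => by simp
  one_mem' := fun n => by
    rw [Polynomial.coeff_one]
    split_ifs with h0
    · subst h0; rw [h.zero]; trivial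
    · exact zero_mem _
  add_mem' := fun hp hp' n => by rw [Polynomial.coeff_add]; exact Ideal.add_mem _ (hp n) (hp' n)
  neg_mem' := fun hp n => by rw [Polynomial.coeff_neg]; exact (Ideal.neg_mem_iff _).2 (hp n)
  mul_mem' := fun hp hp' n => by
    rw [Polynomial.coeff_mul]
    refine Ideal.sum_mem _ fun ij hij => ?_
    rw [← HasAntidiagonal.mem_antidiagonal.1 hij]
    exact h.mul (hp _) (hp' _)

lemma mem_rA {h : KF x q K} {p : B[X]} : p ∈ rA h ↔ ∀ n, p.coeff n ∈ K n := Iff.rfl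

/-- the kernel of the map to the associated graded ring -/
def rB (h : KF x q K) : Ideal (rA h) where
  carrier := {p | ∀ n, (p : B[X]).coeff n ∈ K (n + 1)}
  zero_mem' := fun n => by simp
  add_mem' := fun hp hp' n => by
    rw [Subring.coe_add, Polynomial.coeff_add]; exact Ideal.add_mem _ (hp n) (hp' n)
  smul_mem' := fun c p hp n => by
    rw [smul_eq_mul, Subring.coe_mul, Polynomial.coeff_mul]
    refine Ideal.sum_mem _ fun ij hij => ?_
    rw [← HasAntidiagonal.mem_antidiagonal.1 hij, add_assoc]
    exact h.mul (c.2 _) (hp _)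

lemma mem_rB {h : KF x q K} {p : rA h} : p ∈ rB h ↔ ∀ n, (p : B[X]).coeff n ∈ K (n + 1) := Iff.rfl

/-- leading terms of products -/
lemma KF.lead (h : KF x q K) {p r : B[X]} (hp : ∀ n, p.coeff n ∈ K n) (hr : ∀ n, r.coeff n ∈ K n)
    {n m : ℕ} (hpn : ∀ i, n < i → p.coeff i ∈ K (i + 1)) (hrm : ∀ i, m < i → r.coeff i ∈ K (i + 1)) :
    (p * r).coeff (n + m) - p.coeff n * r.coeff m ∈ K (n + m + 1) := by
  rw [Polynomial.coeff_mul, ← Finset.add_sum_erase _ _ (a := (n, m)) (by simp), add_sub_cancel_left]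
  refine Ideal.sum_mem _ fun ij hij => ?_
  rw [Finset.mem_erase, HasAntidiagonal.mem_antidiagonal] at hij
  obtain ⟨hne, hij⟩ := hij
  rw [← hij]
  by_cases h1 : n < ij.1
  · rw [show ij.1 + ij.2 + 1 = (ij.1 + 1) + ij.2 by ring]
    exact h.mul (hpn _ h1) (hr _)
  · rw [add_assoc]
    refine h.mul (hp _) (hrm _ ?_)
    by_contra h2
    exact hne (Prod.ext (by simp; omega) (by simp; omega))

/-- the highest degree with non zero image -/
lemma exists_top (h : KF x q K) {p : B[X]} (hn : ¬ ∀ n, p.coeff n ∈ K (n + 1)) :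
    ∃ n, p.coeff n ∉ K (n + 1) ∧ ∀ i, n < i → p.coeff i ∈ K (i + 1) := by
  classical
  push Not at hn
  obtain ⟨m, hm⟩ := hn
  have hle : ∀ n, p.coeff n ∉ K (n + 1) → n ≤ p.natDegree := fun n hn => by
    by_contra hlt
    push Not at hlt
    rw [Polynomial.coeff_eq_zero_of_natDegree_lt hlt] at hn
    exact hn (zero_mem _)
  refine ⟨Nat.findGreatest (fun n => p.coeff n ∉ K (n + 1)) p.natDegree,
    Nat.findGreatest_spec (P := fun n => p.coeff n ∉ K (n + 1)) (hle m hm) hm, fun i hi => ?_⟩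
  by_contra hcon
  exact absurd (Nat.le_findGreatest (P := fun n => p.coeff n ∉ K (n + 1)) (hle i hcon) hcon)
    (not_le.2 hi)

/-- homogeneous elements -/
noncomputable def hom (h : KF x q K) (n : ℕ) (z : B) (hz : z ∈ K n) : rA h :=
  ⟨Polynomial.monomial n z, fun m => by
    rw [Polynomial.coeff_monomial]
    split_ifs with h0
    · subst h0; exact hz
    · exact zero_mem _⟩

lemma mk_hom_eq_zero (h : KF x q K) {n : ℕ} {z : B} {hz : z ∈ K n} (hz' : z ∈ K (n + 1)) :
    Ideal.Quotient.mk (rB h) (hom h n z hz) = 0 := by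
  rw [Ideal.Quotient.eq_zero_iff_mem]
  intro m
  show (Polynomial.monomial n z).coeff m ∈ _
  rw [Polynomial.coeff_monomial]
  split_ifs with h0
  · subst h0; exact hz'
  · exact zero_mem _

/-- the polynomial attached to a form -/
noncomputable def pF (x : Fin d → B) (q : ℕ) : MvPolynomial (Fin d) B →+* B[X] :=
  MvPolynomial.eval₂Hom Polynomial.C (fun i => Polynomial.monomial q (x i))

lemma pF_monomial (a : Fin d →₀ ℕ) (c : B) :
    pF x q (MvPolynomial.monomial a c) =
      Polynomial.monomial (q * a.degree) (MvPolynomial.eval x (MvPolynomial.monomial a c)) := by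
  rw [pF, MvPolynomial.coe_eval₂Hom, MvPolynomial.eval₂_monomial, MvPolynomial.eval_monomial]
  have : (a.prod fun i e => (Polynomial.monomial q (x i)) ^ e) =
      Polynomial.monomial (q * a.degree) (a.prod fun i e => x i ^ e) := by
    rw [Finsupp.prod, Finsupp.prod, Finsupp.degree_apply, Finset.mul_sum]
    induction a.support using Finset.induction_on with
    | empty => simp
    | insert i s hi ih =>
      rw [Finset.prod_insert hi, Finset.prod_insert hi, Finset.sum_insert hi, ih,
        Polynomial.monomial_pow, Polynomial.monomial_mul_monomial]
  rw [this, Polynomial.C_mul_monomial]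

lemma pF_hom {f : ℕ} {F : MvPolynomial (Fin d) B} (hF : F.IsHomogeneous f) :
    pF x q F = Polynomial.monomial (q * f) (MvPolynomial.eval x F) := by
  conv_lhs => rw [F.as_sum]
  conv_rhs => rw [F.as_sum]
  rw [map_sum, map_sum, map_sum]
  refine Finset.sum_congr rfl fun a ha => ?_
  rw [pF_monomial, deg_of_isHom hF (MvPolynomial.mem_support_iff.1 ha)]

lemma pF_coeff (F : MvPolynomial (Fin d) B) (n : ℕ) : (pF x q F).coeff n =
    ∑ f ∈ Finset.range (F.totalDegree + 1), if q * f = n then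
      MvPolynomial.eval x (MvPolynomial.homogeneousComponent f F) else 0 := by
  conv_lhs => rw [← MvPolynomial.sum_homogeneousComponent F]
  rw [map_sum, Polynomial.finsetSum_coeff]
  refine Finset.sum_congr rfl fun f _ => ?_
  rw [pF_hom (MvPolynomial.homogeneousComponent_isHomogeneous f F), Polynomial.coeff_monomial]

lemma pF_mem (h : KF x q K) (F : MvPolynomial (Fin d) B) : pF x q F ∈ rA h := by
  intro n
  rw [pF_coeff]
  refine Ideal.sum_mem _ fun f _ => ?_
  split_ifs with h0
  · subst h0
    exact h.Jx_pow f (eval_mem_Jx_pow (MvPolynomial.homogeneousComponent_isHomogeneous f F))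
  · exact zero_mem _

lemma pF_coeff_max (h : KF x q K) (F : MvPolynomial (Fin d) B)
    (n : ℕ) (hF : ∀ a, q * a.degree = n → F.coeff a ∈ maximalIdeal B) :
    (pF x q F).coeff n ∈ K (n + 1) := by
  rw [pF_coeff]
  refine Ideal.sum_mem _ fun f _ => ?_
  split_ifs with h0
  · subst h0
    have h1 := eval_mem_of_coeff x (MvPolynomial.homogeneousComponent_isHomogeneous f F)
      (Q := maximalIdeal B) (fun a => by
        rw [MvPolynomial.coeff_homogeneousComponent]
        split_ifs with h2
        · exact hF a (by rw [h2])
        · exact zero_mem _)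
    refine (Ideal.mul_le.2 fun r hr s hs => ?_ : maximalIdeal B * Jx x ^ f ≤ _) h1
    rw [add_comm]
    exact h.mul (h.max hr) (h.Jx_pow f hs)
  · exact zero_mem _

/-- from forms to the associated graded ring -/
noncomputable def pA (h : KF x q K) : MvPolynomial (Fin d) B →+* rA h :=
  (pF x q).codRestrict (rA h) (pF_mem h)

lemma map_res_surj : Function.Surjective
    (MvPolynomial.map (σ := Fin d) (residue B)) :=
  MvPolynomial.map_surjective _ residue_surjective

lemma map_res_eq_zero {F : MvPolynomial (Fin d) B} (hF : MvPolynomial.map (residue B) F = 0) (a) :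
    F.coeff a ∈ maximalIdeal B := by
  rw [← residue_eq_zero_iff, ← MvPolynomial.coeff_map, hF, MvPolynomial.coeff_zero]

noncomputable def th (h : KF x q K) :
    MvPolynomial (Fin d) (ResidueField B) →+* rA h ⧸ rB h :=
  RingHom.liftOfSurjective (MvPolynomial.map (σ := Fin d) (residue B)) map_res_surj
    ⟨(Ideal.Quotient.mk (rB h)).comp (pA h), by
      intro F hF
      rw [RingHom.mem_ker] at hF ⊢
      rw [RingHom.comp_apply, Ideal.Quotient.eq_zero_iff_mem]
      intro n
      exact pF_coeff_max h F n fun a _ => map_res_eq_zero hF a⟩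

lemma th_map (h : KF x q K) (F : MvPolynomial (Fin d) B) :
    th h (MvPolynomial.map (residue B) F) = Ideal.Quotient.mk (rB h) (pA h F) :=
  RingHom.liftOfRightInverse_comp_apply _ _ _ _ F

/-- finite generation of the associated graded ring in elementary terms -/
theorem KF.fin (h : KF x q K) (hq : 0 < q) (ρ : ℕ)
    (htf : ∀ (f n : ℕ) (F : MvPolynomial (Fin d) B) (z : B), F.IsHomogeneous f → UC F →
      z ∈ K n → MvPolynomial.eval x F * z ∈ K (q * f + n + 1) → z ∈ K (n + 1))
    (hred : ∀ n z, z ∈ K n → z * z ∈ K (n + n + 1) → z ∈ K (n + 1))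
    (hIntg : ∀ n z, z ∈ K n → ∃ b, 0 < b ∧ ∃ a : ℕ → B,
      (∀ i ∈ Icc 1 b, a i ∈ Jx x ^ (n * i)) ∧
      (z ^ q) ^ b + ∑ i ∈ Icc 1 b, a i * (z ^ q) ^ (b - i) = 0)
    (hrk : ∀ (y : Fin (ρ + 1) → B) (n : Fin (ρ + 1) → ℕ), (∀ j, y j ∈ K (n j)) →
      ∃ (e : ℕ) (f : Fin (ρ + 1) → ℕ) (F : Fin (ρ + 1) → MvPolynomial (Fin d) B),
        (∀ j, (F j).IsHomogeneous (f j)) ∧ (∀ j, F j ≠ 0 → q * f j + n j = e) ∧ (∃ j, UC (F j)) ∧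
        ∑ j, MvPolynomial.eval x (F j) * y j ∈ K (e + 1)) :
    ∃ N, ∀ n ≥ N, K n ≤ Jx x * K (n - q) ⊔ K (n + 1) := by
  classical
  let _ : Algebra (MvPolynomial (Fin d) (ResidueField B)) (rA h ⧸ rB h) := (th h).toAlgebra
  have hsm : ∀ F (g : rA h), (MvPolynomial.map (residue B) F : MvPolynomial (Fin d) (ResidueField B)) •
      (Ideal.Quotient.mk (rB h) g) = Ideal.Quotient.mk (rB h) (pA h F * g) := by
    intro F g
    rw [map_mul, ← th_map]
    exact Algebra.smul_def _ _
  have hmk : ∀ g : rA h, Ideal.Quotient.mk (rB h) g = 0 ↔ ∀ n, (g : B[X]).coeff n ∈ K (n + 1) :=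
    fun g => Ideal.Quotient.eq_zero_iff_mem
  -- reduced
  have : IsReduced (rA h ⧸ rB h) := by
    rw [isReduced_iff_pow_one_lt 2 one_lt_two]
    intro g hg
    obtain ⟨p, rfl⟩ := Ideal.Quotient.mk_surjective g
    rw [← map_pow, hmk] at hg
    rw [hmk]
    by_contra hcon
    obtain ⟨n, hn, htop⟩ := exists_top h hcon
    refine hn (hred n _ (p.2 n) ?_)
    have h1 := h.lead p.2 p.2 htop htop
    have h2 := hg (n + n)
    rw [Subring.coe_pow, pow_two] at h2
    have := Ideal.sub_mem _ h2 h1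
    rwa [sub_sub_cancel] at this
  -- torsion free
  have htf' : ∀ (a : MvPolynomial (Fin d) (ResidueField B)) (z : rA h ⧸ rB h), a ≠ 0 →
      a • z = 0 → z = 0 := by
    intro a z ha haz
    obtain ⟨F, rfl⟩ := map_res_surj a
    obtain ⟨p, rfl⟩ := Ideal.Quotient.mk_surjective z
    rw [hsm, hmk] at haz
    rw [hmk]
    by_contra hcon
    obtain ⟨n, hn, htop⟩ := exists_top h hcon
    -- top component with unit content
    rw [← UC_iff] at ha
    obtain ⟨a0, ha0⟩ := ha
    have hdeg : ∀ f, UC (MvPolynomial.homogeneousComponent f F) → f ≤ F.totalDegree := by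
      intro f hf
      by_contra hlt
      push Not at hlt
      rw [MvPolynomial.homogeneousComponent_eq_zero _ _ hlt] at hf
      obtain ⟨b, hb⟩ := hf
      exact hb (by simp)
    have hUC : ∀ b, F.coeff b ∉ maximalIdeal B →
        UC (MvPolynomial.homogeneousComponent b.degree F) := fun b hb =>
      ⟨b, by rw [MvPolynomial.coeff_homogeneousComponent, if_pos rfl]; exact hb⟩
    set f := Nat.findGreatest (fun f => UC (MvPolynomial.homogeneousComponent f F)) F.totalDegree
      with hf
    have hfUC : UC (MvPolynomial.homogeneousComponent f F) :=
      Nat.findGreatest_spec (P := fun f => UC (MvPolynomial.homogeneousComponent f F))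
        (hdeg _ (hUC _ ha0)) (hUC _ ha0)
    have hftop : ∀ i, q * f < i → (pF x q F).coeff i ∈ K (i + 1) := by
      intro i hi
      refine pF_coeff_max h F i fun b hb => ?_
      by_contra hbm
      have h1 := Nat.le_findGreatest (P := fun f => UC (MvPolynomial.homogeneousComponent f F))
        (hdeg _ (hUC _ hbm)) (hUC _ hbm)
      rw [← hb] at hi
      exact absurd (Nat.lt_of_mul_lt_mul_left hi) (not_lt.2 h1)
    refine hn (htf f n _ _ (MvPolynomial.homogeneousComponent_isHomogeneous f F) hfUC (p.2 n) ?_)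
    have h1 := h.lead (pF_mem h F) p.2 hftop htop
    have h2 := haz (q * f + n)
    rw [Subring.coe_mul] at h2
    have h3 := Ideal.sub_mem _ h2 h1
    have h4 : (pF x q F).coeff (q * f) =
        MvPolynomial.eval x (MvPolynomial.homogeneousComponent f F) := by
      rw [pF_coeff, Finset.sum_eq_single f]
      · rw [if_pos rfl]
      · intro b _ hb
        rw [if_neg (fun h => hb (Nat.eq_of_mul_eq_mul_left hq h))]
      · intro hb
        exact absurd (Finset.mem_range.2 (Nat.lt_succ_of_le (hdeg _ hfUC))) hb
    rw [h4] at h3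
    have h5 : ((pA h F : rA h) : B[X]) = pF x q F := rfl
    rw [h5, sub_sub_cancel] at h3
    exact h3
  -- homogeneous elements generate
  let S : Set (rA h ⧸ rB h) := {g | ∃ n z, ∃ hz : z ∈ K n, g = Ideal.Quotient.mk (rB h) (hom h n z hz)}
  have hsum : ∀ p : rA h, p = ∑ n ∈ Finset.range ((p : B[X]).natDegree + 1),
      hom h n ((p : B[X]).coeff n) (p.2 n) := by
    intro p
    apply Subtype.ext
    rw [AddSubmonoidClass.coe_finsetSum]
    exact Polynomial.as_sum_range' _ _ (Nat.lt_succ_self _)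
  have hSspan : Submodule.span (MvPolynomial (Fin d) (ResidueField B)) S = ⊤ := by
    rw [eq_top_iff]
    intro g _
    obtain ⟨p, rfl⟩ := Ideal.Quotient.mk_surjective g
    rw [hsum p, map_sum]
    exact Submodule.sum_mem _ fun n _ => Submodule.subset_span ⟨n, _, _, rfl⟩
  have hpAhom : ∀ {f : ℕ} {F : MvPolynomial (Fin d) B}, F.IsHomogeneous f →
      ((pA h F : rA h) : B[X]) = Polynomial.monomial (q * f) (MvPolynomial.eval x F) :=
    fun hF => pF_hom hF
  -- integral
  have : Algebra.IsIntegral (MvPolynomial (Fin d) (ResidueField B)) (rA h ⧸ rB h) := by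
    suffices hh : ∀ n z (hz : z ∈ K n), IsIntegral (MvPolynomial (Fin d) (ResidueField B))
        (Ideal.Quotient.mk (rB h) (hom h n z hz)) by
      refine ⟨fun g => ?_⟩
      obtain ⟨p, rfl⟩ := Ideal.Quotient.mk_surjective g
      rw [hsum p, map_sum]
      exact IsIntegral.sum _ fun n _ => hh n _ _
    intro n z hz
    obtain ⟨b, hb, a, ha, hab⟩ := hIntg n _ hz
    refine IsIntegral.of_pow hq ?_
    have ha' : ∀ i, ∃ A : MvPolynomial (Fin d) B, i ∈ Icc 1 b →
        A.IsHomogeneous (n * i) ∧ MvPolynomial.eval x A = a i := by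
      intro i
      by_cases hi : i ∈ Icc 1 b
      · obtain ⟨A, hA⟩ := (mem_Jx_pow _ _ _).1 (ha i hi)
        exact ⟨A, fun _ => hA⟩
      · exact ⟨0, fun h => absurd h hi⟩
    choose A hA using ha'
    refine ⟨Polynomial.X ^ b + ∑ i ∈ Icc 1 b,
      Polynomial.C (MvPolynomial.map (residue B) (A i)) * Polynomial.X ^ (b - i), ?_, ?_⟩
    · apply Polynomial.monic_X_pow_add
      refine (Polynomial.degree_sum_le _ _).trans_lt ?_
      rw [Finset.sup_lt_iff (by simpa using WithBot.bot_lt_coe b)]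
      intro i hi
      refine (Polynomial.degree_C_mul_X_pow_le _ _).trans_lt ?_
      rw [Finset.mem_Icc] at hi
      exact_mod_cast (by omega : b - i < b)
    · rw [Polynomial.eval₂_add, Polynomial.eval₂_X_pow, Polynomial.eval₂_finset_sum]
      have h1 : ∀ i ∈ Icc 1 b, Polynomial.eval₂ (algebraMap _ (rA h ⧸ rB h))
          (Ideal.Quotient.mk (rB h) (hom h n z hz) ^ q)
          (Polynomial.C (MvPolynomial.map (residue B) (A i)) * Polynomial.X ^ (b - i)) =
          Ideal.Quotient.mk (rB h) (pA h (A i) * (hom h n z hz ^ q) ^ (b - i)) := by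
        intro i _
        rw [Polynomial.eval₂_mul, Polynomial.eval₂_C, Polynomial.eval₂_X_pow, ← hsm, map_pow, map_pow]
        exact (Algebra.smul_def _ _).symm
      rw [Finset.sum_congr rfl h1, ← map_sum, ← map_pow, ← map_pow, ← map_add]
      refine (congrArg (Ideal.Quotient.mk (rB h)) (?_ : _ = (0 : rA h))).trans (map_zero _)
      apply Subtype.ext
      rw [Subring.coe_add, AddSubmonoidClass.coe_finsetSum, Subring.coe_zero]
      have h2 : ∀ i ∈ Icc 1 b, ((pA h (A i) * (hom h n z hz ^ q) ^ (b - i) : rA h) : B[X]) =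
          Polynomial.monomial (n * q * b) (a i * (z ^ q) ^ (b - i)) := by
        intro i hi
        rw [Subring.coe_mul, hpAhom (hA i hi).1, (hA i hi).2, Subring.coe_pow, Subring.coe_pow]
        show _ * ((Polynomial.monomial n z) ^ q) ^ (b - i) = _
        rw [Polynomial.monomial_pow, Polynomial.monomial_pow, Polynomial.monomial_mul_monomial]
        rw [Finset.mem_Icc] at hi
        obtain ⟨c, rfl⟩ := Nat.exists_eq_add_of_le hi.2
        rw [Nat.add_sub_cancel_left]
        congr 1
        ring
      rw [Finset.sum_congr rfl h2]
      have h3 : (((hom h n z hz ^ q) ^ b : rA h) : B[X]) =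
          Polynomial.monomial (n * q * b) ((z ^ q) ^ b) := by
        rw [Subring.coe_pow, Subring.coe_pow]
        show ((Polynomial.monomial n z) ^ q) ^ b = _
        rw [Polynomial.monomial_pow, Polynomial.monomial_pow]
      rw [h3, ← map_sum, ← map_add, hab, map_zero]
  -- rank
  have hrk' := rank_of_gen S hSspan ρ (by
    intro s hs hli
    choose n z hz hs using hs
    obtain ⟨e, f, F, hF, hfe, ⟨j0, hj0⟩, hrel⟩ := hrk z n hz
    rw [Fintype.linearIndependent_iff] at hli
    refine (UC_iff _).1 hj0 (hli (fun j => MvPolynomial.map (residue B) (F j)) ?_ j0)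
    have h1 : ∀ j, MvPolynomial.map (residue B) (F j) • s j = Ideal.Quotient.mk (rB h)
      (pA h (F j) * hom h (n j) (z j) (hz j)) := fun j => by rw [hs, hsm]
    rw [Finset.sum_congr rfl fun j _ => h1 j, ← map_sum, hmk]
    have h2 : ∀ j, ((pA h (F j) * hom h (n j) (z j) (hz j) : rA h) : B[X]) =
        Polynomial.monomial e (MvPolynomial.eval x (F j) * z j) := by
      intro j
      by_cases h0 : F j = 0
      · rw [h0]; simp
      · rw [Subring.coe_mul, hpAhom (hF j)]
        show _ * Polynomial.monomial (n j) (z j) = _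
        rw [Polynomial.monomial_mul_monomial, hfe j h0]
    intro i
    rw [AddSubmonoidClass.coe_finsetSum, Finset.sum_congr rfl fun j _ => h2 j, ← map_sum,
      Polynomial.coeff_monomial]
    split_ifs with h0
    · subst h0; exact hrel
    · exact zero_mem _)
  have hfin := thmN htf' ρ hrk'
  obtain ⟨T, hT⟩ := hfin.fg_top
  choose lift hlift using fun g : rA h ⧸ rB h => Ideal.Quotient.mk_surjective g
  refine ⟨∑ g ∈ T, (lift g : B[X]).natDegree + 1, fun n hn z hz => ?_⟩
  have hmem : Ideal.Quotient.mk (rB h) (hom h n z hz) ∈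
      Submodule.span (MvPolynomial (Fin d) (ResidueField B)) (T : Set (rA h ⧸ rB h)) := by
    rw [hT]; trivial
  obtain ⟨c, hc⟩ := Submodule.mem_span_finset.1 hmem |>.imp fun _ h => h.2
  choose F hF using fun g => map_res_surj (c g)
  have h1 : ∀ g, c g • g = Ideal.Quotient.mk (rB h) (pA h (F g) * lift g) := fun g => by
    rw [← hsm, hF, hlift]
  rw [Finset.sum_congr rfl fun g _ => h1 g, ← map_sum, eq_comm, Ideal.Quotient.eq] at hc
  have h2 := hc n
  rw [AddSubgroupClass.coe_sub, Polynomial.coeff_sub, AddSubmonoidClass.coe_finsetSum,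
    Polynomial.finsetSum_coeff] at h2
  have h3 : ((hom h n z hz : rA h) : B[X]).coeff n = z := by
    show (Polynomial.monomial n z).coeff n = z
    rw [Polynomial.coeff_monomial, if_pos rfl]
  rw [h3] at h2
  rw [← add_sub_cancel (∑ g ∈ T, ((pA h (F g) * lift g : rA h) : B[X]).coeff n) z]
  refine Submodule.add_mem_sup ?_ h2
  refine Ideal.sum_mem _ fun g hg => ?_
  rw [Subring.coe_mul, Polynomial.coeff_mul]
  refine Ideal.sum_mem _ fun ij hij => ?_
  rw [HasAntidiagonal.mem_antidiagonal] at hij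
  by_cases hj : (lift g : B[X]).natDegree < ij.2
  · rw [Polynomial.coeff_eq_zero_of_natDegree_lt hj, mul_zero]; exact zero_mem _
  have hle : (lift g : B[X]).natDegree ≤ ∑ g ∈ T, (lift g : B[X]).natDegree :=
    Finset.single_le_sum (f := fun g => (lift g : B[X]).natDegree) (fun _ _ => Nat.zero_le _) hg
  have h5 : ((pA h (F g) : rA h) : B[X]) = pF x q (F g) := rfl
  rw [h5, pF_coeff, Finset.sum_mul]
  refine Ideal.sum_mem _ fun f _ => ?_
  split_ifs with h6
  · obtain ⟨f, rfl⟩ : ∃ f', f = f' + 1 := ⟨f - 1, by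
      rcases f with _ | f
      · simp at h6; omega
      · rfl⟩
    have h7 := eval_mem_Jx_pow (x := x)
      (MvPolynomial.homogeneousComponent_isHomogeneous (f + 1) (F g))
    have h8 : Jx x ^ (f + 1) * K ij.2 ≤ Jx x * K (n - q) := by
      rw [pow_succ', mul_assoc]
      refine Ideal.mul_mono_right (Ideal.mul_le.2 fun r hr s hs => ?_)
      have h9 := h.mul (h.Jx_pow f hr) hs
      rwa [show q * f + ij.2 = n - q by rw [← hij, ← h6, mul_add, mul_one]; omega] at h9
    exact h8 (Ideal.mul_mem_mul h7 ((lift g).2 _))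
  · rw [zero_mul]; exact zero_mem _

end grf
end CMP

namespace CMP

section rees

variable {B : Type*} [CommRing B] [IsLocalRing B] {d : ℕ} {x : Fin d → B}

lemma x_mem_Jx (x : Fin d → B) (i : Fin d) : x i ∈ Jx x := Ideal.subset_span ⟨i, rfl⟩

/-- Rees: the filtration of integral closures is bounded by the `J`-adic one -/
theorem rees_bound [IsNoetherianRing B] (h : QS x) (hm : maximalIdeal B ≤ nI (Jx x) 1) {ρ : ℕ}
    (hρ : len (Jx x) ≤ ρ) (hAU : IsReduced (AdicCompletion (maximalIdeal B) B)) :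
    ∃ c, ∀ n, nI (Jx x) n ≤ Jx x ^ (n - c) := by
  classical
  obtain ⟨q', hq'⟩ : ∃ q', ρ.factorial = q' + 1 :=
    ⟨ρ.factorial - 1, by have := Nat.factorial_pos ρ; omega⟩
  set q := q' + 1 with hq
  have hq0 : 0 < q := Nat.succ_pos _
  let K : ℕ → Ideal B := kn h hm hρ q'
  have hK : ∀ n z, z ∈ K n ↔ z ^ q ∈ nI (Jx x) n := fun n z => Iff.rfl
  have hnK : ∀ n, nI (Jx x) n ≤ K (q * n) := by
    intro n z hz
    rw [hK, mul_comm]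
    exact pow_mem_nI hz q
  have hkf : KF x q K :=
    { zero := by
        rw [Ideal.eq_top_iff_one, hK, nI_zero]; trivial
      anti := fun hab z hz => nI_anti _ hab hz
      mul := fun {a b y z} hy hz => by
        rw [hK] at *
        rw [mul_pow]
        exact mul_mem_nI hy hz
      max := fun z hz => nI_anti _ (by omega) (hnK 1 (hm hz))
      xmem := fun i => by
        have := hnK 1 (pow_le_nI _ 1 (by rw [pow_one]; exact x_mem_Jx x i))
        rwa [mul_one] at this }
  obtain ⟨N, hN⟩ := hkf.fin hq0 ρ
    (by
      intro f n F z hF hu _ hz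
      rw [hK] at hz ⊢
      rw [mul_pow, ← map_pow] at hz
      refine h.cancel_nI (hF.pow q) (hu.pow q) ?_
      rw [mul_comm f q]
      exact hz)
    (by
      intro n z _ hz
      rw [hK] at hz ⊢
      have h1 := lemC h hm hρ (z := z) (n := n) (a := n + n + 1) (b := 2 * q) (by omega) (by
        rw [hq']; nlinarith) (by rw [pow_mul, pow_two]; exact hz)
      rwa [hq'] at h1)
    (by
      intro n z hz
      obtain ⟨b, hb, a, ha, hab⟩ := integral_of_As hz
      exact ⟨b, hb, a, fun i hi => by rw [pow_mul]; exact ha i hi, hab⟩)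
    (by
      intro y n hy
      have hqR : (0 : ℝ) < q := by exact_mod_cast hq0
      obtain ⟨e, F, hF, ⟨j0, a0, hj0⟩, hrel⟩ := rank_rel h.qr hρ y (fun j => (n j : ℝ) / q)
        (fun l => K (⌊l * q + 1⌋₊))
        (by
          intro j a l hl
          have h1 : xm x a * y j ∈ K (q * a.degree + n j) :=
            hkf.mul (hkf.Jx_pow _ (xm_mem x rfl)) (hy j)
          refine hkf.anti ?_ h1
          rw [← Nat.lt_succ_iff, Nat.floor_lt' (by omega)]
          have : l * q < (n j / q + a.degree) * q := mul_lt_mul_of_pos_right hl hqR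
          rw [add_mul, div_mul_cancel₀ _ hqR.ne'] at this
          push_cast
          linarith)
        (by
          intro m l hl
          refine (hnK m).trans (hkf.anti ?_)
          rw [← Nat.lt_succ_iff, Nat.floor_lt' (by omega)]
          have : l * q < m * q := mul_lt_mul_of_pos_right hl hqR
          push_cast
          linarith)
      have he : ∀ j a, (F j).coeff a ≠ 0 → q * a.degree + n j = q * a0.degree + n j0 := by
        intro j a ha
        have h1 := hF j a ha
        have h2 := hF j0 a0 (by rw [hj0]; exact one_ne_zero)
        rw [← h2] at h1
        field_simp at h1
        have h3 : (n j + q * a.degree : ℝ) = n j0 + q * a0.degree := by linarith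
        have h4 : n j + q * a.degree = n j0 + q * a0.degree := by exact_mod_cast h3
        omega
      have hfl : ⌊e * q + 1⌋₊ = q * a0.degree + n j0 + 1 := by
        have h2 := hF j0 a0 (by rw [hj0]; exact one_ne_zero)
        have h3 : e * q + 1 = ((q * a0.degree + n j0 + 1 : ℕ) : ℝ) := by
          rw [← h2]; push_cast; field_simp
          ring
        rw [h3, Nat.floor_natCast]
      simp only [hfl] at hrel
      have hex : ∀ j, ∃ f, (F j).IsHomogeneous f ∧ (F j ≠ 0 → q * f + n j = q * a0.degree + n j0) := by
        intro j
        by_cases h0 : F j = 0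
        · exact ⟨0, by rw [h0]; exact MvPolynomial.isHomogeneous_zero _ _ _, fun h => absurd h0 h⟩
        · obtain ⟨a, ha⟩ := MvPolynomial.ne_zero_iff.1 h0
          refine ⟨a.degree, isHom_of fun b hb => ?_, fun _ => he j a ha⟩
          have := (he j b hb).trans (he j a ha).symm
          exact Nat.eq_of_mul_eq_mul_left hq0 (by omega)
      choose f hf1 hf2 using hex
      exact ⟨_, f, F, hf1, hf2, ⟨j0, a0, by
        rw [hj0]; exact fun h1 => (maximalIdeal.isMaximal B).ne_top ((Ideal.eq_top_iff_one _).2 h1)⟩,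
        hrel⟩)
  -- iterate
  have h1 : ∀ n ≥ N, ∀ s, K n ≤ Jx x * K (n - q) ⊔ K (n + s) := by
    intro n hn s
    induction s with
    | zero => exact le_sup_right
    | succ s ih =>
      refine ih.trans (sup_le le_sup_left ?_)
      refine (hN (n + s) (by omega)).trans (sup_le_sup ?_ le_rfl)
      exact Ideal.mul_mono_right (hkf.anti (by omega))
  have h2 : ∀ n ≥ N, K n ≤ Jx x * K (n - q) := by
    intro n hn
    obtain ⟨m, hm'⟩ := chevalley h hρ hAU (n + 1)
    have h3 : K (n + q * m) ≤ Jx x * K (n - q) := by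
      refine (hkf.anti (show q * m ≤ n + q * m by omega)).trans ?_
      intro z hz
      rw [hK, mul_comm] at hz
      have h4 := hm' (nI_root hq0 hz)
      rw [pow_succ'] at h4
      refine Ideal.mul_mono_right ((hkf.Jx_pow n).trans (hkf.anti ?_)) h4
      exact (Nat.sub_le _ _).trans (Nat.le_mul_of_pos_left n hq0)
    exact (h1 n hn (q * m)).trans (sup_le le_rfl h3)
  have h3 : ∀ s, K (N + q * s) ≤ Jx x ^ s := by
    intro s
    induction s with
    | zero => simp
    | succ s ih =>
      refine (h2 _ (by omega)).trans ?_
      rw [pow_succ']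
      refine Ideal.mul_mono_right ((hkf.anti ?_).trans ih)
      rw [mul_add]; omega
  refine ⟨N, fun n => (hnK n).trans ?_⟩
  by_cases hn : n ≤ N
  · rw [Nat.sub_eq_zero_of_le hn, pow_zero]; simp
  push Not at hn
  refine (hkf.anti ?_).trans (h3 (n - N))
  rw [Nat.mul_sub]
  have h4 : q * N ≤ q * n := Nat.mul_le_mul_left q hn.le
  have h5 : N ≤ q * N := Nat.le_mul_of_pos_left N hq0
  omega

end rees
end CMP

namespace CMP

section vanish

variable {B : Type*} [CommRing B] [IsLocalRing B] {d : ℕ} {x : Fin d → B}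

/-- comparison of orders modulo a power of another parameter -/
lemma lemX (h : QS x) {i j : Fin d} (hij : i ≠ j) {A P C : ℕ} {z g : B}
    (hz : x j ^ A * z - x i ^ P * g ∈ Jx x ^ (A + C)) : z ∈ Jx x ^ (min P C) := by
  classical
  have key : ∀ e ≤ min P C, z ∈ Jx x ^ e := by
    intro e
    induction e with
    | zero => intro _; simp
    | succ e ih =>
      intro he
      have hzi := ih (by omega)
      have h1 : x j ^ A * z ∈ Jx x ^ (A + e) := by
        rw [pow_add]
        exact Ideal.mul_mem_mul (Ideal.pow_mem_pow (x_mem_Jx x j) A) hzi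
      by_cases hc : A + e < P
      · have h2 : x i ^ P * g ∈ Jx x ^ (A + (e + 1)) :=
          Ideal.mul_mem_right _ _ (Ideal.pow_le_pow_right (by omega)
            (Ideal.pow_mem_pow (x_mem_Jx x i) P))
        have h3 : x j ^ A * z ∈ Jx x ^ (A + (e + 1)) := by
          have := Ideal.add_mem _ (Ideal.pow_le_pow_right (show A + (e + 1) ≤ A + C by omega) hz) h2
          rwa [sub_add_cancel] at this
        exact h.cancel_X j h3
      · push Not at hc
        obtain ⟨r, hr⟩ := Nat.exists_eq_add_of_le hc
        have h2 : x i ^ P * g ∈ Jx x ^ (P + r) := by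
          rw [← hr]
          have := Ideal.sub_mem _ h1 (Ideal.pow_le_pow_right (show A + e ≤ A + C by omega) hz)
          rwa [sub_sub_cancel] at this
        have h3 := h.cancel_X i h2
        obtain ⟨Z, hZ, rfl⟩ := (mem_Jx_pow _ _ _).1 hzi
        obtain ⟨G, hG, rfl⟩ := (mem_Jx_pow _ _ _).1 h3
        have hhom : (MvPolynomial.monomial (Finsupp.single j A) 1 * Z -
            MvPolynomial.monomial (Finsupp.single i P) 1 * G : MvPolynomial (Fin d) B).IsHomogeneous
            (A + e) := by
          refine MvPolynomial.IsHomogeneous.sub ?_ ?_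
          · exact (MvPolynomial.isHomogeneous_monomial (1 : B) (by simp)).mul hZ
          · rw [hr]
            exact (MvPolynomial.isHomogeneous_monomial (1 : B) (by simp)).mul hG
        have hco := h.qr _ _ hhom (by
          rw [map_sub, map_mul, map_mul, MvPolynomial.eval_monomial, MvPolynomial.eval_monomial]
          simp only [one_mul, Finsupp.prod_single_index, pow_zero]
          exact Ideal.pow_le_pow_right (by omega) hz)
        have hZc : ∀ a, Z.coeff a ∈ Jx x := by
          intro a
          by_cases ha : Z.coeff a = 0
          · rw [ha]; exact zero_mem _
          have hdeg := deg_of_isHom hZ ha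
          have h4 := hco (Finsupp.single j A + a)
          rw [MvPolynomial.coeff_sub, MvPolynomial.coeff_monomial_mul,
            MvPolynomial.coeff_monomial_mul', if_neg, sub_zero, one_mul] at h4
          · exact h4
          · intro hle
            have h5 := hle i
            rw [Finsupp.single_eq_same, Finsupp.add_apply, Finsupp.single_eq_of_ne hij,
              zero_add] at h5
            have h6 : a i ≤ a.degree := Finsupp.le_degree i a
            omega
        have := eval_mem_of_coeff x hZ hZc
        rwa [← pow_succ'] at this
  exact key _ le_rfl

/-- the bound of Rees -/
def RB (x : Fin d → B) : Prop := ∃ c, ∀ n, nI (Jx x) n ≤ Jx x ^ (n - c)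

lemma vanish_step (h : QS x) {c : ℕ} (hc : ∀ n, nI (Jx x) n ≤ Jx x ^ (n - c)) {i j : Fin d}
    (hij : i ≠ j) {p k : ℕ} {z w : B} (hzw : x j ^ p * z - x i ^ p * w ∈ nI (Jx x) (2 * p))
    (hw : w ^ (k + 1) ∈ nI (Jx x) (p * k)) : z ^ (k + 2) ∈ nI (Jx x) (p * (k + 1)) := by
  classical
  refine ⟨p * k + 2 * c, fun m => ?_⟩
  rw [← pow_mul]
  by_cases htr : p * (k + 1) * m ≤ p * k + 2 * c
  · rw [Nat.sub_eq_zero_of_le htr, pow_zero]; simp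
  push Not at htr
  set N := (k + 2) * m with hN
  set a := x j ^ p * z with ha
  set b := x i ^ p * w with hb
  obtain ⟨g, hg⟩ : ∃ g, x j ^ (p * N) * z ^ N - x i ^ (p * ((k + 1) * m)) * g ∈
      Jx x ^ (p * N + (p * (k + 1) * m - (p * k + 2 * c))) := by
    have hexp : a ^ N = ∑ l ∈ range (N + 1), b ^ l * (a - b) ^ (N - l) * (N.choose l : B) := by
      conv_lhs => rw [show a = b + (a - b) by ring, add_pow]
    refine ⟨∑ l ∈ range (N + 1) with (k + 1) * m ≤ l,
      (x i ^ (p * (l - (k + 1) * m)) * w ^ l) * (a - b) ^ (N - l) * (N.choose l : B), ?_⟩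
    have h1 : x j ^ (p * N) * z ^ N = a ^ N := by rw [ha, mul_pow, pow_mul]
    rw [h1, hexp, Finset.mul_sum,
      ← Finset.sum_filter_add_sum_filter_not (range (N + 1)) (fun l => (k + 1) * m ≤ l)]
    rw [add_sub_right_comm, ← Finset.sum_sub_distrib, Finset.sum_eq_zero, zero_add]
    · refine Ideal.sum_mem _ fun l hl => Ideal.mul_mem_right _ _ ?_
      rw [Finset.mem_filter, Finset.mem_range, not_le] at hl
      obtain ⟨hl1, hl2⟩ := hl
      set t := l / (k + 1) with ht
      have hlt : (k + 1) * t + l % (k + 1) = l := Nat.div_add_mod l (k + 1)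
      have hlr : l % (k + 1) < k + 1 := Nat.mod_lt _ (by omega)
      have htm : t < m := by
        by_contra hcon
        push Not at hcon
        have := Nat.mul_le_mul_left (k + 1) hcon
        omega
      have h2 : w ^ l ∈ Jx x ^ (p * k * t - c) := by
        rw [← hlt, pow_add, pow_mul]
        exact Ideal.mul_mem_right _ _ (hc _ (pow_mem_nI hw t))
      have h3 : b ^ l ∈ Jx x ^ (p * l + (p * k * t - c)) := by
        rw [hb, mul_pow, ← pow_mul, pow_add]
        exact Ideal.mul_mem_mul (Ideal.pow_mem_pow (x_mem_Jx x i) _) h2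
      have h4 : (a - b) ^ (N - l) ∈ Jx x ^ (2 * p * (N - l) - c) := hc _ (pow_mem_nI hzw _)
      have h5 := Ideal.mul_mem_mul h3 h4
      rw [← pow_add] at h5
      refine Ideal.pow_le_pow_right ?_ h5
      obtain ⟨s, hs⟩ := Nat.exists_eq_add_of_lt htm
      have hNl : N - l + l = N := by omega
      have e1 : p * N = p * (N - l) + p * l := by rw [← mul_add, hNl]
      have e2 : p * (k + 1) * m ≤ p * (N - l) + p * k * t + p * k := by
        have : (k + 1) * m ≤ (N - l) + k * t + k := by
          have : N = (k + 1) * m + m := by rw [hN]; ring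
          have : (k + 1) * t = k * t + t := by ring
          omega
        calc p * (k + 1) * m = p * ((k + 1) * m) := by ring
          _ ≤ p * ((N - l) + k * t + k) := Nat.mul_le_mul_left p this
          _ = _ := by ring
      have e3 : 2 * p * (N - l) = p * (N - l) + p * (N - l) := by ring
      omega
    · intro l hl
      rw [Finset.mem_filter] at hl
      rw [hb, mul_pow, ← pow_mul]
      have : p * l = p * ((k + 1) * m) + p * (l - (k + 1) * m) := by
        rw [← mul_add, Nat.add_sub_cancel' hl.2]
      rw [this, pow_add]
      ring
  have h6 := lemX h hij hg
  refine Ideal.pow_le_pow_right ?_ h6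
  rw [mul_assoc]
  omega

/-- vanishing -/
lemma vanish (h : QS x) (hR : RB x) {i j : Fin d} (hij : i ≠ j) {p : ℕ} {z w : B}
    (hzw : x j ^ p * z - x i ^ p * w ∈ nI (Jx x) (2 * p)) :
    z ∈ nI (Jx x) p ∧ w ∈ nI (Jx x) p := by
  obtain ⟨c, hc⟩ := hR
  have hwz : x i ^ p * w - x j ^ p * z ∈ nI (Jx x) (2 * p) := by
    rw [← neg_sub]; exact (Ideal.neg_mem_iff _).2 hzw
  have key : ∀ k, z ^ (k + 1) ∈ nI (Jx x) (p * k) ∧ w ^ (k + 1) ∈ nI (Jx x) (p * k) := by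
    intro k
    induction k with
    | zero => rw [mul_zero, nI_zero]; exact ⟨trivial, trivial⟩
    | succ k ih => exact ⟨vanish_step h hc hij hzw ih.2, vanish_step h hc hij.symm hwz ih.1⟩
  have fin : ∀ z : B, (∀ k, z ^ (k + 1) ∈ nI (Jx x) (p * k)) → z ∈ nI (Jx x) p := by
    intro z hz
    refine ⟨c + p, fun j => ?_⟩
    rcases j with _ | k
    · simp
    · refine Ideal.pow_le_pow_right ?_ (hc _ (hz k))
      rw [mul_add]; omega
  exact ⟨fin z fun k => (key k).1, fin w fun k => (key k).2⟩

end vanish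
end CMP

namespace CMP

section dim3

variable {B : Type*} [CommRing B]

lemma length_quot_prod {M N : Type*} [AddCommGroup M] [Module B M] [AddCommGroup N] [Module B N]
    (p : Submodule B M) (q : Submodule B N) :
    Module.length B ((M × N) ⧸ Submodule.prod p q) =
      Module.length B (M ⧸ p) + Module.length B (N ⧸ q) := by
  have hs : Function.Surjective (LinearMap.prodMap p.mkQ q.mkQ) := by
    rintro ⟨u, v⟩
    obtain ⟨u, rfl⟩ := p.mkQ_surjective u
    obtain ⟨v, rfl⟩ := q.mkQ_surjective v
    exact ⟨(u, v), rfl⟩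
  have e := (LinearMap.quotKerEquivOfSurjective _ hs).length_eq
  rwa [LinearMap.ker_prodMap, Submodule.ker_mkQ, Submodule.ker_mkQ, Module.length_prod] at e

/-- abstract Koszul inequality -/
lemma koszul_ineq (a b c : B) (P1 P2 P3 : Ideal B)
    (h12 : ∀ u ∈ ({a, b, c} : Set B), ∀ z ∈ P1, u * z ∈ P2)
    (h23 : ∀ u ∈ ({a, b, c} : Set B), ∀ z ∈ P2, u * z ∈ P3)
    (hinj1 : ∀ z w, a * z - c * w ∈ P2 → z ∈ P1 ∧ w ∈ P1)
    (hinj2 : ∀ z w, a * z - b * w ∈ P2 → z ∈ P1 ∧ w ∈ P1) :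
    len P3 + 3 * len P1 ≤ len (Ideal.span {a, b, c} ⊔ P3) + 3 * len P2 := by
  -- the map `B³ → B`
  let f : (B × B × B) →ₗ[B] B :=
    { toFun := fun v => a * v.1 + b * v.2.1 + c * v.2.2
      map_add' := fun v w => by simp only [Prod.fst_add, Prod.snd_add]; ring
      map_smul' := fun r v => by
        simp only [Prod.smul_fst, Prod.smul_snd, smul_eq_mul, RingHom.id_apply]; ring }
  have hf := len_range f P3
  have hr : LinearMap.range f = Ideal.span {a, b, c} := by
    apply le_antisymm
    · rintro _ ⟨v, rfl⟩
      refine Ideal.add_mem _ (Ideal.add_mem _ ?_ ?_) ?_ <;>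
        exact Ideal.mul_mem_right _ _ (Ideal.subset_span (by simp))
    · rw [Ideal.span_le]
      rintro u (rfl | rfl | rfl)
      · exact ⟨(1, 0, 0), by simp [f]⟩
      · exact ⟨(0, 1, 0), by simp [f]⟩
      · exact ⟨(0, 0, 1), by simp [f]⟩
  rw [hr] at hf
  -- target quotient
  let N2 : Submodule B (B × B × B) := Submodule.prod P2 (Submodule.prod P2 P2)
  let N1 : Submodule B (B × B × B) := Submodule.prod P1 (Submodule.prod P1 P1)
  have hlen : ∀ P : Ideal B, Module.length B ((B × B × B) ⧸ Submodule.prod P (Submodule.prod P P)) = 3 * len P := by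
    intro P
    rw [length_quot_prod, length_quot_prod]
    change len P + (len P + len P) = _
    ring
  let g : (B × B × B) →ₗ[B] (B × B × B) :=
    { toFun := fun v => (-(b * v.1) - c * v.2.1, a * v.1 - c * v.2.2, a * v.2.1 + b * v.2.2)
      map_add' := fun v w => by
        simp only [Prod.fst_add, Prod.snd_add, Prod.mk_add_mk]
        refine Prod.ext ?_ (Prod.ext ?_ ?_) <;> simp only <;> ring
      map_smul' := fun r v => by
        simp only [Prod.smul_fst, Prod.smul_snd, smul_eq_mul, RingHom.id_apply, Prod.smul_mk]
        refine Prod.ext ?_ (Prod.ext ?_ ?_) <;> simp only <;> ring }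
  have hg1 : N1 ≤ Submodule.comap g N2 := by
    rintro ⟨u, v, w⟩ ⟨hu, hv, hw⟩
    refine ⟨?_, ?_, ?_⟩
    · exact Ideal.sub_mem _ ((Ideal.neg_mem_iff _).2 (h12 b (by simp) _ hu)) (h12 c (by simp) _ hv)
    · exact Ideal.sub_mem _ (h12 a (by simp) _ hu) (h12 c (by simp) _ hw)
    · exact Ideal.add_mem _ (h12 a (by simp) _ hv) (h12 b (by simp) _ hw)
  have hg2 : Submodule.comap g N2 ≤ N1 := by
    rintro ⟨u, v, w⟩ ⟨-, h2, h3⟩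
    have := hinj1 u w h2
    refine ⟨this.1, ?_, this.2⟩
    refine (hinj2 v (-w) ?_).1
    have e : a * v - b * -w = a * v + b * w := by ring
    rw [e]; exact h3
  have hc : N2 ≤ Submodule.comap f P3 := by
    rintro ⟨u, v, w⟩ ⟨hu, hv, hw⟩
    exact Ideal.add_mem _ (Ideal.add_mem _ (h23 a (by simp) _ hu) (h23 b (by simp) _ hv))
      (h23 c (by simp) _ hw)
  -- lengths
  let K := Submodule.map N2.mkQ (Submodule.comap f P3)
  have h1 : Module.length B ((B × B × B) ⧸ N2) = Module.length B K +
      Module.length B ((B × B × B) ⧸ Submodule.comap f P3) := by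
    have e := Submodule.quotientQuotientEquivQuotient N2 (Submodule.comap f P3) hc
    rw [← e.length_eq]
    exact Module.length_eq_add_of_exact K.subtype K.mkQ K.injective_subtype K.mkQ_surjective
      (LinearMap.exact_subtype_mkQ K)
  have h2 : Module.length B ((B × B × B) ⧸ N1) ≤ Module.length B K := by
    let G := Submodule.mapQ N1 N2 g hg1
    have hG : ∀ q, G q ∈ K := by
      intro q
      obtain ⟨v, rfl⟩ := N1.mkQ_surjective q
      refine ⟨g v, ?_, rfl⟩
      have : f (g v) = 0 := by simp only [f, g, LinearMap.coe_mk, AddHom.coe_mk]; ring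
      change f (g v) ∈ P3
      rw [this]; exact zero_mem _
    refine Module.length_le_of_injective (G.codRestrict K hG) ?_
    rw [← LinearMap.ker_eq_bot, LinearMap.ker_codRestrict, Submodule.ker_mapQ,
      le_antisymm hg2 hg1]
    simp
  rw [hlen] at h1 h2
  rw [hf, h1]
  calc _ = len (Ideal.span {a, b, c} ⊔ P3) + (3 * len P1 +
          Module.length B ((B × B × B) ⧸ Submodule.comap f P3)) := by ring
    _ ≤ _ := by gcongr

lemma len_sup_pow (S : Ideal B) (a : B) (k : ℕ) :
    len (S ⊔ Ideal.span {a ^ k}) ≤ k * len (S ⊔ Ideal.span {a}) := by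
  induction k with
  | zero => 
    have : S ⊔ Ideal.span {a ^ 0} = ⊤ := by simp
    rw [this]
    simp [len]
  | succ k ih =>
    rw [len_colon _ (a ^ k)]
    push_cast
    rw [add_mul, one_mul, add_comm]
    refine add_le_add ((len_anti ?_).trans ih) (len_anti ?_)
    · exact sup_le (le_sup_left.trans le_sup_right) le_sup_left
    · refine sup_le ?_ ?_
      · intro s hs
        rw [Submodule.mem_colon]
        intro t _
        exact Ideal.mem_sup_left (Ideal.mul_mem_right _ _ hs)
      · rw [Ideal.span_singleton_le_iff_mem, Submodule.mem_colon]
        intro t ht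
        obtain ⟨r, rfl⟩ := Ideal.mem_span_singleton'.1 ht
        refine Ideal.mem_sup_right (Ideal.mem_span_singleton'.2 ⟨r, ?_⟩)
        rw [smul_eq_mul]; ring

lemma stepc (S : Ideal B) (a w : B) (q : ℕ) :
    len (S ⊔ Ideal.span {a ^ (q + 1)} ⊔ Ideal.span {w * a ^ q}) ≤
      q * len (S ⊔ Ideal.span {a}) + len (S ⊔ Ideal.span {a} ⊔ Ideal.span {w}) := by
  rw [len_colon _ (a ^ q), add_comm]
  refine add_le_add ((len_anti ?_).trans (len_sup_pow S a q)) (len_anti ?_)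
  · exact sup_le (le_sup_left.trans (le_sup_left.trans le_sup_right)) le_sup_left
  · refine sup_le (sup_le ?_ ?_) ?_
    · intro s hs
      rw [Submodule.mem_colon]
      intro t _
      exact Ideal.mem_sup_left (Ideal.mem_sup_left (Ideal.mul_mem_right _ _ hs))
    · rw [Ideal.span_singleton_le_iff_mem, Submodule.mem_colon]
      intro t ht
      obtain ⟨r, rfl⟩ := Ideal.mem_span_singleton'.1 ht
      refine Ideal.mem_sup_left (Ideal.mem_sup_right (Ideal.mem_span_singleton'.2 ⟨r, ?_⟩))
      rw [smul_eq_mul]; ring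
    · rw [Ideal.span_singleton_le_iff_mem, Submodule.mem_colon]
      intro t ht
      obtain ⟨r, rfl⟩ := Ideal.mem_span_singleton'.1 ht
      refine Ideal.mem_sup_right (Ideal.mem_span_singleton'.2 ⟨r, ?_⟩)
      rw [smul_eq_mul]; ring

lemma span3 (a b c : B) : Ideal.span {a, b, c} =
    Ideal.span {a} ⊔ Ideal.span {b} ⊔ Ideal.span {c} := by
  rw [Ideal.span_insert, Ideal.span_insert, sup_assoc]

lemma len_pow3 (a b c : B) (p : ℕ) :
    len (Ideal.span {a ^ p, b ^ p, c ^ p}) ≤ p ^ 3 * len (Ideal.span {a, b, c}) := by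
  have h1 := len_sup_pow (Ideal.span {a ^ p} ⊔ Ideal.span {b ^ p}) c p
  have h2 := len_sup_pow (Ideal.span {a ^ p} ⊔ Ideal.span {c}) b p
  have h3 := len_sup_pow (Ideal.span {c} ⊔ Ideal.span {b}) a p
  rw [span3, span3]
  rw [show Ideal.span {a ^ p} ⊔ Ideal.span {c} ⊔ Ideal.span {b ^ p} =
    Ideal.span {a ^ p} ⊔ Ideal.span {b ^ p} ⊔ Ideal.span {c} by ac_rfl] at h2
  rw [show Ideal.span {c} ⊔ Ideal.span {b} ⊔ Ideal.span {a ^ p} =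
    Ideal.span {a ^ p} ⊔ Ideal.span {c} ⊔ Ideal.span {b} by ac_rfl,
    show Ideal.span {c} ⊔ Ideal.span {b} ⊔ Ideal.span {a} =
    Ideal.span {a} ⊔ Ideal.span {b} ⊔ Ideal.span {c} by ac_rfl] at h3
  calc _ ≤ _ := h1
    _ ≤ p * (p * (p * len (Ideal.span {a} ⊔ Ideal.span {b} ⊔ Ideal.span {c}))) := by
      gcongr; exact h2.trans (by gcongr)
    _ = _ := by ring

lemma len_pow3' (a b c w : B) (q : ℕ)
    (hw : w * (a * b * c) ^ q ∈ Ideal.span {a ^ (q + 1), b ^ (q + 1), c ^ (q + 1)}) :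
    len (Ideal.span {a ^ (q + 1), b ^ (q + 1), c ^ (q + 1)}) ≤
      ((q + 1) ^ 3 - 1 : ℕ) * len (Ideal.span {a, b, c}) +
        len (Ideal.span {a, b, c} ⊔ Ideal.span {w}) := by
  have h1 := stepc (Ideal.span {a ^ (q + 1)} ⊔ Ideal.span {b ^ (q + 1)}) c (w * (a * b) ^ q) q
  have h2 := stepc (Ideal.span {a ^ (q + 1)} ⊔ Ideal.span {c}) b (w * a ^ q) q
  have h3 := stepc (Ideal.span {c} ⊔ Ideal.span {b}) a w q
  have k2 := len_sup_pow (Ideal.span {a ^ (q + 1)} ⊔ Ideal.span {c}) b (q + 1)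
  have k3 := len_sup_pow (Ideal.span {c} ⊔ Ideal.span {b}) a (q + 1)
  rw [span3] at hw ⊢
  rw [span3 a b c]
  set ℓ := len (Ideal.span {a} ⊔ Ideal.span {b} ⊔ Ideal.span {c}) with hℓ
  rw [sup_eq_left.2 (by
    rw [Ideal.span_singleton_le_iff_mem]
    have : w * (a * b) ^ q * c ^ q = w * (a * b * c) ^ q := by ring
    rw [this]; exact hw)] at h1
  rw [show w * a ^ q * b ^ q = w * (a * b) ^ q by ring] at h2
  rw [show Ideal.span {a ^ (q+1)} ⊔ Ideal.span {c} ⊔ Ideal.span {b ^ (q+1)} =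
    Ideal.span {a ^ (q+1)} ⊔ Ideal.span {b ^ (q+1)} ⊔ Ideal.span {c} by ac_rfl] at h2 k2
  rw [show Ideal.span {c} ⊔ Ideal.span {b} ⊔ Ideal.span {a ^ (q+1)} =
    Ideal.span {a ^ (q+1)} ⊔ Ideal.span {c} ⊔ Ideal.span {b} by ac_rfl,
    show Ideal.span {c} ⊔ Ideal.span {b} ⊔ Ideal.span {a} =
    Ideal.span {a} ⊔ Ideal.span {b} ⊔ Ideal.span {c} by ac_rfl, ← hℓ] at h3 k3
  set α := len (Ideal.span {a ^ (q+1)} ⊔ Ideal.span {b ^ (q+1)} ⊔ Ideal.span {c})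
  set β := len (Ideal.span {a ^ (q+1)} ⊔ Ideal.span {c} ⊔ Ideal.span {b})
  set ε := len (Ideal.span {a} ⊔ Ideal.span {b} ⊔ Ideal.span {c} ⊔ Ideal.span {w})
  have hq : (q + 1) ^ 3 - 1 = q * ((q + 1) * (q + 1)) + (q * (q + 1) + q) := by
    have : (q + 1) ^ 3 = q * ((q + 1) * (q + 1)) + (q * (q + 1) + q) + 1 := by ring
    omega
  rw [hq]
  refine h1.trans ?_
  push_cast at k2 k3 ⊢
  calc _ ≤ (q : ℕ∞) * ((q + 1) * ((q + 1) * ℓ)) + (q * ((q + 1) * ℓ) + (q * ℓ + ε)) := by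
        gcongr
        · exact k2.trans (by gcongr)
        · refine h2.trans ?_
          gcongr
    _ = _ := by ring

end dim3
end CMP

namespace CMP

section dim3

variable {B : Type*} [CommRing B] [IsLocalRing B] {d : ℕ}

/-- the Hilbert polynomial of the normal filtration -/
def HP (x : Fin d → B) (e : ℕ → ℤ) : Prop :=
  ∃ N : ℕ, ∀ n ≥ N, ∃ l : ℕ, len (nI (Jx x) (n + 1)) = l ∧
    (l : ℤ) = ∑ i ∈ Finset.range (d + 1), (-1 : ℤ) ^ i * e i * ((n + d - i).choose (d - i))

lemma choose3 (n : ℕ) : (6 : ℤ) * ((n + 3).choose 3 : ℕ) = (n + 1) * (n + 2) * (n + 3) := by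
  have h := Nat.descFactorial_eq_factorial_mul_choose (n + 3) 3
  simp [Nat.descFactorial, Nat.factorial] at h
  have : (6 * (n + 3).choose 3 : ℕ) = (n + 1) * (n + 2) * (n + 3) := by rw [← h]; ring
  exact_mod_cast this

lemma choose2 (n : ℕ) : (2 : ℤ) * ((n + 2).choose 2 : ℕ) = (n + 1) * (n + 2) := by
  have h := Nat.descFactorial_eq_factorial_mul_choose (n + 2) 2
  simp [Nat.descFactorial, Nat.factorial] at h
  have : (2 * (n + 2).choose 2 : ℕ) = (n + 1) * (n + 2) := by rw [← h]
  exact_mod_cast this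

lemma HP3 {x : Fin 3 → B} {e : ℕ → ℤ} (hP : HP x e) (he : e 3 = 0) :
    ∃ N : ℕ, ∀ n ≥ N, ∃ l : ℕ, len (nI (Jx x) n) = l ∧
      (6 : ℤ) * l = e 0 * (n * (n + 1) * (n + 2)) - 3 * e 1 * (n * (n + 1)) + 6 * e 2 * n := by
  obtain ⟨N, hN⟩ := hP
  refine ⟨N + 1, fun n hn => ?_⟩
  obtain ⟨m, rfl⟩ : ∃ m, n = m + 1 := ⟨n - 1, by omega⟩
  obtain ⟨l, h1, h2⟩ := hN m (by omega)
  refine ⟨l, h1, ?_⟩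
  rw [h2]
  simp only [Finset.sum_range_succ, Finset.sum_range_zero]
  have c3 := choose3 m
  have c2 := choose2 m
  simp only [he, Nat.sub_zero, show m + 3 - 1 = m + 2 by omega, show m + 3 - 2 = m + 1 by omega,
    show 3 - 1 = 2 by rfl, show 3 - 2 = 1 by rfl, Nat.choose_one_right]
  push_cast
  linear_combination (e 0) * c3 - 3 * (e 1) * c2

open Filter Topology in
lemma e0_ge {x : Fin 3 → B} (h : QS x) (hR : RB x) {e : ℕ → ℤ} (hP : HP x e) :
    ∃ ℓ : ℕ, len (Jx x) = ℓ ∧ (ℓ : ℤ) ≤ e 0 := by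
  obtain ⟨c, hc⟩ := hR
  obtain ⟨N, hN⟩ := hP
  obtain ⟨ℓ, hℓ⟩ : ∃ ℓ : ℕ, len (Jx x) = ℓ := by
    obtain ⟨l, h1, -⟩ := hN (N + c) (by omega)
    have : len (Jx x) ≤ l := by
      rw [← h1]
      refine len_anti ((hc _).trans ?_)
      conv_rhs => rw [← pow_one (Jx x)]
      exact Ideal.pow_le_pow_right (by omega)
    exact ⟨(len (Jx x)).toNat, (ENat.natCast_toNat (ne_top_of_le_ne_top (ENat.natCast_ne_top l) this)).symm⟩
  refine ⟨ℓ, hℓ, ?_⟩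
  have key : ∀ n ≥ N, (ℓ : ℝ) ≤ ∑ i ∈ Finset.range 4, (-1 : ℝ) ^ i * e i *
      (((n + c + (3 - i)).choose (3 - i) : ℕ) / ((n + 3).choose 3 : ℕ)) := by
    intro n hn
    obtain ⟨l, h1, h2⟩ := hN (n + c) (by omega)
    have h3 : len (Jx x ^ (n + 1)) ≤ l := by
      rw [← h1]
      refine len_anti ((hc _).trans (Ideal.pow_le_pow_right (by omega)))
    rw [len_Jx_pow h.qr, hℓ, multichoose_succ_eq] at h3
    have h4 : ((n + 3).choose 3 : ℝ) * ℓ ≤ l := by exact_mod_cast h3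
    have h5 : (l : ℝ) = ∑ i ∈ Finset.range 4, (-1 : ℝ) ^ i * e i *
      ((n + c + (3 - i)).choose (3 - i) : ℕ) := by
      have : (l : ℝ) = ((l : ℤ) : ℝ) := by push_cast; rfl
      rw [this, h2]
      push_cast
      refine Finset.sum_congr rfl fun i hi => ?_
      rw [Finset.mem_range] at hi
      rw [show n + c + 3 - i = n + c + (3 - i) by omega]
    have h6 := choose_pos' n 3
    rw [← mul_le_mul_iff_right₀ h6]
    refine h4.trans (le_of_eq ?_)
    rw [h5, Finset.mul_sum]
    refine Finset.sum_congr rfl fun i _ => ?_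
    field_simp
  have lim : Tendsto (fun n : ℕ => ∑ i ∈ Finset.range 4, (-1 : ℝ) ^ i * e i *
      (((n + c + (3 - i)).choose (3 - i) : ℕ) / ((n + 3).choose 3 : ℕ) : ℝ)) atTop
      (𝓝 (∑ i ∈ Finset.range 4, (-1 : ℝ) ^ i * e i * (if i = 0 then 1 else 0))) := by
    refine tendsto_finsetSum _ fun i hi => Tendsto.const_mul _ ?_
    split_ifs with h0
    · subst h0; exact tend_shift 3 c
    · have := (tend_shift (3 - i) c).mul (tend_lower (3 - i) 3 (by omega))
      rw [one_mul] at this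
      refine this.congr fun n => ?_
      exact div_mul_div_cancel₀ (choose_pos' n (3 - i)).ne'
  have := ge_of_tendsto lim (eventually_atTop.2 ⟨N, key⟩)
  simp [Finset.sum_range_succ] at this
  exact_mod_cast this

lemma dim3_aux {x : Fin 3 → B} (h : QS x) (hR : RB x) {e : ℕ → ℤ} (hP : HP x e) (he : e 3 = 0) :
    ∃ N : ℕ, ∀ q ≥ N, nI (Jx x) (3 * (q + 1)) ≤
        Ideal.span {x 0 ^ (q + 1), x 1 ^ (q + 1), x 2 ^ (q + 1)} ∧
      ∀ w, w * (x 0 * x 1 * x 2) ^ q ∈ Ideal.span {x 0 ^ (q + 1), x 1 ^ (q + 1), x 2 ^ (q + 1)} →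
        w ∈ Jx x := by
  obtain ⟨ℓ, hℓ, hℓe⟩ := e0_ge h hR hP
  obtain ⟨N, hN⟩ := HP3 hP he
  have hJ : Jx x = Ideal.span {x 0, x 1, x 2} := by
    apply le_antisymm
    · rw [Jx, Ideal.span_le]
      rintro _ ⟨i, rfl⟩
      refine Ideal.subset_span ?_
      fin_cases i <;> simp
    · rw [Ideal.span_le]
      rintro u (rfl | rfl | rfl) <;> exact x_mem_Jx x _
  refine ⟨N, fun q hq => ?_⟩
  set p := q + 1 with hp
  obtain ⟨l1, a1, b1⟩ := hN p (by omega)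
  obtain ⟨l2, a2, b2⟩ := hN (2 * p) (by omega)
  obtain ⟨l3, a3, b3⟩ := hN (3 * p) (by omega)
  set X := Ideal.span {x 0 ^ p, x 1 ^ p, x 2 ^ p} with hX
  have hmem : ∀ u ∈ ({x 0 ^ p, x 1 ^ p, x 2 ^ p} : Set B), u ∈ nI (Jx x) p := by
    rintro u (rfl | rfl | rfl) <;>
      exact pow_le_nI _ _ (Ideal.pow_mem_pow (x_mem_Jx x _) _)
  have hk := koszul_ineq (x 0 ^ p) (x 1 ^ p) (x 2 ^ p) (nI (Jx x) p) (nI (Jx x) (2 * p))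
    (nI (Jx x) (3 * p))
    (fun u hu z hz => by
      have := mul_mem_nI (hmem u hu) hz
      rwa [show p + p = 2 * p by ring] at this)
    (fun u hu z hz => by
      have := mul_mem_nI (hmem u hu) hz
      rwa [show p + 2 * p = 3 * p by ring] at this)
    (fun z w hzw => vanish h hR (by decide) hzw)
    (fun z w hzw => vanish h hR (by decide) hzw)
  rw [← hX, a1, a2, a3] at hk
  have hu := len_pow3 (x 0) (x 1) (x 2) p
  rw [← hX, ← hJ, hℓ] at hu
  obtain ⟨v, hv⟩ : ∃ v : ℕ, len X = v := ⟨(len X).toNat, (ENat.natCast_toNat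
    (ne_top_of_le_ne_top (by exact_mod_cast ENat.natCast_ne_top (p ^ 3 * ℓ)) hu)).symm⟩
  obtain ⟨s, hs⟩ : ∃ s : ℕ, len (X ⊔ nI (Jx x) (3 * p)) = s :=
    ⟨(len (X ⊔ nI (Jx x) (3 * p))).toNat, (ENat.natCast_toNat
    (ne_top_of_le_ne_top (by rw [a3]; exact ENat.natCast_ne_top l3) (len_anti le_sup_right))).symm⟩
  rw [hs] at hk
  rw [hv] at hu
  have hk' : (l3 : ℤ) + 3 * l1 ≤ s + 3 * l2 := by exact_mod_cast hk
  have hu' : (v : ℤ) ≤ p ^ 3 * ℓ := by exact_mod_cast hu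
  have hs' : (p : ℤ) ^ 3 * ℓ ≤ s := by
    have h1 : (e 0) * (p : ℤ) ^ 3 ≤ s := by
      push_cast at b1 b2 b3
      have : (l3 : ℤ) + 3 * l1 - 3 * l2 = e 0 * (p : ℤ) ^ 3 := by
        have : (6 : ℤ) * (l3 + 3 * l1 - 3 * l2) = 6 * (e 0 * (p : ℤ) ^ 3) := by
          linear_combination b3 + 3 * b1 - 3 * b2
        linarith
      linarith
    have : (p : ℤ) ^ 3 * ℓ ≤ (p : ℤ) ^ 3 * e 0 := mul_le_mul_of_nonneg_left hℓe (by positivity)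
    linarith
  have hsv : s ≤ v := by
    have := len_anti (B := B) (le_sup_left : X ≤ X ⊔ nI (Jx x) (3 * p))
    rw [hs, hv] at this
    exact_mod_cast this
  constructor
  · have := eq_of_len (le_sup_left : X ≤ X ⊔ nI (Jx x) (3 * p)) (by rw [hs]; exact ENat.natCast_ne_top _)
      (by rw [hs, hv]; exact_mod_cast (by linarith : (v : ℤ) ≤ s))
    rw [this]; exact le_sup_right
  · intro w hw
    by_contra hwJ
    have h1 := len_pow3' (x 0) (x 1) (x 2) w q hw
    rw [← hp, ← hX, ← hJ, hv, hℓ] at h1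
    have h2 := len_lt (B := B) (lt_of_le_of_ne (le_sup_left : Jx x ≤ Jx x ⊔ Ideal.span {w}) (by
      intro heq
      apply hwJ
      rw [heq]
      exact Ideal.mem_sup_right (Ideal.mem_span_singleton_self w)))
    rw [hℓ] at h2
    obtain ⟨r, hr⟩ : ∃ r : ℕ, len (Jx x ⊔ Ideal.span {w}) = r :=
      ⟨_, (ENat.natCast_toNat (ne_top_of_le_ne_top (ENat.natCast_ne_top ℓ)
        (le_self_add.trans h2))).symm⟩
    rw [hr] at h1 h2
    have h1' : v ≤ (p ^ 3 - 1) * ℓ + r := by exact_mod_cast h1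
    have h2' : r + 1 ≤ ℓ := by exact_mod_cast h2
    have h3 : p ^ 3 * ℓ ≤ v := by
      have : ((p ^ 3 * ℓ : ℕ) : ℤ) ≤ v := by push_cast; linarith [(Int.ofNat_le.2 hsv : (s : ℤ) ≤ v)]
      exact_mod_cast this
    have h4 : p ^ 3 = (p ^ 3 - 1) + 1 := by have : 0 < p ^ 3 := by positivity
                                            omega
    have h5 : p ^ 3 * ℓ = (p ^ 3 - 1) * ℓ + ℓ := by
      conv_lhs => rw [h4, add_mul, one_mul]
    omega

/-- dimension three -/
theorem dim3 {x : Fin 3 → B} (h : QS x) (hR : RB x) {e : ℕ → ℤ} (hP : HP x e) (he : e 3 = 0)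
    (n : ℕ) : nI (Jx x) (n + 2) ≤ Jx x ^ n := by
  classical
  obtain ⟨N, hN⟩ := dim3_aux h hR hP he
  intro z hz
  have key : ∀ j ≤ n, z ∈ Jx x ^ j := by
    intro j
    induction j with
    | zero => intro _; simp
    | succ j ih =>
      intro hj
      obtain ⟨F, hF, hFz⟩ := (mem_Jx_pow _ _ _).1 (ih (by omega))
      have hc : ∀ a, F.coeff a ∈ Jx x := by
        intro a
        by_cases ha : F.coeff a = 0
        · rw [ha]; exact zero_mem _
        have hdeg : a.degree = j := deg_of_isHom hF ha
        obtain ⟨q, hq⟩ : ∃ q, q = N + j := ⟨_, rfl⟩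
        obtain ⟨hq1, hq2⟩ := hN q (by omega)
        set X := Ideal.span {x 0 ^ (q + 1), x 1 ^ (q + 1), x 2 ^ (q + 1)} with hX
        have hle : ∀ i, a i ≤ q := fun i => (Finsupp.le_degree i a).trans (by omega)
        let b : Fin 3 →₀ ℕ := Finsupp.equivFunOnFinite.symm fun i => q - a i
        have hb : ∀ i, b i = q - a i := fun i => rfl
        have hdegf : ∀ u : Fin 3 →₀ ℕ, u.degree = u 0 + u 1 + u 2 := by
          intro u
          rw [Finsupp.degree_eq_sum, Fin.sum_univ_three]
        have hxm : ∀ u : Fin 3 →₀ ℕ, xm x u = x 0 ^ u 0 * x 1 ^ u 1 * x 2 ^ u 2 := by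
          intro u
          rw [xm, Finsupp.prod_fintype _ _ (by simp), Fin.prod_univ_three]
        have hbdeg : b.degree + j = 3 * q := by
          rw [← hdeg, hdegf, hdegf, hb, hb, hb]
          have := hle 0; have := hle 1; have := hle 2
          omega
        have h1 : xm x b * z ∈ X := by
          apply hq1
          have := mul_mem_nI (pow_le_nI _ b.degree (xm_mem x (a := b) rfl)) hz
          exact nI_anti _ (by omega) this
        have hexp : z = ∑ u ∈ mons 3 j, F.coeff u * xm x u := by
          rw [← hFz, eq_sum_mons hF, eval_sum_mons]
          refine Finset.sum_congr rfl fun u hu => ?_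
          rw [coeff_sum_mons _ hu]
        have ham : a ∈ mons 3 j := mem_mons.2 hdeg
        apply hq2
        have h2 : F.coeff a * (x 0 * x 1 * x 2) ^ q = xm x b * (F.coeff a * xm x a) := by
          rw [hxm, hxm, hb, hb, hb]
          have e0 : x 0 ^ q = x 0 ^ (q - a 0) * x 0 ^ a 0 := by rw [← pow_add, Nat.sub_add_cancel (hle 0)]
          have e1 : x 1 ^ q = x 1 ^ (q - a 1) * x 1 ^ a 1 := by rw [← pow_add, Nat.sub_add_cancel (hle 1)]
          have e2 : x 2 ^ q = x 2 ^ (q - a 2) * x 2 ^ a 2 := by rw [← pow_add, Nat.sub_add_cancel (hle 2)]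
          rw [mul_pow, mul_pow, e0, e1, e2]; ring
        have h3 : F.coeff a * xm x a = z - ∑ u ∈ (mons 3 j).erase a, F.coeff u * xm x u := by
          rw [hexp, ← Finset.add_sum_erase _ _ ham, add_sub_cancel_right]
        rw [h2, h3, mul_sub, Finset.mul_sum]
        refine Ideal.sub_mem _ h1 (Ideal.sum_mem _ fun u hu => ?_)
        rw [Finset.mem_erase, mem_mons] at hu
        rw [show xm x b * (F.coeff u * xm x u) = F.coeff u * xm x (b + u) by rw [xm_add]; ring]
        refine Ideal.mul_mem_left _ _ ?_
        obtain ⟨i, hi⟩ : ∃ i, a i < u i := by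
          by_contra hcon
          push Not at hcon
          apply hu.1
          have e1 := hdegf u
          have e2 := hdegf a
          have := hcon 0; have := hcon 1; have := hcon 2
          ext i
          fin_cases i <;> simp <;> omega
        have hi2 : q + 1 ≤ (b + u) i := by
          rw [Finsupp.add_apply, hb]; have := hle i; omega
        have hdiv : x i ^ (q + 1) ∣ xm x (b + u) := by
          rw [xm, Finsupp.prod_fintype _ _ (by simp)]
          exact (pow_dvd_pow _ hi2).trans (Finset.dvd_prod_of_mem _ (Finset.mem_univ i))
        refine Ideal.mem_of_dvd _ hdiv (Ideal.subset_span ?_)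
        fin_cases i <;> simp
      have := eval_mem_of_coeff x hF hc
      rwa [← pow_succ', hFz] at this
  exact key n le_rfl

end dim3
end CMP

namespace CMP

section qrgen

variable {S : Type*} [CommRing S] {d : ℕ}

lemma QR.cancel_one {y : Fin d → S} (h : QR y) (i : Fin d) {k : ℕ} {w : S}
    (hw : y i * w ∈ Jx y ^ (k + 1)) : w ∈ Jx y ^ k := by
  have key : ∀ j ≤ k, w ∈ Jx y ^ j := by
    intro j
    induction j with
    | zero => simp
    | succ j ih =>
      intro hj
      obtain ⟨W, hW, rfl⟩ := (mem_Jx_pow _ _ _).1 (ih (by omega))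
      have h1 := h (1 + j) (MvPolynomial.X i * W) ((MvPolynomial.isHomogeneous_X S i).mul hW) (by
        rw [map_mul, MvPolynomial.eval_X]
        exact Ideal.pow_le_pow_right (by omega) hw)
      rw [pow_succ']
      refine eval_mem_of_coeff y hW fun a => ?_
      have := h1 (Finsupp.single i 1 + a)
      rwa [MvPolynomial.coeff_X_mul] at this
  exact key k le_rfl

lemma QR.cancel_pow {y : Fin d → S} (h : QR y) (i : Fin d) (k : ℕ) {n : ℕ} {w : S}
    (hw : y i ^ k * w ∈ Jx y ^ (k + n)) : w ∈ Jx y ^ n := by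
  induction k generalizing w with
  | zero => simpa using hw
  | succ k ih =>
    have h1 : y i * (y i ^ k * w) ∈ Jx y ^ ((k + n) + 1) := by
      rw [← mul_assoc, ← pow_succ', show k + n + 1 = k + 1 + n by omega]; exact hw
    exact ih (h.cancel_one i h1)

lemma QR.cancel_As {y : Fin d → S} (h : QR y) (i : Fin d) {n : ℕ} {w : S}
    (hw : y i * w ∈ nI (Jx y) (n + 1)) : w ∈ nI (Jx y) n := by
  obtain ⟨c, hc⟩ := hw
  refine ⟨c, fun j => ?_⟩
  have h1 := hc j
  rw [mul_pow] at h1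
  by_cases hj : c ≤ n * j
  · refine h.cancel_pow i j ?_
    rwa [show j + (n * j - c) = (n + 1) * j - c by rw [add_mul]; omega]
  · rw [Nat.sub_eq_zero_of_le (by omega)]; simp

lemma Jx_C {σ : Type*} (x : Fin d → S) :
    Jx (fun i => (MvPolynomial.C (x i) : MvPolynomial σ S)) = (Jx x).map MvPolynomial.C := by
  rw [Jx, Jx, Ideal.map_span, ← Set.range_comp]; rfl

lemma xm_C {σ : Type*} (x : Fin d → S) (b) :
    xm (fun i => (MvPolynomial.C (x i) : MvPolynomial σ S)) b = MvPolynomial.C (xm x b) := by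
  rw [xm, xm, map_finsuppProd]
  simp

/-- quasi-regularity passes to polynomial rings -/
lemma QR.poly {σ : Type*} {x : Fin d → S} (h : QR x) :
    QR (fun i => (MvPolynomial.C (x i) : MvPolynomial σ S)) := by
  intro n F hF hz b
  rw [Jx_C, ← Ideal.map_pow, MvPolynomial.mem_map_C_iff] at hz
  rw [Jx_C, MvPolynomial.mem_map_C_iff]
  intro a
  by_cases hb : b ∈ mons d n
  swap
  · have : F.coeff b = 0 := by
      by_contra h0
      exact hb (mem_mons.2 (deg_of_isHom hF h0))
    rw [this]; simp
  have h1 := h n (∑ b ∈ mons d n, MvPolynomial.monomial b ((F.coeff b).coeff a))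
    (isHomogeneous_sum_mons _) (by
      rw [eval_sum_mons]
      have h2 := hz a
      rw [eq_sum_mons hF, eval_sum_mons, MvPolynomial.coeff_sum] at h2
      convert h2 using 2 with b hb
      rw [xm_C, mul_comm (MvPolynomial.coeff b _), MvPolynomial.coeff_C_mul, mul_comm]) b
  rwa [coeff_sum_mons _ hb] at h1

/-- linear change of parameters -/
def lin (x : Fin (d + 1) → S) (c : Fin d → S) : Fin (d + 1) → S :=
  Fin.cons (x 0 - ∑ i, c i * x i.succ) (Fin.tail x)

lemma lin_zero (x : Fin (d + 1) → S) (c : Fin d → S) :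
    lin x c 0 = x 0 - ∑ i, c i * x i.succ := rfl

lemma lin_succ (x : Fin (d + 1) → S) (c : Fin d → S) (i : Fin d) :
    lin x c i.succ = x i.succ := rfl

lemma tail_lin (x : Fin (d + 1) → S) (c : Fin d → S) : Fin.tail (lin x c) = Fin.tail x := rfl

lemma lin_lin (x : Fin (d + 1) → S) (c : Fin d → S) : lin (lin x c) (-c) = x := by
  funext i
  refine Fin.cases ?_ (fun i => ?_) i
  · rw [lin_zero, lin_zero]
    simp [lin_succ]
  · rfl

lemma Jx_lin_le (x : Fin (d + 1) → S) (c : Fin d → S) : Jx (lin x c) ≤ Jx x := by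
  rw [Jx, Ideal.span_le]
  rintro _ ⟨i, rfl⟩
  refine Fin.cases ?_ (fun i => ?_) i
  · rw [lin_zero]
    exact Ideal.sub_mem _ (Ideal.subset_span ⟨0, rfl⟩)
      (Ideal.sum_mem _ fun i _ => Ideal.mul_mem_left _ _ (Ideal.subset_span ⟨_, rfl⟩))
  · exact Ideal.subset_span ⟨i.succ, rfl⟩

lemma Jx_lin (x : Fin (d + 1) → S) (c : Fin d → S) : Jx (lin x c) = Jx x := by
  refine le_antisymm (Jx_lin_le x c) ?_
  conv_lhs => rw [← lin_lin x c]
  exact Jx_lin_le _ _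

lemma QR.lin {x : Fin (d + 1) → S} (h : QR x) (c : Fin d → S) : QR (lin x c) := by
  intro n F hF hz
  rw [Jx_lin] at hz ⊢
  let X' : Fin (d + 1) → MvPolynomial (Fin (d + 1)) S := MvPolynomial.X
  let τ := fun c : Fin d → S => MvPolynomial.aeval (R := S) (CMP.lin X' fun i => MvPolynomial.C (c i))
  have hhom : ∀ c : Fin d → S, ∀ i, (CMP.lin X' (fun i => MvPolynomial.C (c i)) i).IsHomogeneous 1 := by
    intro c i
    refine Fin.cases ?_ (fun i => ?_) i
    · rw [lin_zero]
      refine (MvPolynomial.isHomogeneous_X S _).sub (MvPolynomial.IsHomogeneous.sum _ _ _ fun i _ => ?_)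
      simpa using (MvPolynomial.isHomogeneous_C (Fin (d + 1)) (c i)).mul (MvPolynomial.isHomogeneous_X S i.succ)
    · exact MvPolynomial.isHomogeneous_X S _
  have h1 : (τ c F).IsHomogeneous n := by
    have := hF.aeval _ (hhom c)
    rwa [one_mul] at this
  have h2 : MvPolynomial.eval x (τ c F) = MvPolynomial.eval (CMP.lin x c) F := by
    have : ((MvPolynomial.aeval x : MvPolynomial (Fin (d+1)) S →ₐ[S] S).comp (τ c)) =
        MvPolynomial.aeval (CMP.lin x c) := by
      refine MvPolynomial.algHom_ext fun i => ?_
      rw [AlgHom.comp_apply, MvPolynomial.aeval_X, MvPolynomial.aeval_X]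
      refine Fin.cases ?_ (fun i => ?_) i
      · rw [lin_zero, lin_zero]; simp [X']
      · rw [lin_succ, lin_succ]; simp [X']
    have := DFunLike.congr_fun this F
    simpa [MvPolynomial.aeval_eq_eval] using this
  have h3 := h n _ h1 (by rw [h2]; exact hz)
  have h4 : τ (-c) (τ c F) = F := by
    have : (τ (-c)).comp (τ c) = AlgHom.id S _ := by
      refine MvPolynomial.algHom_ext fun i => ?_
      rw [AlgHom.comp_apply, MvPolynomial.aeval_X]
      refine Fin.cases ?_ (fun i => ?_) i
      · rw [lin_zero, map_sub, map_sum]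
        simp only [map_mul, X', τ, MvPolynomial.aeval_X, lin_zero, lin_succ]
        simp
      · rw [lin_succ]; simp [X', τ, lin_succ]
    simpa using DFunLike.congr_fun this F
  rw [← MvPolynomial.mem_map_C_iff] at h3 ⊢
  have h5 := Ideal.mem_map_of_mem (τ (-c)).toRingHom h3
  rw [Ideal.map_map] at h5
  have h6 : ((τ (-c)).toRingHom.comp MvPolynomial.C) = MvPolynomial.C := by
    ext1 r
    simp [τ, MvPolynomial.algebraMap_eq]
  rw [h6] at h5
  have h7 : (τ (-c)).toRingHom (τ c F) = F := h4
  rwa [h7] at h5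

/-- quasi-regularity modulo the first element -/
lemma QR.mod {y : Fin (d + 1) → S} (h : QR y) {n : ℕ} {F : MvPolynomial (Fin d) S}
    (hF : F.IsHomogeneous n)
    (hz : MvPolynomial.eval (Fin.tail y) F ∈ Jx y ^ (n + 1) ⊔ Ideal.span {y 0}) (a) :
    F.coeff a ∈ Jx y := by
  classical
  have hr : (MvPolynomial.rename Fin.succ F).IsHomogeneous n := hF.rename_isHomogeneous
  have he : MvPolynomial.eval y (MvPolynomial.rename Fin.succ F) =
      MvPolynomial.eval (Fin.tail y) F := by
    rw [MvPolynomial.eval_rename]; rfl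
  have hinj : Function.Injective (Fin.succ : Fin d → Fin (d + 1)) := Fin.succ_injective d
  rcases n with _ | m
  · have h1 := h 0 _ hr (by
      rw [he]
      refine (sup_le (c := Jx y ^ (0 + 1)) le_rfl ?_ : _ ≤ _) hz
      rw [zero_add, pow_one, Ideal.span_singleton_le_iff_mem]
      exact Ideal.subset_span ⟨0, rfl⟩) (a.mapDomain Fin.succ)
    rwa [MvPolynomial.coeff_rename_mapDomain _ hinj] at h1
  · obtain ⟨s, hs, t, ht, hst⟩ := Submodule.mem_sup.1 hz
    obtain ⟨r, rfl⟩ := Ideal.mem_span_singleton'.1 ht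
    have h1 : y 0 * r ∈ Jx y ^ (m + 1) := by
      have h2 : MvPolynomial.eval y (MvPolynomial.rename Fin.succ F) ∈ Jx y ^ (m + 1) :=
        eval_mem_Jx_pow hr
      rw [he, ← hst] at h2
      have := (Ideal.add_mem_iff_right _ (Ideal.pow_le_pow_right (by omega) hs)).1 h2
      rwa [mul_comm] at this
    obtain ⟨W, hW, rfl⟩ := (mem_Jx_pow _ _ _).1 (h.cancel_one 0 h1)
    have h3 := h (m + 1) (MvPolynomial.rename Fin.succ F - W * MvPolynomial.X 0)
      (hr.sub (hW.mul (MvPolynomial.isHomogeneous_X S _))) (by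
        rw [map_sub, he, map_mul, MvPolynomial.eval_X, ← hst, add_sub_cancel_right]; exact hs)
      (a.mapDomain Fin.succ)
    rwa [MvPolynomial.coeff_sub, MvPolynomial.coeff_rename_mapDomain _ hinj,
      MvPolynomial.coeff_mul_X', if_neg, sub_zero] at h3
    rw [Finsupp.mem_support_iff, not_not]
    exact Finsupp.mapDomain_of_notMem_range _ _ (by rintro ⟨i, hi⟩; exact Fin.succ_ne_zero i hi)

lemma sup_pow_le (a b : Ideal S) (j : ℕ) : (a ⊔ b) ^ j ≤ a ^ j ⊔ b := by
  induction j with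
  | zero => simp
  | succ j ih =>
    rw [pow_succ, pow_succ]
    refine (Ideal.mul_mono_left ih).trans ?_
    rw [Ideal.sup_mul]
    refine sup_le ?_ (Ideal.mul_le_left.trans le_sup_right)
    rw [Ideal.mul_sup]
    exact sup_le le_sup_left (Ideal.mul_le_right.trans le_sup_right)

lemma Jx_eq_tail (y : Fin (d + 1) → S) : Jx y = Jx (Fin.tail y) ⊔ Ideal.span {y 0} := by
  apply le_antisymm
  · rw [Jx, Ideal.span_le]
    rintro _ ⟨i, rfl⟩
    refine Fin.cases ?_ (fun i => ?_) i
    · exact Ideal.mem_sup_right (Ideal.mem_span_singleton_self _)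
    · exact Ideal.mem_sup_left (Ideal.subset_span ⟨i, rfl⟩)
  · refine sup_le ?_ ?_
    · rw [Jx, Ideal.span_le]
      rintro _ ⟨i, rfl⟩
      exact Ideal.subset_span ⟨i.succ, rfl⟩
    · rw [Ideal.span_singleton_le_iff_mem]; exact Ideal.subset_span ⟨0, rfl⟩

lemma QR.nzd {y : Fin (d + 1) → S} (h : QR y) {u : S} (hu : ∀ c, u * c ∈ Jx y → c ∈ Jx y) {k : ℕ}
    {g : S} (hg : u * g ∈ Jx y ^ k ⊔ Ideal.span {y 0}) : g ∈ Jx y ^ k ⊔ Ideal.span {y 0} := by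
  have key : ∀ j ≤ k, g ∈ Jx y ^ j ⊔ Ideal.span {y 0} := by
    intro j
    induction j with
    | zero => simp
    | succ j ih =>
      intro hj
      have h1 := ih (by omega)
      have h2 : g ∈ Jx (Fin.tail y) ^ j ⊔ Ideal.span {y 0} := by
        refine (sup_le (c := Jx (Fin.tail y) ^ j ⊔ Ideal.span {y 0}) ?_ le_sup_right : _ ≤ _) h1
        conv_lhs => rw [Jx_eq_tail y]
        exact sup_pow_le _ _ _
      obtain ⟨s, hs, t, ht, rfl⟩ := Submodule.mem_sup.1 h2
      obtain ⟨W, hW, rfl⟩ := (mem_Jx_pow _ _ _).1 hs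
      refine Ideal.add_mem _ ?_ (Ideal.mem_sup_right ht)
      have h3 : ∀ a, (MvPolynomial.C u * W).coeff a ∈ Jx y := by
        refine h.mod (n := j) ?_ ?_
        · simpa using (MvPolynomial.isHomogeneous_C (Fin d) u).mul hW
        · rw [map_mul, MvPolynomial.eval_C]
          rw [mul_add] at hg
          have h4 := (Ideal.add_mem_iff_left _ (Ideal.mem_sup_right (Ideal.mul_mem_left _ u ht))).1 hg
          exact (sup_le_sup_right (Ideal.pow_le_pow_right (by omega)) _ : Jx y ^ k ⊔ _ ≤ Jx y ^ (j + 1) ⊔ _) h4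
      refine Ideal.mem_sup_left ?_
      have h5 := eval_mem_of_coeff (Fin.tail y) hW (Q := Jx y) fun a => hu _ (by
        have := h3 a
        rwa [MvPolynomial.coeff_C_mul] at this)
      rw [pow_succ']
      refine Ideal.mul_mono_right (Ideal.pow_right_mono ?_ j) h5
      rw [Jx_eq_tail y]; exact le_sup_left
  exact key k le_rfl

end qrgen
end CMP

namespace CMP

section lex

variable {B : Type*} [CommRing B]

lemma nI_map {B' : Type*} [CommRing B'] (f : B →+* B') (J : Ideal B) (n : ℕ) :
    (nI J n).map f ≤ nI (J.map f) n := by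
  rw [Ideal.map_le_iff_le_comap]
  rintro z ⟨c, hc⟩
  rw [Ideal.mem_comap]
  refine ⟨c, fun j => ?_⟩
  rw [← map_pow, ← Ideal.map_pow]
  exact Ideal.mem_map_of_mem _ (hc j)

lemma lex_coeff {d : ℕ} (J : Ideal B) (m : ℕ) :
    ∀ (k : ℕ) (G : MvPolynomial (Fin d) B), G.support.card ≤ k →
    G ∈ nI (J.map MvPolynomial.C) m → ∀ a, G.coeff a ∈ nI J m := by
  classical
  intro k
  induction k with
  | zero =>
    intro G hG _ a
    have : G = 0 := by
      rw [← MvPolynomial.support_eq_empty, ← Finset.card_eq_zero]; omega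
    rw [this]; simp
  | succ k ih =>
    intro G hG hz a
    by_cases h0 : G = 0
    · rw [h0]; simp
    set mo := MonomialOrder.lex (σ := Fin d) with hmo
    have hlc : G.coeff (mo.degree G) ∈ nI J m := by
      obtain ⟨c, hc⟩ := hz
      refine ⟨c, fun j => ?_⟩
      have h1 := hc j
      rw [← Ideal.map_pow, MvPolynomial.mem_map_C_iff] at h1
      have h2 := h1 (j • mo.degree G)
      rwa [MonomialOrder.coeff_pow_nsmul_degree] at h2
    set G' := G - MvPolynomial.monomial (mo.degree G) (G.coeff (mo.degree G)) with hG'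
    have hne : mo.degree G ∈ G.support := by
      rw [MvPolynomial.mem_support_iff]
      exact mo.leadingCoeff_ne_zero_iff.2 h0
    have hco : ∀ b, G'.coeff b = if b = mo.degree G then 0 else G.coeff b := by
      intro b
      rw [hG', MvPolynomial.coeff_sub, MvPolynomial.coeff_monomial]
      split_ifs with h1 h2 h2
      · rw [h1, sub_self]
      · exact absurd h1.symm h2
      · exact absurd h2.symm h1
      · rw [sub_zero]
    have h3 : G'.support ⊆ G.support.erase (mo.degree G) := by
      intro b hb
      rw [MvPolynomial.mem_support_iff, hco] at hb
      rw [Finset.mem_erase, MvPolynomial.mem_support_iff]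
      split_ifs at hb with h
      · exact absurd rfl hb
      · exact ⟨h, hb⟩
    have h4 := (Finset.card_le_card h3)
    rw [Finset.card_erase_of_mem hne] at h4
    have h5 : G' ∈ nI (J.map MvPolynomial.C) m := by
      refine Ideal.sub_mem _ hz (nI_map _ _ _ ?_)
      rw [MvPolynomial.mem_map_C_iff]
      intro b
      rw [MvPolynomial.coeff_monomial]
      split_ifs
      · exact hlc
      · exact zero_mem _
    have h6 := ih G' (by omega) h5 a
    rw [hco] at h6
    split_ifs at h6 with h
    · rw [h]; exact hlc
    · exact h6

lemma mem_nI_map_C {d : ℕ} {J : Ideal B} {m : ℕ} {G : MvPolynomial (Fin d) B} :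
    G ∈ nI (J.map MvPolynomial.C) m ↔ ∀ a, G.coeff a ∈ nI J m := by
  refine ⟨lex_coeff J m _ G le_rfl, fun h => nI_map _ _ _ ?_⟩
  rw [MvPolynomial.mem_map_C_iff]; exact h

end lex

section chart

variable {B : Type*} [CommRing B] {d : ℕ} (x : Fin (d + 1) → B)

/-- the constants in the polynomial ring -/
noncomputable abbrev xC : Fin (d + 1) → MvPolynomial (Fin d) B := fun i => MvPolynomial.C (x i)

/-- the generic parameters -/
noncomputable abbrev yg : Fin (d + 1) → MvPolynomial (Fin d) B := lin (xC x) MvPolynomial.X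

variable (i : Fin d)

noncomputable abbrev Lw := Localization.Away (xC x i.succ)

noncomputable def Nn : MvPolynomial (Fin d) B :=
  xC x 0 - ∑ j ∈ Finset.univ.erase i, MvPolynomial.X j * xC x j.succ

lemma Nn_mem : Nn x i ∈ Jx (xC x) :=
  Ideal.sub_mem _ (Ideal.subset_span ⟨0, rfl⟩)
    (Ideal.sum_mem _ fun j _ => Ideal.mul_mem_left _ _ (Ideal.subset_span ⟨_, rfl⟩))

lemma yg_zero : yg x 0 = Nn x i - MvPolynomial.X i * xC x i.succ := by
  rw [yg, lin_zero, Nn, ← Finset.add_sum_erase _ _ (Finset.mem_univ i)]; ring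

noncomputable def iot : MvPolynomial (Fin d) B →+* Lw x i := algebraMap _ _

noncomputable def iv : Lw x i := IsLocalization.Away.invSelf (xC x i.succ)

lemma iot_iv : iot x i (xC x i.succ) * iv x i = 1 := IsLocalization.Away.mul_invSelf _

lemma iot_eq {a b : MvPolynomial (Fin d) B} (h : iot x i a = iot x i b) :
    ∃ N : ℕ, xC x i.succ ^ N * a = xC x i.succ ^ N * b := by
  obtain ⟨⟨_, N, rfl⟩, hc⟩ := (IsLocalization.eq_iff_exists (Submonoid.powers (xC x i.succ)) (Lw x i)).1 h
  exact ⟨N, hc⟩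

noncomputable def tht : MvPolynomial (Fin d) B →+* Lw x i :=
  MvPolynomial.eval₂Hom ((iot x i).comp MvPolynomial.C)
    (fun j => if j = i then iv x i * iot x i (Nn x i) else iot x i (MvPolynomial.X j))

lemma tht_C (b : B) : tht x i (MvPolynomial.C b) = iot x i (MvPolynomial.C b) := by
  simp [tht]

lemma tht_X_self : tht x i (MvPolynomial.X i) = iv x i * iot x i (Nn x i) := by
  simp [tht]

lemma tht_X_ne {j : Fin d} (h : j ≠ i) : tht x i (MvPolynomial.X j) = iot x i (MvPolynomial.X j) := by
  simp [tht, h]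

lemma tht_yg : tht x i (yg x 0) = 0 := by
  have h1 : tht x i (Nn x i) = iot x i (Nn x i) := by
    rw [Nn, map_sub, map_sub, map_sum, map_sum, tht_C]
    congr 1
    refine Finset.sum_congr rfl fun j hj => ?_
    rw [map_mul, map_mul, tht_C, tht_X_ne x i (Finset.ne_of_mem_erase hj)]
  rw [yg_zero x i, map_sub, map_mul, h1, tht_C, tht_X_self]
  have := iot_iv x i
  linear_combination (- iot x i (Nn x i)) * this

/-- the chart relation -/
def Ch (k D : ℕ) (g G : MvPolynomial (Fin d) B) : Prop :=
  G ∈ Jx (xC x) ^ (D + k) ∧ iot x i (xC x i.succ ^ D) * tht x i g = iot x i G ∧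
    xC x i.succ ^ D * g - G ∈ Ideal.span {yg x 0}

lemma Ch.add {k D E : ℕ} {g h G H : MvPolynomial (Fin d) B} (hg : Ch x i k D g G) (hh : Ch x i k E h H) :
    Ch x i k (D + E) (g + h) (xC x i.succ ^ E * G + xC x i.succ ^ D * H) := by
  have hx : xC x i.succ ∈ Jx (xC x) := Ideal.subset_span ⟨_, rfl⟩
  obtain ⟨g1, g2, g3⟩ := hg
  obtain ⟨h1, h2, h3⟩ := hh
  refine ⟨Ideal.add_mem _ ?_ ?_, ?_, ?_⟩
  · have := Ideal.mul_mem_mul (Ideal.pow_mem_pow hx E) g1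
    rwa [← pow_add, show E + (D + k) = D + E + k by omega] at this
  · have := Ideal.mul_mem_mul (Ideal.pow_mem_pow hx D) h1
    rwa [← pow_add, show D + (E + k) = D + E + k by omega] at this
  · rw [map_add, map_add, map_mul, map_mul, ← g2, ← h2, pow_add, map_mul]; ring
  · have := Ideal.add_mem _ (Ideal.mul_mem_left _ (xC x i.succ ^ E) g3)
      (Ideal.mul_mem_left _ (xC x i.succ ^ D) h3)
    convert this using 1; ring

lemma Ch.mul {k l D E : ℕ} {g h G H : MvPolynomial (Fin d) B} (hg : Ch x i k D g G) (hh : Ch x i l E h H) :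
    Ch x i (k + l) (D + E) (g * h) (G * H) := by
  obtain ⟨g1, g2, g3⟩ := hg
  obtain ⟨h1, h2, h3⟩ := hh
  refine ⟨?_, ?_, ?_⟩
  · have := Ideal.mul_mem_mul g1 h1
    rwa [← pow_add, show D + k + (E + l) = D + E + (k + l) by omega] at this
  · rw [map_mul, map_mul, ← g2, ← h2, pow_add, map_mul]; ring
  · have := Ideal.add_mem _ (Ideal.mul_mem_left _ (xC x i.succ ^ E * h) g3)
      (Ideal.mul_mem_left _ G h3)
    convert this using 1; ring

lemma Ch.const {k : ℕ} {b : B} (hb : b ∈ Jx x ^ k) : Ch x i k 0 (MvPolynomial.C b) (MvPolynomial.C b) := by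
  refine ⟨?_, ?_, ?_⟩
  · rw [Jx_C, ← Ideal.map_pow, zero_add]; exact Ideal.mem_map_of_mem _ hb
  · rw [pow_zero, map_one, one_mul, tht_C]
  · simp

lemma Ch.pow {D : ℕ} {g G : MvPolynomial (Fin d) B} (hg : Ch x i 0 D g G) (j : ℕ) :
    Ch x i 0 (D * j) (g ^ j) (G ^ j) := by
  induction j with
  | zero => simpa using Ch.const x i (k := 0) (b := 1) (by simp)
  | succ j ih => simpa [pow_succ, mul_add] using Ch.mul x i ih hg

lemma Ch.exists (g : MvPolynomial (Fin d) B) : ∃ D G, Ch x i 0 D g G := by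
  have hx : xC x i.succ ∈ Jx (xC x) := Ideal.subset_span ⟨_, rfl⟩
  induction g using MvPolynomial.induction_on with
  | C b => exact ⟨0, _, Ch.const x i (by simp)⟩
  | add p q hp hq =>
    obtain ⟨D, G, hp⟩ := hp
    obtain ⟨E, H, hq⟩ := hq
    exact ⟨_, _, Ch.add x i hp hq⟩
  | mul_X p j hp =>
    obtain ⟨D, G, hp⟩ := hp
    by_cases hj : j = i
    · subst hj
      refine ⟨_, _, Ch.mul x j (l := 0) (E := 1) (h := MvPolynomial.X j) (H := Nn x j) hp ⟨?_, ?_, ?_⟩⟩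
      · simpa using Nn_mem x j
      · rw [tht_X_self, pow_one]
        linear_combination iot x j (Nn x j) * iot_iv x j
      · rw [Ideal.mem_span_singleton]
        refine ⟨-1, ?_⟩
        rw [yg_zero x j]; ring
    · refine ⟨_, _, Ch.mul x i (l := 0) (E := 0) (h := MvPolynomial.X j) (H := MvPolynomial.X j) hp ⟨?_, ?_, ?_⟩⟩
      · simp
      · rw [tht_X_ne x i hj]; simp
      · simp

lemma Ch.of_mem {k : ℕ} {h : MvPolynomial (Fin d) B} (hh : h ∈ Jx (xC x) ^ k) : ∃ D H, Ch x i k D h H := by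
  rw [Jx_C, ← Ideal.map_pow, Ideal.map] at hh
  induction hh using Submodule.span_induction with
  | mem z hz =>
    obtain ⟨b, hb, rfl⟩ := hz
    exact ⟨_, _, Ch.const x i hb⟩
  | zero => exact ⟨0, 0, by simp [Ch]⟩
  | add p q _ _ hp hq =>
    obtain ⟨D, G, hp⟩ := hp
    obtain ⟨E, H, hq⟩ := hq
    exact ⟨_, _, Ch.add x i hp hq⟩
  | smul a p _ hp =>
    obtain ⟨D, G, hp⟩ := hp
    obtain ⟨E, H, hq⟩ := Ch.exists x i a
    have := Ch.mul x i hq hp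
    rw [zero_add] at this
    exact ⟨_, _, this⟩

lemma Ch.mem {x : Fin (d + 1) → B} (hq : QR x) {i : Fin d} {k D : ℕ} {g G : MvPolynomial (Fin d) B}
    (h : Ch x i 0 D g G) (hg : g ∈ Jx (xC x) ^ k ⊔ Ideal.span {yg x 0}) : G ∈ Jx (xC x) ^ (D + k) := by
  have hx : xC x i.succ ∈ Jx (xC x) := Ideal.subset_span ⟨_, rfl⟩
  obtain ⟨s, hs, t, ht, rfl⟩ := Submodule.mem_sup.1 hg
  obtain ⟨r, rfl⟩ := Ideal.mem_span_singleton'.1 ht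
  obtain ⟨E, H, h1, h2, h3⟩ := Ch.of_mem x i hs
  obtain ⟨-, g2, -⟩ := h
  rw [map_add, map_mul _ r, tht_yg, mul_zero, add_zero] at g2
  have h4 : iot x i (xC x i.succ ^ E * G) = iot x i (xC x i.succ ^ D * H) := by
    rw [map_mul, map_mul, ← g2, ← h2]; ring
  obtain ⟨N, hN⟩ := iot_eq x i h4
  refine (hq.poly (σ := Fin d)).cancel_pow i.succ (N + E) ?_
  have e1 : xC x i.succ ^ (N + E) * G = xC x i.succ ^ N * (xC x i.succ ^ D * H) := by
    rw [← hN]; ring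
  refine (congrArg (· ∈ Jx (xC x) ^ (N + E + (D + k))) e1).mpr ?_
  have := Ideal.mul_mem_mul (Ideal.pow_mem_pow hx N) (Ideal.mul_mem_mul (Ideal.pow_mem_pow hx D) h1)
  rwa [← pow_add, ← pow_add, show N + (D + (E + k)) = N + E + (D + k) by omega] at this

/-- the chart lemma -/
lemma chart {x : Fin (d + 1) → B} (hq : QR x) (i : Fin d) (g : MvPolynomial (Fin d) B) :
    ∃ D G, xC x i.succ ^ D * g - G ∈ Ideal.span {yg x 0} ∧ ∀ n c,
      (∀ j, g ^ j ∈ Jx (xC x) ^ (n * j - c) ⊔ Ideal.span {yg x 0}) →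
        ∀ a, G.coeff a ∈ nI (Jx x) (n + D) := by
  obtain ⟨D, G, h⟩ := Ch.exists x i g
  refine ⟨D, G, h.2.2, fun n c hc => ?_⟩
  rw [← mem_nI_map_C, ← Jx_C]
  refine ⟨c, fun j => ?_⟩
  have := (Ch.pow x i h j).mem hq (hc j)
  refine Ideal.pow_le_pow_right ?_ this
  rw [add_mul]; omega

lemma pull_const {x : Fin (d + 1) → B} (hq : QR x) (i : Fin d) {z : B} {n : ℕ}
    (hz : MvPolynomial.C z ∈ Jx (xC x) ^ n ⊔ Ideal.span {yg x 0}) : z ∈ Jx x ^ n := by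
  have := (Ch.const x i (k := 0) (b := z) (by simp)).mem hq hz
  rw [zero_add, Jx_C, ← Ideal.map_pow, MvPolynomial.mem_map_C_iff] at this
  simpa using this 0

end chart
end CMP

namespace CMP

section gen

variable {B : Type*} [CommRing B] [IsLocalRing B] {B1 : Type*} [CommRing B1] [IsLocalRing B1]
  {d : ℕ} {x : Fin (d + 1) → B} {φ : MvPolynomial (Fin d) B →+* B1}

/-- the generic hyperplane section -/
structure Gen (x : Fin (d + 1) → B) (φ : MvPolynomial (Fin d) B →+* B1) : Prop where
  unit : ∀ u, UC u → IsUnit (φ u)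
  surj : ∀ b, ∃ u g, UC u ∧ φ u * b = φ g
  ker : ∀ g, φ g = 0 → ∃ u, UC u ∧ u * g ∈ Ideal.span {yg x 0}
  yg0 : φ (yg x 0) = 0

/-- the parameters of the section -/
noncomputable abbrev xb (x : Fin (d + 1) → B) (φ : MvPolynomial (Fin d) B →+* B1) : Fin d → B1 :=
  fun i => φ (xC x i.succ)

lemma Gen.lift (h : Gen x φ) {c : Ideal (MvPolynomial (Fin d) B)} {b : B1} (hb : b ∈ c.map φ) :
    ∃ u g, UC u ∧ g ∈ c ∧ φ u * b = φ g := by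
  rw [Ideal.map] at hb
  induction hb using Submodule.span_induction with
  | mem z hz =>
    obtain ⟨g, hg, rfl⟩ := hz
    exact ⟨1, g, UC_one, hg, by simp⟩
  | zero => exact ⟨1, 0, UC_one, zero_mem _, by simp⟩
  | add p q _ _ hp hq =>
    obtain ⟨u, g, hu, hg, e1⟩ := hp
    obtain ⟨v, k, hv, hk, e2⟩ := hq
    refine ⟨u * v, v * g + u * k, hu.mul hv, Ideal.add_mem _ (Ideal.mul_mem_left _ _ hg)
      (Ideal.mul_mem_left _ _ hk), ?_⟩
    rw [map_add, map_mul, map_mul, map_mul, ← e1, ← e2]; ring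
  | smul a p _ hp =>
    obtain ⟨u, g, hu, hg, e1⟩ := hp
    obtain ⟨v, k, hv, e2⟩ := h.surj a
    refine ⟨u * v, k * g, hu.mul hv, Ideal.mul_mem_left _ _ hg, ?_⟩
    rw [map_mul, map_mul, ← e1, ← e2, smul_eq_mul]; ring

lemma Gen.mem_map (h : Gen x φ) {c : Ideal (MvPolynomial (Fin d) B)} {g} :
    φ g ∈ c.map φ ↔ ∃ u, UC u ∧ u * g ∈ c ⊔ Ideal.span {yg x 0} := by
  constructor
  · intro hg
    obtain ⟨u, k, hu, hk, e⟩ := h.lift hg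
    rw [← map_mul, ← sub_eq_zero, ← map_sub] at e
    obtain ⟨w, hw, hwe⟩ := h.ker _ e
    refine ⟨w * u, hw.mul hu, ?_⟩
    have := Ideal.add_mem _ (Ideal.mem_sup_right (S := c) hwe) (Ideal.mem_sup_left (Ideal.mul_mem_left _ w hk))
    convert this using 1; ring
  · rintro ⟨u, hu, hug⟩
    obtain ⟨s, hs, t, ht, e⟩ := Submodule.mem_sup.1 hug
    obtain ⟨r, rfl⟩ := Ideal.mem_span_singleton'.1 ht
    rw [← Ideal.unit_mul_mem_iff_mem _ (h.unit u hu), ← map_mul, ← e, map_add, map_mul, h.yg0,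
      mul_zero, add_zero]
    exact Ideal.mem_map_of_mem _ hs

lemma Gen.Jxb (h : Gen x φ) : Jx (xb x φ) = (Jx (xC x)).map φ := by
  have e : (Jx (xC x)).map φ = (Jx (yg x)).map φ := by rw [yg, Jx_lin]
  apply le_antisymm
  · rw [Jx, Ideal.span_le]
    rintro _ ⟨i, rfl⟩
    exact Ideal.mem_map_of_mem _ (Ideal.subset_span ⟨i.succ, rfl⟩)
  · rw [e, Jx, Ideal.map_span, Ideal.span_le]
    rintro _ ⟨_, ⟨i, rfl⟩, rfl⟩
    refine Fin.cases ?_ (fun i => ?_) i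
    · rw [SetLike.mem_coe, h.yg0]; exact zero_mem _
    · exact Ideal.subset_span ⟨i, rfl⟩

lemma UC.nzd (hQ : QS x) {u : MvPolynomial (Fin d) B} (hu : UC u) (c : MvPolynomial (Fin d) B)
    (hc : u * c ∈ Jx (xC x)) : c ∈ Jx (xC x) := by
  rw [Jx_C, MvPolynomial.mem_map_C_iff] at *
  obtain ⟨N, hN⟩ := hQ.prim
  exact coeff_mem_of_mul hu hN hc

lemma Gen.mem_pow (h : Gen x φ) (hQ : QS x) {g} {k : ℕ} :
    φ g ∈ Jx (xb x φ) ^ k ↔ g ∈ Jx (xC x) ^ k ⊔ Ideal.span {yg x 0} := by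
  rw [h.Jxb, ← Ideal.map_pow, h.mem_map]
  constructor
  · rintro ⟨u, hu, hg⟩
    have e : Jx (yg x) = Jx (xC x) := by rw [yg, Jx_lin]
    have := ((hQ.qr.poly (σ := Fin d)).lin MvPolynomial.X).nzd (u := u) (k := k) (g := g)
      (fun c hc => by
        have hc' : u * c ∈ Jx (yg x) := hc
        rw [e] at hc'
        have := hu.nzd hQ c hc'
        rw [← e] at this
        exact this) (by
        have hg' := hg
        rw [← e] at hg'
        exact hg')
    rw [← e]
    exact this
  · intro hg
    exact ⟨1, UC_one, by rwa [one_mul]⟩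

lemma Gen.denoms (h : Gen x φ) {ι : Type*} (s : Finset ι) (c : ι → B1) :
    ∃ u, UC u ∧ ∃ g : ι → MvPolynomial (Fin d) B, ∀ a ∈ s, φ u * c a = φ (g a) := by
  classical
  induction s using Finset.induction_on with
  | empty => exact ⟨1, UC_one, fun _ => 0, by simp⟩
  | insert a s ha ih =>
    obtain ⟨u, hu, g, hg⟩ := ih
    obtain ⟨v, k, hv, hk⟩ := h.surj (c a)
    refine ⟨u * v, hu.mul hv, fun b => if b = a then u * k else v * g b, fun b hb => ?_⟩
    by_cases hba : b = a
    · subst hba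
      simp only [if_true, map_mul, ← hk]; ring
    · simp only [if_neg hba, map_mul, ← hg b (Finset.mem_of_mem_insert_of_ne hb hba)]; ring

lemma Gen.nonunit (h : Gen x φ) (hQ : QS x) {g} (hg : φ g ∉ maximalIdeal B1) : UC g := by
  rw [mem_maximalIdeal, mem_nonunits_iff, not_not] at hg
  obtain ⟨b, hb⟩ := hg.exists_right_inv
  obtain ⟨u, k, hu, hk⟩ := h.surj b
  have h1 : φ (g * k - u) = 0 := by
    rw [map_sub, map_mul, ← hk]; linear_combination φ u * hb
  obtain ⟨w, hw, hwe⟩ := h.ker _ h1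
  have h2 : MvPolynomial.map (residue B) (yg x 0) = 0 := by
    have hx : ∀ i, residue B (x i) = 0 := fun i =>
      (residue_eq_zero_iff _).2 (hQ.le (Ideal.subset_span ⟨i, rfl⟩))
    rw [yg, lin_zero, map_sub, map_sum]
    simp [hx]
  obtain ⟨r, hr⟩ := Ideal.mem_span_singleton'.1 hwe
  have h3 := congrArg (MvPolynomial.map (residue B)) hr
  rw [map_mul, h2, mul_zero, map_mul, map_sub, map_mul] at h3
  rw [UC_iff] at hw hu ⊢
  intro h0
  rw [h0, zero_mul, zero_sub] at h3
  exact mul_ne_zero hw (neg_ne_zero.2 hu) h3.symm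

lemma Gen.max (h : Gen x φ) (hQ : QS x) :
    maximalIdeal B1 = ((maximalIdeal B).map MvPolynomial.C).map φ := by
  apply le_antisymm
  · intro b hb
    obtain ⟨u, g, hu, e⟩ := h.surj b
    have h1 : ¬ UC g := by
      intro hg
      have h2 := h.unit g hg
      rw [← e] at h2
      rw [mem_maximalIdeal, mem_nonunits_iff] at hb
      exact hb (isUnit_of_mul_isUnit_right h2)
    rw [← Ideal.unit_mul_mem_iff_mem _ (h.unit u hu), e]
    refine Ideal.mem_map_of_mem _ (MvPolynomial.mem_map_C_iff.2 fun a => ?_)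
    by_contra hcon
    exact h1 ⟨a, hcon⟩
  · rw [Ideal.map_map, Ideal.map_le_iff_le_comap]
    intro b hb
    rw [Ideal.mem_comap]
    by_contra hcon
    obtain ⟨a, ha⟩ := h.nonunit hQ hcon
    rw [MvPolynomial.coeff_C] at ha
    split_ifs at ha
    · exact ha hb
    · exact ha (zero_mem _)

lemma Gen.qs (h : Gen x φ) (hQ : QS x) : QS (xb x φ) := by
  refine ⟨?_, ?_, ?_⟩
  · intro n F hF hz a
    by_cases ha : a ∈ mons d n
    swap
    · have : F.coeff a = 0 := by
        by_contra h0
        exact ha (mem_mons.2 (deg_of_isHom hF h0))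
      rw [this]; exact zero_mem _
    obtain ⟨u, hu, g, hg⟩ := h.denoms (mons d n) (fun a => F.coeff a)
    have h1 := ((hQ.qr.poly (σ := Fin d)).lin MvPolynomial.X).mod (n := n)
      (F := ∑ a ∈ mons d n, MvPolynomial.monomial a (g a)) (isHomogeneous_sum_mons _) (by
        have e : Jx (yg x) = Jx (xC x) := by rw [yg, Jx_lin]
        refine (congrArg (fun I : Ideal _ => _ ∈ I ^ (n + 1) ⊔ Ideal.span {yg x 0}) e).mpr ?_
        rw [eval_sum_mons, ← h.mem_pow hQ, map_sum]
        have : ∑ a ∈ mons d n, φ (g a * xm (Fin.tail (yg x)) a) =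
            φ u * MvPolynomial.eval (xb x φ) F := by
          conv_rhs => rw [eq_sum_mons hF, eval_sum_mons, Finset.mul_sum]
          refine Finset.sum_congr rfl fun b hb => ?_
          rw [map_mul, ← hg b hb, xm, map_finsuppProd, ← mul_assoc]
          congr 1
          rw [xm]
          refine Finsupp.prod_congr fun i _ => ?_
          rw [map_pow]
          rfl
        erw [this]
        exact Ideal.mul_mem_left _ _ hz) a
    rw [coeff_sum_mons _ ha, Jx_lin] at h1
    rw [← Ideal.unit_mul_mem_iff_mem _ (h.unit u hu), hg a ha, h.Jxb]
    exact Ideal.mem_map_of_mem _ h1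
  · obtain ⟨N, hN⟩ := hQ.prim
    refine ⟨N, ?_⟩
    rw [h.max hQ, h.Jxb, ← Ideal.map_pow, ← Ideal.map_pow, Jx_C]
    exact Ideal.map_mono (Ideal.map_mono hN)
  · rw [h.max hQ, h.Jxb, Jx_C]
    exact Ideal.map_mono (Ideal.map_mono hQ.le)

/-- extension of an ideal to the section -/
noncomputable abbrev ext1 (φ : MvPolynomial (Fin d) B →+* B1) (a : Ideal B) : Ideal B1 :=
  (a.map MvPolynomial.C).map φ

lemma ext1_mul (a b : Ideal B) : ext1 φ (a * b) = ext1 φ a * ext1 φ b := by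
  rw [ext1, ext1, ext1, Ideal.map_mul, Ideal.map_mul]

lemma Gen.ext_J (h : Gen x φ) (n : ℕ) : ext1 φ (Jx x ^ n) = Jx (xb x φ) ^ n := by
  rw [h.Jxb, Jx_C, ext1, Ideal.map_pow, Ideal.map_pow]

lemma Gen.ext_nI (h : Gen x φ) (n : ℕ) : ext1 φ (nI (Jx x) n) ≤ nI (Jx (xb x φ)) n := by
  rw [h.Jxb, Jx_C]
  exact (Ideal.map_mono (nI_map _ _ _)).trans (nI_map _ _ _)

lemma Gen.mul_ext (h : Gen x φ) (m n : ℕ) :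
    Jx (xb x φ) ^ m * ext1 φ (nI (Jx x) n) ≤ ext1 φ (nI (Jx x) (m + n)) := by
  rw [← h.ext_J, ← ext1_mul]
  exact Ideal.map_mono (Ideal.map_mono ((Ideal.mul_mono_left (pow_le_nI _ _)).trans (nI_mul_le _ _ _)))

lemma Gen.chart1 (h : Gen x φ) (hQ : QS x) (i : Fin d) (b : B1) :
    ∃ D, ∀ n, b ∈ nI (Jx (xb x φ)) n → xb x φ i ^ D * b ∈ ext1 φ (nI (Jx x) (n + D)) := by
  obtain ⟨u, g, hu, e⟩ := h.surj b
  obtain ⟨D, G, h1, h2⟩ := chart hQ.qr i g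
  refine ⟨D, fun n hn => ?_⟩
  obtain ⟨c, hc⟩ := hn
  have h3 := h2 n c fun j => by
    rw [← h.mem_pow hQ, map_pow, ← e, mul_pow]
    exact Ideal.mul_mem_left _ _ (hc j)
  rw [← MvPolynomial.mem_map_C_iff] at h3
  obtain ⟨r, hr⟩ := Ideal.mem_span_singleton'.1 h1
  have h4 := congrArg φ hr
  rw [map_mul, h.yg0, mul_zero, map_sub, map_mul, map_pow, ← e] at h4
  rw [← Ideal.unit_mul_mem_iff_mem _ (h.unit u hu)]
  have h5 : φ u * (xb x φ i ^ D * b) = φ G := by linear_combination -h4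
  rw [h5]
  exact Ideal.mem_map_of_mem _ h3

lemma Gen.rb (h : Gen x φ) (hQ : QS x) (hR : RB x) (i : Fin d) : RB (xb x φ) := by
  obtain ⟨c, hc⟩ := hR
  refine ⟨c, fun n z hz => ?_⟩
  obtain ⟨D, hD⟩ := h.chart1 hQ i z
  have h1 := hD n hz
  have h2 : ext1 φ (nI (Jx x) (n + D)) ≤ Jx (xb x φ) ^ (n + D - c) := by
    rw [← h.ext_J]; exact Ideal.map_mono (Ideal.map_mono (hc _))
  by_cases hn : c ≤ n
  · refine (h.qs hQ).cancel_X i (k := D) ?_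
    have := h2 h1
    rwa [show n + D - c = D + (n - c) by omega] at this
  · rw [Nat.sub_eq_zero_of_le (by omega)]; simp

lemma Gen.eventually [IsNoetherianRing B1] (h : Gen x φ) (hQ : QS x) (hR : RB x) (i0 : Fin d) :
    ∃ N, ∀ n ≥ N, nI (Jx (xb x φ)) n = ext1 φ (nI (Jx x) n) := by
  classical
  set J := Jx (xb x φ) with hJ
  obtain ⟨c, hc⟩ := h.rb hQ hR i0
  let Fl : J.Filtration B1 :=
    { N := fun n => nI J n
      mono := fun n => nI_anti J (by omega)
      smul_le := fun n => by
        rw [smul_eq_mul]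
        have := (Ideal.mul_mono_left (pow_le_nI J 1)).trans (nI_mul_le J 1 n)
        rw [pow_one, add_comm] at this
        exact this }
  have hst : Fl.Stable := (shiftFilt_stable J c).of_le (fun n => hc n)
  obtain ⟨n0, hn0⟩ := hst.exists_pow_smul_eq_of_ge
  obtain ⟨s, hs⟩ := (isNoetherianRing_iff_ideal_fg B1).1 inferInstance (nI J n0)
  choose D hD using fun (i : Fin d) (b : B1) => h.chart1 hQ i b
  set M := ∑ i, ∑ b ∈ s, D i b with hM
  have hMl : ∀ i, ∀ b ∈ s, D i b ≤ M := by
    intro i b hb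
    refine (Finset.single_le_sum (f := fun b => D i b) (fun _ _ => Nat.zero_le _) hb).trans ?_
    exact Finset.single_le_sum (f := fun i => ∑ b ∈ s, D i b) (fun _ _ => Nat.zero_le _) (Finset.mem_univ i)
  have h1 : ∀ i, ∀ z ∈ nI J n0, xb x φ i ^ M * z ∈ ext1 φ (nI (Jx x) (n0 + M)) := by
    intro i z hz
    rw [← hs] at hz
    induction hz using Submodule.span_induction with
    | mem b hb =>
      have hb' : b ∈ nI J n0 := by rw [← hs]; exact Ideal.subset_span hb
      have h2 := hD i b n0 hb'
      have h3 := h.mul_ext (M - D i b) (n0 + D i b) (Ideal.mul_mem_mul (Ideal.pow_mem_pow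
        (Ideal.subset_span ⟨i, rfl⟩ : xb x φ i ∈ Jx (xb x φ)) (M - D i b)) h2)
      have := hMl i b hb
      rw [← mul_assoc, ← pow_add, show M - D i b + D i b = M by omega,
        show M - D i b + (n0 + D i b) = n0 + M by omega] at h3
      exact h3
    | zero => rw [mul_zero]; exact zero_mem _
    | add p q _ _ hp hq => rw [mul_add]; exact Ideal.add_mem _ hp hq
    | smul a p _ hp =>
      rw [smul_eq_mul, mul_left_comm]; exact Ideal.mul_mem_left _ _ hp
  have hd : 0 < d := i0.pos
  have h2 : J ^ (d * M) * nI J n0 ≤ ext1 φ (nI (Jx x) (n0 + d * M)) := by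
    rw [Ideal.mul_le]
    intro r hr z hz
    obtain ⟨F, hF, rfl⟩ := (mem_Jx_pow _ _ _).1 hr
    rw [eq_sum_mons hF, eval_sum_mons, Finset.sum_mul]
    refine Ideal.sum_mem _ fun a ha => ?_
    rw [mul_assoc]
    refine Ideal.mul_mem_left _ _ ?_
    rw [mem_mons] at ha
    have h3 : ∃ i, M ≤ a i := by
      by_contra hcon
      push Not at hcon
      have h4 : a.degree = ∑ i, a i := Finsupp.degree_eq_sum a
      have h5 : ∑ i : Fin d, a i < ∑ i : Fin d, M :=
        Finset.sum_lt_sum_of_nonempty ⟨i0, Finset.mem_univ _⟩ fun i _ => hcon i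
      simp at h5
      omega
    obtain ⟨i, hi⟩ := h3
    have h4 : a = (a - Finsupp.single i M) + Finsupp.single i M :=
      (tsub_add_cancel_of_le (Finsupp.single_le_iff.2 hi)).symm
    set a' := a - Finsupp.single i M with ha'
    have h5 : xm (xb x φ) a = xm (xb x φ) a' * xb x φ i ^ M := by
      conv_lhs => rw [h4, xm_add]
      congr 1
      rw [xm, Finsupp.prod_single_index (by simp)]
    have h6 : a'.degree + M = d * M := by
      rw [← ha]; conv_rhs => rw [h4]
      simp [map_add, Finsupp.degree_single]
    rw [h5, mul_assoc]
    have h7 := h.mul_ext (d * M - M) (n0 + M) (Ideal.mul_mem_mul (xm_mem (xb x φ) (a := a') (n := d * M - M) (by omega))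
      (h1 i z hz))
    have : M ≤ d * M := Nat.le_mul_of_pos_left M hd
    rwa [show d * M - M + (n0 + M) = n0 + d * M by omega] at h7
  refine ⟨n0 + d * M, fun n hn => le_antisymm ?_ (h.ext_nI n)⟩
  have h3 : nI J n = J ^ (n - n0) * nI J n0 := hn0 n (by omega)
  rw [h3, show n - n0 = (n - n0 - d * M) + d * M by omega, pow_add, mul_assoc]
  refine (Ideal.mul_mono_right h2).trans ((h.mul_ext _ _).trans (le_of_eq ?_))
  congr 2; omega

end gen
end CMP

namespace CMP

section by_

variable {B : Type*} [CommRing B] [IsLocalRing B] {d : ℕ}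

/-- the extended maximal ideal -/
noncomputable def mS (B : Type*) [CommRing B] [IsLocalRing B] (d : ℕ) : Ideal (MvPolynomial (Fin d) B) :=
  (maximalIdeal B).map MvPolynomial.C

lemma mem_mS {g : MvPolynomial (Fin d) B} : g ∉ mS B d ↔ UC g := by
  rw [mS, MvPolynomial.mem_map_C_iff, UC]; push Not; rfl

instance mS_prime : (mS B d).IsPrime := by
  refine ⟨?_, ?_⟩
  · intro h
    have : (1 : MvPolynomial (Fin d) B) ∉ mS B d := mem_mS.2 UC_one
    rw [h] at this; exact this trivial
  · intro a b hab
    by_contra hcon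
    push Not at hcon
    exact (mem_mS.2 ((mem_mS.1 hcon.1).mul (mem_mS.1 hcon.2))) hab

variable (BY : Type*) [CommRing BY] [Algebra (MvPolynomial (Fin d) B) BY]
  [IsLocalization.AtPrime BY (mS B d)]


lemma by_unit {u : MvPolynomial (Fin d) B} (hu : UC u) : IsUnit (algebraMap _ BY u) :=
  IsLocalization.map_units BY (⟨u, mem_mS.2 hu⟩ : (mS B d).primeCompl)

lemma by_surj (b : BY) : ∃ u g : MvPolynomial (Fin d) B, UC u ∧ algebraMap _ BY u * b = algebraMap _ BY g := by
  obtain ⟨⟨g, u⟩, h⟩ := IsLocalization.surj (mS B d).primeCompl b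
  exact ⟨u, g, mem_mS.1 u.2, by rw [mul_comm]; exact h⟩

/-- extension of ideals -/
noncomputable abbrev extY (a : Ideal B) : Ideal BY := (a.map MvPolynomial.C).map (algebraMap (MvPolynomial (Fin d) B) BY)

lemma by_mem {a : Ideal B} {N : ℕ} (ha : maximalIdeal B ^ N ≤ a) {g : MvPolynomial (Fin d) B} :
    algebraMap _ BY g ∈ extY BY (d := d) a ↔ ∀ b, g.coeff b ∈ a := by
  constructor
  · intro h
    obtain ⟨u, hu, h1⟩ := (IsLocalization.algebraMap_mem_map_algebraMap_iff (mS B d).primeCompl BY _ g).1 h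
    rw [MvPolynomial.mem_map_C_iff] at h1
    exact coeff_mem_of_mul (mem_mS.1 hu) ha h1
  · intro h
    exact Ideal.mem_map_of_mem _ (MvPolynomial.mem_map_C_iff.2 h)

lemma by_max [IsLocalRing BY] : extY BY (d := d) (maximalIdeal B) = maximalIdeal BY :=
  IsLocalization.AtPrime.map_eq_maximalIdeal (mS B d) BY

lemma len_top {A : Type*} [CommRing A] : len (⊤ : Ideal A) = 0 := by
  rw [len, Module.length_eq_zero_iff]
  infer_instance

lemma len_max {A : Type*} [CommRing A] [IsLocalRing A] : len (maximalIdeal A) = 1 := by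
  rw [len, Module.length_eq_one_iff, isSimpleModule_iff_isCoatom]
  exact Ideal.isMaximal_def.1 (maximalIdeal.isMaximal A)

lemma len_ext [IsLocalRing BY] (n : ℕ) : ∀ {a : Ideal B} {N : ℕ}, maximalIdeal B ^ N ≤ a → len a = n →
    len (extY BY (d := d) a) = n := by
  classical
  induction n using Nat.strong_induction_on with
  | _ n ih =>
  intro a N ha hn
  by_cases htop : a = ⊤
  · subst htop
    rw [len_top] at hn
    rw [extY, Ideal.map_top, Ideal.map_top, len_top]; exact hn
  have hex : ∃ k, maximalIdeal B ^ k ≤ a := ⟨N, ha⟩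
  obtain ⟨u, hu1, hu2⟩ : ∃ u, u ∉ a ∧ ∀ r ∈ maximalIdeal B, r * u ∈ a := by
    have h0 : Nat.find hex ≠ 0 := by
      intro h0
      have := Nat.find_spec hex
      rw [h0, pow_zero, Ideal.one_eq_top, top_le_iff] at this
      exact htop this
    have h1 := Nat.find_min hex (m := Nat.find hex - 1) (by omega)
    obtain ⟨u, hu, hua⟩ := SetLike.not_le_iff_exists.1 h1
    refine ⟨u, hua, fun r hr => ?_⟩
    have h2 := Nat.find_spec hex
    refine h2 ?_
    rw [show Nat.find hex = Nat.find hex - 1 + 1 by omega, pow_succ']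
    exact Ideal.mul_mem_mul hr hu
  have hc1 : a.colon (Ideal.span {u}) = maximalIdeal B := by
    refine ((maximalIdeal.isMaximal B).eq_of_le ?_ ?_).symm
    · rw [Ne, Ideal.eq_top_iff_one]
      intro h1
      rw [Submodule.mem_colon] at h1
      exact hu1 (by simpa using h1 u (Ideal.mem_span_singleton_self u))
    · intro r hr
      rw [Submodule.mem_colon]
      intro p hp
      obtain ⟨s, rfl⟩ := Ideal.mem_span_singleton'.1 hp
      rw [smul_eq_mul, mul_left_comm]
      exact Ideal.mul_mem_left _ _ (hu2 r hr)
  have hc2 : (extY BY (d := d) a).colon (Ideal.span {algebraMap _ BY (MvPolynomial.C (σ := Fin d) u)}) = maximalIdeal BY := by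
    refine ((maximalIdeal.isMaximal BY).eq_of_le ?_ ?_).symm
    · rw [Ne, Ideal.eq_top_iff_one]
      intro h1
      rw [Submodule.mem_colon] at h1
      have h2 := h1 _ (Ideal.mem_span_singleton_self _)
      rw [one_smul, by_mem BY ha] at h2
      exact hu1 (by simpa using h2 0)
    · intro r hr
      rw [Submodule.mem_colon]
      intro p hp
      obtain ⟨s, rfl⟩ := Ideal.mem_span_singleton'.1 hp
      rw [smul_eq_mul, mul_left_comm]
      refine Ideal.mul_mem_left _ _ ?_
      have h3 : extY BY (d := d) (maximalIdeal B) * Ideal.span {algebraMap _ BY (MvPolynomial.C (σ := Fin d) u)} ≤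
          extY BY (d := d) a := by
        have : Ideal.span {algebraMap _ BY (MvPolynomial.C (σ := Fin d) u)} = extY BY (d := d) (Ideal.span {u}) := by
          rw [extY, Ideal.map_span, Ideal.map_span]; simp
        rw [this, extY, extY, ← Ideal.map_mul, ← Ideal.map_mul]
        refine Ideal.map_mono (Ideal.map_mono ?_)
        rw [Ideal.mul_le]
        intro r hr p hp
        obtain ⟨s, rfl⟩ := Ideal.mem_span_singleton'.1 hp
        rw [mul_left_comm]
        exact Ideal.mul_mem_left _ _ (hu2 r hr)
      refine h3 (Ideal.mul_mem_mul ?_ (Ideal.mem_span_singleton_self _))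
      rw [by_max]; exact hr
  have h4 := len_colon a u
  have h5 := len_colon (extY BY (d := d) a) (algebraMap _ BY (MvPolynomial.C (σ := Fin d) u))
  rw [hc1, len_max] at h4
  rw [hc2, len_max] at h5
  have h6 : Ideal.span {algebraMap _ BY (MvPolynomial.C (σ := Fin d) u)} ⊔ extY BY (d := d) a =
      extY BY (d := d) (Ideal.span {u} ⊔ a) := by
    rw [extY, extY, Ideal.map_sup, Ideal.map_sup, Ideal.map_span, Ideal.map_span]; simp
  obtain ⟨m, hm⟩ : ∃ m : ℕ, len (Ideal.span {u} ⊔ a) = m := by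
    refine ⟨_, (ENat.natCast_toNat ?_).symm⟩
    intro h7
    rw [h7, hn] at h4; simp at h4
  rw [hn, hm] at h4
  have h7 : n = 1 + m := by exact_mod_cast h4
  rw [h5, h6, ih m (by omega) (ha.trans le_sup_right) hm, h7]
  push_cast; rfl

lemma len_comap {A A' : Type*} [CommRing A] [CommRing A'] (f : A →+* A') (hf : Function.Surjective f)
    (Q : Ideal A') : len (Q.comap f) = len Q := by
  let _ := f.toAlgebra
  rw [len, len, ← Module.length_eq_of_surjective (S := A) (R := A') (M := A' ⧸ Q) hf]
  have hk : LinearMap.ker (Algebra.linearMap A (A' ⧸ Q)) = Q.comap f := by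
    ext a
    rw [LinearMap.mem_ker, Algebra.linearMap_apply, Ideal.mem_comap, ← Ideal.Quotient.eq_zero_iff_mem]
    rfl
  have hs : Function.Surjective (Algebra.linearMap A (A' ⧸ Q)) := by
    intro b
    obtain ⟨b, rfl⟩ := Ideal.Quotient.mk_surjective b
    obtain ⟨a, rfl⟩ := hf b
    exact ⟨a, rfl⟩
  rw [← hk]
  exact (LinearMap.quotKerEquivOfSurjective _ hs).length_eq

lemma by_colon [IsLocalRing BY] {x : Fin (d + 1) → B} (h : QS x) (n : ℕ) :
    (extY BY (d := d) (nI (Jx x) (n + 1))).colon (Ideal.span {algebraMap _ BY (yg x 0)}) =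
      extY BY (d := d) (nI (Jx x) n) := by
  have hp : ∀ n, ∃ N, maximalIdeal B ^ N ≤ nI (Jx x) n := by
    intro n
    obtain ⟨N, hN⟩ := h.prim
    refine ⟨N * n, ?_⟩
    rw [pow_mul]
    exact (Ideal.pow_right_mono hN n).trans (pow_le_nI _ _)
  obtain ⟨N1, hN1⟩ := hp (n + 1)
  have e : Jx (yg x) = (Jx x).map MvPolynomial.C := by rw [yg, Jx_lin, Jx_C]
  apply le_antisymm
  · intro b hb
    rw [Submodule.mem_colon] at hb
    have h1 := hb _ (Ideal.mem_span_singleton_self _)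
    obtain ⟨u, g, hu, hg⟩ := by_surj (B := B) (d := d) BY b
    rw [← Ideal.unit_mul_mem_iff_mem _ (by_unit BY hu), hg]
    refine Ideal.mem_map_of_mem _ (MvPolynomial.mem_map_C_iff.2 ?_)
    have h2 : algebraMap _ BY (yg x 0 * g) ∈ extY BY (d := d) (nI (Jx x) (n + 1)) := by
      rw [map_mul, ← hg, mul_left_comm, mul_comm _ b]
      exact Ideal.mul_mem_left _ _ h1
    rw [by_mem BY hN1, ← mem_nI_map_C, ← e] at h2
    have h3 := ((h.qr.poly (σ := Fin d)).lin MvPolynomial.X).cancel_As 0 h2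
    rw [← mem_nI_map_C, ← e]
    exact h3
  · intro b hb
    rw [Submodule.mem_colon]
    intro p hp
    obtain ⟨s, rfl⟩ := Ideal.mem_span_singleton'.1 hp
    rw [smul_eq_mul, mul_left_comm]
    refine Ideal.mul_mem_left _ _ ?_
    have h1 : algebraMap _ BY (yg x 0) ∈ extY BY (d := d) (Jx x ^ 1) := by
      refine Ideal.mem_map_of_mem _ ?_
      rw [pow_one, ← e]; exact Ideal.subset_span ⟨0, rfl⟩
    have h2 := Ideal.mul_mem_mul hb h1
    rw [← Ideal.map_mul, ← Ideal.map_mul] at h2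
    exact Ideal.map_mono (Ideal.map_mono ((Ideal.mul_mono_right (pow_le_nI _ _)).trans (nI_mul_le _ _ _))) h2

lemma by_len [IsLocalRing BY] {x : Fin (d + 1) → B} (h : QS x) (n : ℕ) {l l' : ℕ}
    (hl : len (nI (Jx x) n) = l) (hl' : len (nI (Jx x) (n + 1)) = l') :
    ∃ k : ℕ, len (((extY BY (d := d) (nI (Jx x) (n + 1)))).map
      (Ideal.Quotient.mk (Ideal.span {algebraMap _ BY (yg x 0)}))) = k ∧ l' = l + k := by
  have hp : ∀ n, ∃ N, maximalIdeal B ^ N ≤ nI (Jx x) n := by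
    intro n
    obtain ⟨N, hN⟩ := h.prim
    refine ⟨N * n, ?_⟩
    rw [pow_mul]
    exact (Ideal.pow_right_mono hN n).trans (pow_le_nI _ _)
  obtain ⟨N0, hN0⟩ := hp n
  obtain ⟨N1, hN1⟩ := hp (n + 1)
  have h1 := len_colon (extY BY (d := d) (nI (Jx x) (n + 1))) (algebraMap _ BY (yg x 0))
  rw [by_colon BY h, len_ext BY _ hN0 hl, len_ext BY _ hN1 hl'] at h1
  rw [← len_comap _ Ideal.Quotient.mk_surjective, Ideal.comap_map_of_surjective _ Ideal.Quotient.mk_surjective,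
    ← RingHom.ker_eq_comap_bot, Ideal.mk_ker, sup_comm]
  obtain ⟨k, hk⟩ : ∃ k : ℕ, len (Ideal.span {algebraMap _ BY (yg x 0)} ⊔ extY BY (d := d) (nI (Jx x) (n + 1))) = k := by
    refine ⟨_, (ENat.natCast_toNat ?_).symm⟩
    intro h7
    rw [h7] at h1; simp at h1
  refine ⟨k, hk, ?_⟩
  rw [hk] at h1
  exact_mod_cast h1

end by_

section final

universe u

lemma pascal (d n i : ℕ) (hi : i ≤ d) (hn : 1 ≤ n) :
    ((n + (d + 1) - i).choose (d + 1 - i) : ℤ) - ((n - 1 + (d + 1) - i).choose (d + 1 - i) : ℕ) =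
      ((n + d - i).choose (d - i) : ℕ) := by
  rw [show n + (d + 1) - i = (n + d - i) + 1 by omega, show d + 1 - i = (d - i) + 1 by omega,
    show n - 1 + (d + 1) - i = n + d - i by omega, Nat.choose_succ_succ]
  push_cast; ring

/-- the reduction to dimension three -/
theorem huckaba (k : ℕ) : ∀ (B : Type u) [CommRing B] [IsLocalRing B] [IsNoetherianRing B]
    (x : Fin (k + 3) → B) (_ : QS x) (_ : RB x) (e : ℕ → ℤ) (_ : HP x e) (_ : e 3 = 0) (n : ℕ),
    nI (Jx x) (n + 2) ≤ Jx x ^ n := by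
  induction k with
  | zero => intro B _ _ _ x h hR e hP he n; exact dim3 h hR hP he n
  | succ k ih =>
    intro B _ _ _ x h hR e hP he n
    set d := k + 3 with hd
    have hdd : k + 1 + 3 = d + 1 := by omega
    revert x
    rw [hdd]
    intro x h hR hP
    let BY := Localization.AtPrime (mS B d)
    let S := MvPolynomial (Fin d) B
    let q : Ideal BY := Ideal.span {algebraMap S BY (yg x 0)}
    let B1 := BY ⧸ q
    let φ : S →+* B1 := (Ideal.Quotient.mk q).comp (algebraMap S BY)
    have hyg : yg x 0 ∈ mS B d := by
      rw [mS]
      have e1 : Jx (yg x) = (Jx x).map MvPolynomial.C := by rw [yg, Jx_lin, Jx_C]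
      refine Ideal.map_mono h.le ?_
      rw [← e1]; exact Ideal.subset_span ⟨0, rfl⟩
    have hnt : Nontrivial B1 := by
      refine Ideal.Quotient.nontrivial_iff.2 fun htop => ?_
      have h1 : q ≤ maximalIdeal BY := by
        rw [Ideal.span_singleton_le_iff_mem, ← IsLocalization.AtPrime.map_eq_maximalIdeal (mS B d) BY]
        exact Ideal.mem_map_of_mem _ hyg
      rw [htop, top_le_iff] at h1
      exact (maximalIdeal.isMaximal BY).ne_top h1
    have hloc : IsLocalRing B1 := IsLocalRing.of_surjective' (Ideal.Quotient.mk q) Ideal.Quotient.mk_surjective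
    have hNS : IsNoetherianRing S := inferInstance
    have hN : IsNoetherianRing BY := IsLocalization.isNoetherianRing (mS B d).primeCompl BY hNS
    have hN1 : IsNoetherianRing B1 := inferInstance
    have hg : Gen (B1 := B1) x φ := by
      refine ⟨fun u hu => (by_unit BY hu).map (Ideal.Quotient.mk q), fun b => ?_, fun g hg => ?_, ?_⟩
      · obtain ⟨b, rfl⟩ := Ideal.Quotient.mk_surjective b
        obtain ⟨u, g, hu, hug⟩ := by_surj (B := B) (d := d) BY b
        exact ⟨u, g, hu, by simp only [φ, RingHom.comp_apply]; rw [← map_mul, hug]⟩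
      · have h1 : algebraMap S BY g ∈ (Ideal.span {yg x 0}).map (algebraMap S BY) := by
          rw [Ideal.map_span, Set.image_singleton]
          exact Ideal.Quotient.eq_zero_iff_mem.1 hg
        obtain ⟨u, hu, h2⟩ := (IsLocalization.algebraMap_mem_map_algebraMap_iff (mS B d).primeCompl BY _ g).1 h1
        exact ⟨u, mem_mS.1 hu, h2⟩
      · exact Ideal.Quotient.eq_zero_iff_mem.2 (Ideal.mem_span_singleton_self _)
    have i0 : Fin d := ⟨0, by omega⟩
    obtain ⟨M, hM⟩ := hg.eventually h hR i0
    have hP1 : HP (xb (B1 := B1) x φ) e := by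
      obtain ⟨N, hN⟩ := hP
      refine ⟨N + M + 1, fun n hn => ?_⟩
      obtain ⟨l, hl1, hl2⟩ := hN (n - 1) (by omega)
      obtain ⟨l', hl1', hl2'⟩ := hN n (by omega)
      rw [show n - 1 + 1 = n by omega] at hl1
      obtain ⟨r, hr1, hr2⟩ := by_len BY h n hl1 hl1'
      refine ⟨r, ?_, ?_⟩
      · rw [hM (n + 1) (by omega), ext1, ← hr1, extY, Ideal.map_map _ (Ideal.Quotient.mk q)]
      · have : (r : ℤ) = l' - l := by rw [hr2]; push_cast; ring
        rw [this, hl2, hl2', ← Finset.sum_sub_distrib, Finset.sum_range_succ]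
        have h0 : (-1 : ℤ) ^ (d + 1) * e (d + 1) * ((n + (d + 1) - (d + 1)).choose (d + 1 - (d + 1)) : ℕ) -
            (-1 : ℤ) ^ (d + 1) * e (d + 1) * ((n - 1 + (d + 1) - (d + 1)).choose (d + 1 - (d + 1)) : ℕ) = 0 := by
          simp
        rw [h0, add_zero]
        refine Finset.sum_congr rfl fun i hi => ?_
        rw [Finset.mem_range] at hi
        rw [← pascal d n i (by omega) (by omega)]; ring
    intro z hz
    have h1 := ih B1 (xb (B1 := B1) x φ) (hg.qs h) (hg.rb h hR i0) e hP1 he n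
      (hg.ext_nI _ (Ideal.mem_map_of_mem _ (Ideal.mem_map_of_mem _ hz)))
    rw [hg.mem_pow h] at h1
    exact pull_const h.qr i0 h1

end final
end CMP

namespace CMP

section homog

variable {σ K : Type*} [CommRing K]

/-- the grading as a polynomial -/
noncomputable def gr : MvPolynomial σ K →ₐ[K] (MvPolynomial σ K)[X] :=
  MvPolynomial.aeval (fun i => Polynomial.C (MvPolynomial.X i) * Polynomial.X)

lemma gr_monomial (a : σ →₀ ℕ) (r : K) :
    gr (MvPolynomial.monomial a r) = Polynomial.monomial a.degree (MvPolynomial.monomial a r) := by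
  unfold gr
  rw [MvPolynomial.aeval_monomial, Finsupp.prod]
  simp only [mul_pow, Finset.prod_mul_distrib, Finset.prod_pow_eq_pow_sum]
  rw [MvPolynomial.monomial_eq, Finsupp.prod, ← Polynomial.C_mul_X_pow_eq_monomial,
    map_mul, map_prod, Finsupp.degree, ← mul_assoc]
  simp only [map_pow]
  rfl

lemma gr_of_hom {p : MvPolynomial σ K} {n : ℕ} (hp : p.IsHomogeneous n) :
    gr p = Polynomial.monomial n p := by
  conv_lhs => rw [p.as_sum]
  conv_rhs => rw [p.as_sum]
  rw [map_sum, map_sum]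
  refine Finset.sum_congr rfl fun a ha => ?_
  rw [gr_monomial]
  have h1 : a.degree = n := by
    rw [Finsupp.degree_eq_weight_one]
    exact hp (MvPolynomial.mem_support_iff.1 ha)
  rw [h1]

lemma gr_eval (p : MvPolynomial σ K) : (gr p).eval 1 = p := by
  have : (Polynomial.evalRingHom (1 : MvPolynomial σ K)).comp
      (gr : MvPolynomial σ K →ₐ[K] _).toRingHom = RingHom.id _ := by
    refine MvPolynomial.ringHom_ext ?_ ?_
    · intro r; simp [gr, Polynomial.algebraMap_apply]
    · intro i; simp [gr]
  exact RingHom.congr_fun this p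

lemma coeff_gr_hom (p : MvPolynomial σ K) (n : ℕ) : ((gr p).coeff n).IsHomogeneous n := by
  rw [p.as_sum, map_sum, Polynomial.finsetSum_coeff]
  refine MvPolynomial.IsHomogeneous.sum _ _ _ fun a _ => ?_
  rw [gr_monomial, Polynomial.coeff_monomial]
  split_ifs with h
  · exact MvPolynomial.isHomogeneous_monomial _ h
  · exact MvPolynomial.isHomogeneous_zero _ _ _

/-- factors of forms are forms -/
lemma hom_of_mul [IsDomain K] {p q : MvPolynomial σ K} {n : ℕ} (hpq : (p * q).IsHomogeneous n)
    (h0 : p * q ≠ 0) : ∃ j k, j + k = n ∧ p.IsHomogeneous j ∧ q.IsHomogeneous k := by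
  have h1 := gr_of_hom hpq
  rw [map_mul] at h1
  have hne : gr p * gr q ≠ 0 := by
    rw [h1]; simpa using h0
  have hp : gr p ≠ 0 := left_ne_zero_of_mul hne
  have hq : gr q ≠ 0 := right_ne_zero_of_mul hne
  have e1 := Polynomial.natDegree_mul hp hq
  have e2 := Polynomial.natTrailingDegree_mul hp hq
  rw [h1, Polynomial.natDegree_monomial_eq _ h0] at e1
  rw [h1, Polynomial.natTrailingDegree_monomial h0] at e2
  have e3 := Polynomial.natTrailingDegree_le_natDegree (gr p)
  have e4 := Polynomial.natTrailingDegree_le_natDegree (gr q)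
  have key : ∀ r : MvPolynomial σ K, (gr r).natTrailingDegree = (gr r).natDegree →
      r.IsHomogeneous (gr r).natDegree := by
    intro r hr
    have : gr r = Polynomial.monomial (gr r).natDegree ((gr r).coeff (gr r).natDegree) := by
      ext1 m
      rw [Polynomial.coeff_monomial]
      split_ifs with h
      · rw [h]
      · rcases lt_or_gt_of_ne h with h | h
        · exact Polynomial.coeff_eq_zero_of_natDegree_lt h
        · exact Polynomial.coeff_eq_zero_of_lt_natTrailingDegree (by omega)
    have h2 := gr_eval r
    rw [this, Polynomial.eval_monomial, one_pow, mul_one] at h2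
    have h3 := coeff_gr_hom r (gr r).natDegree
    rwa [h2] at h3
  exact ⟨_, _, e1.symm, key p (by omega), key q (by omega)⟩

lemma hom_of_mul_left [IsDomain K] {p q : MvPolynomial σ K} {n k : ℕ}
    (hpq : (p * q).IsHomogeneous (k + n)) (hp : p.IsHomogeneous k) (hp0 : p ≠ 0) :
    q.IsHomogeneous n := by
  by_cases hq : q = 0
  · rw [hq]; exact MvPolynomial.isHomogeneous_zero _ _ _
  obtain ⟨j, l, h1, h2, h3⟩ := hom_of_mul hpq (mul_ne_zero hp0 hq)
  have := hp.inj_right h2 hp0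
  have : l = n := by omega
  rwa [← this]

end homog

section lift

variable {B : Type*} [CommRing B] [IsLocalRing B] {d : ℕ}

lemma lift_hom {n : ℕ} {p : MvPolynomial (Fin d) (ResidueField B)} (hp : p.IsHomogeneous n) :
    ∃ P : MvPolynomial (Fin d) B, P.IsHomogeneous n ∧ MvPolynomial.map (residue B) P = p := by
  choose g hg using fun a => residue_surjective (R := B) (p.coeff a)
  refine ⟨∑ a ∈ p.support, MvPolynomial.monomial a (g a), ?_, ?_⟩
  · refine MvPolynomial.IsHomogeneous.sum _ _ _ fun a ha => ?_
    refine MvPolynomial.isHomogeneous_monomial _ ?_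
    have := hp (MvPolynomial.mem_support_iff.1 ha)
    rw [Finsupp.degree_eq_weight_one]
    exact this
  · rw [map_sum]
    conv_rhs => rw [p.as_sum]
    refine Finset.sum_congr rfl fun a _ => ?_
    rw [MvPolynomial.map_monomial, hg]

lemma map_eq_iff (P Q : MvPolynomial (Fin d) B) :
    MvPolynomial.map (residue B) P = MvPolynomial.map (residue B) Q ↔
      ∀ a, (P - Q).coeff a ∈ maximalIdeal B := by
  rw [← sub_eq_zero, ← map_sub, MvPolynomial.ext_iff]
  refine forall_congr' fun a => ?_
  rw [MvPolynomial.coeff_map, MvPolynomial.coeff_zero, residue_eq_zero_iff]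

variable {x : Fin d → B}

/-- polynomials with coefficients in `m` -/
lemma eval_mem_nI (hm : maximalIdeal B ≤ nI (Jx x) 1) {n : ℕ} {F : MvPolynomial (Fin d) B}
    (hF : F.IsHomogeneous n) (h : ∀ a, F.coeff a ∈ maximalIdeal B) :
    MvPolynomial.eval x F ∈ nI (Jx x) (n + 1) := by
  have h1 := eval_mem_of_coeff x hF h
  have h2 : maximalIdeal B * Jx x ^ n ≤ nI (Jx x) (1 + n) :=
    le_trans (Ideal.mul_mono hm (pow_le_nI _ n)) (nI_mul_le _ 1 n)
  rw [add_comm]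
  exact h2 h1

lemma pow_sub_pow_mem {J : Ideal B} {s : ℕ} {a b : B} (ha : a ∈ nI J s) (hb : b ∈ nI J s)
    (hab : a - b ∈ nI J (s + 1)) (k : ℕ) : a ^ k - b ^ k ∈ nI J (s * k + 1) := by
  induction k with
  | zero => simp
  | succ k ih =>
    have e : a ^ (k+1) - b ^ (k+1) = a * (a ^ k - b ^ k) + b ^ k * (a - b) := by ring
    rw [e]
    refine Ideal.add_mem _ ?_ ?_
    · have := mul_mem_nI ha ih
      rwa [show s * (k+1) + 1 = s + (s * k + 1) by ring]
    · have := mul_mem_nI (pow_mem_nI hb k) hab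
      rwa [show s * (k+1) + 1 = s * k + (s + 1) by ring]

end lift

end CMP

namespace CMP

section ufd

/-- `k[X]` is integrally closed, in elementary form -/
lemma dvd_of_integral {D : Type*} [CommRing D] [IsDomain D] [UniqueFactorizationMonoid D]
    {a b : D} (ha : a ≠ 0) {p : ℕ} (hp : 0 < p) (c : ℕ → D)
    (h : b ^ p + ∑ i ∈ Finset.Icc 1 p, a ^ i * c i * b ^ (p - i) = 0) : a ∣ b := by
  obtain ⟨a', b', c', hr, h1, h2⟩ := UniqueFactorizationMonoid.exists_reduced_factors a ha b
  have hc' : c' ≠ 0 := by rintro rfl; apply ha; rw [← h1, zero_mul]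
  have e : c' ^ p * (b' ^ p + ∑ i ∈ Finset.Icc 1 p, a' ^ i * c i * b' ^ (p - i)) = 0 := by
    rw [← h, mul_add, Finset.mul_sum, ← h1, ← h2, mul_pow]
    congr 1
    refine Finset.sum_congr rfl fun i hi => ?_
    rw [Finset.mem_Icc] at hi
    have : c' ^ p = c' ^ i * c' ^ (p - i) := by rw [← pow_add]; congr 1; omega
    rw [this]; ring
  have e2 := (mul_eq_zero.1 e).resolve_left (pow_ne_zero _ hc')
  have e3 : a' ∣ b' ^ p := by
    have : b' ^ p = - ∑ i ∈ Finset.Icc 1 p, a' ^ i * c i * b' ^ (p - i) :=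
      eq_neg_of_add_eq_zero_left e2
    rw [this, dvd_neg]
    refine Finset.dvd_sum fun i hi => ?_
    rw [Finset.mem_Icc] at hi
    exact dvd_mul_of_dvd_left (dvd_mul_of_dvd_left (dvd_pow_self _ (by omega)) _) _
  have hu : IsUnit a' := hr.pow_right (dvd_refl _) e3
  rw [← h1, ← h2]
  exact mul_dvd_mul_left _ hu.dvd

end ufd

section key

variable {B : Type*} [CommRing B] [IsLocalRing B] [IsNoetherianRing B] {d : ℕ} {x : Fin d → B}

lemma key_lemma (h : QS x) (hm : maximalIdeal B ≤ nI (Jx x) 1) {f c : ℕ}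
    {F : MvPolynomial (Fin d) B} (hF : F.IsHomogeneous f) (hu : UC F) {τ g : B}
    (hτ : τ ∈ nI (Jx x) (c + 1)) (hg : g ∈ Jx x ^ (f + c + 1))
    (hz : MvPolynomial.eval x F * τ + g ∈ nI (Jx x) (f + c + 2)) :
    ∃ H ∈ Jx x ^ (c + 1), τ - H ∈ nI (Jx x) (c + 2) := by
  obtain ⟨G, hG, rfl⟩ := (mem_Jx_pow _ _ _).1 hg
  obtain ⟨p, hp, a, ha, heq⟩ := integral_of_As hτ
  have ha' : ∀ i ∈ Finset.Icc 1 p, ∃ A : MvPolynomial (Fin d) B,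
      A.IsHomogeneous ((c + 1) * i) ∧ MvPolynomial.eval x A = a i := by
    intro i hi
    have := ha i hi
    rw [← pow_mul] at this
    exact (mem_Jx_pow _ _ _).1 this
  choose! A hA hAe using ha'
  set φ := MvPolynomial.eval x F with hφ
  have hφJ : φ ∈ nI (Jx x) f := pow_le_nI _ _ ((mem_Jx_pow _ _ _).2 ⟨F, hF, rfl⟩)
  set s := f + c + 1 with hs
  have hA1 : φ * τ ∈ nI (Jx x) s := by
    have := mul_mem_nI hφJ hτ
    rwa [← add_assoc] at this
  have hB1 : - MvPolynomial.eval x G ∈ nI (Jx x) s := by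
    rw [Ideal.neg_mem_iff]; exact pow_le_nI _ _ hg
  have hAB : φ * τ - - MvPolynomial.eval x G ∈ nI (Jx x) (s + 1) := by
    rw [sub_neg_eq_add]; exact hz
  have hpow := pow_sub_pow_mem hA1 hB1 hAB
  set W : MvPolynomial (Fin d) B := (-G) ^ p + ∑ i ∈ Finset.Icc 1 p, F ^ i * A i * (-G) ^ (p - i)
    with hW
  have hGn : (-G).IsHomogeneous s := hG.neg
  have hWh : W.IsHomogeneous (s * p) := by
    refine (hGn.pow p).add (MvPolynomial.IsHomogeneous.sum _ _ _ fun i hi => ?_)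
    have h1 := ((hF.pow i).mul (hA i hi)).mul (hGn.pow (p - i))
    rw [Finset.mem_Icc] at hi
    have : f * i + (c + 1) * i + s * (p - i) = s * p := by
      obtain ⟨q, rfl⟩ : ∃ q, p = i + q := ⟨p - i, by omega⟩
      rw [Nat.add_sub_cancel_left, hs]; ring
    rwa [this] at h1
  have hWe : MvPolynomial.eval x W ∈ nI (Jx x) (s * p + 1) := by
    have e0 : (φ * τ) ^ p + ∑ i ∈ Finset.Icc 1 p, φ ^ i * a i * (φ * τ) ^ (p - i) = 0 := by
      have : φ ^ p * (τ ^ p + ∑ i ∈ Finset.Icc 1 p, a i * τ ^ (p - i)) = 0 := by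
        rw [heq, mul_zero]
      rw [← this, mul_add, mul_pow, Finset.mul_sum]
      congr 1
      refine Finset.sum_congr rfl fun i hi => ?_
      rw [Finset.mem_Icc] at hi
      have : φ ^ p = φ ^ i * φ ^ (p - i) := by rw [← pow_add]; congr 1; omega
      rw [this]; ring
    have e1 : MvPolynomial.eval x W = - (((φ * τ) ^ p - (- MvPolynomial.eval x G) ^ p) +
        ∑ i ∈ Finset.Icc 1 p, φ ^ i * a i *
          ((φ * τ) ^ (p - i) - (- MvPolynomial.eval x G) ^ (p - i))) := by
      rw [hW, map_add, map_sum, map_pow, map_neg]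
      have : ∀ i ∈ Finset.Icc 1 p, MvPolynomial.eval x (F ^ i * A i * (-G) ^ (p - i)) =
          φ ^ i * a i * (- MvPolynomial.eval x G) ^ (p - i) := by
        intro i hi
        rw [map_mul, map_mul, map_pow, map_pow, map_neg, hAe i hi]
      rw [Finset.sum_congr rfl this]
      simp only [mul_sub, Finset.sum_sub_distrib]
      linear_combination e0
    rw [e1, Ideal.neg_mem_iff]
    refine Ideal.add_mem _ (hpow p) (Ideal.sum_mem _ fun i hi => ?_)
    have h1 : φ ^ i * a i ∈ nI (Jx x) (f * i + (c + 1) * i) := by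
      refine mul_mem_nI (pow_mem_nI hφJ i) (pow_le_nI _ _ ?_)
      have := ha i hi
      rwa [← pow_mul] at this
    have h2 := mul_mem_nI h1 (hpow (p - i))
    rw [Finset.mem_Icc] at hi
    have : f * i + (c + 1) * i + (s * (p - i) + 1) = s * p + 1 := by
      obtain ⟨q, rfl⟩ : ∃ q, p = i + q := ⟨p - i, by omega⟩
      rw [Nat.add_sub_cancel_left, hs]; ring
    rwa [this] at h2
  have hW0 : MvPolynomial.map (residue B) W = 0 := by
    have := (map_eq_iff W 0).2 (fun b => by
      rw [sub_zero]; exact h.coeff_mem_of_nI hWh hWe b)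
    rwa [map_zero] at this
  have hF0 := (UC_iff F).1 hu
  have hdvd : MvPolynomial.map (residue B) F ∣ MvPolynomial.map (residue B) (-G) := by
    refine dvd_of_integral hF0 hp (fun i => MvPolynomial.map (residue B) (A i)) ?_
    rw [← hW0, hW, map_add, map_sum, map_pow]
    simp only [map_mul, map_pow]
  obtain ⟨y, hy⟩ := hdvd
  have hyh : y.IsHomogeneous (c + 1) := by
    refine hom_of_mul_left (p := MvPolynomial.map (residue B) F) (k := f) ?_ (hF.map _) hF0
    rw [← hy]
    exact hGn.map _
  obtain ⟨Y, hY, hYm⟩ := lift_hom hyh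
  refine ⟨MvPolynomial.eval x Y, (mem_Jx_pow _ _ _).2 ⟨Y, hY, rfl⟩, ?_⟩
  have h1 : ∀ b, (-G - F * Y).coeff b ∈ maximalIdeal B := by
    rw [← map_eq_iff, hy, map_mul, hYm]
  have h2 := eval_mem_nI hm (n := s) (hGn.sub (hF.mul hY)) h1
  refine h.cancel_nI (f := f) hF hu ?_
  have h3 := Ideal.add_mem _ hz h2
  have e : φ * (τ - MvPolynomial.eval x Y) = φ * τ + MvPolynomial.eval x G +
      MvPolynomial.eval x (-G - F * Y) := by
    rw [map_sub, map_neg, map_mul, ← hφ]; ring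
  rw [← hφ, e]
  exact h3

end key

end CMP

namespace CMP

section soc

variable {B : Type*} [CommRing B] [IsLocalRing B] {d : ℕ} {x : Fin d → B}

lemma mem_soc {J : Ideal B} {z : B} :
    z ∈ J.colon (maximalIdeal B) ↔ ∀ p ∈ maximalIdeal B, z * p ∈ J := by
  rw [Submodule.mem_colon]; rfl

lemma decomp {n : ℕ} {F : MvPolynomial (Fin d) B} (hF : F.IsHomogeneous n) {P : Ideal B} {σ : B}
    (h : ∀ a, F.coeff a ∈ P ⊔ Ideal.span {σ}) :
    ∃ f G : MvPolynomial (Fin d) B, f.IsHomogeneous n ∧ G.IsHomogeneous n ∧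
      F = MvPolynomial.C σ * f + G ∧ ∀ a, G.coeff a ∈ P := by
  have h' : ∀ a, ∃ r, F.coeff a - σ * r ∈ P := by
    intro a
    obtain ⟨y, hy, z, hz, hyz⟩ := Submodule.mem_sup.1 (h a)
    obtain ⟨r, rfl⟩ := Ideal.mem_span_singleton'.1 hz
    refine ⟨r, ?_⟩
    rw [← hyz, mul_comm, add_sub_cancel_right]; exact hy
  choose r hr using h'
  set f : MvPolynomial (Fin d) B := ∑ a ∈ mons d n, MvPolynomial.monomial a (r a) with hf
  have hfh : f.IsHomogeneous n := isHomogeneous_sum_mons r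
  have hGh : (F - MvPolynomial.C σ * f).IsHomogeneous n := by
    refine hF.sub ?_
    have := (MvPolynomial.isHomogeneous_C (Fin d) σ).mul hfh
    rwa [zero_add] at this
  refine ⟨f, F - MvPolynomial.C σ * f, hfh, hGh, by ring, fun a => ?_⟩
  by_cases ha : a ∈ mons d n
  · rw [MvPolynomial.coeff_sub, MvPolynomial.coeff_C_mul, hf, coeff_sum_mons r ha]
    exact hr a
  · have : (F - MvPolynomial.C σ * f).coeff a = 0 := by
      by_contra h0
      exact ha (mem_mons.2 (deg_of_isHom hGh h0))
    rw [this]; exact zero_mem _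

lemma hom_C_mul {n : ℕ} {F : MvPolynomial (Fin d) B} (hF : F.IsHomogeneous n) (r : B) :
    (MvPolynomial.C r * F).IsHomogeneous n := by
  have := (MvPolynomial.isHomogeneous_C (Fin d) r).mul hF
  rwa [zero_add] at this

lemma coeff_mem_soc (h : QS x) (hm : maximalIdeal B ≤ nI (Jx x) 1)
    (hsub : ∀ n, nI (Jx x) (n + 2) ≤ Jx x ^ n) {n : ℕ}
    {F : MvPolynomial (Fin d) B} (hF : F.IsHomogeneous n)
    (hz : MvPolynomial.eval x F ∈ nI (Jx x) (n + 2)) (a) :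
    F.coeff a ∈ (Jx x).colon (maximalIdeal B) := by
  rw [mem_soc]
  intro p hp
  have h1 : MvPolynomial.eval x (MvPolynomial.C p * F) ∈ Jx x ^ (n + 1) := by
    refine hsub (n+1) ?_
    rw [map_mul, MvPolynomial.eval_C]
    have := mul_mem_nI (hm hp) hz
    rwa [show 1 + (n + 2) = n + 1 + 2 by ring] at this
  have h2 := h.qr _ _ (hom_C_mul hF p) h1 a
  rwa [MvPolynomial.coeff_C_mul, mul_comm] at h2

/-- the goal follows from a statement on coefficients -/
lemma goal_of_coeff (h : QS x) (hm : maximalIdeal B ≤ nI (Jx x) 1)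
    (hsub : ∀ n, nI (Jx x) (n + 2) ≤ Jx x ^ n) (n : ℕ)
    (H : ∀ (F : MvPolynomial (Fin d) B), F.IsHomogeneous n →
      MvPolynomial.eval x F ∈ nI (Jx x) (n + 2) → ∀ a, F.coeff a ∈ Jx x ⊔ nI (Jx x) 2) :
    nI (Jx x) (n + 2) ≤ Jx x ^ n * nI (Jx x) 2 := by
  intro z hz
  obtain ⟨F, hF, rfl⟩ := (mem_Jx_pow _ _ _).1 (hsub n hz)
  have h1 := eval_mem_of_coeff x hF (H F hF hz)
  rw [Ideal.sup_mul] at h1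
  obtain ⟨u, hu, v, hv, huv⟩ := Submodule.mem_sup.1 h1
  have hv2 : v ∈ nI (Jx x) (n + 2) := by
    have : nI (Jx x) 2 * Jx x ^ n ≤ nI (Jx x) (2 + n) :=
      le_trans (Ideal.mul_mono le_rfl (pow_le_nI _ n)) (nI_mul_le _ _ _)
    rw [add_comm]; exact this hv
  have hu2 : u ∈ nI (Jx x) (n + 1 + 1) := by
    rw [← huv] at hz
    exact (Ideal.add_mem_iff_left _ hv2).1 hz
  have hu3 := h.nI_inf_pow hu2 (by rw [pow_succ']; exact hu)
  have hle : maximalIdeal B * Jx x ^ (n + 1) ≤ Jx x ^ n * nI (Jx x) 2 := by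
    rw [pow_succ, mul_left_comm]
    refine Ideal.mul_mono le_rfl ?_
    refine le_trans (Ideal.mul_mono hm ?_) (nI_mul_le (Jx x) 1 1)
    have := pow_le_nI (Jx x) 1
    rwa [pow_one] at this
  rw [← huv, mul_comm]
  refine Ideal.add_mem _ ?_ hv
  rw [mul_comm]
  exact hle hu3

end soc

section rankone

variable {B : Type*} [CommRing B] [IsLocalRing B] [IsNoetherianRing B] {d : ℕ} {x : Fin d → B}

/-- if `UC f` and `f σ` is in the closure then `σ ∈ J + I₂` -/
lemma mem_of_UC (h : QS x) (hm : maximalIdeal B ≤ nI (Jx x) 1) {n : ℕ}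
    {f : MvPolynomial (Fin d) B} (hf : f.IsHomogeneous n) (hu : UC f) {σ : B}
    (hσ : σ ∈ maximalIdeal B)
    (hz : MvPolynomial.eval x f * σ ∈ nI (Jx x) (n + 2) ⊔ Jx x ^ (n + 1)) :
    σ ∈ Jx x ⊔ nI (Jx x) 2 := by
  obtain ⟨u, hu1, v, hv, huv⟩ := Submodule.mem_sup.1 hz
  obtain ⟨H, hH, hH2⟩ := key_lemma h hm (c := 0) (τ := σ) (g := -v) hf hu (hm hσ)
    ((Ideal.neg_mem_iff _).2 hv) (by rw [← huv, add_neg_cancel_right]; exact hu1)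
  rw [zero_add, pow_one] at hH
  have : σ = H + (σ - H) := by ring
  rw [this]
  exact Submodule.add_mem_sup hH hH2

lemma case_one (h : QS x) (hm : maximalIdeal B ≤ nI (Jx x) 1)
    (hsub : ∀ n, nI (Jx x) (n + 2) ≤ Jx x ^ n) {σ : B} (hσ : σ ∈ maximalIdeal B)
    (hσs : σ ∈ (Jx x).colon (maximalIdeal B))
    (hσV : σ ∉ Jx x ⊔ nI (Jx x) 2)
    (hsoc : (Jx x).colon (maximalIdeal B) ≤ Jx x ⊔ nI (Jx x) 2 ⊔ Ideal.span {σ}) (n : ℕ) :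
    nI (Jx x) (n + 2) ≤ Jx x ^ n * nI (Jx x) 2 := by
  refine goal_of_coeff h hm hsub n fun F hF hz => ?_
  obtain ⟨f, G, hf, hG, hFG, hGc⟩ := decomp hF fun a => hsoc (coeff_mem_soc h hm hsub hF hz a)
  have hGe : MvPolynomial.eval x G ∈ nI (Jx x) (n + 2) ⊔ Jx x ^ (n + 1) := by
    have h1 := eval_mem_of_coeff x hG hGc
    rw [Ideal.sup_mul] at h1
    refine (sup_le (c := nI (Jx x) (n + 2) ⊔ Jx x ^ (n + 1)) ?_ ?_ : _ ≤ _) h1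
    · rw [pow_succ']; exact le_sup_right
    · refine le_sup_of_le_left ?_
      rw [add_comm n 2]
      exact le_trans (Ideal.mul_mono le_rfl (pow_le_nI _ n)) (nI_mul_le _ _ _)
  have hfm : ∀ a, f.coeff a ∈ maximalIdeal B := by
    by_contra hcon
    push Not at hcon
    refine hσV (mem_of_UC h hm hf hcon hσ ?_)
    have e : MvPolynomial.eval x f * σ = MvPolynomial.eval x F - MvPolynomial.eval x G := by
      rw [hFG, map_add, map_mul, MvPolynomial.eval_C]; ring
    rw [e]
    exact Ideal.sub_mem _ (Ideal.mem_sup_left hz) hGe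
  intro a
  rw [hFG, MvPolynomial.coeff_add, MvPolynomial.coeff_C_mul]
  exact Ideal.add_mem _ (Ideal.mem_sup_left (mem_soc.1 hσs _ (hfm a))) (hGc a)

end rankone

end CMP

namespace CMP

section alg

/-- the proportionality lemma -/
lemma prop_of_det {D : Type*} [CommRing D] [IsDomain D] [UniqueFactorizationMonoid D]
    {q1 q2 g1 g2 : D} (hr : IsRelPrime q1 q2) (h0 : q1 ≠ 0 ∨ q2 ≠ 0) (h : q1 * g2 = q2 * g1) :
    ∃ t, g1 = q1 * t ∧ g2 = q2 * t := by
  rcases h0 with h0 | h0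
  · obtain ⟨t, ht⟩ : q1 ∣ g1 := hr.dvd_of_dvd_mul_left (Dvd.intro _ h)
    refine ⟨t, ht, ?_⟩
    apply mul_left_cancel₀ h0
    rw [h, ht]; ring
  · obtain ⟨t, ht⟩ : q2 ∣ g2 := hr.symm.dvd_of_dvd_mul_left (Dvd.intro _ h.symm)
    refine ⟨t, ?_, ht⟩
    apply mul_left_cancel₀ h0
    rw [← h, ht]; ring

lemma reduced_pair {K : Type*} [Field K] {d n : ℕ} {p1 p2 : MvPolynomial (Fin d) K}
    (h1 : p1.IsHomogeneous n) (h2 : p2.IsHomogeneous n) (h0 : p1 ≠ 0 ∨ p2 ≠ 0) :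
    ∃ (q1 q2 h : MvPolynomial (Fin d) K) (a c : ℕ), a + c = n ∧ h.IsHomogeneous a ∧ h ≠ 0 ∧
      q1.IsHomogeneous c ∧ q2.IsHomogeneous c ∧ IsRelPrime q1 q2 ∧ (q1 ≠ 0 ∨ q2 ≠ 0) ∧
      p1 = h * q1 ∧ p2 = h * q2 := by
  have : ∃ q1 q2 h : MvPolynomial (Fin d) K, IsRelPrime q1 q2 ∧ h * q1 = p1 ∧ h * q2 = p2 := by
    rcases h0 with h0 | h0
    · exact UniqueFactorizationMonoid.exists_reduced_factors p1 h0 p2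
    · exact UniqueFactorizationMonoid.exists_reduced_factors' p1 p2 h0
  obtain ⟨q1, q2, h, hr, rfl, rfl⟩ := this
  rcases h0 with h0 | h0
  · obtain ⟨a, c, hac, ha, hc⟩ := hom_of_mul h1 h0
    subst hac
    exact ⟨q1, q2, h, a, c, rfl, ha, left_ne_zero_of_mul h0, hc,
      hom_of_mul_left h2 ha (left_ne_zero_of_mul h0), hr, Or.inl (right_ne_zero_of_mul h0), rfl, rfl⟩
  · obtain ⟨a, c, hac, ha, hc⟩ := hom_of_mul h2 h0
    subst hac
    exact ⟨q1, q2, h, a, c, rfl, ha, left_ne_zero_of_mul h0,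
      hom_of_mul_left h1 ha (left_ne_zero_of_mul h0), hc, hr, Or.inr (right_ne_zero_of_mul h0),
      rfl, rfl⟩

end alg

section ranktwo

variable {B : Type*} [CommRing B] [IsLocalRing B] [IsNoetherianRing B] {d : ℕ} {x : Fin d → B}

/-- the situation in type two -/
structure T2 (x : Fin d → B) (s1 s2 : B) : Prop where
  qs : QS x
  hm : maximalIdeal B ≤ nI (Jx x) 1
  hsub : ∀ n, nI (Jx x) (n + 2) ≤ Jx x ^ n
  hI2 : nI (Jx x) 2 ≤ Jx x
  m1 : s1 ∈ maximalIdeal B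
  m2 : s2 ∈ maximalIdeal B
  c1 : s1 ∈ (Jx x).colon (maximalIdeal B)
  c2 : s2 ∈ (Jx x).colon (maximalIdeal B)
  soc : (Jx x).colon (maximalIdeal B) ≤ Jx x ⊔ Ideal.span {s1} ⊔ Ideal.span {s2}
  ind : ∀ r1 r2, r1 * s1 + r2 * s2 ∈ Jx x → r1 ∈ maximalIdeal B ∧ r2 ∈ maximalIdeal B

variable {s1 s2 : B}

/-- pairs -/
structure Pr (x : Fin d → B) (s1 s2 : B) (n : ℕ) (f1 f2 : MvPolynomial (Fin d) B) : Prop where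
  h1 : f1.IsHomogeneous n
  h2 : f2.IsHomogeneous n
  mem : MvPolynomial.eval x f1 * s1 + MvPolynomial.eval x f2 * s2 ∈
    nI (Jx x) (n + 2) ⊔ Jx x ^ (n + 1)

lemma ev_mem {n : ℕ} {f : MvPolynomial (Fin d) B} (hf : f.IsHomogeneous n) :
    MvPolynomial.eval x f ∈ Jx x ^ n := (mem_Jx_pow _ _ _).2 ⟨f, hf, rfl⟩

lemma mul_W {k n : ℕ} {a z : B} (ha : a ∈ Jx x ^ k)
    (hz : z ∈ nI (Jx x) (n + 2) ⊔ Jx x ^ (n + 1)) :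
    a * z ∈ nI (Jx x) (k + n + 2) ⊔ Jx x ^ (k + n + 1) := by
  obtain ⟨u, hu, v, hv, rfl⟩ := Submodule.mem_sup.1 hz
  rw [mul_add]
  refine Submodule.add_mem_sup ?_ ?_
  · have := mul_mem_nI (pow_le_nI _ _ ha) hu
    rwa [← add_assoc] at this
  · rw [add_assoc, pow_add]; exact Ideal.mul_mem_mul ha hv

lemma T2.one (h : T2 x s1 s2) : s1 ∉ Jx x := fun h1 => by
  have := (h.ind 1 0 (by simpa using h1)).1
  exact (maximalIdeal.isMaximal B).ne_top ((Ideal.eq_top_iff_one _).2 this)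

lemma T2.det (h : T2 x s1 s2) {n k : ℕ} {f1 f2 g1 g2 : MvPolynomial (Fin d) B}
    (hf : Pr x s1 s2 n f1 f2) (hg : Pr x s1 s2 k g1 g2) (a) :
    (f1 * g2 - f2 * g1).coeff a ∈ maximalIdeal B := by
  by_contra hcon
  have h1 : (f1 * g2 - f2 * g1).IsHomogeneous (n + k) := (hf.h1.mul hg.h2).sub (hf.h2.mul hg.h1)
  have := mem_of_UC h.qs h.hm h1 ⟨a, hcon⟩ h.m1 ?_
  · rw [sup_eq_left.2 h.hI2] at this
    exact h.one this
  · have e : MvPolynomial.eval x (f1 * g2 - f2 * g1) * s1 =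
        MvPolynomial.eval x g2 * (MvPolynomial.eval x f1 * s1 + MvPolynomial.eval x f2 * s2) -
        MvPolynomial.eval x f2 * (MvPolynomial.eval x g1 * s1 + MvPolynomial.eval x g2 * s2) := by
      rw [map_sub, map_mul, map_mul]; ring
    rw [e]
    refine Ideal.sub_mem _ ?_ (mul_W (ev_mem hf.h2) hg.mem)
    have := mul_W (ev_mem (x := x) hg.h2) hf.mem
    rwa [add_comm k n] at this

/-- coefficients in `m` times a socle element -/
lemma mul_soc_mem {n : ℕ} {f : MvPolynomial (Fin d) B} (hf : f.IsHomogeneous n)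
    (hc : ∀ a, f.coeff a ∈ maximalIdeal B) {s : B} (hs : s ∈ (Jx x).colon (maximalIdeal B)) :
    MvPolynomial.eval x f * s ∈ Jx x ^ (n + 1) := by
  have : MvPolynomial.eval x (MvPolynomial.C s * f) ∈ Jx x * Jx x ^ n := by
    refine eval_mem_of_coeff x (hom_C_mul hf s) fun a => ?_
    rw [MvPolynomial.coeff_C_mul]
    exact mem_soc.1 hs _ (hc a)
  rw [map_mul, MvPolynomial.eval_C, ← pow_succ', mul_comm] at this
  exact this

lemma T2.dec (h : T2 x s1 s2) {n : ℕ} {F : MvPolynomial (Fin d) B} (hF : F.IsHomogeneous n)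
    (hz : MvPolynomial.eval x F ∈ nI (Jx x) (n + 2)) :
    ∃ f1 f2 G, Pr x s1 s2 n f1 f2 ∧ F = MvPolynomial.C s1 * f1 + MvPolynomial.C s2 * f2 + G ∧
      G.IsHomogeneous n ∧ ∀ a, G.coeff a ∈ Jx x := by
  obtain ⟨f2, G', hf2, hG', hFG', hGc'⟩ := decomp hF fun a => h.soc
    (coeff_mem_soc h.qs h.hm h.hsub hF hz a)
  obtain ⟨f1, G, hf1, hG, hFG, hGc⟩ := decomp hG' hGc'
  refine ⟨f1, f2, G, ⟨hf1, hf2, ?_⟩, by rw [hFG', hFG]; ring, hG, hGc⟩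
  have e : MvPolynomial.eval x f1 * s1 + MvPolynomial.eval x f2 * s2 =
      MvPolynomial.eval x F - MvPolynomial.eval x G := by
    rw [hFG', hFG]
    simp only [map_add, map_mul, MvPolynomial.eval_C]; ring
  rw [e]
  refine Ideal.sub_mem _ (Ideal.mem_sup_left hz) (Ideal.mem_sup_right ?_)
  rw [pow_succ']
  exact eval_mem_of_coeff x hG hGc

lemma T2.goal_of_zero (h : T2 x s1 s2)
    (h0 : ∀ n f1 f2, Pr x s1 s2 n f1 f2 → (∀ a, f1.coeff a ∈ maximalIdeal B) ∧
      (∀ a, f2.coeff a ∈ maximalIdeal B)) (n : ℕ) :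
    nI (Jx x) (n + 2) ≤ Jx x ^ n * nI (Jx x) 2 := by
  refine goal_of_coeff h.qs h.hm h.hsub n fun F hF hz a => Ideal.mem_sup_left ?_
  obtain ⟨f1, f2, G, hp, rfl, hG, hGc⟩ := h.dec hF hz
  obtain ⟨k1, k2⟩ := h0 n f1 f2 hp
  rw [MvPolynomial.coeff_add, MvPolynomial.coeff_add, MvPolynomial.coeff_C_mul,
    MvPolynomial.coeff_C_mul]
  exact Ideal.add_mem _ (Ideal.add_mem _ (mem_soc.1 h.c1 _ (k1 a)) (mem_soc.1 h.c2 _ (k2 a)))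
    (hGc a)

/-- the generator in rank one -/
structure Tau (x : Fin d → B) (s1 s2 : B) (c : ℕ) (Q1 Q2 : MvPolynomial (Fin d) B) (τ : B) :
    Prop where
  h1 : Q1.IsHomogeneous c
  h2 : Q2.IsHomogeneous c
  mem : τ ∈ nI (Jx x) (c + 2)
  sub : MvPolynomial.eval x Q1 * s1 + MvPolynomial.eval x Q2 * s2 - τ ∈ Jx x ^ (c + 1)
  ne : UC Q1 ∨ UC Q2
  gen : ∀ k g1 g2, Pr x s1 s2 (k + c) g1 g2 → ∃ H : MvPolynomial (Fin d) B, H.IsHomogeneous k ∧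
    (∀ a, (g1 - H * Q1).coeff a ∈ maximalIdeal B) ∧ (∀ a, (g2 - H * Q2).coeff a ∈ maximalIdeal B)

lemma T2.exists_tau (h : T2 x s1 s2) {n : ℕ} {f1 f2 : MvPolynomial (Fin d) B}
    (hf : Pr x s1 s2 n f1 f2) (hu : UC f1 ∨ UC f2) : ∃ c Q1 Q2 τ, Tau x s1 s2 c Q1 Q2 τ := by
  obtain ⟨q1, q2, η, a, c, hac, hη, hη0, hq1, hq2, hr, hq0, e1, e2⟩ :=
    reduced_pair (hf.h1.map (residue B)) (hf.h2.map (residue B))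
      (hu.imp (UC_iff _).1 (UC_iff _).1)
  obtain ⟨Q1, hQ1, rfl⟩ := lift_hom hq1
  obtain ⟨Q2, hQ2, rfl⟩ := lift_hom hq2
  obtain ⟨E, hE, rfl⟩ := lift_hom hη
  rw [← map_mul, map_eq_iff] at e1 e2
  subst hac
  have hτ : MvPolynomial.eval x Q1 * s1 + MvPolynomial.eval x Q2 * s2 ∈ nI (Jx x) (c + 1) :=
    Ideal.add_mem _ (mul_mem_nI (pow_le_nI _ _ (ev_mem hQ1)) (h.hm h.m1))
      (mul_mem_nI (pow_le_nI _ _ (ev_mem hQ2)) (h.hm h.m2))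
  have hEτ : MvPolynomial.eval x E * (MvPolynomial.eval x Q1 * s1 + MvPolynomial.eval x Q2 * s2) ∈
      nI (Jx x) (a + c + 2) ⊔ Jx x ^ (a + c + 1) := by
    have k1 := mul_soc_mem (x := x) (hf.h1.sub (hE.mul hQ1)) e1 h.c1
    have k2 := mul_soc_mem (x := x) (hf.h2.sub (hE.mul hQ2)) e2 h.c2
    have := Ideal.sub_mem _ (Ideal.sub_mem _ hf.mem (Ideal.mem_sup_right k1))
      (Ideal.mem_sup_right k2)
    rw [map_sub, map_sub, map_mul, map_mul] at this
    convert this using 1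
    ring
  obtain ⟨u, hu1, v, hv, huv⟩ := Submodule.mem_sup.1 hEτ
  obtain ⟨g, hg, hg2⟩ := key_lemma h.qs h.hm (g := -v) hE ((UC_iff _).2 hη0) hτ
    ((Ideal.neg_mem_iff _).2 hv) (by rw [← huv, add_neg_cancel_right]; exact hu1)
  refine ⟨c, Q1, Q2, _, hQ1, hQ2, hg2, by rwa [sub_sub_cancel],
    hq0.imp (UC_iff _).2 (UC_iff _).2, ?_⟩
  intro k g1 g2 hg'
  have hdet := h.det hf hg'
  rw [← map_eq_iff, map_mul, map_mul] at hdet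
  rw [← map_eq_iff, map_mul] at e1 e2
  rw [e1, e2, mul_assoc, mul_assoc] at hdet
  have hdet2 := mul_left_cancel₀ hη0 hdet
  obtain ⟨t, ht1, ht2⟩ := prop_of_det hr hq0 hdet2
  have hth : t.IsHomogeneous k := by
    rcases hq0 with h0 | h0
    · refine hom_of_mul_left (k := c) ?_ hq1 h0
      rw [← ht1, add_comm]; exact hg'.h1.map _
    · refine hom_of_mul_left (k := c) ?_ hq2 h0
      rw [← ht2, add_comm]; exact hg'.h2.map _
  obtain ⟨H, hH, rfl⟩ := lift_hom hth
  refine ⟨H, hH, ?_, ?_⟩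
  · rw [← map_eq_iff, ht1, map_mul, mul_comm]
  · rw [← map_eq_iff, ht2, map_mul, mul_comm]

lemma Tau.indep (h : T2 x s1 s2) {c : ℕ} {Q1 Q2 : MvPolynomial (Fin d) B} {τ : B}
    (ht : Tau x s1 s2 c Q1 Q2 τ) {k : ℕ} {H : MvPolynomial (Fin d) B} (hH : H.IsHomogeneous k)
    (hz : MvPolynomial.eval x H * τ ∈ Jx x ^ (k + c + 1)) (a) : H.coeff a ∈ maximalIdeal B := by
  by_contra hcon
  have hu : UC H := ⟨a, hcon⟩
  have hh : (MvPolynomial.C s1 * (H * Q1) + MvPolynomial.C s2 * (H * Q2)).IsHomogeneous (k + c) :=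
    (hom_C_mul (hH.mul ht.h1) s1).add (hom_C_mul (hH.mul ht.h2) s2)
  have h1 : ∀ b, (H * Q1).coeff b ∈ maximalIdeal B ∧ (H * Q2).coeff b ∈ maximalIdeal B := by
    intro b
    have := h.qs.qr _ _ hh ?_ b
    · rw [MvPolynomial.coeff_add, MvPolynomial.coeff_C_mul, MvPolynomial.coeff_C_mul,
        mul_comm s1, mul_comm s2] at this
      exact h.ind _ _ this
    · have k1 : MvPolynomial.eval x H *
          (MvPolynomial.eval x Q1 * s1 + MvPolynomial.eval x Q2 * s2 - τ) ∈ Jx x ^ (k + c + 1) := by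
        rw [add_assoc, pow_add]
        exact Ideal.mul_mem_mul (ev_mem hH) ht.sub
      have k2 := Ideal.add_mem _ k1 hz
      convert k2 using 1
      simp only [map_add, map_mul, MvPolynomial.eval_C]; ring
  rcases ht.ne with h0 | h0
  · obtain ⟨b, hb⟩ := hu.mul h0
    exact hb (h1 b).1
  · obtain ⟨b, hb⟩ := hu.mul h0
    exact hb (h1 b).2

lemma Tau.pos (h : T2 x s1 s2) {c : ℕ} {Q1 Q2 : MvPolynomial (Fin d) B} {τ : B}
    (ht : Tau x s1 s2 c Q1 Q2 τ) : 1 ≤ c := by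
  by_contra hc
  have : c = 0 := by omega
  subst this
  have h1 := ht.indep h (MvPolynomial.isHomogeneous_one (Fin d) B) (by
    rw [map_one, one_mul]; simpa using h.hI2 ht.mem) 0
  rw [MvPolynomial.coeff_zero_one] at h1
  exact (maximalIdeal.isMaximal B).ne_top ((Ideal.eq_top_iff_one _).2 h1)

lemma Tau.nI_le (h : T2 x s1 s2) {c : ℕ} {Q1 Q2 : MvPolynomial (Fin d) B} {τ : B}
    (ht : Tau x s1 s2 c Q1 Q2 τ) {k : ℕ} {z : B} (hz : z ∈ nI (Jx x) (k + c + 2)) :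
    ∃ H : MvPolynomial (Fin d) B, H.IsHomogeneous k ∧
      z - MvPolynomial.eval x H * τ ∈ maximalIdeal B * Jx x ^ (k + c + 1) := by
  obtain ⟨F, hF, rfl⟩ := (mem_Jx_pow _ _ _).1 (h.hsub _ hz)
  obtain ⟨f1, f2, G, hp, hFe, hG, hGc⟩ := h.dec hF hz
  obtain ⟨H, hH, k1, k2⟩ := ht.gen k f1 f2 hp
  refine ⟨H, hH, h.qs.nI_inf_pow (Ideal.sub_mem _ hz ?_) ?_⟩
  · have := mul_mem_nI (pow_le_nI _ _ (ev_mem (x := x) hH)) ht.mem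
    rwa [← add_assoc] at this
  · have l0 : MvPolynomial.eval x G ∈ Jx x ^ (k + c + 1) := by
      rw [pow_succ']; exact eval_mem_of_coeff x hG hGc
    have l1 := mul_soc_mem (x := x) (hp.h1.sub (hH.mul ht.h1)) k1 h.c1
    have l2 := mul_soc_mem (x := x) (hp.h2.sub (hH.mul ht.h2)) k2 h.c2
    have l3 : MvPolynomial.eval x H *
          (MvPolynomial.eval x Q1 * s1 + MvPolynomial.eval x Q2 * s2 - τ) ∈ Jx x ^ (k + c + 1) := by
      rw [add_assoc, pow_add]
      exact Ideal.mul_mem_mul (ev_mem hH) ht.sub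
    have l4 := Ideal.add_mem _ (Ideal.add_mem _ (Ideal.add_mem _ l0 l1) l2) l3
    convert l4 using 1
    rw [hFe]
    simp only [map_add, map_sub, map_mul, MvPolynomial.eval_C]; ring

lemma Tau.len_eq (h : T2 x s1 s2) {c : ℕ} {Q1 Q2 : MvPolynomial (Fin d) B} {τ : B}
    (ht : Tau x s1 s2 c Q1 Q2 τ) (k : ℕ) :
    len (maximalIdeal B * Jx x ^ (k + c + 1)) = d.multichoose k + len (nI (Jx x) (k + c + 2)) := by
  classical
  let f : (mons d k → B) →ₗ[B] B :=
    ∑ a : mons d k, (LinearMap.mulRight B (xm x a.1 * τ)).comp (LinearMap.proj a)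
  have hf : ∀ c : (Fin d →₀ ℕ) → B, f (fun a => c a.1) = (∑ a ∈ mons d k, c a * xm x a) * τ := by
    intro c
    rw [← Finset.sum_coe_sort (mons d k) (fun a => c a * xm x a), Finset.sum_mul]
    simp [f, mul_assoc]
  have hext : ∀ c : mons d k → B, ∃ c' : (Fin d →₀ ℕ) → B, c = fun a => c' a.1 := by
    intro c
    refine ⟨fun a => if h : a ∈ mons d k then c ⟨a, h⟩ else 0, ?_⟩
    ext a; simp
  rw [len_range f (maximalIdeal B * Jx x ^ (k + c + 1))]
  congr 1
  · have h1 : Submodule.comap f (maximalIdeal B * Jx x ^ (k + c + 1)) =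
        Submodule.pi Set.univ (fun _ => maximalIdeal B) := by
      ext v
      obtain ⟨v, rfl⟩ := hext v
      rw [Submodule.mem_comap, hf, ← eval_sum_mons, Submodule.mem_pi]
      constructor
      · intro hz a _
        have := ht.indep h (isHomogeneous_sum_mons v) (Ideal.mul_le_right hz) a.1
        rwa [coeff_sum_mons _ a.2] at this
      · intro hv
        have hcv : MvPolynomial.eval x (∑ b ∈ mons d k, MvPolynomial.monomial b (v b)) ∈
            nI (Jx x) (k + 1) := by
          rw [eval_sum_mons]
          refine Ideal.sum_mem _ fun a ha => ?_
          have := mul_mem_nI (pow_le_nI _ _ (xm_mem x (mem_mons.1 ha))) (h.hm (hv ⟨a, ha⟩ trivial))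
          rwa [mul_comm] at this
        have h2 := mul_mem_nI hcv ht.mem
        refine h.qs.nI_inf_pow (nI_anti _ (by omega) h2) (h.hsub _ (nI_anti _ (by omega) h2))
    rw [h1, (Submodule.quotientPi _).length_eq, Module.length_pi]
    have h3 : Module.length B (B ⧸ maximalIdeal B) = 1 := len_max
    rw [h3, ENat.card_eq_coe_fintype_card, Fintype.card_coe, card_mons, mul_one]
  · congr 1
    apply le_antisymm
    · refine sup_le ?_ ?_
      · rintro _ ⟨v, rfl⟩
        obtain ⟨v, rfl⟩ := hext v
        rw [hf, ← eval_sum_mons]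
        have := mul_mem_nI (pow_le_nI _ _ (ev_mem (x := x) (isHomogeneous_sum_mons (n := k) v)))
          ht.mem
        rwa [← add_assoc] at this
      · have h2 : maximalIdeal B * Jx x ^ (k + c + 1) ≤ nI (Jx x) (1 + (k + c + 1)) :=
          le_trans (Ideal.mul_mono h.hm (pow_le_nI _ _)) (nI_mul_le _ 1 _)
        exact h2.trans (nI_anti _ (by omega))
    · intro z hz
      obtain ⟨H, hH, hz2⟩ := ht.nI_le h hz
      refine Submodule.mem_sup.2 ⟨MvPolynomial.eval x H * τ, ?_, _, hz2, by ring⟩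
      refine ⟨fun a => H.coeff a.1, ?_⟩
      rw [hf (fun a => H.coeff a), ← eval_sum_mons, ← eq_sum_mons hH]

end ranktwo

end CMP

namespace CMP

section numeric

/-- the numerical identity -/
def NE (e : ℕ → ℤ) (l c d : ℕ) : Prop :=
  ∃ N0 : ℕ, ∀ N ≥ N0, ∑ i ∈ Finset.range (d + 1), (-1 : ℤ) ^ i * e i * ((N + d - i).choose (d - i)) =
    l * ((d + 1).multichoose (N - 1) : ℕ) + (d.multichoose N : ℕ) - (d.multichoose (N - 1 - c) : ℕ)

lemma NE.step {e : ℕ → ℤ} {l c d : ℕ} (h : NE e l c (d + 1)) : NE e l c d := by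
  obtain ⟨N0, hN⟩ := h
  refine ⟨N0 + c + 3, fun N hN' => ?_⟩
  have h1 := hN N (by omega)
  have h2 := hN (N - 1) (by omega)
  have h3 : ∑ i ∈ Finset.range (d + 1), (-1 : ℤ) ^ i * e i * ((N + d - i).choose (d - i)) =
      ∑ i ∈ Finset.range (d + 1 + 1), (-1 : ℤ) ^ i * e i * ((N + (d + 1) - i).choose (d + 1 - i)) -
      ∑ i ∈ Finset.range (d + 1 + 1),
        (-1 : ℤ) ^ i * e i * ((N - 1 + (d + 1) - i).choose (d + 1 - i)) := by
    rw [← Finset.sum_sub_distrib, Finset.sum_range_succ _ (d + 1)]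
    simp only [Nat.sub_self, Nat.choose_zero_right, sub_self, add_zero]
    refine Finset.sum_congr rfl fun i hi => ?_
    rw [Finset.mem_range] at hi
    rw [← mul_sub, pascal d N i (by omega) (by omega)]
  rw [h3, h1, h2]
  obtain ⟨M, rfl⟩ : ∃ M, N = M + c + 3 := ⟨N - c - 3, by omega⟩
  have e1 : M + c + 3 - 1 = (M + c + 1) + 1 := by omega
  have e2 : M + c + 3 - 1 - 1 = M + c + 1 := by omega
  have e3 : M + c + 3 - 1 - c = M + 1 + 1 := by omega
  have e4 : M + c + 3 - 1 - 1 - c = M + 1 := by omega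
  rw [e3, e4, e2, e1]
  have f1 := Nat.multichoose_succ_succ (d + 1) (M + c + 1)
  have f2 := Nat.multichoose_succ_succ d (M + c + 1 + 1)
  have f3 := Nat.multichoose_succ_succ d (M + 1)
  rw [f1, show M + c + 3 = M + c + 1 + 1 + 1 by ring, f2, f3]
  push_cast; ring

lemma NE.three {e : ℕ → ℤ} {l c : ℕ} (h : NE e l c 3) : 2 * e 3 = c * (c + 1) := by
  obtain ⟨N3, h3⟩ := h
  obtain ⟨N2, h2⟩ := (show NE e l c 3 from ⟨N3, h3⟩).step
  obtain ⟨N1, h1⟩ := (show NE e l c 2 from ⟨N2, h2⟩).step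
  obtain ⟨N0, h0⟩ := (show NE e l c 1 from ⟨N1, h1⟩).step
  obtain ⟨M, hM⟩ : ∃ M, M + c + 2 ≥ N0 + N1 + N2 + N3 := ⟨N0 + N1 + N2 + N3, by omega⟩
  have k0 := h0 (M + c + 2) (by omega)
  have k1 := h1 (M + c + 2) (by omega)
  have k2 := h2 (M + c + 2) (by omega)
  have k3 := h3 (M + c + 2) (by omega)
  rw [show M + c + 2 - 1 - c = M + 1 by omega, show M + c + 2 - 1 = M + c + 1 by omega] at k0 k1 k2 k3
  have c2 : ∀ n : ℕ, (2 : ℤ) * ((n + 2).choose 2 : ℕ) = (n + 1) * (n + 2) := choose2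
  have c3 : ∀ n : ℕ, (6 : ℤ) * ((n + 3).choose 3 : ℕ) = (n + 1) * (n + 2) * (n + 3) := choose3
  have m3 : ∀ n, Nat.multichoose 3 n = (n + 2).choose 2 := fun n => by
    rw [Nat.multichoose_eq, show 3 + n - 1 = n + 2 by omega]
    rw [← Nat.choose_symm_of_eq_add]; omega
  have m4 : ∀ n, Nat.multichoose 4 n = (n + 3).choose 3 := fun n => by
    rw [Nat.multichoose_eq, show 4 + n - 1 = n + 3 by omega]
    rw [← Nat.choose_symm_of_eq_add]; omega
  simp [Finset.sum_range_succ, Nat.multichoose_two, m3, m4] at k0 k1 k2 k3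
  have e1 : e 1 = l := by
    rw [k0] at k1; linear_combination -k1
  have d1 := c2 (M + c + 2)
  have d2 := c2 (M + c + 1)
  have d3 := c3 (M + c + 2)
  have d4 := c3 (M + c + 1)
  have d5 := c2 (M + 1)
  rw [show M + c + 4 = M + c + 2 + 2 by ring] at k3
  rw [k0, e1] at k2 k3
  push_cast at d1 d2 d3 d4 d5
  have e2 : e 2 = c + 1 := by
    have : 2 * e 2 = 2 * (c + 1) := by
      linear_combination 2 * k2 - l * d1 + l * d2
    linarith
  rw [e2] at k3
  have : 6 * e 3 = 3 * (c * (c + 1)) := by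
    linear_combination (-6) * k3 + l * d3 - 3 * l * d1 - l * d4 - 3 * d1 + 3 * d5
  linarith

end numeric

section type

variable {B : Type*} [CommRing B] [IsLocalRing B] [IsNoetherianRing B]

lemma NE_down {e : ℕ → ℤ} {l c : ℕ} : ∀ k, NE e l c (k + 3) → NE e l c 3 := by
  intro k
  induction k with
  | zero => exact fun h => h
  | succ k ih => exact fun h => ih (NE.step h)

lemma tau_false {k : ℕ} {x : Fin (k + 3) → B} {s1 s2 : B} (h : T2 x s1 s2) {l : ℕ}
    (hl : len (Jx x) = l) {e : ℕ → ℤ} (hP : HP x e) (he : e 3 = 0) {c : ℕ}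
    {Q1 Q2 : MvPolynomial (Fin (k + 3)) B} {τ : B} (ht : Tau x s1 s2 c Q1 Q2 τ) : False := by
  have hne : NE e l c (k + 3) := by
    obtain ⟨N, hN⟩ := hP
    refine ⟨N + c + 1, fun n hn => ?_⟩
    obtain ⟨a, rfl⟩ : ∃ a, n = a + c + 1 := ⟨n - c - 1, by omega⟩
    obtain ⟨L, hL1, hL2⟩ := hN (a + c + 1) (by omega)
    have h1 := ht.len_eq h a
    rw [len_mul_pow h.qs.qr h.qs.le, len_max, mul_one, len_Jx_pow h.qs.qr, hl] at h1
    rw [show a + c + 2 = a + c + 1 + 1 by ring, hL1] at h1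
    have h2 : (k + 3).multichoose (a + c + 1) + (k + 3 + 1).multichoose (a + c) * l =
        (k + 3).multichoose a + L := by exact_mod_cast h1
    rw [← hL2, show a + c + 1 - 1 - c = a by omega, Nat.add_sub_cancel]
    have h3 : (((k + 3).multichoose (a + c + 1) + (k + 3 + 1).multichoose (a + c) * l : ℕ) : ℤ) =
        ((k + 3).multichoose a + L : ℕ) := by rw [h2]
    push_cast at h3
    linear_combination -h3
  have h1 := (NE_down k hne).three
  rw [he] at h1
  have h2 := ht.pos h
  have : (0 : ℤ) < c * (c + 1) := by positivity
  omega

theorem type_thm {k : ℕ} {x : Fin (k + 3) → B} (h : QS x) (hm : maximalIdeal B ≤ nI (Jx x) 1)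
    (hsub : ∀ n, nI (Jx x) (n + 2) ≤ Jx x ^ n) {l : ℕ} (hl : len (Jx x) = l)
    {e : ℕ → ℤ} (hP : HP x e) (he : e 3 = 0) {t : ℕ} (ht2 : t ≤ 2)
    (ht : len (Jx x) = t + len ((Jx x).colon (maximalIdeal B))) (n : ℕ) :
    nI (Jx x) (n + 2) ≤ Jx x ^ n * nI (Jx x) 2 := by
  by_cases hJm : maximalIdeal B ≤ Jx x
  · refine goal_of_coeff h hm hsub n fun F hF hz a => Ideal.mem_sup_left (hJm ?_)
    exact h.coeff_mem_of_nI hF (nI_anti _ (by omega) hz) a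
  have hsm : (Jx x).colon (maximalIdeal B) ≤ maximalIdeal B := by
    intro s hs
    by_contra hcon
    have hu : IsUnit s := by
      rwa [mem_maximalIdeal, mem_nonunits_iff, not_not] at hcon
    exact hJm fun p hp => (Ideal.unit_mul_mem_iff_mem _ hu).1 (mem_soc.1 hs p hp)
  have hJs : Jx x ≤ (Jx x).colon (maximalIdeal B) := fun z hz =>
    mem_soc.2 fun p _ => Ideal.mul_mem_right _ _ hz
  have hVs : Jx x ⊔ nI (Jx x) 2 ≤ (Jx x).colon (maximalIdeal B) := by
    refine sup_le hJs fun z hz => mem_soc.2 fun p hp => ?_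
    have h0 : z * p ∈ nI (Jx x) (2 + 1) := mul_mem_nI hz (hm hp)
    have := hsub 1 h0
    rwa [pow_one] at this
  by_cases c0 : (Jx x).colon (maximalIdeal B) ≤ Jx x ⊔ nI (Jx x) 2
  · exact goal_of_coeff h hm hsub n fun F hF hz a => c0 (coeff_mem_soc h hm hsub hF hz a)
  obtain ⟨s1, hs1, hs1V⟩ := SetLike.not_le_iff_exists.1 c0
  by_cases c1 : (Jx x).colon (maximalIdeal B) ≤ Jx x ⊔ nI (Jx x) 2 ⊔ Ideal.span {s1}
  · exact case_one h hm hsub (hsm hs1) hs1 hs1V c1 n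
  obtain ⟨s2, hs2, hs2V⟩ := SetLike.not_le_iff_exists.1 c1
  have lt1 : Jx x ⊔ nI (Jx x) 2 < Jx x ⊔ nI (Jx x) 2 ⊔ Ideal.span {s1} := by
    refine lt_of_le_of_ne le_sup_left fun heq => hs1V ?_
    rw [heq]; exact Ideal.mem_sup_right (Ideal.mem_span_singleton_self _)
  have lt2 : Jx x ⊔ nI (Jx x) 2 ⊔ Ideal.span {s1} <
      Jx x ⊔ nI (Jx x) 2 ⊔ Ideal.span {s1} ⊔ Ideal.span {s2} := by
    refine lt_of_le_of_ne le_sup_left fun heq => hs2V ?_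
    rw [heq]; exact Ideal.mem_sup_right (Ideal.mem_span_singleton_self _)
  have le3 : Jx x ⊔ nI (Jx x) 2 ⊔ Ideal.span {s1} ⊔ Ideal.span {s2} ≤
      (Jx x).colon (maximalIdeal B) :=
    sup_le (sup_le hVs (by rwa [Ideal.span_singleton_le_iff_mem]))
      (by rwa [Ideal.span_singleton_le_iff_mem])
  have i1 := len_lt lt1
  have i2 := len_lt lt2
  have i3 := len_anti le3
  have i4 : len (Jx x ⊔ nI (Jx x) 2) ≤ len (Jx x) := len_anti le_sup_left
  have fin : ∀ {Q : Ideal B}, Jx x ≤ Q → ∃ q : ℕ, len Q = q := by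
    intro Q hQ
    have : len Q ≠ ⊤ := ne_top_of_le_ne_top (by rw [hl]; exact ENat.natCast_ne_top l) (len_anti hQ)
    exact ⟨(len Q).toNat, (ENat.natCast_toNat this).symm⟩
  obtain ⟨a0, ha0⟩ := fin (Q := Jx x ⊔ nI (Jx x) 2) le_sup_left
  obtain ⟨a1, ha1⟩ := fin (Q := Jx x ⊔ nI (Jx x) 2 ⊔ Ideal.span {s1})
    (le_sup_left.trans le_sup_left)
  obtain ⟨a2, ha2⟩ := fin (Q := Jx x ⊔ nI (Jx x) 2 ⊔ Ideal.span {s1} ⊔ Ideal.span {s2})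
    ((le_sup_left.trans le_sup_left).trans le_sup_left)
  obtain ⟨a3, ha3⟩ := fin hJs
  rw [ha0, ha1] at i1
  rw [ha1, ha2] at i2
  rw [ha2, ha3] at i3
  rw [ha0, hl] at i4
  rw [ha3, hl] at ht
  have i1' : a1 + 1 ≤ a0 := by exact_mod_cast i1
  have i2' : a2 + 1 ≤ a1 := by exact_mod_cast i2
  have i3' : a3 ≤ a2 := by exact_mod_cast i3
  have i4' : a0 ≤ l := by exact_mod_cast i4
  have ht' : l = t + a3 := by exact_mod_cast ht
  have hV : Jx x = Jx x ⊔ nI (Jx x) 2 := by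
    refine eq_of_len le_sup_left (by rw [ha0]; exact ENat.natCast_ne_top _) ?_
    rw [ha0, hl]; exact_mod_cast (by omega : l ≤ a0)
  have hS : Jx x ⊔ nI (Jx x) 2 ⊔ Ideal.span {s1} ⊔ Ideal.span {s2} =
      (Jx x).colon (maximalIdeal B) := by
    refine eq_of_len le3 (by rw [ha3]; exact ENat.natCast_ne_top _) ?_
    rw [ha2, ha3]; exact_mod_cast (by omega : a2 ≤ a3)
  have hI2 : nI (Jx x) 2 ≤ Jx x := le_sup_right.trans hV.ge
  rw [sup_eq_left.2 hI2] at hS hs1V hs2V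
  have hT : T2 x s1 s2 := by
    refine ⟨h, hm, hsub, hI2, hsm hs1, hsm hs2, hs1, hs2, hS.ge, ?_⟩
    intro r1 r2 hr
    have m2 : r2 ∈ maximalIdeal B := by
      by_contra hcon
      have hu : IsUnit r2 := by rwa [mem_maximalIdeal, mem_nonunits_iff, not_not] at hcon
      refine hs2V ((Ideal.unit_mul_mem_iff_mem _ hu).1 ?_)
      have : r2 * s2 = (r1 * s1 + r2 * s2) - r1 * s1 := by ring
      rw [this]
      exact Ideal.sub_mem _ (Ideal.mem_sup_left hr)
        (Ideal.mem_sup_right (Ideal.mul_mem_left _ _ (Ideal.mem_span_singleton_self _)))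
    refine ⟨?_, m2⟩
    by_contra hcon
    have hu : IsUnit r1 := by rwa [mem_maximalIdeal, mem_nonunits_iff, not_not] at hcon
    refine hs1V ((Ideal.unit_mul_mem_iff_mem _ hu).1 ?_)
    have h2 := mem_soc.1 hs2 _ m2
    rw [mul_comm] at h2
    exact (Ideal.add_mem_iff_left _ h2).1 hr
  by_cases hz : ∀ n f1 f2, Pr x s1 s2 n f1 f2 → (∀ a, f1.coeff a ∈ maximalIdeal B) ∧
      (∀ a, f2.coeff a ∈ maximalIdeal B)
  · exact hT.goal_of_zero hz n
  exfalso
  push Not at hz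
  obtain ⟨n', f1, f2, hp, hz⟩ := hz
  have hu : UC f1 ∨ UC f2 := by
    by_contra hcon
    push Not at hcon
    unfold UC at hcon
    push Not at hcon
    obtain ⟨a, ha⟩ := hz hcon.1
    exact ha (hcon.2 a)
  obtain ⟨c, Q1, Q2, τ, htau⟩ := hT.exists_tau hp hu
  exact tau_false hT hl hP he htau

end type

end CMP

namespace CMP

section sop

universe u

variable {B : Type u} [CommRing B] [IsLocalRing B] [IsNoetherianRing B]

/-- there is an `M`-regular sequence of length `n` in the maximal ideal -/
def DD (B : Type u) [CommRing B] [IsLocalRing B] (M : Type u) [AddCommGroup M] [Module B M]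
    (n : ℕ) : Prop :=
  ∃ rs : List B, rs.length = n ∧ (∀ r ∈ rs, r ∈ maximalIdeal B) ∧
    RingTheory.Sequence.IsRegular M rs

lemma smul_top_lt (M : Type u) [AddCommGroup M] [Module B M] [Module.Finite B M] [Nontrivial M] :
    maximalIdeal B • (⊤ : Submodule B M) < ⊤ := by
  rw [lt_top_iff_ne_top]
  intro h
  have := Submodule.eq_bot_of_le_smul_of_le_jacobson_bot (maximalIdeal B) (⊤ : Submodule B M)
    (Module.Finite.fg_top) h.ge (maximalIdeal_le_jacobson _)
  exact top_ne_bot this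

open Pointwise in
lemma exists_ass {M : Type u} [AddCommGroup M] [Module B M] [Module.Finite B M] {y : B}
    (hy : y ∈ maximalIdeal B) (hreg : IsSMulRegular M y) {p : Ideal B} (hp : IsAssociatedPrime p M) :
    ∃ q, IsAssociatedPrime q (QuotSMulTop y M) ∧ p ≤ q ∧ y ∈ q ∧ y ∉ p := by
  obtain ⟨hpp, x, hx⟩ := isAssociatedPrime_iff.1 hp
  let N : Submodule B M :=
    { carrier := {z | ∀ a ∈ p, a • z = 0}
      add_mem' := fun {a b} ha hb c hc => by rw [smul_add, ha c hc, hb c hc, add_zero]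
      zero_mem' := fun c _ => smul_zero c
      smul_mem' := fun r z hz c hc => by rw [smul_comm, hz c hc, smul_zero] }
  have hxN : x ∈ N := by
    intro a ha
    rw [hx, Submodule.mem_colon_singleton] at ha
    simpa using ha
  have hx0 : x ≠ 0 := by
    rintro rfl
    apply hpp.ne_top
    rw [hx]; simp
  have hyp : y ∉ p := by
    intro h
    exact hx0 (hreg (by simpa using hxN y h))
  have hex : ∃ z ∈ N, z ∉ y • (⊤ : Submodule B M) := by
    by_contra hcon
    push Not at hcon
    have h1 : N ≤ (Ideal.span {y}) • N := by
      intro z hz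
      obtain ⟨w, -, rfl⟩ := (Submodule.mem_smul_pointwise_iff_exists _ _ _).1 (hcon z hz)
      rw [Submodule.ideal_span_singleton_smul]
      refine Submodule.smul_mem_pointwise_smul _ _ _ ?_
      intro a ha
      have := hz a ha
      rw [smul_comm] at this
      exact hreg (by simpa using this)
    have h2 := Submodule.eq_bot_of_le_smul_of_le_jacobson_bot _ N (IsNoetherian.noetherian N) h1
      (((Ideal.span_singleton_le_iff_mem _).2 hy).trans (maximalIdeal_le_jacobson _))
    rw [h2] at hxN
    exact hx0 (by simpa using hxN)
  obtain ⟨z, hzN, hz⟩ := hex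
  have hz0 : (Submodule.Quotient.mk z : QuotSMulTop y M) ≠ 0 := by
    intro h
    exact hz ((Submodule.Quotient.mk_eq_zero _).1 h)
  obtain ⟨q, hq, hle⟩ := exists_le_isAssociatedPrime_of_isNoetherianRing B _ hz0
  refine ⟨q, hq, fun a ha => hle ?_, hle ?_, hyp⟩
  · rw [Submodule.mem_colon_singleton, ← Submodule.Quotient.mk_smul, hzN a ha]
    simp
  · rw [Submodule.mem_colon_singleton, ← Submodule.Quotient.mk_smul, Submodule.mem_bot,
      Submodule.Quotient.mk_eq_zero]
    exact Submodule.smul_mem_pointwise_smul _ _ _ trivial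

lemma dim_step {p q : Ideal B} (hp : p.IsPrime) (hpq : p ≤ q) {y : B} (hy : y ∈ q) (hyp : y ∉ p) :
    ringKrullDim (B ⧸ q) + 1 ≤ ringKrullDim (B ⧸ p) := by
  have hnz : Ideal.Quotient.mk p y ∈ nonZeroDivisors (B ⧸ p) := by
    rw [mem_nonZeroDivisors_iff_ne_zero]
    rwa [Ne, Ideal.Quotient.eq_zero_iff_mem]
  refine le_trans ?_ (ringKrullDim_quotient_succ_le_of_nonZeroDivisor hnz)
  gcongr
  refine ringKrullDim_le_of_surjective
    (Ideal.Quotient.lift (Ideal.span {Ideal.Quotient.mk p y}) (Ideal.Quotient.factor hpq) ?_) ?_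
  · intro a ha
    have : Ideal.span {Ideal.Quotient.mk p y} ≤ RingHom.ker (Ideal.Quotient.factor hpq) := by
      rw [Ideal.span_singleton_le_iff_mem, RingHom.mem_ker, Ideal.Quotient.factor_mk,
        Ideal.Quotient.eq_zero_iff_mem]
      exact hy
    exact this ha
  · refine Ideal.Quotient.lift_surjective_of_surjective _ _ (Ideal.Quotient.factor_surjective hpq)

lemma dim_ass (n : ℕ) : ∀ (M : Type u) [AddCommGroup M] [Module B M] [Module.Finite B M],
    DD B M n → ∀ p : Ideal B, IsAssociatedPrime p M → (n : WithBot ℕ∞) ≤ ringKrullDim (B ⧸ p) := by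
  induction n with
  | zero =>
    intro M _ _ _ _ p hp
    have := hp.isPrime
    have : Nontrivial (B ⧸ p) := inferInstance
    simpa using ringKrullDim_nonneg_of_nontrivial
  | succ n ih =>
    rintro M _ _ _ ⟨rs, hl, hm, hreg⟩ p hp
    match rs, hl with
    | y :: rs, hl =>
      rw [RingTheory.Sequence.isRegular_cons_iff] at hreg
      obtain ⟨q, hq, hpq, hyq, hyp⟩ := exists_ass (hm y (by simp)) hreg.1 hp
      have h1 := ih (QuotSMulTop y M) ⟨rs, by simpa using hl, fun r hr => hm r (by simp [hr]), hreg.2⟩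
        q hq
      refine le_trans ?_ (dim_step hp.isPrime hpq hyq hyp)
      push_cast
      gcongr

lemma ann_quot {M : Type u} [AddCommGroup M] [Module B M] (s : B) :
    Ideal.span {s} ⊔ Module.annihilator B M ≤ Module.annihilator B (QuotSMulTop s M) := by
  refine sup_le ?_ ?_
  · rw [Ideal.span_singleton_le_iff_mem, Module.mem_annihilator]
    intro m
    obtain ⟨m, rfl⟩ := Submodule.Quotient.mk_surjective _ m
    rw [← Submodule.Quotient.mk_smul, Submodule.Quotient.mk_eq_zero]
    exact Submodule.smul_mem_pointwise_smul _ _ _ trivial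
  · intro a ha
    rw [Module.mem_annihilator] at ha ⊢
    intro m
    obtain ⟨m, rfl⟩ := Submodule.Quotient.mk_surjective _ m
    rw [← Submodule.Quotient.mk_smul, ha, Submodule.Quotient.mk_zero]

lemma ann_step {M : Type u} [AddCommGroup M] [Module B M] {s : B} {ss : List B} {N : ℕ}
    (h : maximalIdeal B ^ N ≤ Ideal.ofList (s :: ss) ⊔ Module.annihilator B M) :
    maximalIdeal B ^ N ≤ Ideal.ofList ss ⊔ Module.annihilator B (QuotSMulTop s M) := by
  refine h.trans ?_
  rw [Ideal.ofList_cons, sup_comm (Ideal.span {s}), sup_assoc]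
  exact sup_le_sup_left (ann_quot s) _

lemma dim_le_length (ss : List B) : ∀ (M : Type u) [AddCommGroup M] [Module B M] [Module.Finite B M]
    (N : ℕ), (∀ s ∈ ss, s ∈ maximalIdeal B) →
    maximalIdeal B ^ N ≤ Ideal.ofList ss ⊔ Module.annihilator B M →
    Module.supportDim B M ≤ ss.length := by
  induction ss with
  | nil =>
    intro M _ _ _ N _ hN
    rw [Ideal.ofList_nil, bot_sup_eq] at hN
    have : Subsingleton (Module.support B M) := by
      rw [Module.support_eq_zeroLocus]
      refine ⟨fun p q => Subtype.ext (PrimeSpectrum.ext ?_)⟩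
      have : ∀ p : PrimeSpectrum.zeroLocus (Module.annihilator B M : Set B),
          p.1.asIdeal = maximalIdeal B := by
        intro p
        refine le_antisymm (le_maximalIdeal p.1.2.ne_top) ?_
        exact p.1.2.le_of_pow_le (hN.trans p.2)
      rw [this p, this q]
    rw [Module.supportDim]
    simpa using Order.krullDim_nonpos_of_subsingleton
  | cons s ss ih =>
    intro M _ _ _ N hm hN
    refine (Module.supportDim_le_supportDim_quotSMulTop_succ (hm s (by simp))).trans ?_
    have := ih (QuotSMulTop s M) N (fun r hr => hm r (by simp [hr])) (ann_step hN)
    simp only [List.length_cons]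
    push_cast
    gcongr

open CategoryTheory Abelian Limits in
lemma DD.drop {M : Type u} [AddCommGroup M] [Module B M] [Module.Finite B M] {n : ℕ}
    (h : DD B M (n + 1)) {s : B} (hs : s ∈ maximalIdeal B) (hreg : IsSMulRegular M s) :
    DD B (QuotSMulTop s M) n := by
  obtain ⟨rs, hl, hm, hr⟩ := h
  have := hr.nontrivial
  have : Nontrivial (QuotSMulTop s M) := nontrivial_quotSMulTop_of_mem_maximalIdeal _ hs
  let N : ModuleCat.{u} B := ModuleCat.of B (B ⧸ maximalIdeal B)
  have hN : Module.support B N = PrimeSpectrum.zeroLocus (maximalIdeal B) := by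
    have : Module.support B (B ⧸ maximalIdeal B) = PrimeSpectrum.zeroLocus (maximalIdeal B) := by
      rw [Module.support_eq_zeroLocus, Ideal.annihilator_quotient]
    exact this
  have hfin : Module.Finite B N := inferInstanceAs (Module.Finite B (B ⧸ maximalIdeal B))
  have h_ext := ModuleCat.subsingleton_ext_of_exists_isRegular (maximalIdeal B) N hN.subset
    (ModuleCat.of B M) (smul_top_lt M) rs hm hr
  have h_ext' : ∀ i < n, Subsingleton (Ext N (ModuleCat.of B (QuotSMulTop s M)) i) := by
    intro i hi
    have zero1 := AddCommGrpCat.isZero_of_iff_subsingleton.mpr (h_ext i (by omega))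
    have zero2 := AddCommGrpCat.isZero_of_iff_subsingleton.mpr (h_ext (i + 1) (by omega))
    exact AddCommGrpCat.subsingleton_of_isZero <| ShortComplex.Exact.isZero_of_both_zeros
      ((Ext.covariant_sequence_exact₃' N
        (IsSMulRegular.smulShortComplex_shortExact (M := ModuleCat.of B M) hreg)) i (i + 1) rfl)
      (zero1.eq_zero_of_src _) (zero2.eq_zero_of_tgt _)
  exact ModuleCat.exists_isRegular_of_exists_subsingleton_ext (maximalIdeal B) n
    (ModuleCat.of B (QuotSMulTop s M)) (smul_top_lt _) N hN h_ext'

lemma regular_of_primary (ss : List B) : ∀ (M : Type u) [AddCommGroup M] [Module B M]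
    [Module.Finite B M] (N : ℕ), (∀ s ∈ ss, s ∈ maximalIdeal B) →
    maximalIdeal B ^ N ≤ Ideal.ofList ss ⊔ Module.annihilator B M → DD B M ss.length →
    RingTheory.Sequence.IsRegular M ss := by
  induction ss with
  | nil =>
    rintro M _ _ _ N _ _ ⟨rs, hl, _, hr⟩
    have := hr.nontrivial
    exact RingTheory.Sequence.IsRegular.nil B M
  | cons s ss ih =>
    intro M _ _ _ N hm hN hD
    have hreg : IsSMulRegular M s := by
      by_contra hcon
      have h1 : s ∈ ⋃ p ∈ associatedPrimes B M, (p : Set B) := by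
        rw [biUnion_associatedPrimes_eq_compl_regular]
        exact hcon
      simp only [Set.mem_iUnion] at h1
      obtain ⟨p, hp, hsp⟩ := h1
      have h2 := dim_ass _ M hD p hp
      have h3 : Module.annihilator B M ≤ p := by
        have := IsAssociatedPrime.annihilator_le hp
        rwa [Submodule.annihilator_top] at this
      have h4 := dim_le_length ss (B ⧸ p) N (fun r hr => hm r (by simp [hr])) (by
        rw [Ideal.annihilator_quotient]
        refine hN.trans ?_
        rw [Ideal.ofList_cons]
        refine sup_le (sup_le ?_ le_sup_left) (h3.trans le_sup_right)
        rw [Ideal.span_singleton_le_iff_mem]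
        exact Ideal.mem_sup_right hsp)
      rw [Module.supportDim_quotient_eq_ringKrullDim] at h4
      have h5 := h2.trans h4
      have h6 : ((ss.length + 1 : ℕ) : WithBot ℕ∞) ≤ (ss.length : ℕ) := by simpa using h5
      have h7 : (ss.length + 1 : ℕ) ≤ ss.length := by exact_mod_cast h6
      omega
    rw [RingTheory.Sequence.isRegular_cons_iff]
    exact ⟨hreg, ih (QuotSMulTop s M) N (fun r hr => hm r (by simp [hr])) (ann_step hN)
      (hD.drop (hm s (by simp)) hreg)⟩

lemma cm_regular {d : ℕ} (hdim : ringKrullDim B = d) (hCM : IsCMLocal B) (ss : List B)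
    (hl : ss.length = d) (hm : ∀ s ∈ ss, s ∈ maximalIdeal B) {N : ℕ}
    (hN : maximalIdeal B ^ N ≤ Ideal.ofList ss) : RingTheory.Sequence.IsRegular B ss := by
  refine regular_of_primary ss B N hm (hN.trans le_sup_left) ?_
  rw [IsCMLocal, hdim] at hCM
  have h1 : rdepth B (maximalIdeal B) B = (d : ℕ∞) := by exact_mod_cast hCM
  have hne : ({n : ℕ∞ | ∃ rs : List B, (rs.length : ℕ∞) = n ∧ (∀ x ∈ rs, x ∈ maximalIdeal B) ∧
    RingTheory.Sequence.IsRegular B rs}).Nonempty :=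
    ⟨0, [], by simp, by simp, RingTheory.Sequence.IsRegular.nil B B⟩
  obtain ⟨n, ⟨rs, h3, h4, h5⟩, h6⟩ : ∃ n ∈ {n : ℕ∞ | ∃ rs : List B, (rs.length : ℕ∞) = n ∧ (∀ x ∈ rs, x ∈ maximalIdeal B) ∧
    RingTheory.Sequence.IsRegular B rs}, n = d := by
    refine ⟨_, @ENat.sSup_mem_of_nonempty_of_lt_top _ hne.to_subtype ?_, h1⟩
    exact h1.trans_lt (ENat.coe_lt_top d)
  refine ⟨rs, ?_, h4, h5⟩
  rw [hl]
  rw [h6] at h3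
  exact_mod_cast h3

end sop

end CMP

namespace CMP

section regqr

variable {S : Type*} [CommRing S]

/-- regular sequence, read from the last to the first entry -/
def SR : ∀ {d : ℕ}, (Fin d → S) → Prop
  | 0, _ => True
  | _ + 1, x => (∀ z, x 0 * z ∈ Jx (Fin.tail x) → z ∈ Jx (Fin.tail x)) ∧ SR (Fin.tail x)

lemma exists_of_mul {d : ℕ} (x : Fin d → S) (Q : Ideal S) (n : ℕ) {z : S} (hz : z ∈ Q * Jx x ^ n) :
    ∃ F : MvPolynomial (Fin d) S, F.IsHomogeneous n ∧ (∀ a, F.coeff a ∈ Q) ∧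
      MvPolynomial.eval x F = z := by
  refine Submodule.mul_induction_on hz ?_ ?_
  · intro a ha b hb
    obtain ⟨F, hF, rfl⟩ := (mem_Jx_pow _ _ _).1 hb
    refine ⟨MvPolynomial.C a * F, by simpa using (MvPolynomial.isHomogeneous_C _ a).mul hF, ?_, by simp⟩
    intro b
    rw [MvPolynomial.coeff_C_mul]
    exact Ideal.mul_mem_right _ _ ha
  · rintro a b ⟨F, h1, h2, rfl⟩ ⟨G, h3, h4, rfl⟩
    exact ⟨F + G, h1.add h3, fun a => by
      rw [MvPolynomial.coeff_add]; exact Ideal.add_mem _ (h2 a) (h4 a), by simp⟩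

lemma QR_of_zero {d : ℕ} {x : Fin d → S} (n : ℕ) (h : ∀ (F : MvPolynomial (Fin d) S), F.IsHomogeneous n →
    MvPolynomial.eval x F = 0 → ∀ a, F.coeff a ∈ Jx x) {F : MvPolynomial (Fin d) S}
    (hF : F.IsHomogeneous n) (hz : MvPolynomial.eval x F ∈ Jx x ^ (n + 1)) (a) : F.coeff a ∈ Jx x := by
  rw [pow_succ'] at hz
  obtain ⟨G, h1, h2, h3⟩ := exists_of_mul x _ n hz
  have := h (F - G) (hF.sub h1) (by rw [map_sub, h3, sub_self]) a
  rw [MvPolynomial.coeff_sub] at this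
  have h4 := Ideal.add_mem _ this (h2 a)
  simpa using h4

lemma nzd_pow {d : ℕ} {x : Fin d → S} (h : QR x) {y : S} (hy : ∀ z, y * z ∈ Jx x → z ∈ Jx x) (j : ℕ)
    {z : S} (hz : y * z ∈ Jx x ^ j) : z ∈ Jx x ^ j := by
  induction j with
  | zero => simp
  | succ j ih =>
    have h1 := ih (Ideal.pow_le_pow_right (Nat.le_succ j) hz)
    obtain ⟨F, hF, rfl⟩ := (mem_Jx_pow _ _ _).1 h1
    rw [pow_succ']
    refine eval_mem_of_coeff x hF fun a => hy _ ?_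
    have := h j (MvPolynomial.C y * F) (by simpa using (MvPolynomial.isHomogeneous_C _ y).mul hF)
      (by simpa using hz) a
    rwa [MvPolynomial.coeff_C_mul] at this

lemma degree_cons {d : ℕ} (i : ℕ) (m : Fin d →₀ ℕ) : (m.cons i).degree = i + m.degree := by
  rw [Finsupp.degree_eq_sum, Finsupp.degree_eq_sum, Fin.sum_univ_succ]
  simp

/-- splitting off the first variable -/
lemma split_first {d : ℕ} (x : Fin (d + 1) → S) {n : ℕ} {F : MvPolynomial (Fin (d + 1)) S}
    (hF : F.IsHomogeneous (n + 1)) : ∃ (G : MvPolynomial (Fin d) S) (H : MvPolynomial (Fin (d + 1)) S),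
    G.IsHomogeneous (n + 1) ∧ H.IsHomogeneous n ∧
    MvPolynomial.eval x F = MvPolynomial.eval (Fin.tail x) G + x 0 * MvPolynomial.eval x H ∧
    (∀ m, F.coeff (m.cons 0) = G.coeff m) ∧ (∀ (m : Fin d →₀ ℕ) (i : ℕ), F.coeff (m.cons (i + 1)) = H.coeff (m.cons i)) := by
  have hG : ∀ m, F.coeff (m.cons 0) = MvPolynomial.coeff m ((MvPolynomial.finSuccEquiv S d F).coeff 0) :=
    fun m => (MvPolynomial.finSuccEquiv_coeff_coeff _ _ _).symm
  have hH : ∀ (m : Fin d →₀ ℕ) (i : ℕ), F.coeff (m.cons (i + 1)) = MvPolynomial.coeff (m.cons i)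
      ((MvPolynomial.finSuccEquiv S d).symm (MvPolynomial.finSuccEquiv S d F).divX) := by
    intro m i
    rw [← MvPolynomial.finSuccEquiv_coeff_coeff, ← MvPolynomial.finSuccEquiv_coeff_coeff,
      AlgEquiv.apply_symm_apply, Polynomial.coeff_divX]
  refine ⟨_, _, ?_, ?_, ?_, hG, hH⟩
  · refine isHom_of fun m hm => ?_
    rw [← hG] at hm
    have := deg_of_isHom hF hm
    rw [degree_cons] at this
    omega
  · refine isHom_of fun a ha => ?_
    rw [← Finsupp.cons_tail a, ← hH] at ha
    have := deg_of_isHom hF ha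
    rw [degree_cons] at this
    conv_lhs => rw [← Finsupp.cons_tail a, degree_cons]
    omega
  · have key : ∀ P : MvPolynomial (Fin (d + 1)) S, MvPolynomial.eval x P =
        Polynomial.eval (x 0) (Polynomial.map (MvPolynomial.eval (Fin.tail x))
          (MvPolynomial.finSuccEquiv S d P)) := by
      intro P
      conv_lhs => rw [← Fin.cons_self_tail x]
      exact MvPolynomial.eval_eq_eval_mv_eval' _ _ _
    rw [key, key ((MvPolynomial.finSuccEquiv S d).symm _), AlgEquiv.apply_symm_apply]
    conv_lhs => rw [← Polynomial.divX_mul_X_add (MvPolynomial.finSuccEquiv S d F)]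
    simp
    ring

lemma SR.qr : ∀ {d : ℕ} {x : Fin d → S}, SR x → QR x := by
  intro d
  induction d with
  | zero =>
    intro x _ n F hF hz a
    have h1 : F = MvPolynomial.C (F.coeff 0) := MvPolynomial.eq_C_of_isEmpty F
    have h2 : Jx x = ⊥ := by simp [Jx]
    rw [h2] at hz ⊢
    rw [h1] at hz
    have h3 : F.coeff 0 = 0 := by simpa using hz
    rw [Subsingleton.elim a 0, h3]; simp
  | succ d ih =>
    intro x ⟨hx, hsr⟩ n
    have hq := ih hsr
    have hle : Jx (Fin.tail x) ≤ Jx x := by rw [Jx_eq_tail x]; exact le_sup_left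
    have h0 : x 0 ∈ Jx x := Ideal.subset_span ⟨0, rfl⟩
    induction n with
    | zero =>
      intro F hF hz a
      by_cases ha : F.coeff a = 0
      · rw [ha]; simp
      have h1 := deg_of_isHom hF ha
      have h2 : a = 0 := (Finsupp.degree_eq_zero_iff a).1 h1
      have h3 : F = MvPolynomial.C (F.coeff 0) := by
        rw [← MvPolynomial.totalDegree_eq_zero_iff_eq_C]
        exact Nat.le_zero.1 hF.totalDegree_le
      rw [h3] at hz
      rw [h2]
      simpa using hz
    | succ n ihn =>
      intro F hF hz
      refine QR_of_zero (n + 1) ?_ hF hz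
      intro F hF hz
      obtain ⟨G, H, hG, hH, he, hc0, hcs⟩ := split_first x hF
      rw [hz] at he
      have h1 : MvPolynomial.eval x H ∈ Jx (Fin.tail x) ^ (n + 1) := by
        refine nzd_pow hq hx _ ?_
        have : x 0 * MvPolynomial.eval x H = - MvPolynomial.eval (Fin.tail x) G := by
          linear_combination -he
        rw [this, Ideal.neg_mem_iff]
        exact eval_mem_Jx_pow hG
      have h2 := ihn H hH (Ideal.pow_right_mono hle _ h1)
      obtain ⟨H', hH', he'⟩ := (mem_Jx_pow _ _ _).1 h1
      have h3 := hq (n + 1) (G + MvPolynomial.C (x 0) * H')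
        (hG.add (by simpa using (MvPolynomial.isHomogeneous_C _ (x 0)).mul hH'))
        (by rw [map_add, map_mul, MvPolynomial.eval_C, he', ← he]; simp)
      intro a
      rw [← Finsupp.cons_tail a]
      cases a 0 with
      | zero =>
        rw [hc0]
        have := h3 (Finsupp.tail a)
        rw [MvPolynomial.coeff_add, MvPolynomial.coeff_C_mul] at this
        refine (Ideal.add_mem_iff_left _ (Ideal.mul_mem_right _ _ h0)).1 (hle this)
      | succ i =>
        rw [hcs]
        exact h2 _

lemma ofList_ofFn {d : ℕ} (x : Fin d → S) : Ideal.ofList (List.ofFn x) = Jx x := by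
  rw [Ideal.ofList, Jx]
  congr 1
  ext y; simp [List.mem_ofFn]

lemma Jx_rev {d : ℕ} (x : Fin d → S) : Jx (fun i => x i.rev) = Jx x := by
  rw [Jx, Jx]
  congr 1
  exact Fin.revPerm.surjective.range_comp x

lemma SR_of_weakly {d : ℕ} {x : Fin d → S}
    (h : RingTheory.Sequence.IsWeaklyRegular S (List.ofFn (fun i => x i.rev))) : SR x := by
  induction d with
  | zero => trivial
  | succ d ih =>
    have e : List.ofFn (fun i : Fin (d + 1) => x i.rev) =
        List.ofFn (fun i : Fin d => Fin.tail x i.rev) ++ [x 0] := by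
      rw [List.ofFn_succ_last]
      simp [Fin.tail, Fin.rev_castSucc]
    rw [e, RingTheory.Sequence.isWeaklyRegular_append_iff] at h
    refine ⟨?_, ih h.1⟩
    have h2 := h.2
    rw [RingTheory.Sequence.isWeaklyRegular_singleton_iff,
      isSMulRegular_quotient_iff_mem_of_smul_mem, ofList_ofFn, Jx_rev] at h2
    intro z hz
    have := h2 z (by simpa using hz)
    simpa using this

end regqr

end CMP

namespace CMP

section assemble

universe u

variable {B : Type u} [CommRing B] [IsLocalRing B] [IsNoetherianRing B]

lemma mlen_eq (M : Type*) [AddCommGroup M] [Module B M] {n : ℕ} (h : mlen B M = n) :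
    Module.length B M = n := by
  have h1 : ((Module.length B M : ℕ∞) : WithBot ℕ∞) = n := (Module.coe_length B M).trans h
  exact_mod_cast h1

lemma len_finite {Q : Ideal B} {N : ℕ} (hN : maximalIdeal B ^ N ≤ Q) (hQ : Q ≤ maximalIdeal B) :
    ∃ l : ℕ, len Q = l := by
  have hnt : Nontrivial (B ⧸ Q) := Ideal.Quotient.nontrivial_iff.2
    (fun h => (maximalIdeal.isMaximal B).ne_top (top_le_iff.1 (h ▸ hQ)))
  have : IsLocalRing (B ⧸ Q) := IsLocalRing.of_surjective' (Ideal.Quotient.mk Q) Ideal.Quotient.mk_surjective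
  have hmax : maximalIdeal (B ⧸ Q) ≤ (maximalIdeal B).map (Ideal.Quotient.mk Q) := by
    intro z hz
    obtain ⟨z, rfl⟩ := Ideal.Quotient.mk_surjective z
    refine Ideal.mem_map_of_mem _ ?_
    rw [mem_maximalIdeal] at hz ⊢
    exact fun h => hz (h.map _)
  have hart : IsArtinianRing (B ⧸ Q) := by
    rw [isArtinianRing_iff_isNilpotent_maximalIdeal]
    refine ⟨N, ?_⟩
    rw [Ideal.zero_eq_bot, eq_bot_iff]
    refine (Ideal.pow_right_mono hmax N).trans ?_
    rw [← Ideal.map_pow, ← eq_bot_iff, Ideal.map_eq_bot_iff_le_ker, Ideal.mk_ker]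
    exact hN
  have h2 : IsArtinian B (B ⧸ Q) :=
    isArtinian_of_surjective_algebraMap (M := B ⧸ Q) (S := B) (R := B ⧸ Q) Ideal.Quotient.mk_surjective
  have h3 : Module.length B (B ⧸ Q) ≠ ⊤ := by
    rw [Module.length_ne_top_iff, isFiniteLength_iff_isNoetherian_isArtinian]
    exact ⟨inferInstance, h2⟩
  exact ⟨(len Q).toNat, (ENat.coe_toNat h3).symm⟩

lemma span_ofFn {d : ℕ} (s : Fin d → B) : Ideal.span {x | x ∈ List.ofFn s} = Jx s := by
  rw [Jx]
  congr 1
  ext y; simp [List.mem_ofFn]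

theorem assemble (d : ℕ) (hd : 3 ≤ d) (hdim : ringKrullDim B = d)
    (hCM : IsCMLocal B) (hAU : AnalyticallyUnramified B)
    (t : ℕ) (ht : CMTypeData B d t) (ht2 : t ≤ 2)
    (I J : Ideal B) (hIm : intCl I = maximalIdeal B)
    (hJ : IsMinimalReduction d J I)
    (L : ℕ → ℕ) (e : ℕ → ℤ) (hHilb : NormalHilbertData d I L e) (he3 : e 3 = 0) :
    ∃ s : Fin d → B, QS s ∧ (∀ n, intCl (I ^ n) = nI (Jx s) n) ∧
      maximalIdeal B = nI (Jx s) 1 ∧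
      (∀ n, nI (Jx s) (n + 2) ≤ Jx s ^ n * nI (Jx s) 2) ∧
      RingTheory.Sequence.IsRegular B (List.ofFn s) := by
  obtain ⟨hJI, ⟨s, rfl⟩, hred⟩ := hJ
  obtain ⟨k, rfl⟩ : ∃ k, d = k + 3 := ⟨d - 3, by omega⟩
  have hcl : ∀ n, intCl (I ^ n) = nI (Jx s) n := intCl_eq_nI hJI hred
  have hm1 : maximalIdeal B = nI (Jx s) 1 := by rw [← hIm, ← hcl, pow_one]
  have hle : Jx s ≤ maximalIdeal B := by
    rw [hm1]; simpa using pow_le_nI (Jx s) 1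
  have hrad : maximalIdeal B ≤ (Jx s).radical := by
    intro z hz
    rw [hm1] at hz
    obtain ⟨c, hc⟩ := hz
    refine ⟨c + 1, ?_⟩
    have := hc (c + 1)
    simpa using this
  obtain ⟨N, hN⟩ := Ideal.exists_pow_le_of_le_radical_of_fg hrad (IsNoetherian.noetherian _)
  have hreg : ∀ s' : Fin (k + 3) → B, Jx s' = Jx s →
      RingTheory.Sequence.IsRegular B (List.ofFn s') := by
    intro s' hs'
    refine cm_regular hdim hCM _ (by simp) ?_ (N := N) ?_
    · intro y hy
      obtain ⟨i, rfl⟩ := List.mem_ofFn.1 hy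
      exact hle (hs' ▸ Ideal.subset_span ⟨i, rfl⟩)
    · rw [ofList_ofFn, hs']; exact hN
  have hQS : QS s := ⟨(SR_of_weakly (hreg _ (Jx_rev s)).toIsWeaklyRegular).qr, ⟨N, hN⟩, hle⟩
  obtain ⟨l, hl⟩ := len_finite hN hle
  have hHP : HP s e := by
    obtain ⟨h1, N0, h2⟩ := hHilb
    refine ⟨N0, fun n hn => ⟨L n, ?_, h2 n hn⟩⟩
    rw [← hcl]
    exact mlen_eq _ (h1 n)
  have hRB : RB s := rees_bound hQS hm1.le hl.le hAU
  have hsub := huckaba k B s hQS hRB e hHP he3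
  have htype : len (Jx s) = t + len ((Jx s).colon (maximalIdeal B)) := by
    have h1 := ht (List.ofFn s) (by simp) (fun y hy => by
      obtain ⟨i, rfl⟩ := List.mem_ofFn.1 hy
      exact hle (Ideal.subset_span ⟨i, rfl⟩)) (hreg s rfl)
    rw [span_ofFn] at h1
    have h2 := mlen_eq _ h1
    have h3 := len_range (((Jx s).colon (maximalIdeal B)).subtype) (Jx s)
    rw [h2, Submodule.range_subtype, sup_eq_left.2 ?_] at h3
    · exact h3
    · intro z hz
      rw [Submodule.mem_colon]
      intro p _
      exact Ideal.mul_mem_right _ _ hz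
  exact ⟨s, hQS, hcl, hm1, type_thm hQS hm1.le hsub hl hHP he3 ht2 htype, hreg s rfl⟩

end assemble

end CMP

namespace CMP

section PPs

variable {S : Type*} [CommRing S] {d : ℕ}

/-- ideal generated by the first `i` entries -/
def PP (g : Fin d → S) (i : ℕ) : Ideal S := Ideal.span {y | ∃ j : Fin d, j.val < i ∧ g j = y}

lemma PP_mem (g : Fin d → S) (j : Fin d) {i : ℕ} (h : j.val < i) : g j ∈ PP g i :=
  Ideal.subset_span ⟨j, h, rfl⟩

lemma PP_le (g : Fin d → S) {i : ℕ} {K : Ideal S} (h : ∀ j : Fin d, j.val < i → g j ∈ K) :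
    PP g i ≤ K := by
  rw [PP, Ideal.span_le]
  rintro _ ⟨j, hj, rfl⟩
  exact h j hj

lemma PP_last (g : Fin d → S) : PP g d = Jx g := by
  apply le_antisymm
  · exact PP_le g fun j _ => Ideal.subset_span ⟨j, rfl⟩
  · rw [Jx, Ideal.span_le]
    rintro _ ⟨j, rfl⟩
    exact PP_mem g j j.2

lemma PP_le_Jx (g : Fin d → S) (i : ℕ) : PP g i ≤ Jx g := PP_le g fun j _ => Ideal.subset_span ⟨j, rfl⟩

lemma PP_succ (g : Fin d → S) (i : Fin d) : PP g (i.val + 1) = PP g i ⊔ Ideal.span {g i} := by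
  apply le_antisymm
  · refine PP_le g fun j hj => ?_
    rcases Nat.lt_succ_iff_lt_or_eq.1 hj with h | h
    · exact Ideal.mem_sup_left (PP_mem g j h)
    · rw [Fin.ext h]
      exact Ideal.mem_sup_right (Ideal.mem_span_singleton_self _)
  · refine sup_le (PP_le g fun j hj => PP_mem g j (by omega)) ?_
    rw [Ideal.span_le, Set.singleton_subset_iff]
    exact PP_mem g i (by omega)

lemma ofList_take (g : Fin d → S) (i : ℕ) : Ideal.ofList ((List.ofFn g).take i) = PP g i := by
  rw [Ideal.ofList, PP]
  congr 1
  ext y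
  simp only [Set.mem_ofPred_eq, List.mem_take_iff_getElem, List.getElem_ofFn, List.length_ofFn]
  constructor
  · rintro ⟨j, hj, rfl⟩
    exact ⟨⟨j, by omega⟩, by simp; omega, rfl⟩
  · rintro ⟨j, hj, rfl⟩
    exact ⟨j, by have := j.2; omega, rfl⟩

lemma weakly_iff (g : Fin d → S) : RingTheory.Sequence.IsWeaklyRegular S (List.ofFn g) ↔
    ∀ i : Fin d, ∀ z, g i * z ∈ PP g i → z ∈ PP g i := by
  rw [RingTheory.Sequence.isWeaklyRegular_iff]
  simp only [ofList_take, List.length_ofFn, List.getElem_ofFn,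
    isSMulRegular_quotient_iff_mem_of_smul_mem, smul_eq_mul, Ideal.mul_top]
  exact ⟨fun h i => h i.1 i.2, fun h i hi => h ⟨i, hi⟩⟩

lemma length_le_dim_aux : ∀ (rs : List S) (M : Type _) [AddCommGroup M] [Module S M]
    [Module.Finite S M], RingTheory.Sequence.IsRegular M rs →
    (rs.length : WithBot ℕ∞) ≤ Module.supportDim S M
  | [], M, _, _, _, h => by
    have : Nontrivial M := by
      by_contra hn
      rw [not_nontrivial_iff_subsingleton] at hn
      exact h.top_ne_smul (Subsingleton.elim _ _)
    have := (Module.supportDim_ne_bot_iff_nontrivial S M).2 this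
    obtain ⟨a, ha⟩ := WithBot.ne_bot_iff_exists.1 this
    rw [← ha]
    simp only [List.length_nil, Nat.cast_zero]
    exact WithBot.coe_le_coe.2 zero_le
  | r :: rs, M, _, _, _, h => by
    rw [RingTheory.Sequence.isRegular_cons_iff] at h
    have h1 := length_le_dim_aux rs (QuotSMulTop r M) h.2
    have h2 := Module.supportDim_quotSMulTop_succ_le_of_notMem_minimalPrimes (x := r) (M := M)
      (fun _ => h.1.notMem_of_mem_minimalPrimes)
    refine le_trans ?_ h2
    simp only [List.length_cons, Nat.cast_add, Nat.cast_one]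
    gcongr

lemma rdepth_le_dim [Nontrivial S] (K : Ideal S) :
    (rdepth S K S : WithBot ℕ∞) ≤ ringKrullDim S := by
  have h0 : ringKrullDim S ≠ ⊥ := by
    have := ringKrullDim_nonneg_of_nontrivial (R := S)
    intro h; rw [h] at this; simp at this
  obtain ⟨a, ha⟩ := WithBot.ne_bot_iff_exists.1 h0
  rw [← ha, WithBot.coe_le_coe]
  refine sSup_le ?_
  rintro n ⟨rs, rfl, -, h⟩
  have := length_le_dim_aux rs S h
  rw [Module.supportDim_self_eq_ringKrullDim, ← ha] at this
  exact_mod_cast this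

lemma dim_le_of_integral {k : Type*} [CommRing k] (f : k →+* S) (hf : f.IsIntegral) :
    ringKrullDim S ≤ ringKrullDim k := by
  algebraize [f]
  refine Order.krullDim_le_of_strictMono (PrimeSpectrum.comap (algebraMap k S)) ?_
  intro p q hpq
  exact Ideal.IsIntegral.comap_lt_comap (R := k) (A := S) (I := p.asIdeal) (J := q.asIdeal) hpq

end PPs

section VV

variable {B : Type*} [CommRing B] [IsLocalRing B] {d : ℕ} {s : Fin d → B}

lemma vv_top (h : QS s) (hm1 : maximalIdeal B = nI (Jx s) 1)
    (h2 : ∀ n, nI (Jx s) (n + 2) ≤ Jx s ^ n * nI (Jx s) 2) (n : ℕ) :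
    Jx s ⊓ nI (Jx s) n ≤ Jx s * nI (Jx s) (n - 1) := by
  rcases n with _ | _ | _ | n
  · simp [nI_zero]
  · simp [nI_zero]
  · rintro z ⟨hz1, hz2⟩
    have := h.nI_inf_pow (n := 1) hz2 (by simpa using hz1)
    rw [pow_one, hm1, mul_comm] at this
    exact this
  · intro z hz
    have h3 := h2 (n + 1) hz.2
    rw [pow_succ', mul_assoc] at h3
    refine Ideal.mul_mono_right ?_ h3
    refine le_trans (Ideal.mul_mono_left (pow_le_nI (Jx s) n)) ?_
    exact nI_mul_le _ _ _

lemma mul_span_sup {P : Ideal B} {K : Ideal B} {x z : B} (hz : z ∈ (P ⊔ Ideal.span {x}) * K) :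
    ∃ y ∈ P * K, ∃ w ∈ K, z = y + x * w := by
  rw [Ideal.sup_mul, Submodule.mem_sup] at hz
  obtain ⟨y, hy, v, hv, rfl⟩ := hz
  obtain ⟨w, hw, rfl⟩ := Ideal.mem_span_singleton_mul.1 hv
  exact ⟨y, hy, w, hw, rfl⟩

lemma s_mem_nI (s : Fin d → B) (i : Fin d) : s i ∈ nI (Jx s) 1 :=
  pow_le_nI (Jx s) 1 (by simpa using x_mem_Jx s i)

lemma s_mul_mem (s : Fin d → B) (i : Fin d) {P : Ideal B} {n : ℕ} {w : B}
    (hw : w ∈ P * nI (Jx s) (n - 1)) : s i * w ∈ P * nI (Jx s) n := by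
  rcases n with _ | n
  · exact Ideal.mul_mem_left _ _ hw
  · refine Submodule.mul_induction_on hw ?_ ?_
    · intro a ha b hb
      have : s i * (a * b) = a * (s i * b) := by ring
      rw [this]
      refine Ideal.mul_mem_mul ha ?_
      have := mul_mem_nI (s_mem_nI s i) hb
      rwa [show 1 + (n + 1 - 1) = n + 1 by omega] at this
    · intro a b ha hb
      rw [mul_add]; exact Ideal.add_mem _ ha hb

lemma vv (h : QS s) (hm1 : maximalIdeal B = nI (Jx s) 1)
    (h2 : ∀ n, nI (Jx s) (n + 2) ≤ Jx s ^ n * nI (Jx s) 2)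
    (hreg : RingTheory.Sequence.IsWeaklyRegular B (List.ofFn s)) (c : ℕ) :
    ∀ i, i + c = d → ∀ n, PP s i ⊓ nI (Jx s) n ≤ PP s i * nI (Jx s) (n - 1) := by
  induction c with
  | zero =>
    intro i hi n
    obtain rfl : i = d := by omega
    rw [PP_last]
    exact vv_top h hm1 h2 n
  | succ c ih =>
    intro i hi n
    have hid : i < d := by omega
    have hs := PP_succ s ⟨i, hid⟩
    have hr := (weakly_iff s).1 hreg ⟨i, hid⟩
    simp only at hs hr
    induction n with
    | zero => simp [nI_zero]
    | succ n ihn =>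
      rintro z ⟨hz1, hz2⟩
      have h3 : z ∈ PP s (i + 1) * nI (Jx s) n :=
        ih (i + 1) (by omega) (n + 1) ⟨by rw [hs]; exact Ideal.mem_sup_left hz1, hz2⟩
      rw [hs] at h3
      obtain ⟨y, hy, w, hw, rfl⟩ := mul_span_sup h3
      rw [show n + 1 - 1 = n by omega]
      refine Ideal.add_mem _ hy (s_mul_mem s _ (ihn ⟨hr w ?_, hw⟩))
      exact (Ideal.add_mem_iff_right _ (Ideal.mul_le_left hy)).1 hz1

lemma vv_claim (h : QS s) (hm1 : maximalIdeal B = nI (Jx s) 1)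
    (h2 : ∀ n, nI (Jx s) (n + 2) ≤ Jx s ^ n * nI (Jx s) 2)
    (hreg : RingTheory.Sequence.IsWeaklyRegular B (List.ofFn s)) (i : Fin d) (n : ℕ) {z : B}
    (hz : z ∈ nI (Jx s) n) (hsz : s i * z ∈ PP s i * nI (Jx s) n ⊔ nI (Jx s) (n + 2)) :
    z ∈ PP s i * nI (Jx s) (n - 1) ⊔ nI (Jx s) (n + 1) := by
  obtain ⟨y, hy, k, hk, hyk⟩ := Submodule.mem_sup.1 hsz
  have hid := i.2
  have hs := PP_succ s i
  have hr := (weakly_iff s).1 hreg i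
  have hyP : y ∈ PP s i := Ideal.mul_le_left hy
  have hk1 : k ∈ PP s (i + 1) := by
    rw [hs, show k = - y + s i * z by rw [← hyk]; ring]
    exact Ideal.add_mem _ (Ideal.mem_sup_left (neg_mem hyP))
      (Ideal.mem_sup_right (Ideal.mul_mem_right _ _ (Ideal.mem_span_singleton_self _)))
  have hk2 := vv h hm1 h2 hreg (d - (i + 1)) (i + 1) (by omega) (n + 2) ⟨hk1, hk⟩
  rw [hs] at hk2
  obtain ⟨y', hy', w, hw, rfl⟩ := mul_span_sup hk2
  rw [show n + 2 - 1 = n + 1 by omega] at hw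
  have h5 : z - w ∈ PP s i := by
    apply hr
    rw [show s i * (z - w) = y + y' by linear_combination -hyk]
    exact Ideal.add_mem _ hyP (Ideal.mul_le_left hy')
  have h6 := vv h hm1 h2 hreg (d - i) i (by omega) n
    ⟨h5, Ideal.sub_mem _ hz (nI_anti _ (by omega) hw)⟩
  rw [show z = (z - w) + w by ring]
  exact Submodule.add_mem_sup h6 hw

end VV

end CMP

namespace CMP

section gr

variable {B : Type*} [CommRing B] {d : ℕ} {s : Fin d → B}

/-- homogeneous element of the Rees algebra of the filtration -/
noncomputable def mono {A : Subalgebra B B[X]} (hA : ∀ p : B[X], p ∈ A ↔ ∀ n, p.coeff n ∈ nI (Jx s) n)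
    (n : ℕ) (z : B) (hz : z ∈ nI (Jx s) n) : A :=
  ⟨monomial n z, (hA _).2 fun k => by
    rw [coeff_monomial]
    split_ifs with h
    · exact h ▸ hz
    · exact zero_mem _⟩

variable {A : Subalgebra B B[X]} (hA : ∀ p : B[X], p ∈ A ↔ ∀ n, p.coeff n ∈ nI (Jx s) n)

lemma mono_coe (n : ℕ) (z : B) (hz : z ∈ nI (Jx s) n) :
    ((mono hA n z hz : A) : B[X]) = monomial n z := rfl

lemma A_ind (T : AddSubmonoid A) (p : A)
    (h : ∀ n, mono hA n ((p : B[X]).coeff n) ((hA _).1 p.2 n) ∈ T) : p ∈ T := by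
  have : p = ∑ n ∈ Finset.range ((p : B[X]).natDegree + 1),
      mono hA n ((p : B[X]).coeff n) ((hA _).1 p.2 n) := by
    apply Subtype.ext
    rw [AddSubmonoidClass.coe_finsetSum]
    simp only [mono_coe]
    exact (p : B[X]).as_sum_range
  rw [this]
  exact sum_mem fun n _ => h n

/-- the degree one generators -/
noncomputable def Xt [IsLocalRing B] (i : Fin d) : A := mono hA 1 (s i) (s_mem_nI s i)

variable [IsLocalRing B]

/-- the ideal described coefficientwise -/
noncomputable def QQ (hA : ∀ p : B[X], p ∈ A ↔ ∀ n, p.coeff n ∈ nI (Jx s) n) (i : ℕ) : Ideal A where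
  carrier := {p | ∀ n, (p : B[X]).coeff n ∈ PP s i * nI (Jx s) (n - 1) ⊔ nI (Jx s) (n + 1)}
  add_mem' := fun {a b} ha hb n => by
    rw [Subalgebra.coe_add, coeff_add]
    exact Ideal.add_mem _ (ha n) (hb n)
  zero_mem' := fun n => by simp
  smul_mem' := fun q p hp n => by
    rw [smul_eq_mul, Subalgebra.coe_mul, coeff_mul]
    refine sum_mem fun ab hab => ?_
    rw [HasAntidiagonal.mem_antidiagonal] at hab
    have hq := (hA _).1 q.2 ab.1
    obtain ⟨y, hy, k, hk, hyk⟩ := Submodule.mem_sup.1 (hp ab.2)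
    rw [← hyk, mul_add]
    refine Submodule.add_mem_sup ?_ ?_
    · have h1 := Ideal.mul_mem_mul hq hy
      rw [mul_left_comm] at h1
      refine Ideal.mul_mono_right ?_ h1
      exact (nI_mul_le _ _ _).trans (nI_anti _ (by omega))
    · exact nI_anti _ (by omega) (mul_mem_nI hq hk)

lemma mem_QQ (i : ℕ) (p : A) : p ∈ QQ hA i ↔
    ∀ n, (p : B[X]).coeff n ∈ PP s i * nI (Jx s) (n - 1) ⊔ nI (Jx s) (n + 1) := Iff.rfl

variable {K : Ideal A}


lemma le_QQ (hK : ∀ p : A, p ∈ K ↔ ∀ n, (p : B[X]).coeff n ∈ nI (Jx s) (n + 1)) (i : ℕ) :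
    PP (Xt hA) i ⊔ K ≤ QQ hA i := by
  refine sup_le (PP_le _ fun j hj => ?_) fun p hp => ?_
  · rw [mem_QQ]
    intro n
    rw [Xt, mono_coe, coeff_monomial]
    split_ifs with h
    · subst h
      refine Ideal.mem_sup_left ?_
      simpa [nI_zero] using PP_mem s j hj
    · exact zero_mem _
  · rw [mem_QQ]
    exact fun n => Ideal.mem_sup_right ((hK p).1 hp n)

lemma mono_PP (i n : ℕ) {y : B} (hy : y ∈ PP s i * nI (Jx s) n) :
    ∃ q ∈ PP (Xt hA) i, (q : B[X]) = monomial (n + 1) y := by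
  refine Submodule.mul_induction_on hy ?_ ?_
  · intro a ha b hb
    refine Submodule.span_induction (p := fun a _ => ∃ q ∈ PP (Xt hA) i,
      (q : B[X]) = monomial (n + 1) (a * b)) ?_ ?_ ?_ ?_ ha
    · rintro _ ⟨j, hj, rfl⟩
      refine ⟨Xt hA j * mono hA n b hb, Ideal.mul_mem_right _ _ (PP_mem _ j hj), ?_⟩
      rw [Subalgebra.coe_mul, Xt, mono_coe, mono_coe, monomial_mul_monomial, add_comm]
    · exact ⟨0, zero_mem _, by simp⟩
    · rintro u v - - ⟨q, hq, hq'⟩ ⟨r, hr, hr'⟩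
      exact ⟨q + r, add_mem hq hr, by rw [Subalgebra.coe_add, hq', hr', add_mul, map_add]⟩
    · rintro r u - ⟨q, hq, hq'⟩
      refine ⟨algebraMap B A r * q, Ideal.mul_mem_left _ _ hq, ?_⟩
      rw [Subalgebra.coe_mul, hq', Subalgebra.coe_algebraMap, Polynomial.algebraMap_apply,
        Algebra.algebraMap_self, RingHom.id_apply, C_mul_monomial, smul_eq_mul, mul_assoc]
  · rintro u v ⟨q, hq, hq'⟩ ⟨r, hr, hr'⟩
    exact ⟨q + r, add_mem hq hr, by rw [Subalgebra.coe_add, hq', hr', map_add]⟩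

lemma QQ_le (hm1 : maximalIdeal B = nI (Jx s) 1) (hle : Jx s ≤ maximalIdeal B)
    (hK : ∀ p : A, p ∈ K ↔ ∀ n, (p : B[X]).coeff n ∈ nI (Jx s) (n + 1)) (i : ℕ) :
    QQ hA i ≤ PP (Xt hA) i ⊔ K := by
  intro p hp
  refine A_ind hA (PP (Xt hA) i ⊔ K).toAddSubmonoid p fun n => ?_
  rw [Submodule.mem_toAddSubmonoid]
  have hmK : ∀ n z hz, z ∈ nI (Jx s) (n + 1) → mono hA n z hz ∈ K := by
    intro n z hz h
    rw [hK]
    intro k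
    rw [mono_coe, coeff_monomial]
    split_ifs with e
    · exact e ▸ h
    · exact zero_mem _
  have hpn := (mem_QQ hA i p).1 hp n
  rcases n with _ | n
  · refine Ideal.mem_sup_right (hmK _ _ _ ?_)
    have h1 : PP s i * nI (Jx s) (0 - 1) ⊔ nI (Jx s) (0 + 1) ≤ nI (Jx s) (0 + 1) := by
      refine sup_le (Ideal.mul_le_left.trans ((PP_le_Jx s i).trans ?_)) le_rfl
      rw [zero_add, ← hm1]; exact hle
    exact h1 hpn
  · obtain ⟨y, hy, k, hk, hyk⟩ := Submodule.mem_sup.1 hpn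
    rw [Nat.add_sub_cancel] at hy
    obtain ⟨q, hq, hq'⟩ := mono_PP hA i n hy
    have : mono hA (n + 1) ((p : B[X]).coeff (n + 1)) ((hA _).1 p.2 (n + 1)) =
        q + mono hA (n + 1) k (nI_anti _ (by omega) hk) := by
      apply Subtype.ext
      rw [Subalgebra.coe_add, hq', mono_coe, mono_coe, ← map_add, hyk]
    rw [this]
    exact Submodule.add_mem_sup hq (hmK _ _ _ hk)

/-- images of the degree one generators -/
noncomputable def gg (K : Ideal A) (i : Fin d) : A ⧸ K := Ideal.Quotient.mk K (Xt hA i)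

lemma PP_gg (i : ℕ) : PP (gg hA K) i = (PP (Xt hA) i).map (Ideal.Quotient.mk K) := by
  rw [PP, PP, Ideal.map_span]
  congr 1
  ext y
  constructor
  · rintro ⟨j, hj, rfl⟩
    exact ⟨_, ⟨j, hj, rfl⟩, rfl⟩
  · rintro ⟨_, ⟨j, hj, rfl⟩, rfl⟩
    exact ⟨j, hj, rfl⟩

lemma mem_PP_gg (hm1 : maximalIdeal B = nI (Jx s) 1) (hle : Jx s ≤ maximalIdeal B)
    (hK : ∀ p : A, p ∈ K ↔ ∀ n, (p : B[X]).coeff n ∈ nI (Jx s) (n + 1)) (i : ℕ) (p : A) :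
    Ideal.Quotient.mk K p ∈ PP (gg hA K) i ↔
      ∀ n, (p : B[X]).coeff n ∈ PP s i * nI (Jx s) (n - 1) ⊔ nI (Jx s) (n + 1) := by
  rw [PP_gg, ← mem_QQ hA, le_antisymm (QQ_le hA hm1 hle hK i) (le_QQ hA hK i),
    ← Ideal.mem_comap, Ideal.comap_map_of_surjective _ Ideal.Quotient.mk_surjective,
    ← RingHom.ker_eq_comap_bot, Ideal.mk_ker]

lemma gg_regular (h : QS s) (hm1 : maximalIdeal B = nI (Jx s) 1)
    (h2 : ∀ n, nI (Jx s) (n + 2) ≤ Jx s ^ n * nI (Jx s) 2)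
    (hreg : RingTheory.Sequence.IsWeaklyRegular B (List.ofFn s))
    (hK : ∀ p : A, p ∈ K ↔ ∀ n, (p : B[X]).coeff n ∈ nI (Jx s) (n + 1)) :
    RingTheory.Sequence.IsRegular (A ⧸ K) (List.ofFn (gg hA K)) := by
  rw [RingTheory.Sequence.isRegular_iff, weakly_iff]
  refine ⟨fun i z hz => ?_, fun htop => ?_⟩
  · obtain ⟨p, rfl⟩ := Ideal.Quotient.mk_surjective z
    rw [gg, ← map_mul, mem_PP_gg hA hm1 h.le hK] at hz
    rw [mem_PP_gg hA hm1 h.le hK]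
    intro n
    have h3 := hz (n + 1)
    rw [Subalgebra.coe_mul, Xt, mono_coe, ← C_mul_X_pow_eq_monomial, pow_one, mul_assoc,
      coeff_C_mul, coeff_X_mul, Nat.add_sub_cancel] at h3
    exact vv_claim h hm1 h2 hreg i n ((hA _).1 p.2 n) h3
  · have h1 : Ideal.Quotient.mk K 1 ∈ PP (gg hA K) d := by
      rw [PP_last, ← ofList_ofFn]
      have h4 : (Ideal.Quotient.mk K 1) ∈ (⊤ : Ideal (A ⧸ K)) := Submodule.mem_top
      rw [htop, smul_eq_mul, Ideal.mul_top] at h4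
      exact h4
    rw [mem_PP_gg hA hm1 h.le hK] at h1
    have h3 := h1 0
    rw [Subalgebra.coe_one, coeff_one_zero, PP_last] at h3
    have h5 : Jx s * nI (Jx s) (0 - 1) ⊔ nI (Jx s) (0 + 1) ≤ maximalIdeal B :=
      sup_le (Ideal.mul_le_left.trans h.le) (by rw [hm1])
    exact (maximalIdeal.isMaximal B).ne_top ((Ideal.eq_top_iff_one _).2 (h5 h3))

lemma aeval_hom {e : ℕ} {F : MvPolynomial (Fin d) B} (hF : F.IsHomogeneous e) :
    MvPolynomial.aeval (fun j => (monomial 1 (s j) : B[X])) F =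
      monomial e (MvPolynomial.eval s F) := by
  rw [MvPolynomial.aeval_def, MvPolynomial.eval₂_eq', MvPolynomial.eval_eq', map_sum]
  refine Finset.sum_congr rfl fun u hu => ?_
  have h1 := deg_of_isHom hF (MvPolynomial.mem_support_iff.1 hu)
  simp only [monomial_pow, one_mul]
  have h2 : ∀ T : Finset (Fin d), ∏ i ∈ T, (monomial (u i) (s i ^ u i) : B[X]) =
      monomial (∑ i ∈ T, u i) (∏ i ∈ T, s i ^ u i) := by
    intro T
    induction T using Finset.induction_on with
    | empty => simp
    | insert a T ha ih =>
      rw [Finset.prod_insert ha, Finset.prod_insert ha, Finset.sum_insert ha, ih,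
        monomial_mul_monomial]
  rw [h2, Polynomial.algebraMap_apply, Algebra.algebraMap_self, RingHom.id_apply, C_mul_monomial,
    ← h1, Finsupp.degree_eq_sum]

lemma aeval_Xt {e : ℕ} {F : MvPolynomial (Fin d) B} (hF : F.IsHomogeneous e) :
    ((MvPolynomial.aeval (Xt hA) F : A) : B[X]) = monomial e (MvPolynomial.eval s F) := by
  rw [← aeval_hom hF, ← Subalgebra.coe_val, ← AlgHom.comp_apply, MvPolynomial.comp_aeval]
  rfl

lemma gr_dim_le [IsNoetherianRing B]
    (hA : ∀ p : B[X], p ∈ A ↔ ∀ n, p.coeff n ∈ nI (Jx s) n) (hm1 : maximalIdeal B = nI (Jx s) 1)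
    (hK : ∀ p : A, p ∈ K ↔ ∀ n, (p : B[X]).coeff n ∈ nI (Jx s) (n + 1)) :
    ringKrullDim (A ⧸ K) ≤ d := by
  have hker : ∀ b ∈ maximalIdeal B, algebraMap B (A ⧸ K) b = 0 := by
    intro b hb
    rw [IsScalarTower.algebraMap_apply B A (A ⧸ K), Ideal.Quotient.algebraMap_eq,
      Ideal.Quotient.eq_zero_iff_mem, hK]
    intro n
    rw [Subalgebra.coe_algebraMap, Polynomial.algebraMap_apply, Algebra.algebraMap_self,
      RingHom.id_apply, coeff_C]
    split_ifs with h
    · subst h; rw [hm1] at hb; exact hb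
    · exact zero_mem _
  let ψ : (B ⧸ maximalIdeal B) →+* (A ⧸ K) := Ideal.Quotient.lift _ (algebraMap B (A ⧸ K)) hker
  let f : MvPolynomial (Fin d) (B ⧸ maximalIdeal B) →+* (A ⧸ K) :=
    MvPolynomial.eval₂Hom ψ (gg hA K)
  have hf : ∀ F : MvPolynomial (Fin d) B,
      f (MvPolynomial.map (Ideal.Quotient.mk (maximalIdeal B)) F) =
        Ideal.Quotient.mk K (MvPolynomial.aeval (Xt hA) F) := by
    intro F
    have : f.comp (MvPolynomial.map (Ideal.Quotient.mk (maximalIdeal B))) =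
        (Ideal.Quotient.mk K).comp (MvPolynomial.aeval (Xt hA)).toRingHom := by
      apply MvPolynomial.ringHom_ext
      · intro r
        simp [f, ψ]
      · intro i
        simp [f, gg]
    exact RingHom.congr_fun this F
  have hIntg : f.IsIntegral := by
    letI : Algebra (MvPolynomial (Fin d) (B ⧸ maximalIdeal B)) (A ⧸ K) :=
      RingHom.toAlgebra (R := MvPolynomial (Fin d) (B ⧸ maximalIdeal B)) (S := A ⧸ K) f
    intro x
    obtain ⟨p, rfl⟩ := Ideal.Quotient.mk_surjective x
    refine A_ind hA ((integralClosure (MvPolynomial (Fin d) (B ⧸ maximalIdeal B))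
      (A ⧸ K)).toSubring.toAddSubgroup.toAddSubmonoid.comap
        (Ideal.Quotient.mk K).toAddMonoidHom) p fun n => ?_
    suffices hmain : ∀ z hz, IsIntegral (MvPolynomial (Fin d) (B ⧸ maximalIdeal B))
        (Ideal.Quotient.mk K (mono hA n z hz)) from hmain _ _
    intro z hz
    change IsIntegral (MvPolynomial (Fin d) (B ⧸ maximalIdeal B))
      (Ideal.Quotient.mk K (mono hA n z hz))
    obtain ⟨m, hm, a, ha, he⟩ := integral_of_As hz
    have hF : ∀ i, ∃ F : MvPolynomial (Fin d) B, i ∈ Finset.Icc 1 m →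
        F.IsHomogeneous (n * i) ∧ MvPolynomial.eval s F = a i := by
      intro i
      by_cases hi : i ∈ Finset.Icc 1 m
      · have := ha i hi
        rw [← pow_mul, mem_Jx_pow] at this
        obtain ⟨F, hF⟩ := this
        exact ⟨F, fun _ => hF⟩
      · exact ⟨0, fun h => absurd h hi⟩
    choose F hF using hF
    have hrel : (mono hA n z hz) ^ m + ∑ i ∈ Finset.Icc 1 m,
        MvPolynomial.aeval (Xt hA) (F i) * (mono hA n z hz) ^ (m - i) = 0 := by
      apply Subtype.ext
      rw [Subalgebra.coe_add, AddSubmonoidClass.coe_finsetSum, Subalgebra.coe_pow, mono_coe,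
        Subalgebra.coe_zero, monomial_pow]
      have : ∀ i ∈ Finset.Icc 1 m, ((MvPolynomial.aeval (Xt hA) (F i) *
          (mono hA n z hz) ^ (m - i) : A) : B[X]) = monomial (n * m) (a i * z ^ (m - i)) := by
        intro i hi
        rw [Subalgebra.coe_mul, aeval_Xt hA (hF i hi).1, (hF i hi).2, Subalgebra.coe_pow, mono_coe,
          monomial_pow, monomial_mul_monomial, ← mul_add]
        rw [Finset.mem_Icc] at hi
        rw [Nat.add_sub_cancel' hi.2]
      rw [Finset.sum_congr rfl this, ← map_sum, ← map_add, he, map_zero]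
    refine ⟨X ^ m + ∑ i ∈ Finset.Icc 1 m,
      C (MvPolynomial.map (Ideal.Quotient.mk (maximalIdeal B)) (F i)) * X ^ (m - i), ?_, ?_⟩
    · apply monic_X_pow_add
      refine lt_of_le_of_lt (degree_sum_le _ _) ?_
      rw [Finset.sup_lt_iff (WithBot.bot_lt_coe _)]
      intro i hi
      refine lt_of_le_of_lt (degree_C_mul_X_pow_le _ _) ?_
      rw [Finset.mem_Icc] at hi
      exact_mod_cast (by omega : m - i < m)
    · have h1 := congrArg (Ideal.Quotient.mk K) hrel
      rw [map_add, map_sum, map_pow, map_zero] at h1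
      rw [eval₂_add, eval₂_finset_sum, eval₂_X_pow]
      rw [← h1]
      congr 1
      refine Finset.sum_congr rfl fun i _ => ?_
      rw [map_mul, map_pow, ← hf]
      refine (eval₂_mul _ _).trans ?_
      rw [eval₂_C, eval₂_X_pow]
      rfl
  refine (dim_le_of_integral (S := A ⧸ K) (k := MvPolynomial (Fin d) (B ⧸ maximalIdeal B)) f hIntg).trans ?_
  letI : Field (B ⧸ maximalIdeal B) := Ideal.Quotient.field _
  rw [MvPolynomial.ringKrullDim_of_isNoetherianRing,
    ringKrullDim_eq_zero_of_isField (Field.toIsField _)]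
  simp

end gr

theorem final {B : Type*} [CommRing B] [IsLocalRing B] [IsNoetherianRing B] {d : ℕ}
    {s : Fin d → B} (h : QS s) (hm1 : maximalIdeal B = nI (Jx s) 1)
    (h2 : ∀ n, nI (Jx s) (n + 2) ≤ Jx s ^ n * nI (Jx s) 2)
    (hreg : RingTheory.Sequence.IsWeaklyRegular B (List.ofFn s))
    (A : Subalgebra B B[X]) (hA : ∀ p : B[X], p ∈ A ↔ ∀ n, p.coeff n ∈ nI (Jx s) n)
    (K : Ideal A) (hK : ∀ p : A, p ∈ K ↔ ∀ n, (p : B[X]).coeff n ∈ nI (Jx s) (n + 1))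
    (MG : Ideal A) (hMG : ∀ p : A, p ∈ MG ↔ (p : B[X]).coeff 0 ∈ maximalIdeal B) :
    (rdepth (A ⧸ K) (MG.map (Ideal.Quotient.mk K)) (A ⧸ K) : WithBot ℕ∞) =
      ringKrullDim (A ⧸ K) := by
  have hr := gg_regular hA h hm1 h2 hreg hK
  have hnt : Nontrivial (A ⧸ K) := by
    by_contra hn
    rw [not_nontrivial_iff_subsingleton] at hn
    exact hr.top_ne_smul (Subsingleton.elim _ _)
  have h3 : (d : ℕ∞) ≤ rdepth (A ⧸ K) (MG.map (Ideal.Quotient.mk K)) (A ⧸ K) := by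
    refine le_sSup ⟨List.ofFn (gg hA K), by simp, ?_, hr⟩
    intro y hy
    obtain ⟨i, rfl⟩ := List.mem_ofFn.1 hy
    refine Ideal.mem_map_of_mem _ ((hMG _).2 ?_)
    rw [Xt, mono_coe, coeff_monomial]
    simp
  have h4 : (rdepth (A ⧸ K) (MG.map (Ideal.Quotient.mk K)) (A ⧸ K) : WithBot ℕ∞) ≤
      ringKrullDim (A ⧸ K) := rdepth_le_dim _
  have h5 := gr_dim_le hA hm1 hK
  refine le_antisymm h4 (h5.trans ?_)
  exact_mod_cast h3

end CMP

theorem CM_agr_of_type_le_two_e3_zero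
    (R : Type*) [CommRing R] [IsLocalRing R] [IsNoetherianRing R]
    (d : ℕ) (hd : 3 ≤ d) (hdim : ringKrullDim R = d)
    (hCM : IsCMLocal R) (hAU : AnalyticallyUnramified R)
    (hres : Infinite (ResidueField R))
    (t : ℕ) (ht : CMTypeData R d t) (ht2 : t ≤ 2)
    (I J : Ideal R) (hIm : intCl I = maximalIdeal R)
    (hJ : IsMinimalReduction d J I)
    (L : ℕ → ℕ) (e : ℕ → ℤ) (hHilb : NormalHilbertData d I L e)
    (he3 : e 3 = 0)
    -- the Rees algebra of the normal filtration and its associated graded ring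
    (A : Subalgebra R (Polynomial R))
    (hA : ∀ p : Polynomial R, p ∈ A ↔ ∀ n, p.coeff n ∈ intCl (I ^ n))
    (K : Ideal A)
    (hK : ∀ p : A, p ∈ K ↔ ∀ n, (p : Polynomial R).coeff n ∈ intCl (I ^ (n + 1)))
    (MG : Ideal A)
    (hMG : ∀ p : A, p ∈ MG ↔ (p : Polynomial R).coeff 0 ∈ maximalIdeal R) :
    -- `Ḡ` is Cohen-Macaulay
    (rdepth (A ⧸ K) (MG.map (Ideal.Quotient.mk K)) (A ⧸ K) : WithBot ℕ∞) =
      ringKrullDim (A ⧸ K) := by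
  
  obtain ⟨s, hQS, hcl, hm1, h2, hreg⟩ :=
    CMP.assemble d hd hdim hCM hAU t ht ht2 I J hIm hJ L e hHilb he3
  simp only [hcl] at hA hK
  exact CMP.final hQS hm1 h2 hreg.toIsWeaklyRegular A hA K hK MG hMG
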